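/- For n ≥ 1 let μ_n be the critical Ising measure on the box Q_n = {0,…,n}² with free boundary conditions: the probability measure on {−1,1}^{Q_n} with μ_n(σ) proportional to exp(β_c·Σ σ_x σ_y), the sum running over nearest-neighbour pairs {x,y} in Q_n, where β_c = (1/2)·ln(1+√2) is the critical inverse temperature of the planar Ising model. Let M_n(σ) := |Q_n|⁻¹·Σ_{x∈Q_n} σ_x be the average magnetization and Maj_n(σ) := 1 if M_n(σ) > 0 and −1 otherwise. Let (s_n) be positive integers with s_n/n^{7/8} → 0, and let H_n := ({0, s_n, 2s_n, 3s_n, …})² ∩ Q_n be the sublattice of mesh size s_n. Then clue(M_n | H_n) → 1 and clue(Maj_n | H_n) → 1 as n → ∞; i.e., the total average magnetization and its sign can be fully reconstructed from the sparse sublattice H_n. -/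

import Mathlib

open Finset

namespace SR

/-- `p` is a probability mass function on the finite type `X`. -/
def IsPMF {X : Type*} [Fintype X] (p : X → ℝ) : Prop :=
  (∀ x, 0 ≤ p x) ∧ ∑ x : X, p x = 1

/-- Expectation of `f` under the pmf `p`. -/
noncomputable def pexp {X : Type*} [Fintype X] (p f : X → ℝ) : ℝ := ∑ x : X, p x * f x

/-- Variance of `f` under the pmf `p`. -/
noncomputable def pvar {X : Type*} [Fintype X] (p f : X → ℝ) : ℝ :=
  ∑ x : X, p x * (f x - pexp p f) ^ 2

/-- Conditional expectation of `f` given the coordinates in `U`. -/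
noncomputable def cexp {V : Type*} [Fintype V] [DecidableEq V]
    {Ω : Type*} [Fintype Ω] [DecidableEq Ω]
    (p : (V → Ω) → ℝ) (U : Finset V) (f : (V → Ω) → ℝ) : (V → Ω) → ℝ :=
  fun ω =>
    (∑ ω' ∈ univ.filter (fun ω' : V → Ω => ∀ v ∈ U, ω' v = ω v), p ω' * f ω') /
      ∑ ω' ∈ univ.filter (fun ω' : V → Ω => ∀ v ∈ U, ω' v = ω v), p ω'

/-- `clue(f|U) = Var(E[f|F_U])/Var(f)`, with the convention that it is `0` when `Var f = 0`. -/
noncomputable def clue {V : Type*} [Fintype V] [DecidableEq V]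
    {Ω : Type*} [Fintype Ω] [DecidableEq Ω]
    (p : (V → Ω) → ℝ) (f : (V → Ω) → ℝ) (U : Finset V) : ℝ :=
  if pvar p f = 0 then 0 else pvar p (cexp p U f) / pvar p f

/-- `ν` is a probability distribution on the subsets of `V` (a random subset of `V`). -/
def IsSubsetDist {V : Type*} [Fintype V] (ν : Finset V → ℝ) : Prop :=
  (∀ S, 0 ≤ ν S) ∧ ∑ S : Finset V, ν S = 1

/-- Expected clue `E[clue(f|𝒰)]` for a random subset with distribution `ν`. -/
noncomputable def eClue {V : Type*} [Fintype V] [DecidableEq V]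
    {Ω : Type*} [Fintype Ω] [DecidableEq Ω]
    (p : (V → Ω) → ℝ) (f : (V → Ω) → ℝ) (ν : Finset V → ℝ) : ℝ :=
  ∑ S : Finset V, ν S * clue p f S

/-- The revealment `δ(𝒰) = max_v P[v ∈ 𝒰]` of a random subset with distribution `ν`. -/
noncomputable def revealment {V : Type*} [Fintype V] [DecidableEq V] (ν : Finset V → ℝ) : ℝ :=
  sSup (Set.range fun v : V => ∑ S ∈ univ.filter (fun S : Finset V => v ∈ S), ν S)

/-- The spin `±1 ∈ ℝ` associated to a Boolean value. -/
noncomputable def spinR (b : Bool) : ℝ := if b then 1 else -1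

end SR

namespace SR

open Finset

/-- The box `Q_n = {0,…,n}²`. -/
abbrev BoxV (n : ℕ) := Fin (n + 1) × Fin (n + 1)

/-- The critical inverse temperature `β_c = (1/2)·ln(1+√2)` of the planar Ising model. -/
noncomputable def criticalBeta : ℝ := Real.log (1 + Real.sqrt 2) / 2

/-- `Σ_{{x,y}} σ_x σ_y`, the sum running over nearest-neighbour pairs in `Q_n`
(each unordered pair counted once, via half of the sum over ordered pairs). -/
noncomputable def boxInteraction (n : ℕ) (σ : BoxV n → Bool) : ℝ :=
  (1 / 2) * ∑ x : BoxV n, ∑ y : BoxV n,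
    if ((x.1 : ℤ) - (y.1 : ℤ)).natAbs + ((x.2 : ℤ) - (y.2 : ℤ)).natAbs = 1
      then spinR (σ x) * spinR (σ y) else 0

/-- The critical Ising measure on the box `Q_n` with free boundary conditions:
`μ_n(σ) ∝ exp(β_c·Σ_{{x,y}} σ_x σ_y)`. -/
noncomputable def criticalIsingBox (n : ℕ) : (BoxV n → Bool) → ℝ := fun σ =>
  Real.exp (criticalBeta * boxInteraction n σ) /
    ∑ τ : BoxV n → Bool, Real.exp (criticalBeta * boxInteraction n τ)

/-- The average magnetization `M_n(σ) = |Q_n|⁻¹·Σ_{x ∈ Q_n} σ_x`. -/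
noncomputable def avgMagn (n : ℕ) (σ : BoxV n → Bool) : ℝ :=
  (Fintype.card (BoxV n) : ℝ)⁻¹ * ∑ x : BoxV n, spinR (σ x)

/-- The majority function `Maj_n = sign(M_n)` (`1` if `M_n > 0` and `−1` otherwise). -/
noncomputable def majority (n : ℕ) (σ : BoxV n → Bool) : ℝ :=
  if 0 < avgMagn n σ then 1 else -1

/-- The sublattice `H_n = ({0, s, 2s, …})² ∩ Q_n` of mesh size `s`. -/
def sublattice (n s : ℕ) : Finset (BoxV n) :=
  univ.filter fun x : BoxV n => s ∣ (x.1 : ℕ) ∧ s ∣ (x.2 : ℕ)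

end SR

set_option linter.unusedSectionVars false

namespace SR

open Finset

/-! ### Positive cones of functions on finite spaces -/

/-- The semiring generated by a family of functions and the nonnegative constants. -/
def posCone {Ω : Type*} (gens : Set (Ω → ℝ)) : Subsemiring (Ω → ℝ) :=
  Subsemiring.closure (gens ∪ {f | ∃ c : ℝ, 0 ≤ c ∧ f = fun _ => c})

section posCone

variable {Ω : Type*} {gens : Set (Ω → ℝ)}

theorem posCone_gen {f : Ω → ℝ} (hf : f ∈ gens) : f ∈ posCone gens :=
  Subsemiring.subset_closure (Or.inl hf)

theorem posCone_const {c : ℝ} (hc : 0 ≤ c) : (fun _ => c : Ω → ℝ) ∈ posCone gens :=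
  Subsemiring.subset_closure (Or.inr ⟨c, hc, rfl⟩)

theorem posCone_smul {c : ℝ} (hc : 0 ≤ c) {f : Ω → ℝ} (hf : f ∈ posCone gens) :
    (fun ω => c * f ω) ∈ posCone gens :=
  mul_mem (posCone_const hc) hf

theorem posCone_add {f g : Ω → ℝ} (hf : f ∈ posCone gens) (hg : g ∈ posCone gens) :
    (fun ω => f ω + g ω) ∈ posCone gens := add_mem hf hg

theorem posCone_mul {f g : Ω → ℝ} (hf : f ∈ posCone gens) (hg : g ∈ posCone gens) :
    (fun ω => f ω * g ω) ∈ posCone gens := mul_mem hf hg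

theorem posCone_sum {ι : Type*} (s : Finset ι) {f : ι → Ω → ℝ}
    (hf : ∀ i ∈ s, f i ∈ posCone gens) : (fun ω => ∑ i ∈ s, f i ω) ∈ posCone gens := by
  have := sum_mem hf
  convert this using 1
  ext ω
  simp

theorem sum_nonneg_of_mem_posCone [Fintype Ω]
    (h : ∀ m ∈ Submonoid.closure gens, 0 ≤ ∑ ω, m ω) {f : Ω → ℝ} (hf : f ∈ posCone gens) :
    0 ≤ ∑ ω, f ω := by
  rw [posCone, Subsemiring.mem_closure_iff] at hf
  induction hf using AddSubmonoid.closure_induction with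
  | zero => simp
  | add f g _ _ hf hg => simpa [Finset.sum_add_distrib] using add_nonneg hf hg
  | mem f hf =>
    have : ∃ c : ℝ, 0 ≤ c ∧ ∃ m ∈ Submonoid.closure gens, f = fun ω => c * m ω := by
      refine Submonoid.closure_induction ?_ ?_ ?_ hf
      · rintro f (hf | ⟨c, hc, rfl⟩)
        · exact ⟨1, zero_le_one, f, Submonoid.subset_closure hf, by simp⟩
        · exact ⟨c, hc, 1, one_mem _, by simp⟩
      · exact ⟨1, zero_le_one, 1, one_mem _, by ext; simp⟩
      · rintro f g - - ⟨c, hc, m, hm, rfl⟩ ⟨c', hc', m', hm', rfl⟩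
        exact ⟨c * c', mul_nonneg hc hc', m * m', mul_mem hm hm', by
          ext; simp only [Pi.mul_apply]; ring⟩
    obtain ⟨c, hc, m, hm, rfl⟩ := this
    rw [← Finset.mul_sum]
    exact mul_nonneg hc (h m hm)

theorem sum_mul_exp_nonneg [Fintype Ω]
    (h : ∀ m ∈ Submonoid.closure gens, 0 ≤ ∑ ω, m ω) {f H : Ω → ℝ} (hf : f ∈ posCone gens)
    (hH : H ∈ posCone gens) : 0 ≤ ∑ ω, f ω * Real.exp (H ω) := by
  have key : ∀ ω, HasSum (fun n : ℕ => f ω * (H ω ^ n / n.factorial)) (f ω * Real.exp (H ω)) := by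
    intro ω
    have := NormedSpace.expSeries_div_hasSum_exp (𝔸 := ℝ) (H ω)
    rw [← Real.exp_eq_exp_ℝ] at this
    exact this.mul_left _
  have hs := hasSum_sum (s := univ) (fun ω _ => key ω)
  refine hs.nonneg fun n => ?_
  refine sum_nonneg_of_mem_posCone (f := fun ω => f ω * (H ω ^ n / n.factorial)) h ?_
  refine posCone_mul hf ?_
  have := posCone_smul (gens := gens) (c := ((n.factorial : ℝ))⁻¹) (by positivity) (pow_mem hH n)
  convert this using 1
  ext ω
  simp only [Pi.pow_apply]
  ring

end posCone

/-- Generators obtained by reading site dependent functions at the sites of a product space. -/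
def siteFamily {V S ι : Type*} (u : V → ι → S → ℝ) : Set ((V → S) → ℝ) :=
  {f | ∃ x i, f = fun ω => u x i (ω x)}

/-- Generators obtained by reading one-site functions at the sites of a product space. -/
def siteGens (V : Type*) {S ι : Type*} (u : ι → S → ℝ) : Set ((V → S) → ℝ) :=
  siteFamily fun _ => u

theorem sum_nonneg_of_siteFamily {V S ι : Type*} [Fintype V] [DecidableEq V] [Fintype S]
    {u : V → ι → S → ℝ} (hu : ∀ x, ∀ m ∈ Submonoid.closure (Set.range (u x)), 0 ≤ ∑ s, m s) :
    ∀ m ∈ Submonoid.closure (siteFamily u), 0 ≤ ∑ ω, m ω := by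
  intro m hm
  have : ∃ k : V → S → ℝ, (∀ x, k x ∈ Submonoid.closure (Set.range (u x))) ∧
      m = fun ω => ∏ x, k x (ω x) := by
    refine Submonoid.closure_induction ?_ ?_ ?_ hm
    · rintro f ⟨x, i, rfl⟩
      refine ⟨Function.update 1 x (u x i), fun y => ?_, ?_⟩
      · by_cases hy : y = x
        · subst hy
          simpa using Submonoid.subset_closure (Set.mem_range_self (f := u y) i)
        · simp [Function.update_of_ne hy]
      · ext ω
        rw [Finset.prod_eq_single x]
        · simp
        · intro y _ hy
          simp [Function.update_of_ne hy]
        · simp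
    · exact ⟨1, fun _ => one_mem _, by ext; simp⟩
    · rintro f g - - ⟨k, hk, rfl⟩ ⟨l, hl, rfl⟩
      exact ⟨k * l, fun x => mul_mem (hk x) (hl x), by ext; simp [Finset.prod_mul_distrib]⟩
  obtain ⟨k, hk, rfl⟩ := this
  rw [← Fintype.prod_sum]
  exact Finset.prod_nonneg fun x _ => hu _ _ (hk x)

theorem sum_nonneg_of_siteGens {V S ι : Type*} [Fintype V] [DecidableEq V] [Fintype S]
    {u : ι → S → ℝ} (hu : ∀ m ∈ Submonoid.closure (Set.range u), 0 ≤ ∑ s, m s) :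
    ∀ m ∈ Submonoid.closure (siteGens V u), 0 ≤ ∑ ω, m ω :=
  sum_nonneg_of_siteFamily fun _ => hu

/-! ### Ising measures with general couplings and fields -/

section Ising

variable {V : Type*} [Fintype V]

/-- Interaction energy; the sum runs over ordered pairs. -/
noncomputable def energy (J : V → V → ℝ) (h : V → ℝ) (σ : V → Bool) : ℝ :=
  ∑ x, ∑ y, J x y * (spinR (σ x) * spinR (σ y)) + ∑ x, h x * spinR (σ x)

/-- Boltzmann weight. -/
noncomputable def wt (J : V → V → ℝ) (h : V → ℝ) (σ : V → Bool) : ℝ := Real.exp (energy J h σ)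

/-- Partition function. -/
noncomputable def pf [DecidableEq V] (J : V → V → ℝ) (h : V → ℝ) : ℝ := ∑ σ, wt J h σ

/-- Expectation under the Ising measure. -/
noncomputable def ev [DecidableEq V] (J : V → V → ℝ) (h : V → ℝ) (F : (V → Bool) → ℝ) : ℝ :=
  (∑ σ, wt J h σ * F σ) / pf J h

theorem wt_pos (J : V → V → ℝ) (h : V → ℝ) (σ : V → Bool) : 0 < wt J h σ := Real.exp_pos _

variable [DecidableEq V] (J : V → V → ℝ) (h : V → ℝ)

theorem pf_pos : 0 < pf J h := Finset.sum_pos (fun σ _ => wt_pos J h σ) Finset.univ_nonempty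

theorem ev_const (c : ℝ) : ev J h (fun _ => c) = c := by
  rw [ev, ← Finset.sum_mul]
  exact mul_div_cancel_left₀ c (pf_pos J h).ne'

theorem ev_add (F G : (V → Bool) → ℝ) : ev J h (fun σ => F σ + G σ) = ev J h F + ev J h G := by
  simp only [ev, mul_add, Finset.sum_add_distrib, add_div]

theorem ev_mul (c : ℝ) (F : (V → Bool) → ℝ) : ev J h (fun σ => c * F σ) = c * ev J h F := by
  simp only [ev, mul_left_comm _ c, ← Finset.mul_sum, mul_div_assoc]

theorem ev_sub (F G : (V → Bool) → ℝ) : ev J h (fun σ => F σ - G σ) = ev J h F - ev J h G := by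
  simp only [ev, mul_sub, Finset.sum_sub_distrib, sub_div]

theorem ev_sum {ι : Type*} (s : Finset ι) (F : ι → (V → Bool) → ℝ) :
    ev J h (fun σ => ∑ i ∈ s, F i σ) = ∑ i ∈ s, ev J h (F i) := by
  simp only [ev, Finset.mul_sum]
  rw [Finset.sum_comm, Finset.sum_div]

theorem ev_mono {F G : (V → Bool) → ℝ} (hFG : ∀ σ, F σ ≤ G σ) : ev J h F ≤ ev J h G := by
  unfold ev
  gcongr with σ
  · exact (pf_pos J h).le
  · exact (wt_pos J h σ).le
  · exact hFG σ

theorem ev_nonneg {F : (V → Bool) → ℝ} (hF : ∀ σ, 0 ≤ F σ) : 0 ≤ ev J h F := by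
  simpa [ev_const] using ev_mono J h (F := fun _ => 0) hF

theorem spinR_sq (b : Bool) : spinR b * spinR b = 1 := by cases b <;> simp [spinR]

theorem spinR_not (b : Bool) : spinR (!b) = -spinR b := by cases b <;> simp [spinR]

theorem abs_spinR (b : Bool) : |spinR b| = 1 := by cases b <;> simp [spinR]

end Ising

end SR

namespace SR

open Finset

/-! ### Replicas -/

section replica

variable {V ι κ : Type*} [Fintype V] [DecidableEq V] [Fintype ι] [DecidableEq ι]

theorem replica_sum (g : ι → (V → Bool) → ℝ) :
    ∑ ω : V → ι → Bool, ∏ i, g i (fun x => ω x i) = ∏ i, ∑ σ, g i σ := by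
  rw [Fintype.prod_sum]
  exact Fintype.sum_equiv (Equiv.piComm (fun (_ : V) (_ : ι) => Bool)) _ _ fun ω => rfl

theorem replica_energy_mem {u : κ → (ι → Bool) → ℝ} (J : ι → V → V → ℝ) (h : ι → V → ℝ)
    (hJ : ∀ x y, (fun ω : V → ι → Bool => ∑ i, J i x y * (spinR (ω x i) * spinR (ω y i))) ∈
      posCone (siteGens V u))
    (hh : ∀ x, (fun ω : V → ι → Bool => ∑ i, h i x * spinR (ω x i)) ∈ posCone (siteGens V u)) :
    (fun ω : V → ι → Bool => ∑ i, energy (J i) (h i) (fun x => ω x i)) ∈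
      posCone (siteGens V u) := by
  have h1 := posCone_add (posCone_sum univ fun x _ => posCone_sum univ fun y _ => hJ x y)
    (posCone_sum univ fun x _ => hh x)
  convert h1 using 1
  ext ω
  simp only [energy, Finset.sum_add_distrib]
  congr 1
  · rw [Finset.sum_comm]
    refine Finset.sum_congr rfl fun x _ => ?_
    rw [Finset.sum_comm]
  · rw [Finset.sum_comm]

theorem replica_nonneg {u : κ → (ι → Bool) → ℝ}
    (hu : ∀ m ∈ Submonoid.closure (Set.range u), 0 ≤ ∑ s, m s)
    (J : ι → V → V → ℝ) (h : ι → V → ℝ)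
    (hJ : ∀ x y, (fun ω : V → ι → Bool => ∑ i, J i x y * (spinR (ω x i) * spinR (ω y i))) ∈
      posCone (siteGens V u))
    (hh : ∀ x, (fun ω : V → ι → Bool => ∑ i, h i x * spinR (ω x i)) ∈ posCone (siteGens V u))
    {F : (V → ι → Bool) → ℝ} (hF : F ∈ posCone (siteGens V u)) :
    0 ≤ ∑ ω, F ω * ∏ i, wt (J i) (h i) (fun x => ω x i) := by
  simp only [wt, ← Real.exp_sum]
  exact sum_mul_exp_nonneg (sum_nonneg_of_siteGens hu) hF (replica_energy_mem J h hJ hh)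

end replica

section Ginibre

variable {V : Type*} [Fintype V] [DecidableEq V]

/-- Sum and difference of two replicas. -/
noncomputable def duo (i : Fin 2) (s : Fin 2 → Bool) : ℝ :=
  if i = 0 then spinR (s 0) + spinR (s 1) else spinR (s 0) - spinR (s 1)

theorem duo_monomials : ∀ m ∈ Submonoid.closure (Set.range duo), 0 ≤ ∑ s, m s := by
  intro m hm
  have : ∃ a b : ℕ, m = duo 0 ^ a * duo 1 ^ b := by
    refine Submonoid.closure_induction ?_ ?_ ?_ hm
    · rintro f ⟨i, rfl⟩
      fin_cases i
      · exact ⟨1, 0, by simp⟩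
      · exact ⟨0, 1, by simp⟩
    · exact ⟨0, 0, by simp⟩
    · rintro f g - - ⟨a, b, rfl⟩ ⟨c, d, rfl⟩
      exact ⟨a + c, b + d, by ring⟩
  obtain ⟨a, b, rfl⟩ := this
  have e : ∀ m : (Fin 2 → Bool) → ℝ, ∑ s, m s =
      m ![true, true] + m ![true, false] + (m ![false, true] + m ![false, false]) := by
    intro m
    rw [← (finTwoArrowEquiv Bool).symm.sum_comp, Fintype.sum_prod_type]
    simp [finTwoArrowEquiv]
  rw [e]
  simp only [duo, spinR, Pi.mul_apply, Pi.pow_apply]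
  norm_num
  rcases Nat.even_or_odd a with ha | ha <;> rcases Nat.even_or_odd b with hb | hb <;>
    simp only [ha.neg_pow, hb.neg_pow] <;> ring_nf <;> positivity

/-- Functions of a spin configuration generated by spins and nonnegative constants. -/
def spinCone (V : Type*) : Subsemiring ((V → Bool) → ℝ) :=
  posCone {f | ∃ x, f = fun σ => spinR (σ x)}

theorem spin_mem (x : V) : (fun σ : V → Bool => spinR (σ x)) ∈ spinCone V :=
  posCone_gen ⟨x, rfl⟩

theorem spinCone_duo {F : (V → Bool) → ℝ} (hF : F ∈ spinCone V) :
    (fun ω : V → Fin 2 → Bool => F (fun x => ω x 0) + F (fun x => ω x 1)) ∈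
        posCone (siteGens V duo) ∧
      (fun ω : V → Fin 2 → Bool => F (fun x => ω x 0) - F (fun x => ω x 1)) ∈
        posCone (siteGens V duo) := by
  refine Subsemiring.closure_induction ?_ ?_ ?_ ?_ ?_ hF
  · rintro f (⟨x, rfl⟩ | ⟨c, hc, rfl⟩)
    · constructor
      · exact posCone_gen ⟨x, 0, by ext; simp [duo]⟩
      · exact posCone_gen ⟨x, 1, by ext; simp [duo]⟩
    · constructor
      · exact posCone_const (add_nonneg hc hc)
      · simp only [sub_self]
        exact posCone_const le_rfl
  · constructor
    · exact posCone_const (c := 0 + 0) (by norm_num)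
    · simpa using posCone_const (gens := siteGens V duo) (le_refl (0 : ℝ))
  · constructor
    · exact posCone_const (c := 1 + 1) (by norm_num)
    · simpa using posCone_const (gens := siteGens V duo) (le_refl (0 : ℝ))
  · rintro f g - - ⟨hf, hf'⟩ ⟨hg, hg'⟩
    constructor
    · convert posCone_add hf hg using 1
      ext; simp only [Pi.add_apply]; ring
    · convert posCone_add hf' hg' using 1
      ext; simp only [Pi.add_apply]; ring
  · rintro f g - - ⟨hf, hf'⟩ ⟨hg, hg'⟩
    constructor
    · convert posCone_smul (c := 1 / 2) (by norm_num)
        (posCone_add (posCone_mul hf hg) (posCone_mul hf' hg')) using 1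
      ext; simp only [Pi.mul_apply]; ring
    · convert posCone_smul (c := 1 / 2) (by norm_num)
        (posCone_add (posCone_mul hf hg') (posCone_mul hf' hg)) using 1
      ext; simp only [Pi.mul_apply]; ring

variable {J J' : V → V → ℝ} {h h' : V → ℝ}

theorem duo_coupling (a b : ℝ) (hab : |b| ≤ a) (x y : V) :
    (fun ω : V → Fin 2 → Bool => a * (spinR (ω x 0) * spinR (ω y 0)) +
      b * (spinR (ω x 1) * spinR (ω y 1))) ∈ posCone (siteGens V duo) := by
  obtain ⟨h1, h2⟩ := abs_le.1 hab
  have t : ∀ x, (fun ω : V → Fin 2 → Bool => duo 0 (ω x)) ∈ posCone (siteGens V duo) :=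
    fun x => posCone_gen ⟨x, 0, rfl⟩
  have q : ∀ x, (fun ω : V → Fin 2 → Bool => duo 1 (ω x)) ∈ posCone (siteGens V duo) :=
    fun x => posCone_gen ⟨x, 1, rfl⟩
  convert posCone_add
    (posCone_smul (c := (a + b) / 4) (by linarith)
      (posCone_add (posCone_mul (t x) (t y)) (posCone_mul (q x) (q y))))
    (posCone_smul (c := (a - b) / 4) (by linarith)
      (posCone_add (posCone_mul (t x) (q y)) (posCone_mul (q x) (t y)))) using 1
  ext ω
  simp [duo]
  ring

theorem duo_field (a b : ℝ) (hab : |b| ≤ a) (x : V) :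
    (fun ω : V → Fin 2 → Bool => a * spinR (ω x 0) + b * spinR (ω x 1)) ∈
      posCone (siteGens V duo) := by
  obtain ⟨h1, h2⟩ := abs_le.1 hab
  convert posCone_add
    (posCone_smul (c := (a + b) / 2) (by linarith)
      (posCone_gen (gens := siteGens V duo) ⟨x, 0, rfl⟩))
    (posCone_smul (c := (a - b) / 2) (by linarith)
      (posCone_gen (gens := siteGens V duo) ⟨x, 1, rfl⟩)) using 1
  ext ω
  simp [duo]
  ring

theorem replica_two (F G : (V → Bool) → ℝ) (J : Fin 2 → V → V → ℝ) (h : Fin 2 → V → ℝ) :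
    ∑ ω : V → Fin 2 → Bool, (F (fun x => ω x 0) * G (fun x => ω x 1)) *
      ∏ i, wt (J i) (h i) (fun x => ω x i) =
    (∑ σ, wt (J 0) (h 0) σ * F σ) * ∑ σ, wt (J 1) (h 1) σ * G σ := by
  have := replica_sum (V := V) (ι := Fin 2)
    ![fun σ => wt (J 0) (h 0) σ * F σ, fun σ => wt (J 1) (h 1) σ * G σ]
  simp only [Fin.prod_univ_two, Matrix.cons_val_zero, Matrix.cons_val_one] at this ⊢
  rw [← this]
  refine Finset.sum_congr rfl fun ω _ => ?_
  ring

/-- Ginibre's inequality: expectations of functions in the spin cone increase with the couplings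
and the fields, and dominate those for couplings and fields of arbitrary signs. -/
theorem abs_ev_le_ev (hJ : ∀ x y, |J' x y| ≤ J x y) (hh : ∀ x, |h' x| ≤ h x)
    {F : (V → Bool) → ℝ} (hF : F ∈ spinCone V) : |ev J' h' F| ≤ ev J h F := by
  obtain ⟨hp, hm⟩ := spinCone_duo hF
  have hJ2 : ∀ x y, (fun ω : V → Fin 2 → Bool => ∑ i, (![J, J'] : Fin 2 → V → V → ℝ) i x y *
      (spinR (ω x i) * spinR (ω y i))) ∈ posCone (siteGens V duo) := by
    intro x y
    simpa [Fin.sum_univ_two] using duo_coupling _ _ (hJ x y) x y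
  have hh2 : ∀ x, (fun ω : V → Fin 2 → Bool => ∑ i, (![h, h'] : Fin 2 → V → ℝ) i x *
      spinR (ω x i)) ∈ posCone (siteGens V duo) := by
    intro x
    simpa [Fin.sum_univ_two] using duo_field _ _ (hh x) x
  have h1 := replica_nonneg duo_monomials _ _ hJ2 hh2 hp
  have h2 := replica_nonneg duo_monomials _ _ hJ2 hh2 hm
  have e1 := replica_two F (fun _ => 1) ![J, J'] ![h, h']
  have e2 := replica_two (fun _ => 1) F ![J, J'] ![h, h']
  simp only [mul_one, one_mul, Matrix.cons_val_zero, Matrix.cons_val_one] at e1 e2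
  simp only [add_mul, sub_mul, Finset.sum_add_distrib, Finset.sum_sub_distrib] at h1 h2
  rw [e1, e2] at h1 h2
  have z := pf_pos J h
  have z' := pf_pos J' h'
  have eZ : ∑ σ, wt J h σ = pf J h := rfl
  have eZ' : ∑ σ, wt J' h' σ = pf J' h' := rfl
  rw [eZ, eZ'] at h1 h2
  rw [abs_le, ev, ev, ← neg_div, div_le_div_iff₀ z z', div_le_div_iff₀ z' z]
  constructor <;> nlinarith

theorem ev_le_ev (hJ0 : ∀ x y, 0 ≤ J' x y) (hh0 : ∀ x, 0 ≤ h' x)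
    (hJ : ∀ x y, J' x y ≤ J x y) (hh : ∀ x, h' x ≤ h x)
    {F : (V → Bool) → ℝ} (hF : F ∈ spinCone V) : ev J' h' F ≤ ev J h F :=
  (le_abs_self _).trans (abs_ev_le_ev (fun x y => by rw [abs_of_nonneg (hJ0 x y)]; exact hJ x y)
    (fun x => by rw [abs_of_nonneg (hh0 x)]; exact hh x) hF)

theorem ev_nonneg_of_mem (hJ0 : ∀ x y, 0 ≤ J x y) (hh0 : ∀ x, 0 ≤ h x)
    {F : (V → Bool) → ℝ} (hF : F ∈ spinCone V) : 0 ≤ ev J h F :=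
  (abs_nonneg _).trans (abs_ev_le_ev (J' := fun _ _ => 0) (h' := fun _ => 0)
    (by simpa using hJ0) (by simpa using hh0) hF)

end Ginibre

end SR

namespace SR

open Finset

section replicaExpectation

variable {V ι : Type*} [Fintype V] [DecidableEq V] [Fintype ι] [DecidableEq ι]
  (J : ι → V → V → ℝ) (h : ι → V → ℝ)

theorem replica_pair {i j : ι} (hij : i ≠ j) (F G : (V → Bool) → ℝ) :
    ∑ ω : V → ι → Bool, (F (fun x => ω x i) * G (fun x => ω x j)) *
      ∏ k, wt (J k) (h k) (fun x => ω x k) =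
    (∏ k, pf (J k) (h k)) * (ev (J i) (h i) F * ev (J j) (h j) G) := by
  set A : ι → (V → Bool) → ℝ := fun k σ => (if k = i then F σ else 1) * if k = j then G σ else 1
  have h1 := replica_sum (V := V) (ι := ι) fun k σ => wt (J k) (h k) σ * A k σ
  have h2 : ∀ k, ∑ σ, wt (J k) (h k) σ * A k σ = pf (J k) (h k) *
      ((if k = i then ev (J k) (h k) F else 1) * if k = j then ev (J k) (h k) G else 1) := by
    intro k
    have hp := (pf_pos (J k) (h k)).ne'
    by_cases hi : k = i
    · subst hi
      simp only [A, hij, if_true, if_false, mul_one, ev]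
      field_simp
    · by_cases hj : k = j
      · subst hj
        simp only [A, hi, if_true, if_false, one_mul, ev]
        field_simp
      · simp [A, hi, hj, pf]
  simp only [h2, Finset.prod_mul_distrib, Finset.prod_ite_eq', Finset.mem_univ, if_true, A] at h1
  rw [← h1]
  refine Finset.sum_congr rfl fun ω _ => ?_
  ring

theorem replica_single (i : ι) (F : (V → Bool) → ℝ) :
    ∑ ω : V → ι → Bool, F (fun x => ω x i) * ∏ k, wt (J k) (h k) (fun x => ω x k) =
    (∏ k, pf (J k) (h k)) * ev (J i) (h i) F := by
  set A : ι → (V → Bool) → ℝ := fun k σ => if k = i then F σ else 1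
  have h1 := replica_sum (V := V) (ι := ι) fun k σ => wt (J k) (h k) σ * A k σ
  have h2 : ∀ k, ∑ σ, wt (J k) (h k) σ * A k σ = pf (J k) (h k) *
      (if k = i then ev (J k) (h k) F else 1) := by
    intro k
    have hp := (pf_pos (J k) (h k)).ne'
    by_cases hi : k = i
    · subst hi
      simp only [A, if_true, ev]
      field_simp
    · simp [A, hi, pf]
  simp only [h2, Finset.prod_mul_distrib, Finset.prod_ite_eq', Finset.mem_univ, if_true, A] at h1
  rw [← h1]
  refine Finset.sum_congr rfl fun ω _ => ?_
  ring

end replicaExpectation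

section FourReplicas

variable {V : Type*} [Fintype V] [DecidableEq V]

/-- Orthogonal combinations of four replicas. -/
noncomputable def quad (i : Fin 4) (s : Fin 4 → Bool) : ℝ :=
  (![spinR (s 0) + spinR (s 1) + spinR (s 2) + spinR (s 3),
    -spinR (s 0) - spinR (s 1) + spinR (s 2) + spinR (s 3),
    spinR (s 0) - spinR (s 1) + spinR (s 2) - spinR (s 3),
    spinR (s 0) - spinR (s 1) - spinR (s 2) + spinR (s 3)] : Fin 4 → ℝ) i

theorem quad_monomials : ∀ m ∈ Submonoid.closure (Set.range quad), 0 ≤ ∑ s, m s := by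
  intro m hm
  have : ∃ a b c d : ℕ, m = quad 0 ^ a * quad 1 ^ b * quad 2 ^ c * quad 3 ^ d := by
    refine Submonoid.closure_induction ?_ ?_ ?_ hm
    · rintro f ⟨i, rfl⟩
      fin_cases i
      · exact ⟨1, 0, 0, 0, by simp⟩
      · exact ⟨0, 1, 0, 0, by simp⟩
      · exact ⟨0, 0, 1, 0, by simp⟩
      · exact ⟨0, 0, 0, 1, by simp⟩
    · exact ⟨0, 0, 0, 0, by simp⟩
    · rintro f g - - ⟨a, b, c, d, rfl⟩ ⟨a', b', c', d', rfl⟩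
      exact ⟨a + a', b + b', c + c', d + d', by ring⟩
  obtain ⟨a, b, c, d, rfl⟩ := this
  have e : ∀ m : (Fin 4 → Bool) → ℝ, ∑ s, m s = ∑ p : Bool × Bool × Bool × Bool,
      m ![p.1, p.2.1, p.2.2.1, p.2.2.2] := by
    intro m
    refine (Fintype.sum_equiv
      { toFun := fun p => ![p.1, p.2.1, p.2.2.1, p.2.2.2]
        invFun := fun s => (s 0, s 1, s 2, s 3)
        left_inv := fun p => by simp
        right_inv := fun s => by
          ext i
          fin_cases i <;> rfl } _ _ fun p => rfl).symm
  rw [e]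
  simp only [Fintype.sum_prod_type, Fintype.sum_bool, quad, spinR, Pi.mul_apply, Pi.pow_apply,
    Matrix.cons_val_zero, Matrix.cons_val_one, Matrix.cons_val]
  norm_num
  rcases Nat.even_or_odd a with ha | ha <;> rcases Nat.even_or_odd b with hb | hb <;>
    rcases Nat.even_or_odd c with hc | hc <;> rcases Nat.even_or_odd d with hd | hd <;>
    simp only [ha.neg_pow, hb.neg_pow, hc.neg_pow, hd.neg_pow] <;> ring_nf <;> positivity

theorem quad_coupling {a : ℝ} (ha : 0 ≤ a) (x y : V) :
    (fun ω : V → Fin 4 → Bool => ∑ i, a * (spinR (ω x i) * spinR (ω y i))) ∈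
      posCone (siteGens V quad) := by
  have t : ∀ (i : Fin 4) (x : V), (fun ω : V → Fin 4 → Bool => quad i (ω x)) ∈
      posCone (siteGens V quad) := fun i x => posCone_gen ⟨x, i, rfl⟩
  convert posCone_smul (c := a / 4) (by linarith)
    (posCone_sum univ fun i _ => posCone_mul (t i x) (t i y)) using 1
  ext ω
  simp [Fin.sum_univ_four, quad]
  ring

variable {J : V → V → ℝ} {h h' : V → ℝ}

/-- Lebowitz type inequality: the truncated two-point function decreases when the field is
increased to a field dominating it in absolute value. -/
theorem cov_le_cov (hJ : ∀ x y, 0 ≤ J x y) (hh : ∀ x, |h' x| ≤ h x) (x y : V) :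
    ev J h (fun σ => spinR (σ x) * spinR (σ y)) -
        ev J h (fun σ => spinR (σ x)) * ev J h (fun σ => spinR (σ y)) ≤
      ev J h' (fun σ => spinR (σ x) * spinR (σ y)) -
        ev J h' (fun σ => spinR (σ x)) * ev J h' (fun σ => spinR (σ y)) := by
  set K : Fin 4 → V → ℝ := ![h, h', h, h']
  have hK : ∀ x, (fun ω : V → Fin 4 → Bool => ∑ i, K i x * spinR (ω x i)) ∈
      posCone (siteGens V quad) := by
    intro x
    obtain ⟨h1, h2⟩ := abs_le.1 (hh x)
    convert posCone_add
      (posCone_smul (c := (h x + h' x) / 2) (by linarith)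
        (posCone_gen (gens := siteGens V quad) ⟨x, 0, rfl⟩))
      (posCone_smul (c := (h x - h' x) / 2) (by linarith)
        (posCone_gen (gens := siteGens V quad) ⟨x, 2, rfl⟩)) using 1
    ext ω
    simp [Fin.sum_univ_four, quad, K]
    ring
  have key := replica_nonneg quad_monomials (fun _ => J) K (fun x y => quad_coupling (hJ x y) x y)
    hK (posCone_mul (posCone_gen (gens := siteGens V quad) ⟨x, 1, rfl⟩)
      (posCone_gen (gens := siteGens V quad) ⟨y, 3, rfl⟩))
  have hP : 0 < ∏ k, pf J (K k) := Finset.prod_pos fun k _ => pf_pos _ _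
  have s1 : ∀ i j : Fin 4, i ≠ j → _ := fun i j hij => replica_pair (fun _ => J) K hij
    (fun σ => spinR (σ x)) (fun σ => spinR (σ y))
  have s2 := fun i : Fin 4 => replica_single (fun _ => J) K i
    (fun σ => spinR (σ x) * spinR (σ y))
  have e : ∀ ω : V → Fin 4 → Bool, quad 1 (ω x) * quad 3 (ω y) =
      -(spinR (ω x 0) * spinR (ω y 0)) + spinR (ω x 0) * spinR (ω y 1)
      + spinR (ω x 0) * spinR (ω y 2) - spinR (ω x 0) * spinR (ω y 3)
      - spinR (ω x 1) * spinR (ω y 0) + spinR (ω x 1) * spinR (ω y 1)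
      + spinR (ω x 1) * spinR (ω y 2) - spinR (ω x 1) * spinR (ω y 3)
      + spinR (ω x 2) * spinR (ω y 0) - spinR (ω x 2) * spinR (ω y 1)
      - spinR (ω x 2) * spinR (ω y 2) + spinR (ω x 2) * spinR (ω y 3)
      + spinR (ω x 3) * spinR (ω y 0) - spinR (ω x 3) * spinR (ω y 1)
      - spinR (ω x 3) * spinR (ω y 2) + spinR (ω x 3) * spinR (ω y 3) := by
    intro ω
    simp [quad]
    ring
  simp only [e, add_mul, sub_mul, neg_mul, Finset.sum_add_distrib, Finset.sum_sub_distrib,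
    Finset.sum_neg_distrib] at key
  rw [s2 0, s2 1, s2 2, s2 3, s1 0 1 (by decide), s1 0 2 (by decide), s1 0 3 (by decide),
    s1 1 0 (by decide), s1 1 2 (by decide), s1 1 3 (by decide), s1 2 0 (by decide),
    s1 2 1 (by decide), s1 2 3 (by decide), s1 3 0 (by decide), s1 3 1 (by decide),
    s1 3 2 (by decide)] at key
  simp only [K, Matrix.cons_val_zero, Matrix.cons_val_one, Matrix.cons_val] at key hP
  refine le_of_mul_le_mul_left ?_ hP
  linarith

/-- Subadditivity of the magnetization in the field. -/
theorem magn_add_le (hJ : ∀ x y, 0 ≤ J x y) (hh : ∀ x, 0 ≤ h x) (hh' : ∀ x, 0 ≤ h' x) (x : V) :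
    ev J (fun y => h y + h' y) (fun σ => spinR (σ x)) ≤
      ev J h (fun σ => spinR (σ x)) + ev J h' (fun σ => spinR (σ x)) := by
  set K : Fin 4 → V → ℝ := ![fun y => h y + h' y, fun _ => 0, h, h']
  have hK : ∀ x, (fun ω : V → Fin 4 → Bool => ∑ i, K i x * spinR (ω x i)) ∈
      posCone (siteGens V quad) := by
    intro x
    have h1 := hh x
    have h2 := hh' x
    convert posCone_add (posCone_add
      (posCone_smul (c := (h x + h' x) / 2) (by linarith)
        (posCone_gen (gens := siteGens V quad) ⟨x, 0, rfl⟩))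
      (posCone_smul (c := h x / 2) (by linarith)
        (posCone_gen (gens := siteGens V quad) ⟨x, 2, rfl⟩)))
      (posCone_smul (c := h' x / 2) (by linarith)
        (posCone_gen (gens := siteGens V quad) ⟨x, 3, rfl⟩)) using 1
    ext ω
    simp [Fin.sum_univ_four, quad, K]
    ring
  have key := replica_nonneg quad_monomials (fun _ => J) K (fun x y => quad_coupling (hJ x y) x y)
    hK (posCone_gen (gens := siteGens V quad) ⟨x, 1, rfl⟩)
  have hP : 0 < ∏ k, pf J (K k) := Finset.prod_pos fun k _ => pf_pos _ _
  have s2 := fun i : Fin 4 => replica_single (fun _ => J) K i (fun σ => spinR (σ x))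
  have e : ∀ ω : V → Fin 4 → Bool, quad 1 (ω x) =
      -spinR (ω x 0) - spinR (ω x 1) + spinR (ω x 2) + spinR (ω x 3) := by
    intro ω
    simp [quad]
  simp only [e, add_mul, sub_mul, neg_mul, Finset.sum_add_distrib, Finset.sum_sub_distrib,
    Finset.sum_neg_distrib] at key
  rw [s2 0, s2 1, s2 2, s2 3] at key
  have h0 : 0 ≤ ev J (K 1) (fun σ => spinR (σ x)) :=
    ev_nonneg_of_mem hJ (fun x => by simp [K]) (spin_mem x)
  simp only [K, Matrix.cons_val_zero, Matrix.cons_val_one, Matrix.cons_val] at key hP h0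
  refine le_of_mul_le_mul_left ?_ hP
  nlinarith [mul_nonneg hP.le h0]

end FourReplicas

end SR

namespace SR

open Finset

/-! ### Embeddings, ghost vertices, conditioning -/

section Embedding

variable {V W : Type*} [Fintype V] [DecidableEq V] [Fintype W] [DecidableEq W]

theorem exists_sum_comp_injective {e : V → W} (he : Function.Injective e) :
    ∃ c : ℝ, 0 < c ∧ ∀ g : (V → Bool) → ℝ, ∑ τ : W → Bool, g (τ ∘ e) = c * ∑ σ, g σ := by
  classical
  let R := {w // w ∉ Set.range e}
  let E : V ⊕ R ≃ W :=
    ((Equiv.ofInjective e he).sumCongr (Equiv.refl R)).trans (Equiv.Set.sumCompl (Set.range e))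
  refine ⟨Fintype.card (R → Bool), by exact_mod_cast Fintype.card_pos, fun g => ?_⟩
  let Q : (W → Bool) ≃ (V → Bool) × (R → Bool) :=
    (Equiv.arrowCongr E.symm (Equiv.refl Bool)).trans (Equiv.sumArrowEquivProdArrow V R Bool)
  have h1 : ∑ τ : W → Bool, g (τ ∘ e) = ∑ p : (V → Bool) × (R → Bool), g p.1 := by
    refine Fintype.sum_equiv Q _ _ fun τ => ?_
    congr 1
  rw [h1, Fintype.sum_prod_type]
  simp [Finset.mul_sum]

theorem sum_range_indicator {e : V → W} (he : Function.Injective e) (f : W → ℝ) :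
    ∑ w, (if w ∈ univ.image e then f w else 0) = ∑ x, f (e x) := by
  rw [← Finset.sum_filter, Finset.filter_mem_eq_inter, Finset.univ_inter,
    Finset.sum_image fun x _ y _ h => he h]

theorem spinCone_comp (e : V → W) {F : (V → Bool) → ℝ} (hF : F ∈ spinCone V) :
    (fun τ : W → Bool => F (τ ∘ e)) ∈ spinCone W := by
  refine Subsemiring.closure_induction ?_ ?_ ?_ ?_ ?_ hF
  · rintro f (⟨x, rfl⟩ | ⟨c, hc, rfl⟩)
    · exact spin_mem (e x)
    · exact posCone_const hc
  · exact zero_mem _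
  · exact one_mem _
  · rintro f g - - hf hg
    exact posCone_add hf hg
  · rintro f g - - hf hg
    exact posCone_mul hf hg

/-- Correlations increase under embeddings of weighted graphs. -/
theorem ev_le_ev_of_embedding {e : V → W} (he : Function.Injective e) {J : V → V → ℝ} {h : V → ℝ}
    {J' : W → W → ℝ} {h' : W → ℝ} (hJ0 : ∀ x y, 0 ≤ J x y) (hh0 : ∀ x, 0 ≤ h x)
    (hJ0' : ∀ x y, 0 ≤ J' x y) (hh0' : ∀ x, 0 ≤ h' x)
    (hJ : ∀ x y, J x y ≤ J' (e x) (e y)) (hh : ∀ x, h x ≤ h' (e x))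
    {F : (V → Bool) → ℝ} (hF : F ∈ spinCone V) :
    ev J h F ≤ ev J' h' (fun τ => F (τ ∘ e)) := by
  obtain ⟨c, hc, hsum⟩ := exists_sum_comp_injective he
  set K : W → W → ℝ := fun w w' =>
    if w ∈ univ.image e then (if w' ∈ univ.image e then J' w w' else 0) else 0
  set k : W → ℝ := fun w => if w ∈ univ.image e then h' w else 0
  have hK : ∀ τ : W → Bool, wt K k τ =
      wt (fun x y => J' (e x) (e y)) (fun x => h' (e x)) (τ ∘ e) := by
    intro τ
    simp only [wt, energy, K, k, ite_mul, zero_mul]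
    congr 2
    · have : ∀ w, (∑ w', if w ∈ univ.image e then
          (if w' ∈ univ.image e then J' w w' * (spinR (τ w) * spinR (τ w')) else 0) else 0) =
          if w ∈ univ.image e then ∑ y, J' w (e y) * (spinR (τ w) * spinR (τ (e y))) else 0 := by
        intro w
        split_ifs
        · exact sum_range_indicator he fun w' => J' w w' * (spinR (τ w) * spinR (τ w'))
        · simp
      simp only [this]
      exact sum_range_indicator he _
    · exact sum_range_indicator he _
  calc ev J h F ≤ ev (fun x y => J' (e x) (e y)) (fun x => h' (e x)) F :=
        ev_le_ev hJ0 hh0 hJ hh hF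
    _ = ev K k (fun τ => F (τ ∘ e)) := by
        simp only [ev, pf, hK]
        rw [hsum (fun σ => wt (fun x y => J' (e x) (e y)) (fun x => h' (e x)) σ * F σ),
          hsum (fun σ => wt (fun x y => J' (e x) (e y)) (fun x => h' (e x)) σ),
          mul_div_mul_left _ _ hc.ne']
    _ ≤ _ := by
        refine ev_le_ev ?_ ?_ ?_ ?_ (spinCone_comp e hF)
        · intro x y
          simp only [K]
          split_ifs <;> first | exact hJ0' x y | exact le_rfl
        · intro x
          simp only [k]
          split_ifs
          exacts [hh0' x, le_rfl]
        · intro x y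
          simp only [K]
          split_ifs
          exacts [le_rfl, hJ0' x y, hJ0' x y]
        · intro x
          simp only [k]
          split_ifs
          exacts [le_rfl, hh0' x]

/-- Couplings in which a field is realized by an additional vertex. -/
def ghostJ (J : V → V → ℝ) (h : V → ℝ) : Option V → Option V → ℝ
  | some x, some y => J x y
  | some x, none => h x
  | _, _ => 0

theorem ev_ghost (J : V → V → ℝ) (h : V → ℝ) (x : V) :
    ev (ghostJ J h) (fun _ => 0) (fun τ => spinR (τ (some x)) * spinR (τ none)) =
      ev J h (fun σ => spinR (σ x)) := by
  let E : Bool × (V → Bool) ≃ (Option V → Bool) :=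
    { toFun := fun p o => o.elim p.1 fun x => p.1 == p.2 x
      invFun := fun τ => (τ none, fun x => τ none == τ (some x))
      left_inv := by
        rintro ⟨b, σ⟩
        ext <;> simp
      right_inv := by
        intro τ
        ext o
        cases o <;> simp }
  have hs : ∀ b c : Bool, spinR (b == c) = spinR b * spinR c := by
    intro b c; cases b <;> cases c <;> simp [spinR]
  have hw : ∀ p, wt (ghostJ J h) (fun _ => 0) (E p) = wt J h p.2 := by
    intro p
    simp only [wt, energy, Fintype.sum_option, ghostJ, E, Equiv.coe_fn_mk, Option.elim, hs]
    congr 1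
    have := spinR_sq p.1
    simp only [zero_mul, Finset.sum_const_zero, add_zero, zero_add, Finset.sum_add_distrib]
    rw [add_comm]
    congr 1
    · refine Finset.sum_congr rfl fun x _ => Finset.sum_congr rfl fun y _ => ?_
      linear_combination J x y * spinR (p.2 x) * spinR (p.2 y) * this
    · refine Finset.sum_congr rfl fun x _ => ?_
      linear_combination h x * spinR (p.2 x) * this
  have hx : ∀ p, spinR (E p (some x)) * spinR (E p none) = spinR (p.2 x) := by
    intro p
    simp only [E, Equiv.coe_fn_mk, Option.elim, hs]
    linear_combination spinR (p.2 x) * spinR_sq p.1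
  simp only [ev, pf, ← E.sum_comp, hw, hx, Fintype.sum_prod_type, Finset.sum_const]
  simp only [nsmul_eq_mul]
  exact mul_div_mul_left _ _ (by simp)

end Embedding

section Conditioning

variable {V : Type*} [Fintype V] [DecidableEq V] (p : V → Prop) [DecidablePred p]

/-- The configuration equal to `σ` on `p` and to `ξ` elsewhere. -/
def glue (ξ : V → Bool) (σ : Subtype p → Bool) (x : V) : Bool :=
  if hx : p x then σ ⟨x, hx⟩ else ξ x

/-- The field induced on `p` by the boundary condition `ξ`. -/
noncomputable def bdField (J : V → V → ℝ) (h : V → ℝ) (ξ : V → Bool) (x : Subtype p) : ℝ :=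
  h x + ∑ y, if p y then 0 else (J x y + J y x) * spinR (ξ y)

/-- Conditional expectation of `F` given the configuration outside of `p`. -/
noncomputable def cev (J : V → V → ℝ) (h : V → ℝ) (F : (V → Bool) → ℝ) (ξ : V → Bool) : ℝ :=
  ev (fun x y : Subtype p => J x y) (bdField p J h ξ) (fun σ => F (glue p ξ σ))

variable {p}

theorem glue_of_mem (ξ : V → Bool) (σ : Subtype p → Bool) {x : V} (hx : p x) :
    glue p ξ σ x = σ ⟨x, hx⟩ := dif_pos hx

theorem glue_of_notMem (ξ : V → Bool) (σ : Subtype p → Bool) {x : V} (hx : ¬p x) :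
    glue p ξ σ x = ξ x := dif_neg hx

theorem sum_ite_subtype (f : V → ℝ) :
    ∑ x, f x = ∑ x : Subtype p, f x + ∑ x, if p x then 0 else f x := by
  rw [← Finset.sum_subtype (univ.filter p) (by simp) f, Finset.sum_filter,
    ← Finset.sum_add_distrib]
  refine Finset.sum_congr rfl fun x _ => ?_
  split_ifs <;> simp

variable (J : V → V → ℝ) (h : V → ℝ)

theorem exists_energy_glue (ξ : V → Bool) : ∃ C : ℝ, ∀ σ : Subtype p → Bool,
    energy J h (glue p ξ σ) = energy (fun x y : Subtype p => J x y) (bdField p J h ξ) σ + C := by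
  refine ⟨(∑ x, if p x then 0 else ∑ y, if p y then 0 else J x y * (spinR (ξ x) * spinR (ξ y))) +
    ∑ x, if p x then 0 else h x * spinR (ξ x), fun σ => ?_⟩
  have hs : ∀ (f : V → V → ℝ), ∑ x, ∑ y, f x y = ∑ x : Subtype p, ∑ y : Subtype p, f x y +
      ∑ x : Subtype p, (∑ y, if p y then 0 else f x y) +
      ∑ x : Subtype p, (∑ y, if p y then 0 else f y x) +
      ∑ x, if p x then 0 else ∑ y, if p y then 0 else f x y := by
    intro f
    rw [sum_ite_subtype (p := p)]
    have h1 : ∀ x : V, ∑ y, f x y = ∑ y : Subtype p, f x y + ∑ y, if p y then 0 else f x y :=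
      fun x => sum_ite_subtype _
    simp only [h1, Finset.sum_add_distrib]
    have h2 : (∑ x, if p x then 0 else (∑ y : Subtype p, f x y +
        ∑ y, if p y then 0 else f x y)) = ∑ x : Subtype p, (∑ y, if p y then 0 else f y x) +
        ∑ x, if p x then 0 else ∑ y, if p y then 0 else f x y := by
      rw [Finset.sum_comm (s := (univ : Finset (Subtype p))), ← Finset.sum_add_distrib]
      refine Finset.sum_congr rfl fun x _ => ?_
      split_ifs <;> simp
    rw [h2]
    ring
  unfold energy
  rw [hs, sum_ite_subtype (p := p) (fun x => h x * spinR (glue p ξ σ x))]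
  have e1 : ∀ x : Subtype p, glue p ξ σ x = σ x := fun x => glue_of_mem ξ σ x.2
  have e2 : ∀ (f : V → Bool → ℝ) (x : V), (if p x then 0 else f x (glue p ξ σ x)) =
      if p x then 0 else f x (ξ x) := by
    intro f x
    split_ifs with hx
    · rfl
    · rw [glue_of_notMem ξ σ hx]
  simp only [e1]
  have e7 : (∑ x, if p x then 0 else h x * spinR (glue p ξ σ x)) =
      ∑ x, if p x then 0 else h x * spinR (ξ x) :=
    Finset.sum_congr rfl fun x _ => e2 (fun x b => h x * spinR b) x
  rw [e7]
  have e3 : ∀ x : Subtype p, (∑ y, if p y then 0 else J x y * (spinR (σ x) *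
      spinR (glue p ξ σ y))) = ∑ y, if p y then 0 else J x y * (spinR (σ x) * spinR (ξ y)) :=
    fun x => Finset.sum_congr rfl fun y _ => e2 (fun y b => J x y * (spinR (σ x) * spinR b)) y
  have e4 : ∀ x : Subtype p, (∑ y, if p y then 0 else J y x * (spinR (glue p ξ σ y) *
      spinR (σ x))) = ∑ y, if p y then 0 else J y x * (spinR (ξ y) * spinR (σ x)) :=
    fun x => Finset.sum_congr rfl fun y _ => e2 (fun y b => J y x * (spinR b * spinR (σ x))) y
  have e5 : (∑ x, if p x then 0 else ∑ y, if p y then 0 else J x y * (spinR (glue p ξ σ x) *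
      spinR (glue p ξ σ y))) =
      ∑ x, if p x then 0 else ∑ y, if p y then 0 else J x y * (spinR (ξ x) * spinR (ξ y)) := by
    refine Finset.sum_congr rfl fun x _ => ?_
    split_ifs with hx
    · rfl
    · refine Finset.sum_congr rfl fun y _ => ?_
      split_ifs with hy
      · rfl
      · rw [glue_of_notMem ξ σ hx, glue_of_notMem ξ σ hy]
  rw [e5]
  simp only [e3, e4]
  have e6 : ∑ x : Subtype p, bdField p J h ξ x * spinR (σ x) =
      ∑ x : Subtype p, h x * spinR (σ x) +
      ∑ x : Subtype p, (∑ y, if p y then 0 else J x y * (spinR (σ x) * spinR (ξ y))) +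
      ∑ x : Subtype p, (∑ y, if p y then 0 else J y x * (spinR (ξ y) * spinR (σ x))) := by
    simp only [← Finset.sum_add_distrib, bdField, add_mul, Finset.sum_mul]
    refine Finset.sum_congr rfl fun x _ => ?_
    rw [add_assoc, ← Finset.sum_add_distrib]
    congr 1
    refine Finset.sum_congr rfl fun y _ => ?_
    split_ifs
    · simp
    · ring
  rw [e6]
  ring

theorem sum_glue (F : (V → Bool) → ℝ) : ∑ τ, F τ =
    ∑ ξ : {x // ¬p x} → Bool, ∑ σ : Subtype p → Bool,
      F (glue p (fun x => if hx : p x then true else ξ ⟨x, hx⟩) σ) := by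
  rw [← (Equiv.piEquivPiSubtypeProd p fun _ => Bool).symm.sum_comp, Fintype.sum_prod_type,
    Finset.sum_comm]
  refine Finset.sum_congr rfl fun ξ _ => Finset.sum_congr rfl fun σ _ => ?_
  congr 1
  ext x
  by_cases hx : p x <;> simp [Equiv.piEquivPiSubtypeProd, glue, hx]

theorem cev_glue (F : (V → Bool) → ℝ) (ξ : V → Bool) (σ : Subtype p → Bool) :
    cev p J h F (glue p ξ σ) = cev p J h F ξ := by
  have h1 : ∀ σ', glue p (glue p ξ σ) σ' = glue p ξ σ' := by
    intro σ'
    ext x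
    by_cases hx : p x <;> simp [glue, hx]
  have h2 : bdField p J h (glue p ξ σ) = bdField p J h ξ := by
    ext x
    simp only [bdField]
    congr 1
    refine Finset.sum_congr rfl fun y _ => ?_
    split_ifs with hy
    · rfl
    · rw [glue_of_notMem ξ σ hy]
  simp only [cev, h1, h2]

/-- Weighted form of the tower property: the Boltzmann sums of `F` and of its conditional
expectation agree for each boundary condition. -/
theorem sum_wt_glue (F : (V → Bool) → ℝ) (ξ : V → Bool) :
    ∑ σ : Subtype p → Bool, wt J h (glue p ξ σ) * F (glue p ξ σ) =
      (∑ σ : Subtype p → Bool, wt J h (glue p ξ σ)) * cev p J h F ξ := by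
  obtain ⟨C, hC⟩ := exists_energy_glue (p := p) J h ξ
  have hw : ∀ σ : Subtype p → Bool, wt J h (glue p ξ σ) =
      wt (fun x y : Subtype p => J x y) (bdField p J h ξ) σ * Real.exp C := by
    intro σ
    rw [wt, hC, Real.exp_add, wt]
  have hz := (pf_pos (fun x y : Subtype p => J x y) (bdField p J h ξ)).ne'
  simp only [hw, cev, ev, mul_right_comm _ (Real.exp C), ← Finset.sum_mul]
  change _ = pf _ _ * _ * _
  field_simp

theorem ev_cev (F : (V → Bool) → ℝ) : ev J h (cev p J h F) = ev J h F := by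
  unfold ev
  congr 1
  rw [sum_glue (p := p), sum_glue (p := p)]
  refine Finset.sum_congr rfl fun ξ _ => ?_
  rw [sum_wt_glue J h F]
  simp only [cev_glue]
  rw [← Finset.sum_mul]

end Conditioning

end SR

namespace SR

open Finset

/-! ### Reflections -/

/-- Data of a partial reflection `θ` of a weighted graph. The label of a vertex tells whether
it is on the high side of the mirror and has a mirror image (`0`), is on the low side (`1`),
on the mirror (`2`), or on the high side without mirror image (`3`). -/
structure Reflection {V : Type*} (J : V → V → ℝ) (k : V → Fin 4) (θ : V → V) : Prop where
  nonneg : ∀ x y, 0 ≤ J x y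
  k_high : ∀ x, k x = 0 → k (θ x) = 1
  k_low : ∀ x, k x = 1 → k (θ x) = 0
  invol : ∀ x, k x = 0 ∨ k x = 1 → θ (θ x) = x
  high_high : ∀ x y, k x = 0 → k y = 0 → J (θ x) (θ y) = J x y
  cross : ∀ x y, k x = 0 → k y = 0 → x ≠ y → J x (θ y) = 0 ∧ J (θ x) y = 0
  mirror : ∀ x y, k x = 2 → k y = 0 → J x (θ y) = J x y ∧ J (θ y) x = J y x
  lone : ∀ x y, k x = 3 → k y = 0 → J x (θ y) = 0 ∧ J (θ y) x = 0

section Reflection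

variable {V : Type*} [Fintype V] [DecidableEq V] {J : V → V → ℝ} {k : V → Fin 4} {θ : V → V}

/-- The configuration encoded by pairs of spins on the high side. -/
def unfold (k : V → Fin 4) (θ : V → V) (ω : V → Fin 2 → Bool) (x : V) : Bool :=
  if k x = 1 then ω (θ x) 1 else ω x 0

/-- Sum and difference of a spin and its mirror image. -/
noncomputable def foldGen (k : V → Fin 4) (x : V) (i : Fin 2) (s : Fin 2 → Bool) : ℝ :=
  if k x = 0 then duo i s else if k x = 1 then 0 else
    if k x = 2 then (if i = 0 then 2 * spinR (s 0) else 0) else spinR (s 0)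

theorem sum_fin_two_bool (m : (Fin 2 → Bool) → ℝ) : ∑ s, m s =
    m ![true, true] + m ![true, false] + (m ![false, true] + m ![false, false]) := by
  rw [← (finTwoArrowEquiv Bool).symm.sum_comp, Fintype.sum_prod_type]
  simp [finTwoArrowEquiv]

theorem foldGen_monomials (k : V → Fin 4) (x : V) :
    ∀ m ∈ Submonoid.closure (Set.range (foldGen k x)), 0 ≤ ∑ s, m s := by
  by_cases h0 : k x = 0
  · have : foldGen k x = duo := by ext; simp [foldGen, h0]
    rw [this]
    exact duo_monomials
  intro m hm
  have : ∃ c : ℝ, 0 ≤ c ∧ ∃ n : ℕ, m = fun s => c * spinR (s 0) ^ n := by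
    refine Submonoid.closure_induction ?_ ?_ ?_ hm
    · rintro f ⟨i, rfl⟩
      by_cases h1 : k x = 1
      · exact ⟨0, le_rfl, 1, by ext; simp [foldGen, h1]⟩
      by_cases h2 : k x = 2
      · by_cases hi : i = 0
        · exact ⟨2, by norm_num, 1, by ext; simp [foldGen, h2, hi]⟩
        · exact ⟨0, by norm_num, 1, by ext; simp [foldGen, h2, hi]⟩
      · exact ⟨1, by norm_num, 1, by ext; simp [foldGen, h0, h1, h2]⟩
    · exact ⟨1, by norm_num, 0, by ext; simp⟩
    · rintro f g - - ⟨c, hc, n, rfl⟩ ⟨d, hd, l, rfl⟩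
      exact ⟨c * d, mul_nonneg hc hd, n + l, by ext; simp only [Pi.mul_apply]; ring⟩
  obtain ⟨c, hc, n, rfl⟩ := this
  rw [sum_fin_two_bool]
  simp only [spinR, Matrix.cons_val_zero]
  rcases Nat.even_or_odd n with hn | hn <;> simp [hn.neg_pow] <;> positivity

/-- Membership in the cone up to an additive constant. -/
def InFoldCone (k : V → Fin 4) (f : (V → Fin 2 → Bool) → ℝ) : Prop :=
  ∃ c : ℝ, (fun ω => f ω + c) ∈ posCone (siteFamily (foldGen k))

theorem InFoldCone.of_mem {f : (V → Fin 2 → Bool) → ℝ}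
    (hf : f ∈ posCone (siteFamily (foldGen k))) : InFoldCone k f :=
  ⟨0, by simpa using hf⟩

theorem InFoldCone.sum {ι : Type*} (s : Finset ι) {f : ι → (V → Fin 2 → Bool) → ℝ}
    (hf : ∀ i ∈ s, InFoldCone k (f i)) : InFoldCone k (fun ω => ∑ i ∈ s, f i ω) := by
  choose! c hc using hf
  refine ⟨∑ i ∈ s, c i, ?_⟩
  simpa only [Finset.sum_add_distrib] using posCone_sum s hc

/-- The half-sum of the two generators at a site: the spin on the high side. -/
noncomputable def foldA (k : V → Fin 4) (x : V) (ω : V → Fin 2 → Bool) : ℝ :=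
  1 / 2 * (foldGen k x 0 (ω x) + foldGen k x 1 (ω x))

/-- The half-difference of the two generators at a site: the mirror image of the spin. -/
noncomputable def foldB (k : V → Fin 4) (x : V) (ω : V → Fin 2 → Bool) : ℝ :=
  1 / 2 * (foldGen k x 0 (ω x) - foldGen k x 1 (ω x))

theorem foldGen_mem (x : V) (i : Fin 2) : (fun ω : V → Fin 2 → Bool => foldGen k x i (ω x)) ∈
    posCone (siteFamily (foldGen k)) := posCone_gen ⟨x, i, rfl⟩

theorem foldA_mem (x : V) : foldA k x ∈ posCone (siteFamily (foldGen k)) :=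
  posCone_smul (by norm_num) (posCone_add (foldGen_mem x 0) (foldGen_mem x 1))

theorem spin_unfold_high {x : V} (hx : k x ≠ 1) (ω : V → Fin 2 → Bool) :
    spinR (unfold k θ ω x) = foldA k x ω := by
  by_cases h0 : k x = 0
  · simp [unfold, foldA, foldGen, h0, duo]
    ring
  · by_cases h2 : k x = 2
    · simp [unfold, foldA, foldGen, h2]
    · simp [unfold, foldA, foldGen, h0, hx, h2]
      ring

theorem spin_unfold_low (hθ : Reflection J k θ) {x : V} (hx : k x = 0) (ω : V → Fin 2 → Bool) :
    spinR (unfold k θ ω (θ x)) = foldB k x ω := by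
  simp [unfold, foldB, foldGen, hx, duo, hθ.k_high x hx, hθ.invol x (Or.inl hx)]
  ring

theorem sum_reflection (hθ : Reflection J k θ) (f : V → ℝ) :
    ∑ x, f x = ∑ x, ((if k x ≠ 1 then f x else 0) + if k x = 0 then f (θ x) else 0) := by
  rw [Finset.sum_add_distrib, ← Finset.sum_filter, ← Finset.sum_filter,
    ← Finset.sum_filter_add_sum_filter_not univ (fun x => k x ≠ 1) f]
  congr 1
  symm
  refine Finset.sum_bij' (fun x _ => θ x) (fun x _ => θ x) ?_ ?_ ?_ ?_ ?_
  · intro x hx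
    simpa using hθ.k_high x (by simpa using hx)
  · intro x hx
    simpa using hθ.k_low x (by simpa using hx)
  · intro x hx
    exact hθ.invol x (Or.inl (by simpa using hx))
  · intro x hx
    exact hθ.invol x (Or.inr (by simpa using hx))
  · simp

theorem fold_energy (hθ : Reflection J k θ) :
    InFoldCone k (fun ω => energy J (fun _ => 0) (unfold k θ ω)) := by
  have e : ∀ ω, energy J (fun _ => 0) (unfold k θ ω) = ∑ x, ∑ y,
      ((if k x ≠ 1 then (if k y ≠ 1 then J x y * (foldA k x ω * foldA k y ω) else 0) +
          (if k y = 0 then J x (θ y) * (foldA k x ω * foldB k y ω) else 0) else 0) +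
        if k x = 0 then (if k y ≠ 1 then J (θ x) y * (foldB k x ω * foldA k y ω) else 0) +
          (if k y = 0 then J (θ x) (θ y) * (foldB k x ω * foldB k y ω) else 0) else 0) := by
    intro ω
    simp only [energy, zero_mul, Finset.sum_const_zero, add_zero]
    rw [sum_reflection hθ]
    refine Finset.sum_congr rfl fun x _ => ?_
    rw [Finset.sum_add_distrib]
    congr 1
    · split_ifs with hx
      · rw [sum_reflection hθ]
        refine Finset.sum_congr rfl fun y _ => ?_
        rw [spin_unfold_high hx]
        congr 1
        · split_ifs with hy
          · rw [spin_unfold_high hy]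
          · rfl
        · split_ifs with hy
          · rw [spin_unfold_low hθ hy]
          · rfl
      · simp
    · split_ifs with hx
      · rw [sum_reflection hθ]
        refine Finset.sum_congr rfl fun y _ => ?_
        rw [spin_unfold_low hθ hx]
        congr 1
        · split_ifs with hy
          · rw [spin_unfold_high hy]
          · rfl
        · split_ifs with hy
          · rw [spin_unfold_low hθ hy]
          · rfl
      · simp
  simp only [e]
  refine InFoldCone.sum _ fun x _ => InFoldCone.sum _ fun y _ => ?_
  have zero : InFoldCone k fun _ => 0 := .of_mem (posCone_const le_rfl)
  have AA : InFoldCone k fun ω => J x y * (foldA k x ω * foldA k y ω) :=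
    .of_mem (posCone_smul (hθ.nonneg x y) (posCone_mul (foldA_mem x) (foldA_mem y)))
  have TT := posCone_mul (foldGen_mem (k := k) x 0) (foldGen_mem y 0)
  have QQ := posCone_mul (foldGen_mem (k := k) x 1) (foldGen_mem y 1)
  have kx : k x = 0 ∨ k x = 1 ∨ k x = 2 ∨ k x = 3 := by
    generalize k x = a; revert a; decide
  have ky : k y = 0 ∨ k y = 1 ∨ k y = 2 ∨ k y = 3 := by
    generalize k y = a; revert a; decide
  rcases kx with kx | kx | kx | kx <;> rcases ky with ky | ky | ky | ky <;>
    simp only [kx, ky, reduceIte, ne_eq, Fin.reduceEq, not_false_eq_true, not_true_eq_false,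
      add_zero] <;> try first | exact zero | exact AA
  · by_cases hxy : x = y
    · subst hxy
      refine ⟨J x (θ x) + J (θ x) x, ?_⟩
      convert posCone_add (posCone_smul (c := J x x / 2)
          (by linarith [hθ.nonneg x x]) (posCone_add TT QQ))
        (posCone_smul (c := (J x (θ x) + J (θ x) x) / 2)
          (by linarith [hθ.nonneg x (θ x), hθ.nonneg (θ x) x]) TT) using 1
      ext ω
      rw [hθ.high_high x x kx kx]
      have sq : foldGen k x 0 (ω x) ^ 2 + foldGen k x 1 (ω x) ^ 2 = 4 := by
        simp only [foldGen, kx, reduceIte, duo, Fin.reduceEq]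
        linear_combination 2 * spinR_sq (ω x 0) + 2 * spinR_sq (ω x 1)
      simp only [foldA, foldB]
      linear_combination -(J x (θ x) + J (θ x) x) / 4 * sq
    · obtain ⟨h1, h2⟩ := hθ.cross x y kx ky hxy
      refine .of_mem ?_
      convert posCone_smul (c := J x y / 2) (by linarith [hθ.nonneg x y])
        (posCone_add TT QQ) using 1
      ext ω
      rw [hθ.high_high x y kx ky, h1, h2]
      simp only [foldA, foldB]
      ring
  · refine .of_mem ?_
    convert posCone_smul (hθ.nonneg x y) (posCone_mul (foldGen_mem (k := k) x 0)
      (foldA_mem y)) using 1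
    ext ω
    rw [(hθ.mirror y x ky kx).2]
    simp only [foldA, foldB]
    ring
  · simpa only [(hθ.lone y x ky kx).2, zero_mul, add_zero] using AA
  · refine .of_mem ?_
    convert posCone_smul (hθ.nonneg x y) (posCone_mul (foldA_mem x)
      (foldGen_mem (k := k) y 0)) using 1
    ext ω
    rw [(hθ.mirror x y kx ky).1]
    simp only [foldA, foldB]
    ring
  · simpa only [(hθ.lone x y kx ky).1, zero_mul, add_zero] using AA

theorem fold_nonneg (hθ : Reflection J k θ) {F : (V → Bool) → ℝ}
    (hF : (fun ω => F (unfold k θ ω)) ∈ posCone (siteFamily (foldGen k))) :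
    0 ≤ ev J (fun _ => 0) F := by
  obtain ⟨c, hc⟩ := fold_energy hθ
  have h1 := sum_mul_exp_nonneg (sum_nonneg_of_siteFamily (foldGen_monomials k)) hF hc
  let e : V → V × Fin 2 := fun x => if k x = 1 then (θ x, 1) else (x, 0)
  have he : Function.Injective e := by
    intro x y hxy
    simp only [e] at hxy
    split_ifs at hxy with hx hy hy
    · have := congrArg (fun p => θ p.1) hxy
      simpa [hθ.invol x (Or.inr hx), hθ.invol y (Or.inr hy)] using this
    · simp at hxy
    · simp at hxy
    · simpa using hxy
  obtain ⟨a, ha, hsum⟩ := exists_sum_comp_injective he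
  have h2 := hsum fun σ => F σ * Real.exp (energy J (fun _ => 0) σ + c)
  have h3 : ∑ τ : V × Fin 2 → Bool, F (τ ∘ e) * Real.exp (energy J (fun _ => 0) (τ ∘ e) + c) =
      ∑ ω, F (unfold k θ ω) * Real.exp (energy J (fun _ => 0) (unfold k θ ω) + c) := by
    refine Fintype.sum_equiv (Equiv.curry V (Fin 2) Bool) _ _ fun τ => ?_
    have : τ ∘ e = unfold k θ (Equiv.curry V (Fin 2) Bool τ) := by
      ext x
      simp only [Function.comp, e, unfold, Equiv.curry_apply, Function.curry]
      split_ifs <;> rfl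
    rw [this]
  rw [h3] at h2
  rw [h2] at h1
  have h4 : 0 ≤ ∑ σ, F σ * Real.exp (energy J (fun _ => 0) σ + c) :=
    nonneg_of_mul_nonneg_right h1 ha
  refine div_nonneg ?_ (pf_pos _ _).le
  simp only [Real.exp_add, ← mul_assoc, ← Finset.sum_mul] at h4
  simpa only [wt, mul_comm] using nonneg_of_mul_nonneg_left h4 (Real.exp_pos c)

/-- Messager--Miracle-Solé inequality, reflecting one endpoint. -/
theorem ev_reflect_one (hθ : Reflection J k θ) {x y : V} (hx : k x ≠ 1) (hy : k y = 0) :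
    ev J (fun _ => 0) (fun σ => spinR (σ x) * spinR (σ (θ y))) ≤
      ev J (fun _ => 0) (fun σ => spinR (σ x) * spinR (σ y)) := by
  rw [← sub_nonneg, ← ev_sub]
  refine fold_nonneg hθ ?_
  convert posCone_mul (foldA_mem (k := k) x) (foldGen_mem y 1) using 1
  ext ω
  rw [spin_unfold_high hx, spin_unfold_high (by rw [hy]; decide), spin_unfold_low hθ hy]
  simp only [foldA, foldB]
  ring

/-- Messager--Miracle-Solé inequality, reflecting both endpoints. -/
theorem ev_reflect_both (hθ : Reflection J k θ) {x y : V} (hx : k x = 0) (hy : k y = 0) :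
    ev J (fun _ => 0) (fun σ => spinR (σ (θ x)) * spinR (σ (θ y))) ≤
      ev J (fun _ => 0) (fun σ => spinR (σ x) * spinR (σ y)) := by
  rw [← sub_nonneg, ← ev_sub]
  refine fold_nonneg hθ ?_
  convert posCone_smul (c := 1 / 2) (by norm_num) (posCone_add
    (posCone_mul (foldGen_mem (k := k) x 0) (foldGen_mem y 1))
    (posCone_mul (foldGen_mem (k := k) x 1) (foldGen_mem y 0))) using 1
  ext ω
  rw [spin_unfold_high (by rw [hx]; decide), spin_unfold_high (by rw [hy]; decide),
    spin_unfold_low hθ hx, spin_unfold_low hθ hy]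
  simp only [foldA, foldB]
  ring

end Reflection

end SR

open Finset
namespace SR
section Wick
variable {R : Type*} [Ring R] [Algebra ℝ R]

/-- The product `a (n-1) * ⋯ * a 0`. -/
def revProd : (n : ℕ) → (Fin n → R) → R
  | 0, _ => 1
  | n + 1, a => a (Fin.last n) * revProd n (fun i => a i.castSucc)

/-- The product `b 0 * ⋯ * b (n-1)`. -/
def fwdProd : (n : ℕ) → (Fin n → R) → R
  | 0, _ => 1
  | n + 1, b => fwdProd n (fun i => b i.castSucc) * b (Fin.last n)

theorem revProd_mul_anticomm (n : ℕ) (a : Fin (n + 1) → R) (c : R) (γ : Fin (n + 1) → ℝ)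
    (h : ∀ i, a i * c + c * a i = algebraMap ℝ R (γ i)) :
    revProd (n + 1) a * c = (-1) ^ (n + 1) * (c * revProd (n + 1) a) +
      ∑ i : Fin (n + 1), ((-1) ^ (i : ℕ) * γ i) • revProd n (fun k => a (i.succAbove k)) := by
  induction n with
  | zero =>
    have := h 0
    rw [Fin.sum_univ_one]
    simp only [revProd, Fin.val_zero, pow_zero, one_mul, Algebra.smul_def, mul_one]
    rw [← this]
    show a 0 * c = (-1) ^ 1 * (c * a 0) + (a 0 * c + c * a 0)
    noncomm_ring
  | succ n ih =>
    have h1 := ih (fun i => a i.castSucc) (fun i => γ i.castSucc) (fun i => h _)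
    have hl := h (Fin.last (n + 1))
    have hl' : a (Fin.last (n + 1)) * c = algebraMap ℝ R (γ (Fin.last (n + 1))) -
      c * a (Fin.last (n + 1)) := by rw [← hl]; abel
    set A := revProd (n + 1) (fun i : Fin (n + 1) => a i.castSucc) with hA
    have e1 : revProd (n + 1 + 1) a = a (Fin.last (n + 1)) * A := rfl
    rw [e1, Fin.sum_univ_castSucc]
    have e2 : ∀ i : Fin (n + 1), revProd (n + 1) (fun k => a (i.castSucc.succAbove k)) =
        a (Fin.last (n + 1)) * revProd n (fun k => a (i.succAbove k).castSucc) := by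
      intro i
      show a (i.castSucc.succAbove (Fin.last n)) * _ = _
      have e : i.castSucc.succAbove (Fin.last n) = Fin.last (n + 1) := by
        rw [Fin.succAbove_of_le_castSucc _ _ (by
          rw [Fin.le_def]; simpa using Nat.le_of_lt_succ i.2), Fin.succ_last]
      simp only [e, Fin.castSucc_succAbove_castSucc]
    simp only [e2, Fin.succAbove_last, Fin.val_castSucc, Fin.val_last, ← hA]
    rw [mul_assoc, h1, mul_add, Finset.mul_sum]
    simp only [mul_smul_comm]
    have e3 : a (Fin.last (n + 1)) * ((-1) ^ (n + 1) * (c * A)) =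
        (-1) ^ (n + 1) * ((a (Fin.last (n + 1)) * c) * A) := by
      rw [← mul_assoc, ((Commute.neg_one_right (a (Fin.last (n+1)))).pow_right (n+1)).eq]
      noncomm_ring
    rw [e3, hl', Algebra.smul_def, map_mul, map_pow, map_neg, map_one, pow_succ (-1 : R) (n+1)]
    noncomm_ring

theorem fwdProd_mul_anticomm (n : ℕ) (b : Fin n → R) (c : R)
    (h : ∀ i, b i * c + c * b i = 0) :
    fwdProd n b * c = (-1) ^ n * (c * fwdProd n b) := by
  induction n with
  | zero => simp [fwdProd]
  | succ n ih =>
    have e : b (Fin.last n) * c = - (c * b (Fin.last n)) := eq_neg_of_add_eq_zero_left (h _)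
    show fwdProd n (fun i => b i.castSucc) * b (Fin.last n) * c = _ * (c * (fwdProd n _ * _))
    rw [mul_assoc, e, mul_neg, ← mul_assoc, ih _ (fun i => h _), pow_succ]
    noncomm_ring

/-- Wick's theorem in determinantal form. -/
theorem wick_det (ω : R →ₗ[ℝ] ℝ) (h1 : ω 1 = 1) (n : ℕ) (a b c : Fin n → R)
    (Γ : Matrix (Fin n) (Fin n) ℝ)
    (hb : ∀ i x, ω (x * b i) = ω (x * c i)) (hc : ∀ i x, ω (c i * x) = 0)
    (hac : ∀ i j, a i * c j + c j * a i = algebraMap ℝ R (Γ i j))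
    (hbc : ∀ i j, i ≠ j → b i * c j + c j * b i = 0) :
    ω (revProd n a * fwdProd n b) = Γ.det := by
  induction n with
  | zero => simp [revProd, fwdProd, h1]
  | succ n ih =>
    have e1 : revProd (n + 1) a * fwdProd (n + 1) b =
      (revProd (n + 1) a * fwdProd n (fun i => b i.castSucc)) * b (Fin.last n) := by
      rw [mul_assoc]; rfl
    rw [e1, hb, mul_assoc, fwdProd_mul_anticomm n _ _ (fun i => hbc _ _ (Fin.castSucc_lt_last i).ne)]
    have e2 : revProd (n + 1) a * ((-1) ^ n * (c (Fin.last n) * fwdProd n fun i => b i.castSucc)) =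
        (-1 : ℝ) ^ n • ((revProd (n + 1) a * c (Fin.last n)) * fwdProd n fun i => b i.castSucc) := by
      rw [Algebra.smul_def, map_pow, map_neg, map_one, ← mul_assoc,
        ((Commute.neg_one_right (revProd (n+1) a)).pow_right n).eq]
      noncomm_ring
    rw [e2, revProd_mul_anticomm n a _ (fun i => Γ i (Fin.last n)) (fun i => hac _ _)]
    have e3 : ((-1 : R)) ^ (n + 1) * (c (Fin.last n) * revProd (n + 1) a) *
        fwdProd n (fun i => b i.castSucc) = (-1 : ℝ) ^ (n + 1) •
        (c (Fin.last n) * (revProd (n + 1) a * fwdProd n (fun i => b i.castSucc))) := by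
      rw [Algebra.smul_def, map_pow, map_neg, map_one]; noncomm_ring
    rw [add_mul, e3, map_smul, map_add, map_smul, hc, smul_zero, zero_add, Finset.sum_mul, map_sum,
      Matrix.det_succ_column Γ (Fin.last n), Finset.smul_sum]
    refine Finset.sum_congr rfl fun i _ => ?_
    rw [smul_mul_assoc, map_smul, ih (fun k => a (i.succAbove k)) (fun k => b k.castSucc)
      (fun k => c k.castSucc) (Γ.submatrix i.succAbove (Fin.last n).succAbove)]
    · simp only [smul_eq_mul, Fin.val_last, pow_add]; ring
    · intro j x; exact hb _ _
    · intro j x; exact hc _ _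
    · intro j k; rw [hac]; simp
    · intro j k hjk; exact hbc _ _ (fun h => hjk (Fin.castSucc_injective _ h))

end Wick
end SR

open Finset
namespace SR
section Dirac
variable {M : ℕ}

/-- Flip all spins with index below `a`. -/
def flipLow (a : ℕ) (s : Fin M → Bool) : Fin M → Bool :=
  fun i => if (i : ℕ) < a then !(s i) else s i

/-- The spin at site `b` (and `1` outside of the range). -/
noncomputable def spinAt (b : ℕ) (s : Fin M → Bool) : ℝ :=
  if h : b < M then spinR (s ⟨b, h⟩) else 1

/-- The operator flipping all spins with index below `a`. -/
noncomputable def flipM (M a : ℕ) : Matrix (Fin M → Bool) (Fin M → Bool) ℝ :=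
  Matrix.of fun s s' => if s' = flipLow a s then 1 else 0

/-- The operator of multiplication by the spin at site `b`. -/
noncomputable def spinM (M b : ℕ) : Matrix (Fin M → Bool) (Fin M → Bool) ℝ :=
  Matrix.diagonal (spinAt b)

theorem flipLow_flipLow (a : ℕ) (s : Fin M → Bool) : flipLow a (flipLow a s) = s := by
  funext i; simp only [flipLow]; split_ifs <;> simp

theorem flipLow_comm (a b : ℕ) (s : Fin M → Bool) :
    flipLow a (flipLow b s) = flipLow b (flipLow a s) := by
  funext i; simp only [flipLow]; split_ifs <;> simp

theorem spinAt_sq (b : ℕ) (s : Fin M → Bool) : spinAt b s * spinAt b s = 1 := by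
  unfold spinAt; split_ifs
  · exact spinR_sq _
  · simp

theorem spinAt_flipLow {a b : ℕ} (s : Fin M → Bool) (hb : b < M) :
    spinAt b (flipLow a s) = (if b < a then -1 else 1) * spinAt b s := by
  simp only [spinAt, hb, dif_pos, flipLow]
  split_ifs <;> simp [spinR_not]

theorem flipM_mul_apply (a : ℕ) (A : Matrix (Fin M → Bool) (Fin M → Bool) ℝ) (s s') :
    (flipM M a * A) s s' = A (flipLow a s) s' := by
  simp [flipM, Matrix.mul_apply]

theorem flipM_mul_self (a : ℕ) : flipM M a * flipM M a = 1 := by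
  ext s s'
  rw [flipM_mul_apply]
  simp [flipM, flipLow_flipLow, Matrix.one_apply, eq_comm]

theorem flipM_comm (a b : ℕ) : flipM M a * flipM M b = flipM M b * flipM M a := by
  ext s s'
  rw [flipM_mul_apply, flipM_mul_apply]
  simp [flipM, flipLow_comm]

theorem flipM_transpose (a : ℕ) : (flipM M a).transpose = flipM M a := by
  ext s s'
  simp only [flipM, Matrix.transpose_apply, Matrix.of_apply]
  congr 1
  exact propext ⟨fun h => by rw [h, flipLow_flipLow], fun h => by rw [h, flipLow_flipLow]⟩

theorem spinM_mul_self (b : ℕ) : spinM M b * spinM M b = 1 := by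
  simp [spinM, spinAt_sq]

theorem spinM_comm (a b : ℕ) : spinM M a * spinM M b = spinM M b * spinM M a := by
  simp [spinM, mul_comm]

theorem spinM_transpose (b : ℕ) : (spinM M b).transpose = spinM M b := by
  simp [spinM]

theorem flipM_mul_spinM {b : ℕ} (a : ℕ) (hb : b < M) :
    flipM M a * spinM M b = (if b < a then (-1 : ℝ) else 1) • (spinM M b * flipM M a) := by
  ext s s'
  rw [flipM_mul_apply, Matrix.smul_apply, spinM, Matrix.diagonal_apply, Matrix.diagonal_mul]
  by_cases h : s' = flipLow a s
  · subst h
    simp [flipM, spinAt_flipLow _ hb]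
  · rw [if_neg (fun h' => h h'.symm)]
    simp [flipM, h]

/-- The fermion operators of the transfer matrix. -/
noncomputable def dirac (M j : ℕ) : Matrix (Fin M → Bool) (Fin M → Bool) ℝ :=
  flipM M (j / 2 + 1) * spinM M ((j + 1) / 2)

/-- The sign `(-1)^(j+1)`. -/
def eps (j : ℕ) : ℝ := (-1) ^ (j + 1)

theorem eps_sq (j : ℕ) : eps j * eps j = 1 := by
  unfold eps; rw [← mul_pow]; simp

theorem eps_succ (j : ℕ) : eps (j + 1) = - eps j := by
  unfold eps; rw [pow_succ]; ring

theorem eps_even (j : ℕ) : eps (2 * j) = -1 := by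
  unfold eps; rw [pow_succ, pow_mul]; simp

theorem eps_odd (j : ℕ) : eps (2 * j + 1) = 1 := by
  rw [eps_succ, eps_even]; simp

theorem eps_eq_ite (j : ℕ) : eps j = if (j + 1) / 2 < j / 2 + 1 then -1 else 1 := by
  rcases Nat.even_or_odd' j with ⟨k, rfl | rfl⟩
  · rw [eps_even, if_pos (by omega)]
  · rw [eps_odd, if_neg (by omega)]

theorem dirac_transpose {j : ℕ} (hj : (j + 1) / 2 < M) :
    (dirac M j).transpose = eps j • dirac M j := by
  rw [dirac, Matrix.transpose_mul, flipM_transpose, spinM_transpose, flipM_mul_spinM _ hj,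
    smul_smul, eps_eq_ite]
  split_ifs <;> simp

theorem dirac_mul_self {j : ℕ} (hj : (j + 1) / 2 < M) :
    dirac M j * dirac M j = algebraMap ℝ _ (eps j) := by
  have h := flipM_mul_spinM (j / 2 + 1) hj
  rw [← eps_eq_ite] at h
  calc dirac M j * dirac M j
      = (flipM M (j / 2 + 1) * spinM M ((j + 1) / 2)) *
        (flipM M (j / 2 + 1) * spinM M ((j + 1) / 2)) := rfl
    _ = eps j • (spinM M ((j + 1) / 2) * (flipM M (j / 2 + 1) *
        flipM M (j / 2 + 1)) * spinM M ((j + 1) / 2)) := by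
          nth_rewrite 1 [h]; simp only [smul_mul_assoc, mul_assoc]
    _ = _ := by rw [flipM_mul_self, mul_one, spinM_mul_self, Algebra.algebraMap_eq_smul_one]

theorem dirac_anticomm_of_lt {i j : ℕ} (hij : i < j) (hj : (j + 1) / 2 < M) :
    dirac M i * dirac M j + dirac M j * dirac M i = 0 := by
  have h1 := flipM_mul_spinM (M := M) (b := (i + 1) / 2) (j / 2 + 1) (by omega)
  have h2 := flipM_mul_spinM (M := M) (b := (j + 1) / 2) (i / 2 + 1) hj
  rw [if_pos (by omega)] at h1
  rw [if_neg (by omega), one_smul] at h2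
  have h1' : spinM M ((i + 1) / 2) * flipM M (j / 2 + 1) =
    - (flipM M (j / 2 + 1) * spinM M ((i + 1) / 2)) := by rw [h1]; simp
  have e1 : dirac M i * dirac M j =
      - (flipM M (i / 2 + 1) * flipM M (j / 2 + 1) * (spinM M ((i + 1) / 2) *
        spinM M ((j + 1) / 2))) := by
    calc dirac M i * dirac M j = flipM M (i / 2 + 1) * (spinM M ((i + 1) / 2) *
          flipM M (j / 2 + 1)) * spinM M ((j + 1) / 2) := by simp only [dirac, mul_assoc]
      _ = _ := by rw [h1']; noncomm_ring
  have e2 : dirac M j * dirac M i =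
      flipM M (i / 2 + 1) * flipM M (j / 2 + 1) * (spinM M ((i + 1) / 2) *
        spinM M ((j + 1) / 2)) := by
    calc dirac M j * dirac M i = flipM M (j / 2 + 1) * (spinM M ((j + 1) / 2) *
          flipM M (i / 2 + 1)) * spinM M ((i + 1) / 2) := by simp only [dirac, mul_assoc]
      _ = (flipM M (j / 2 + 1) * flipM M (i / 2 + 1)) * (spinM M ((j + 1) / 2) *
          spinM M ((i + 1) / 2)) := by rw [← h2]; noncomm_ring
      _ = _ := by rw [flipM_comm, spinM_comm]
  rw [e1, e2]; abel

theorem dirac_anticomm {i j : ℕ} (hij : i ≠ j) (hi : (i + 1) / 2 < M) (hj : (j + 1) / 2 < M) :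
    dirac M i * dirac M j + dirac M j * dirac M i = 0 := by
  rcases lt_or_gt_of_ne hij with h | h
  · exact dirac_anticomm_of_lt h hj
  · rw [add_comm]; exact dirac_anticomm_of_lt h hi

/-- The quadratic fermion operators. -/
noncomputable def bond (M j : ℕ) : Matrix (Fin M → Bool) (Fin M → Bool) ℝ :=
  dirac M (j + 1) * dirac M j

theorem bond_even {k : ℕ} (hk : k + 1 < M) :
    bond M (2 * k) = spinM M k * spinM M (k + 1) := by
  have h1 := flipM_mul_spinM (M := M) (b := k + 1) (k + 1) hk
  rw [if_neg (by omega), one_smul] at h1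
  rw [bond, dirac, dirac, show (2 * k + 1) / 2 = k by omega, show (2 * k + 1 + 1) / 2 = k + 1 by omega,
    show 2 * k / 2 = k by omega, h1]
  calc _ = spinM M (k + 1) * (flipM M (k + 1) * flipM M (k + 1)) * spinM M k := by noncomm_ring
    _ = _ := by rw [flipM_mul_self, mul_one, spinM_comm]

theorem bond_odd {k : ℕ} (hk : k + 1 < M) :
    bond M (2 * k + 1) = flipM M (k + 2) * flipM M (k + 1) := by
  have h1 := flipM_mul_spinM (M := M) (b := k + 1) (k + 1) hk
  rw [if_neg (by omega), one_smul] at h1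
  rw [bond, dirac, dirac, show (2 * k + 1) / 2 = k by omega, show (2 * k + 1 + 1) / 2 = k + 1 by omega,
    show (2 * k + 1 + 1 + 1) / 2 = k + 1 by omega]
  calc _ = flipM M (k + 2) * (spinM M (k + 1) * (flipM M (k + 1) * spinM M (k + 1))) := by
        noncomm_ring
    _ = flipM M (k + 2) * ((spinM M (k + 1) * spinM M (k + 1)) * flipM M (k + 1)) := by
        rw [h1]; noncomm_ring
    _ = _ := by rw [spinM_mul_self, one_mul]

end Dirac
end SR

open Finset
namespace SR
section Modes

theorem sqrt_two_sq : √2 * √2 = (2 : ℝ) := Real.mul_self_sqrt (by norm_num)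

/-- One elementary factor of the transfer matrix. -/
noncomputable def gate (M j : ℕ) : Matrix (Fin M → Bool) (Fin M → Bool) ℝ :=
  1 + (√2 - 1) • bond M j

theorem gate_mul_left {M j : ℕ} (hj : (j + 2) / 2 < M) :
    gate M j * dirac M j = (√2 • dirac M j + eps j • dirac M (j + 1)) * gate M j := by
  have h0 := dirac_mul_self (M := M) (j := j) (by omega)
  have h1 := dirac_mul_self (M := M) (j := j + 1) (by omega)
  have h2 : dirac M j * dirac M (j + 1) = - (dirac M (j + 1) * dirac M j) :=
    eq_neg_of_add_eq_zero_left (dirac_anticomm (by omega) (by omega) (by omega))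
  rw [Algebra.algebraMap_eq_smul_one] at h0 h1
  set a := dirac M j
  set b := dirac M (j + 1) with hb
  have e1 : bond M j * a = eps j • b := by
    rw [bond, mul_assoc, h0]; simp [hb]
  have e2 : a * bond M j = - eps j • b := by
    rw [bond, ← mul_assoc, h2, neg_mul, mul_assoc, h0]; simp [hb]
  have e3 : b * bond M j = - eps j • a := by
    rw [bond, ← mul_assoc, h1, eps_succ]; simp [a]
  rw [gate, add_mul, mul_add, smul_mul_assoc, e1, mul_smul_comm, add_mul, add_mul,
    smul_mul_assoc, smul_mul_assoc, smul_mul_assoc, smul_mul_assoc, e2, e3]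
  have hs := sqrt_two_sq
  have he := eps_sq j
  simp only [smul_smul, smul_add, mul_one, one_mul]
  have c1 : (1 : ℝ) = √2 + (√2 - 1) * (eps j * -eps j) := by linear_combination (√2 - 1) * he
  have c2 : (√2 - 1) * eps j = eps j + (√2 - 1) * (√2 * -eps j) := by
    linear_combination eps j * hs
  nth_rewrite 1 [← one_smul ℝ a]
  rw [c2]
  nth_rewrite 1 [c1]
  module

theorem gate_mul_right {M j : ℕ} (hj : (j + 2) / 2 < M) :
    gate M j * dirac M (j + 1) = (√2 • dirac M (j + 1) + eps j • dirac M j) * gate M j := by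
  have h0 := dirac_mul_self (M := M) (j := j) (by omega)
  have h1 := dirac_mul_self (M := M) (j := j + 1) (by omega)
  have h2 : dirac M j * dirac M (j + 1) = - (dirac M (j + 1) * dirac M j) :=
    eq_neg_of_add_eq_zero_left (dirac_anticomm (by omega) (by omega) (by omega))
  rw [Algebra.algebraMap_eq_smul_one] at h0 h1
  set a := dirac M j
  set b := dirac M (j + 1) with hb
  have e1 : bond M j * b = eps j • a := by
    rw [bond, mul_assoc, h2, mul_neg, ← mul_assoc, h1, eps_succ]; simp [a]
  have e2 : a * bond M j = - eps j • b := by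
    rw [bond, ← mul_assoc, h2, neg_mul, mul_assoc, h0]; simp [hb]
  have e3 : b * bond M j = - eps j • a := by
    rw [bond, ← mul_assoc, h1, eps_succ]; simp [a]
  rw [gate, add_mul, mul_add, smul_mul_assoc, e1, mul_smul_comm, add_mul, add_mul,
    smul_mul_assoc, smul_mul_assoc, smul_mul_assoc, smul_mul_assoc, e2, e3]
  have hs := sqrt_two_sq
  have he := eps_sq j
  simp only [smul_smul, smul_add, mul_one, one_mul]
  have c1 : (1 : ℝ) = √2 + (√2 - 1) * (eps j * -eps j) := by linear_combination (√2 - 1) * he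
  have c2 : (√2 - 1) * eps j = eps j + (√2 - 1) * (√2 * -eps j) := by
    linear_combination eps j * hs
  nth_rewrite 1 [← one_smul ℝ b]
  rw [c2]
  nth_rewrite 1 [c1]
  module

theorem gate_mul_other {M i j : ℕ} (hj : (j + 2) / 2 < M) (hi : (i + 1) / 2 < M) (h0 : i ≠ j)
    (h1 : i ≠ j + 1) : gate M j * dirac M i = dirac M i * gate M j := by
  have e0 : dirac M j * dirac M i = - (dirac M i * dirac M j) :=
    eq_neg_of_add_eq_zero_left (dirac_anticomm h0.symm (by omega) (by omega))
  have e1 : dirac M (j + 1) * dirac M i = - (dirac M i * dirac M (j + 1)) :=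
    eq_neg_of_add_eq_zero_left (dirac_anticomm h1.symm (by omega) (by omega))
  have : bond M j * dirac M i = dirac M i * bond M j := by
    rw [bond, mul_assoc, e0, mul_neg, ← mul_assoc, e1]; noncomm_ring
  rw [gate, add_mul, mul_add, smul_mul_assoc, this, mul_smul_comm, one_mul, mul_one]

/-- A linear combination of fermion operators. -/
noncomputable def eta (L : ℕ) (x : ℕ → ℝ) : Matrix (Fin (L + 2) → Bool) (Fin (L + 2) → Bool) ℝ :=
  ∑ j ∈ range (2 * L + 2), x j • dirac (L + 2) j

/-- The action of a gate on the coefficients of `eta`. -/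
noncomputable def gateAct (n : ℕ) (x : ℕ → ℝ) (j : ℕ) : ℝ :=
  if j = n then √2 * x n + eps n * x (n + 1)
  else if j = n + 1 then eps n * x n + √2 * x (n + 1) else x j

theorem gate_mul_eta {L n : ℕ} (hn : n < 2 * L + 1) (x : ℕ → ℝ) :
    gate (L + 2) n * eta L x = eta L (gateAct n x) * gate (L + 2) n := by
  have h0 : n ∈ range (2 * L + 2) := mem_range.2 (by omega)
  have h1 : n + 1 ∈ (range (2 * L + 2)).erase n := by simp; omega
  have key : ∀ y : ℕ → ℝ, eta L y = y n • dirac (L + 2) n + (y (n + 1) • dirac (L + 2) (n + 1) +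
      ∑ j ∈ ((range (2 * L + 2)).erase n).erase (n + 1), y j • dirac (L + 2) j) := by
    intro y
    rw [Finset.add_sum_erase _ (fun j => y j • dirac (L + 2) j) h1,
      Finset.add_sum_erase _ (fun j => y j • dirac (L + 2) j) h0]; rfl
  rw [key x, key (gateAct n x)]
  have e : (∑ j ∈ ((range (2 * L + 2)).erase n).erase (n + 1), gateAct n x j • dirac (L + 2) j) *
      gate (L + 2) n = gate (L + 2) n *
      ∑ j ∈ ((range (2 * L + 2)).erase n).erase (n + 1), x j • dirac (L + 2) j := by
    rw [Finset.sum_mul, Finset.mul_sum]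
    refine Finset.sum_congr rfl fun j hj => ?_
    simp only [mem_erase, mem_range, ne_eq] at hj
    rw [mul_smul_comm, smul_mul_assoc, gate_mul_other (by omega) (by omega) hj.2.1 hj.1]
    simp [gateAct, hj.1, hj.2.1]
  rw [mul_add, mul_add, add_mul, add_mul, e]
  simp only [mul_smul_comm, smul_mul_assoc]
  rw [gate_mul_left (by omega), gate_mul_right (by omega)]
  simp only [gateAct, if_true, Nat.succ_ne_self, if_false, add_mul, smul_mul_assoc]
  module

/-- Partial products of gates. -/
noncomputable def gates (L : ℕ) : ℕ → Matrix (Fin (L + 2) → Bool) (Fin (L + 2) → Bool) ℝ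
  | 0 => 1
  | n + 1 => gate (L + 2) n * gates L n

/-- Iterated action of the gates on the coefficients. -/
noncomputable def gatesAct (x : ℕ → ℝ) : ℕ → ℕ → ℝ
  | 0 => x
  | n + 1 => gateAct n (gatesAct x n)

theorem gates_mul_eta {L n : ℕ} (hn : n ≤ 2 * L + 1) (x : ℕ → ℝ) :
    gates L n * eta L x = eta L (gatesAct x n) * gates L n := by
  induction n with
  | zero => simp [gates, gatesAct]
  | succ n ih =>
    rw [gates, mul_assoc, ih (by omega), ← mul_assoc, gate_mul_eta (by omega), mul_assoc]; rfl

/-- The sign pattern `+,+,-,-`. -/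
def sgn4 (j : ℕ) : ℝ := (-1) ^ (j / 2)

theorem sgn4_succ (j : ℕ) : sgn4 (j + 1) = - eps j * sgn4 j := by
  rcases Nat.even_or_odd' j with ⟨k, rfl | rfl⟩
  · rw [eps_even, sgn4, sgn4, show (2 * k + 1) / 2 = k by omega, show 2 * k / 2 = k by omega]; simp
  · rw [eps_odd, sgn4, sgn4, show (2 * k + 1) / 2 = k by omega,
      show (2 * k + 1 + 1) / 2 = k + 1 by omega, pow_succ]; ring

theorem sgn4_sq (j : ℕ) : sgn4 j * sgn4 j = 1 := by
  unfold sgn4; rw [← mul_pow]; simp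

theorem sgn4_even (j : ℕ) : sgn4 (2 * j) = (-1) ^ j := by
  unfold sgn4; congr 1; omega

theorem sgn4_odd (j : ℕ) : sgn4 (2 * j + 1) = (-1) ^ j := by
  unfold sgn4; congr 1; omega

/-- Cosine mode. -/
noncomputable def cosMode (θ : ℝ) (j : ℕ) : ℝ := if j = 0 then 1 / √2 else Real.cos (θ * j)

/-- Sine mode, with the last entry corrected. -/
noncomputable def sinMode (L : ℕ) (θ : ℝ) (j : ℕ) : ℝ :=
  if j = 2 * L + 1 then Real.sin (θ * (2 * L + 2)) / √2 else Real.sin (θ * (j + 1))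

theorem gatesAct_cosMode {θ : ℝ} (hθ : Real.cos (θ / 2) ≠ 0) (n j : ℕ) :
    gatesAct (fun j => sgn4 j * cosMode θ j) n j = sgn4 j *
      (if j < n then Real.tan (θ / 2) * Real.sin (θ * (j + 1)) else
        if j = n then Real.cos (θ * (j + 1 / 2)) / (√2 * Real.cos (θ / 2)) else cosMode θ j) := by
  have hs := sqrt_two_sq
  have hs0 : (√2 : ℝ) ≠ 0 := by positivity
  induction n generalizing j with
  | zero =>
    rcases Nat.eq_zero_or_pos j with rfl | hj
    · simp [gatesAct, cosMode]; left
      rw [mul_comm θ, show 2⁻¹ * θ = θ / 2 by ring]; field_simp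
    · simp [gatesAct, cosMode, hj.ne']
  | succ n ih =>
    rw [gatesAct, gateAct]
    have a1 := Real.cos_add (θ * (n + 1)) (θ / 2)
    have a2 := Real.cos_sub (θ * (n + 1)) (θ / 2)
    have c2 : Real.cos (θ * (n + 1 / 2)) = Real.cos (θ * (n + 1) - θ / 2) := by congr 1; ring
    have c1 : Real.cos (θ * ((n + 1 : ℕ) + 1 / 2)) = Real.cos (θ * (n + 1) + θ / 2) := by
      congr 1; push_cast; ring
    have e1 := ih n
    have e2 := ih (n + 1)
    rw [if_neg (lt_irrefl _), if_pos rfl, c2, a2] at e1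
    rw [if_neg (by omega), if_neg (by omega), cosMode, if_neg (by omega)] at e2
    push_cast at e2
    by_cases h1 : j = n
    · subst h1
      rw [if_pos rfl, if_pos (by omega), e1, e2, sgn4_succ, Real.tan_eq_sin_div_cos]
      have he := eps_sq j
      field_simp
      linear_combination (-sgn4 j * Real.cos (θ * (j + 1)) * Real.cos (θ / 2)) * he
    · rw [if_neg h1]
      by_cases h2 : j = n + 1
      · subst h2
        rw [if_pos rfl, e1, e2, if_neg (by omega), if_pos rfl, c1, a1, sgn4_succ]
        field_simp
        rw [show (√2 : ℝ) ^ 2 = 2 by rw [sq, hs]]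
        ring
      · rw [if_neg h2, ih]
        by_cases h3 : j < n
        · rw [if_pos h3, if_pos (by omega)]
        · rw [if_neg h3, if_neg h1, if_neg (by omega), if_neg h2]

/-- Half of the diagonal-to-diagonal transfer matrix. -/
noncomputable def halfT (L : ℕ) : Matrix (Fin (L + 2) → Bool) (Fin (L + 2) → Bool) ℝ :=
  gates L (2 * L + 1)

theorem halfT_mul_eta {L : ℕ} {θ : ℝ} (hθ : Real.cos (θ / 2) ≠ 0)
    (hN : Real.cos (θ * (2 * L + 2)) = 0) :
    halfT L * eta L (fun j => sgn4 j * cosMode θ j) =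
      Real.tan (θ / 2) • (eta L (fun j => sgn4 j * sinMode L θ j) * halfT L) := by
  rw [halfT, gates_mul_eta le_rfl, ← smul_mul_assoc]
  congr 1
  rw [eta, eta, Finset.smul_sum]
  refine Finset.sum_congr rfl fun j hj => ?_
  rw [smul_smul]
  congr 1
  rw [gatesAct_cosMode hθ, sinMode]
  by_cases h : j = 2 * L + 1
  · rw [if_neg (by omega), if_pos h, if_pos h]
    have : Real.cos (θ * (j + 1 / 2)) = Real.cos (θ * (2 * L + 2) - θ / 2) := by
      rw [h]; congr 1; push_cast; ring
    rw [this, Real.cos_sub, hN, Real.tan_eq_sin_div_cos]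
    have hs0 : (√2 : ℝ) ≠ 0 := by positivity
    field_simp
    ring
  · rw [mem_range] at hj
    rw [if_pos (by omega), if_neg h]; ring

theorem eta_transpose (L : ℕ) (x : ℕ → ℝ) :
    (eta L x).transpose = eta L (fun j => eps j * x j) := by
  rw [eta, eta, Matrix.transpose_sum]
  refine Finset.sum_congr rfl fun j hj => ?_
  rw [mem_range] at hj
  rw [Matrix.transpose_smul, dirac_transpose (by omega), smul_smul, mul_comm]

theorem cosMode_pi_sub (θ : ℝ) (j : ℕ) : cosMode (Real.pi - θ) j = - eps j * cosMode θ j := by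
  unfold cosMode eps
  split_ifs with h
  · subst h; simp
  · rw [sub_mul, mul_comm Real.pi, Real.cos_nat_mul_pi_sub]; ring

theorem sinMode_pi_sub (L : ℕ) (θ : ℝ) (j : ℕ) :
    sinMode L (Real.pi - θ) j = - eps j * sinMode L θ j := by
  have key : ∀ k : ℕ, Real.sin ((Real.pi - θ) * (k + 1)) = (-1) ^ k * Real.sin (θ * (k + 1)) := by
    intro k
    have : (Real.pi - θ) * (k + 1) = ((k + 1 : ℕ) : ℝ) * Real.pi - θ * (k + 1) := by push_cast; ring
    rw [this, Real.sin_nat_mul_pi_sub, pow_succ]; ring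
  unfold sinMode eps
  split_ifs with h
  · subst h
    have := key (2 * L + 1)
    rw [show (((2 * L + 1 : ℕ) : ℝ) + 1) = 2 * L + 2 by push_cast; ring] at this
    rw [this]; ring
  · rw [key]; ring

/-- The mode operator. -/
noncomputable def modeOp (L : ℕ) (θ : ℝ) := eta L (fun j => sgn4 j * cosMode θ j)

theorem modeOp_transpose (L : ℕ) (θ : ℝ) :
    (modeOp L θ).transpose = - modeOp L (Real.pi - θ) := by
  rw [modeOp, eta_transpose, modeOp, eta, eta, ← Finset.sum_neg_distrib]
  refine Finset.sum_congr rfl fun j _ => ?_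
  rw [cosMode_pi_sub, ← neg_smul]; congr 1; ring

theorem sinOp_transpose (L : ℕ) (θ : ℝ) :
    (eta L (fun j => sgn4 j * sinMode L θ j)).transpose =
      - eta L (fun j => sgn4 j * sinMode L (Real.pi - θ) j) := by
  rw [eta_transpose, eta, eta, ← Finset.sum_neg_distrib]
  refine Finset.sum_congr rfl fun j _ => ?_
  rw [sinMode_pi_sub, ← neg_smul]; congr 1; ring

theorem transfer_mul_modeOp {L : ℕ} {θ : ℝ} (h0 : 0 < θ) (h1 : θ < Real.pi)
    (hN : Real.cos (θ * (2 * L + 2)) = 0) :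
    ((halfT L).transpose * halfT L) * modeOp L θ =
      Real.tan (θ / 2) ^ 2 • (modeOp L θ * ((halfT L).transpose * halfT L)) := by
  have hc : Real.cos (θ / 2) ≠ 0 :=
    (Real.cos_pos_of_mem_Ioo ⟨by linarith [Real.pi_pos], by linarith⟩).ne'
  have hsn : Real.sin (θ / 2) ≠ 0 :=
    (Real.sin_pos_of_pos_of_lt_pi (by linarith) (by linarith [Real.pi_pos])).ne'
  have hc' : Real.cos ((Real.pi - θ) / 2) = Real.sin (θ / 2) := by
    rw [sub_div, Real.cos_pi_div_two_sub]
  have hN' : Real.cos ((Real.pi - θ) * (2 * L + 2)) = 0 := by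
    have : (Real.pi - θ) * (2 * L + 2) = ((2 * L + 2 : ℕ) : ℝ) * Real.pi - θ * (2 * L + 2) := by
      push_cast; ring
    rw [this, Real.cos_nat_mul_pi_sub, hN, mul_zero]
  have e1 := halfT_mul_eta hc hN
  have e2 := congrArg Matrix.transpose
    (halfT_mul_eta (L := L) (θ := Real.pi - θ) (by rw [hc']; exact hsn) hN')
  rw [Matrix.transpose_mul, Matrix.transpose_smul, Matrix.transpose_mul, sinOp_transpose] at e2
  have e3 := modeOp_transpose L (Real.pi - θ)
  rw [modeOp] at e3
  rw [e3, sub_sub_cancel, neg_mul, mul_neg, smul_neg, neg_inj] at e2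
  have ht : Real.tan (θ / 2) * Real.tan ((Real.pi - θ) / 2) = 1 := by
    rw [Real.tan_eq_sin_div_cos, Real.tan_eq_sin_div_cos, hc', sub_div, Real.sin_pi_div_two_sub]
    field_simp
  rw [mul_assoc]
  change _ * (halfT L * eta L _) = _
  rw [e1, mul_smul_comm, ← mul_assoc, ← mul_assoc, e2, smul_mul_assoc, smul_smul, sq]
  rw [show Real.tan (θ / 2) * Real.tan (θ / 2) * Real.tan ((Real.pi - θ) / 2) =
    Real.tan (θ / 2) by rw [mul_assoc, ht, mul_one]]

end Modes
end SR

open Finset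
namespace SR
section StringOp

theorem spinM_comm_dirac {M J r : ℕ} (hr : J + r + 1 < M) :
    (spinM M J * spinM M (J + r)) * dirac M (2 * (J + r) + 1) =
      dirac M (2 * (J + r) + 1) * (spinM M J * spinM M (J + r)) := by
  rw [dirac, show (2 * (J + r) + 1) / 2 + 1 = J + r + 1 by omega,
    show (2 * (J + r) + 1 + 1) / 2 = J + r + 1 by omega]
  have h1 := flipM_mul_spinM (M := M) (b := J) (J + r + 1) (by omega)
  have h2 := flipM_mul_spinM (M := M) (b := J + r) (J + r + 1) (by omega)
  rw [if_pos (by omega)] at h1 h2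
  have e1 : spinM M J * spinM M (J + r) * flipM M (J + r + 1) =
      flipM M (J + r + 1) * (spinM M J * spinM M (J + r)) := by
    rw [← mul_assoc (flipM M (J + r + 1)), h1, smul_mul_assoc,
      mul_assoc (spinM M J) (flipM M (J + r + 1)), h2, mul_smul_comm, smul_smul]
    simp [mul_assoc]
  rw [← mul_assoc, e1]
  simp only [mul_assoc]
  congr 1
  rw [spinM_comm (J + r) (J + r + 1), ← mul_assoc, spinM_comm J, mul_assoc]

theorem spinM_mul_spinM_eq {M J : ℕ} (r : ℕ) (hr : J + r < M) :
    spinM M J * spinM M (J + r) = revProd r (fun i => dirac M (2 * (J + i) + 1)) *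
      fwdProd r (fun i => dirac M (2 * (J + i))) := by
  induction r with
  | zero => simp [revProd, fwdProd, spinM_mul_self]
  | succ r ih =>
    have ih := ih (by omega)
    have e : spinM M J * spinM M (J + (r + 1)) = (spinM M J * spinM M (J + r)) *
        bond M (2 * (J + r)) := by
      rw [bond_even (by omega), mul_assoc, ← mul_assoc (spinM M (J + r)), spinM_mul_self, one_mul]
      rfl
    rw [e, bond, ← mul_assoc, spinM_comm_dirac (by omega), ih]
    simp only [revProd, fwdProd, Fin.val_last, Fin.val_castSucc, mul_assoc]

theorem dirac_eta_anticomm {L a : ℕ} (ha : a < 2 * L + 2) (x : ℕ → ℝ) :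
    dirac (L + 2) a * eta L x + eta L x * dirac (L + 2) a =
      algebraMap ℝ _ (2 * eps a * x a) := by
  rw [eta, Finset.mul_sum, Finset.sum_mul, ← Finset.sum_add_distrib,
    Finset.sum_eq_single_of_mem a (mem_range.2 ha)]
  · rw [mul_smul_comm, smul_mul_assoc, dirac_mul_self (by omega), Algebra.algebraMap_eq_smul_one,
      Algebra.algebraMap_eq_smul_one]
    module
  · intro j hj hja
    rw [mem_range] at hj
    rw [mul_smul_comm, smul_mul_assoc, ← smul_add, dirac_anticomm hja.symm (by omega) (by omega),
      smul_zero]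

end StringOp

section Trig

theorem sum_cos_mul_sin (a : ℝ) (K : ℕ) :
    (∑ m ∈ range K, Real.cos ((m + 1 / 2) * a)) * (2 * Real.sin (a / 2)) = Real.sin (K * a) := by
  induction K with
  | zero => simp
  | succ K ih =>
    rw [sum_range_succ, add_mul, ih]
    have h1 : ((K : ℝ) + 1 : ℝ) * a = (K + 1 / 2) * a + a / 2 := by ring
    have h2 : (K : ℝ) * a = (K + 1 / 2) * a - a / 2 := by ring
    push_cast
    rw [h1, Real.sin_add, h2, Real.sin_sub]; ring

/-- The momenta of the transfer matrix. -/
noncomputable def momentum (L m : ℕ) : ℝ := (m + 1 / 2) * (Real.pi / (2 * L + 2))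

theorem momentum_pos (L m : ℕ) : 0 < momentum L m := by unfold momentum; positivity

theorem momentum_lt {L m : ℕ} (hm : m < 2 * L + 2) : momentum L m < Real.pi := by
  unfold momentum
  rw [← mul_div_assoc, div_lt_iff₀ (by positivity), mul_comm]
  have : (m : ℝ) + 1 ≤ 2 * L + 2 := by exact_mod_cast hm
  exact mul_lt_mul_of_pos_left (by linarith) Real.pi_pos

theorem momentum_lt_half {L m : ℕ} (hm : m < L + 1) : momentum L m < Real.pi / 2 := by
  unfold momentum
  rw [← mul_div_assoc, div_lt_iff₀ (by positivity)]
  have : (m : ℝ) + 1 ≤ L + 1 := by exact_mod_cast hm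
  nlinarith [Real.pi_pos]

theorem half_lt_momentum {L m : ℕ} (hm : L + 1 ≤ m) : Real.pi / 2 < momentum L m := by
  unfold momentum
  rw [← mul_div_assoc, lt_div_iff₀ (by positivity)]
  have : (L : ℝ) + 1 ≤ m := by exact_mod_cast hm
  nlinarith [Real.pi_pos]

theorem cos_momentum (L m : ℕ) : Real.cos (momentum L m * (2 * L + 2)) = 0 := by
  rw [Real.cos_eq_zero_iff]
  refine ⟨m, ?_⟩
  unfold momentum
  have : (2 * (L : ℝ) + 2) ≠ 0 := by positivity
  push_cast
  field_simp

/-- Weight of the boundary mode. -/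
noncomputable def bw (a : ℕ) : ℝ := if a = 0 then 1 / √2 else 1

theorem cosMode_mul (θ : ℝ) (a b : ℕ) : cosMode θ a * cosMode θ b =
    bw a * bw b * (1 / 2) * (Real.cos (((a : ℝ) - b) * θ) + Real.cos (((a : ℝ) + b) * θ)) := by
  have e : ∀ a : ℕ, cosMode θ a = bw a * Real.cos (a * θ) := by
    intro a; unfold cosMode bw; split_ifs with h
    · simp [h]
    · rw [mul_comm θ, one_mul]
  rw [e, e, sub_mul, add_mul, Real.cos_sub, Real.cos_add]; ring

theorem sin_half_ne_zero {L : ℕ} {k : ℝ} (h0 : k ≠ 0) (h1 : |k| < 2 * (2 * L + 2)) :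
    Real.sin (k * (Real.pi / (2 * L + 2)) / 2) ≠ 0 := by
  have hp : 0 < Real.pi / (2 * (L : ℝ) + 2) / 2 := by positivity
  have e : k * (Real.pi / (2 * L + 2)) / 2 = k * (Real.pi / (2 * L + 2) / 2) := by ring
  have hb : |k * (Real.pi / (2 * L + 2) / 2)| < Real.pi := by
    rw [abs_mul, abs_of_pos hp]
    calc _ < 2 * (2 * (L : ℝ) + 2) * (Real.pi / (2 * L + 2) / 2) := by gcongr
      _ = Real.pi := by field_simp
  rw [e]
  rw [abs_lt] at hb
  intro h
  rw [Real.sin_eq_zero_iff_of_lt_of_lt hb.1 hb.2] at h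
  rcases mul_eq_zero.1 h with h | h
  · exact h0 h
  · exact hp.ne' h

theorem sum_cos_momentum {L K : ℕ} {k : ℝ} (h0 : k ≠ 0) (h1 : |k| < 2 * (2 * L + 2)) :
    ∑ m ∈ range K, Real.cos (k * momentum L m) =
      Real.sin (K * (k * (Real.pi / (2 * L + 2)))) /
        (2 * Real.sin (k * (Real.pi / (2 * L + 2)) / 2)) := by
  rw [eq_div_iff (mul_ne_zero two_ne_zero (sin_half_ne_zero h0 h1)), ← sum_cos_mul_sin]
  congr 1
  refine Finset.sum_congr rfl fun m _ => ?_
  unfold momentum; congr 1; ring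

theorem sum_cos_momentum_full {L : ℕ} {k : ℤ} (h0 : k ≠ 0) (h1 : |k| < 2 * (2 * L + 2)) :
    ∑ m ∈ range (2 * L + 2), Real.cos (k * momentum L m) = 0 := by
  rw [sum_cos_momentum (by exact_mod_cast h0) (by exact_mod_cast h1)]
  have : ((2 * L + 2 : ℕ) : ℝ) * ((k : ℝ) * (Real.pi / (2 * L + 2))) = k * Real.pi := by
    push_cast; field_simp
  rw [this, Real.sin_int_mul_pi, zero_div]

theorem sum_cos_momentum_half_even {L : ℕ} {k : ℤ} (h0 : k ≠ 0) (h1 : |k| < 2 * L + 2) :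
    ∑ m ∈ range (L + 1), Real.cos ((2 * k : ℤ) * momentum L m) = 0 := by
  rw [sum_cos_momentum (by exact_mod_cast (by omega : 2 * k ≠ 0))
    (by
      rw [← Int.cast_abs, abs_mul]
      have h1' : ((|k| : ℤ) : ℝ) < 2 * L + 2 := by exact_mod_cast h1
      push_cast at h1' ⊢; norm_num; linarith)]
  have : ((L + 1 : ℕ) : ℝ) * (((2 * k : ℤ) : ℝ) * (Real.pi / (2 * L + 2))) = k * Real.pi := by
    push_cast; field_simp
  rw [this, Real.sin_int_mul_pi, zero_div]

theorem sum_cos_momentum_half_odd {L : ℕ} {p : ℤ} (h1 : |2 * p + 1| < 2 * (2 * L + 2)) :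
    ∑ m ∈ range (L + 1), Real.cos ((2 * p + 1 : ℤ) * momentum L m) =
      (-1) ^ p / (2 * Real.sin ((2 * p + 1) * (Real.pi / (2 * L + 2)) / 2)) := by
  rw [sum_cos_momentum (by exact_mod_cast (by omega : 2 * p + 1 ≠ 0)) (by exact_mod_cast h1)]
  have : ((L + 1 : ℕ) : ℝ) * (((2 * p + 1 : ℤ) : ℝ) * (Real.pi / (2 * L + 2))) =
      p * Real.pi + Real.pi / 2 := by
    push_cast; field_simp
  rw [this, Real.sin_add_pi_div_two, Real.cos_int_mul_pi]; push_cast; rfl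

theorem sum_cosMode_full {L a b : ℕ} (ha : a < 2 * L + 2) (hb : b < 2 * L + 2) :
    ∑ m ∈ range (2 * L + 2), cosMode (momentum L m) a * cosMode (momentum L m) b =
      if a = b then (L + 1 : ℝ) else 0 := by
  simp only [cosMode_mul]
  rw [← Finset.mul_sum, Finset.sum_add_distrib]
  have hs := sqrt_two_sq
  have e1 : ∀ m, Real.cos (((a : ℝ) - b) * momentum L m) =
    Real.cos ((((a : ℤ) - b : ℤ) : ℝ) * momentum L m) := by intro m; push_cast; rfl
  have e2 : ∀ m, Real.cos (((a : ℝ) + b) * momentum L m) =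
    Real.cos ((((a : ℤ) + b : ℤ) : ℝ) * momentum L m) := by intro m; push_cast; rfl
  split_ifs with h
  · subst h
    rcases Nat.eq_zero_or_pos a with rfl | ha0
    · simp only [bw, if_true, CharP.cast_eq_zero, sub_zero, zero_mul, Real.cos_zero, sum_const,
        card_range, nsmul_eq_mul, mul_one, add_zero]
      push_cast
      field_simp
      rw [sq, hs]; ring
    · rw [Finset.sum_congr rfl fun m _ => e2 m,
        sum_cos_momentum_full (by omega) (by rw [abs_lt]; constructor <;> omega)]
      simp [bw, ha0.ne']; ring
  · rw [Finset.sum_congr rfl fun m _ => e2 m, Finset.sum_congr rfl fun m _ => e1 m,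
      sum_cos_momentum_full (by omega) (by rw [abs_lt]; constructor <;> omega),
      sum_cos_momentum_full (by omega) (by rw [abs_lt]; constructor <;> omega)]
    simp

theorem sum_cosMode_half_even {L i l : ℕ} (hi : 2 * i < 2 * L + 2) (hl : 2 * l < 2 * L + 2)
    (hil : i ≠ l) :
    ∑ m ∈ range (L + 1), cosMode (momentum L m) (2 * l) * cosMode (momentum L m) (2 * i) = 0 := by
  simp only [cosMode_mul]
  rw [← Finset.mul_sum, Finset.sum_add_distrib]
  have e1 : ∀ m, Real.cos ((((2 * l : ℕ) : ℝ) - (2 * i : ℕ)) * momentum L m) =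
    Real.cos ((2 * ((l : ℤ) - i) : ℤ) * momentum L m) := by intro m; push_cast; congr 2; ring
  have e2 : ∀ m, Real.cos ((((2 * l : ℕ) : ℝ) + (2 * i : ℕ)) * momentum L m) =
    Real.cos ((2 * ((l : ℤ) + i) : ℤ) * momentum L m) := by intro m; push_cast; congr 2; ring
  rw [Finset.sum_congr rfl fun m _ => e1 m, Finset.sum_congr rfl fun m _ => e2 m,
    sum_cos_momentum_half_even (by omega) (by rw [abs_lt]; constructor <;> omega),
    sum_cos_momentum_half_even (by omega) (by rw [abs_lt]; constructor <;> omega)]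
  simp

/-- The two-point contraction of the fermions in the top eigenvector. -/
noncomputable def contraction (L i l : ℕ) : ℝ :=
  bw l / (2 * L + 2) * (1 / Real.sin ((2 * ((i : ℝ) - l) + 1) * (Real.pi / (2 * L + 2)) / 2) +
    1 / Real.sin ((2 * ((i : ℝ) + l) + 1) * (Real.pi / (2 * L + 2)) / 2))

theorem sum_cosMode_half_odd {L i l : ℕ} (hi : i < L + 1) (hl : l < L + 1) :
    sgn4 (2 * l) * sgn4 (2 * i + 1) * (4 / (2 * L + 2)) *
    ∑ m ∈ range (L + 1), cosMode (momentum L m) (2 * l) * cosMode (momentum L m) (2 * i + 1) =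
      contraction L i l := by
  simp only [cosMode_mul]
  rw [← Finset.mul_sum, Finset.sum_add_distrib]
  have e1 : ∀ m, Real.cos ((((2 * l : ℕ) : ℝ) - (2 * i + 1 : ℕ)) * momentum L m) =
    Real.cos ((2 * ((i : ℤ) - l) + 1 : ℤ) * momentum L m) := by
      intro m; rw [← Real.cos_neg]; push_cast; congr 1; ring
  have e2 : ∀ m, Real.cos ((((2 * l : ℕ) : ℝ) + (2 * i + 1 : ℕ)) * momentum L m) =
    Real.cos ((2 * ((i : ℤ) + l) + 1 : ℤ) * momentum L m) := by intro m; push_cast; congr 2; ring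
  rw [Finset.sum_congr rfl fun m _ => e1 m, Finset.sum_congr rfl fun m _ => e2 m,
    sum_cos_momentum_half_odd (by rw [abs_lt]; constructor <;> omega),
    sum_cos_momentum_half_odd (by rw [abs_lt]; constructor <;> omega), sgn4_even, sgn4_odd,
    contraction]
  have p1 : ((-1 : ℝ)) ^ ((i : ℤ) + l) = (-1) ^ i * (-1) ^ l := by
    rw [zpow_add₀ (by norm_num)]; simp
  have p2 : ((-1 : ℝ)) ^ ((i : ℤ) - l) = (-1) ^ i * (-1) ^ l := by
    rw [zpow_sub₀ (by norm_num), div_eq_mul_inv]; simp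
    rw [← inv_pow]; norm_num
  have q : ((-1 : ℝ) ^ l * (-1) ^ i) * ((-1) ^ i * (-1) ^ l) = 1 := by
    rw [mul_comm ((-1 : ℝ) ^ i) ((-1) ^ l), ← pow_add, ← mul_pow]; norm_num
  have hb1 : bw (2 * i + 1) = 1 := by simp [bw]
  have hb2 : bw (2 * l) = bw l := by simp [bw]
  rw [p1, p2, hb1, hb2]
  push_cast
  generalize Real.sin ((2 * ((i : ℝ) - l) + 1) * (Real.pi / (2 * L + 2)) / 2) = A
  generalize Real.sin ((2 * ((i : ℝ) + l) + 1) * (Real.pi / (2 * L + 2)) / 2) = B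
  have : (2 * (L : ℝ) + 2) ≠ 0 := by positivity
  calc _ = (((-1 : ℝ) ^ l * (-1) ^ i) * ((-1) ^ i * (-1) ^ l)) * (bw l / (2 * L + 2) *
      (1 / A + 1 / B)) := by ring
    _ = _ := by rw [q, one_mul]

end Trig
end SR

open Finset
namespace SR
section Top
open Matrix

/-- The transfer matrix. -/
noncomputable def transfer (L : ℕ) : Matrix (Fin (L + 2) → Bool) (Fin (L + 2) → Bool) ℝ :=
  (halfT L).transpose * halfT L

/-- `ψ` is an eigenvector of `transfer L` for the largest eigenvalue, which is positive. -/
structure IsTop (L : ℕ) (Λ : ℝ) (ψ : (Fin (L + 2) → Bool) → ℝ) : Prop where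
  pos : 0 < Λ
  eig : transfer L *ᵥ ψ = Λ • ψ
  max : ∀ (c : ℝ) (φ : (Fin (L + 2) → Bool) → ℝ), transfer L *ᵥ φ = c • φ → φ ≠ 0 → c ≤ Λ

theorem IsTop.modeOp_mulVec {L : ℕ} {Λ : ℝ} {ψ : (Fin (L + 2) → Bool) → ℝ} (h : IsTop L Λ ψ)
    {θ : ℝ} (h0 : Real.pi / 2 < θ) (h1 : θ < Real.pi) (hN : Real.cos (θ * (2 * L + 2)) = 0) :
    modeOp L θ *ᵥ ψ = 0 := by
  by_contra hne
  have e := transfer_mul_modeOp (by linarith [Real.pi_pos]) h1 hN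
  have ht : 1 < Real.tan (θ / 2) := by
    rw [← Real.tan_pi_div_four]
    exact Real.tan_lt_tan_of_lt_of_lt_pi_div_two (by linarith [Real.pi_pos]) (by linarith)
      (by linarith)
  have := h.max (Real.tan (θ / 2) ^ 2 * Λ) (modeOp L θ *ᵥ ψ) (by
    rw [mulVec_mulVec, transfer, e, smul_mulVec, ← mulVec_mulVec, ← transfer, h.eig, mulVec_smul,
      smul_smul]) hne
  have h2 : 1 < Real.tan (θ / 2) ^ 2 := by nlinarith
  nlinarith [mul_pos h.pos (sub_pos.2 h2)]

theorem IsTop.modeOp_transpose_mulVec {L : ℕ} {Λ : ℝ} {ψ : (Fin (L + 2) → Bool) → ℝ}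
    (h : IsTop L Λ ψ) {m : ℕ} (hm : m < L + 1) :
    (modeOp L (momentum L m))ᵀ *ᵥ ψ = 0 := by
  have hN : Real.cos ((Real.pi - momentum L m) * (2 * L + 2)) = 0 := by
    have : (Real.pi - momentum L m) * (2 * L + 2) =
        ((2 * L + 2 : ℕ) : ℝ) * Real.pi - momentum L m * (2 * L + 2) := by
      push_cast; ring
    rw [this, Real.cos_nat_mul_pi_sub, cos_momentum, mul_zero]
  rw [modeOp_transpose, neg_mulVec, h.modeOp_mulVec (by linarith [momentum_lt_half hm])
    (by linarith [momentum_pos L m]) hN, neg_zero]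

/-- The creation part of the fermion `dirac (2 * l)`. -/
noncomputable def creation (L l : ℕ) : Matrix (Fin (L + 2) → Bool) (Fin (L + 2) → Bool) ℝ :=
  ∑ m ∈ range (L + 1), (sgn4 (2 * l) * (2 / (2 * L + 2)) * cosMode (momentum L m) (2 * l)) •
    modeOp L (momentum L m)

theorem sum_modeOp (L : ℕ) (s : Finset ℕ) (c : ℕ → ℝ) :
    ∑ m ∈ s, c m • modeOp L (momentum L m) =
      eta L fun j => sgn4 j * ∑ m ∈ s, c m * cosMode (momentum L m) j := by
  simp only [modeOp, eta, Finset.smul_sum, smul_smul]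
  rw [Finset.sum_comm]
  refine Finset.sum_congr rfl fun j _ => ?_
  rw [← Finset.sum_smul]
  congr 1
  rw [Finset.mul_sum]
  refine Finset.sum_congr rfl fun m _ => ?_
  ring

theorem dirac_eq_sum_modeOp {L l : ℕ} (hl : 2 * l < 2 * L + 2) :
    dirac (L + 2) (2 * l) = ∑ m ∈ range (2 * L + 2),
      (sgn4 (2 * l) * (2 / (2 * L + 2)) * cosMode (momentum L m) (2 * l)) •
        modeOp L (momentum L m) := by
  rw [sum_modeOp, eta, Finset.sum_eq_single_of_mem (2 * l) (mem_range.2 hl)]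
  · simp only [mul_assoc]
    rw [← Finset.mul_sum, ← Finset.mul_sum, sum_cosMode_full hl hl, if_pos rfl, ← mul_assoc,
      sgn4_sq]
    have : (2 * (L : ℝ) + 2) ≠ 0 := by positivity
    rw [show (1 : ℝ) * (2 / (2 * L + 2) * (L + 1)) = 1 by field_simp, one_smul]
  · intro j hj hjl
    simp only [mul_assoc]
    rw [← Finset.mul_sum, ← Finset.mul_sum, sum_cosMode_full hl (mem_range.1 hj),
      if_neg (Ne.symm hjl)]
    simp

theorem IsTop.dirac_mulVec {L : ℕ} {Λ : ℝ} {ψ : (Fin (L + 2) → Bool) → ℝ} (h : IsTop L Λ ψ)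
    {l : ℕ} (hl : l < L + 1) : dirac (L + 2) (2 * l) *ᵥ ψ = creation L l *ᵥ ψ := by
  rw [dirac_eq_sum_modeOp (by omega), creation, sum_mulVec, sum_mulVec]
  symm
  apply Finset.sum_subset (range_subset_range.2 (by omega))
  intro m hm hm'
  rw [mem_range] at hm hm'
  rw [smul_mulVec, h.modeOp_mulVec (half_lt_momentum (by omega)) (momentum_lt hm)
    (cos_momentum L m), smul_zero]

theorem IsTop.creation_transpose_mulVec {L : ℕ} {Λ : ℝ} {ψ : (Fin (L + 2) → Bool) → ℝ}
    (h : IsTop L Λ ψ) (l : ℕ) : (creation L l)ᵀ *ᵥ ψ = 0 := by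
  rw [creation, transpose_sum, sum_mulVec]
  apply Finset.sum_eq_zero
  intro m hm
  rw [transpose_smul, smul_mulVec, h.modeOp_transpose_mulVec (mem_range.1 hm), smul_zero]

theorem dirac_creation_anticomm {L a l : ℕ} (ha : a < 2 * L + 2) :
    dirac (L + 2) a * creation L l + creation L l * dirac (L + 2) a =
      algebraMap ℝ _ (eps a * (sgn4 (2 * l) * sgn4 a * (4 / (2 * L + 2)) *
        ∑ m ∈ range (L + 1), cosMode (momentum L m) (2 * l) * cosMode (momentum L m) a)) := by
  rw [creation, sum_modeOp, dirac_eta_anticomm ha]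
  congr 1
  simp only [mul_assoc]
  rw [← Finset.mul_sum, ← Finset.mul_sum]
  ring

/-- The spin-spin correlation in the top eigenvector is a determinant. -/
theorem IsTop.correlation {L : ℕ} {Λ : ℝ} {ψ : (Fin (L + 2) → Bool) → ℝ} (h : IsTop L Λ ψ)
    (h1 : ψ ⬝ᵥ ψ = 1) {J r : ℕ} (hr : J + r < L + 2) :
    ψ ⬝ᵥ (spinM (L + 2) J * spinM (L + 2) (J + r)) *ᵥ ψ =
      (Matrix.of fun i l : Fin r => contraction L (J + i) (J + l)).det := by
  let ω : Matrix (Fin (L + 2) → Bool) (Fin (L + 2) → Bool) ℝ →ₗ[ℝ] ℝ :=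
    { toFun := fun A => ψ ⬝ᵥ A *ᵥ ψ
      map_add' := fun A B => by rw [add_mulVec, dotProduct_add]
      map_smul' := fun c A => by rw [smul_mulVec, dotProduct_smul]; rfl }
  rw [spinM_mul_spinM_eq r hr]
  refine wick_det ω (by simpa [ω] using h1) r _ _ (fun i => creation L (J + i)) _ ?_ ?_ ?_ ?_
  · intro i x
    show ψ ⬝ᵥ (x * _) *ᵥ ψ = ψ ⬝ᵥ (x * _) *ᵥ ψ
    rw [← mulVec_mulVec, ← mulVec_mulVec, h.dirac_mulVec (by omega)]
  · intro i x
    show ψ ⬝ᵥ (_ * x) *ᵥ ψ = 0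
    rw [← mulVec_mulVec, dotProduct_mulVec, ← mulVec_transpose, h.creation_transpose_mulVec,
      zero_dotProduct]
  · intro i l
    rw [dirac_creation_anticomm (by omega), eps_odd, one_mul,
      sum_cosMode_half_odd (by omega) (by omega)]
    simp
  · intro i l hil
    have : J + (i : ℕ) ≠ J + l := fun h => hil (Fin.ext (by omega))
    rw [dirac_creation_anticomm (by omega), sum_cosMode_half_even (by omega) (by omega) this]
    simp

end Top
end SR

open Finset
namespace SR
section Power
open Matrix Filter

variable {n : Type*} [Fintype n] [DecidableEq n]

/-- A real eigenbasis of a positive semidefinite matrix. -/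
theorem exists_eigenbasis {T : Matrix n n ℝ} (hT : T.PosSemidef) :
    ∃ (u : n → n → ℝ) (l : n → ℝ), (∀ i, 0 ≤ l i) ∧ (∀ i, T *ᵥ u i = l i • u i) ∧
      (∀ i, u i ⬝ᵥ u i = 1) ∧ ∀ v : n → ℝ, v = ∑ i, (u i ⬝ᵥ v) • u i := by
  refine ⟨fun i => (hT.1.eigenvectorBasis i).ofLp, hT.1.eigenvalues,
    fun i => hT.eigenvalues_nonneg i, hT.1.mulVec_eigenvectorBasis, fun i => ?_, fun v => ?_⟩
  · have := hT.1.eigenvectorBasis.inner_eq_ite i i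
    rw [EuclideanSpace.inner_eq_star_dotProduct, if_pos rfl] at this
    simpa using this
  · have := congrArg (fun w : EuclideanSpace ℝ n => w.ofLp)
      (hT.1.eigenvectorBasis.sum_repr' (WithLp.toLp 2 v))
    simp only [EuclideanSpace.inner_eq_star_dotProduct] at this
    rw [WithLp.ofLp_sum] at this
    refine this.symm.trans (Finset.sum_congr rfl fun i _ => ?_)
    simp [dotProduct_comm]

theorem pow_mulVec_eigen {T : Matrix n n ℝ} {u : n → ℝ} {l : ℝ} (h : T *ᵥ u = l • u) (m : ℕ) :
    T ^ m *ᵥ u = l ^ m • u := by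
  induction m with
  | zero => simp
  | succ m ih => rw [pow_succ, ← mulVec_mulVec, h, mulVec_smul, ih, smul_smul, pow_succ, mul_comm]

theorem pow_apply_nonneg {T : Matrix n n ℝ} (h : ∀ x y, 0 ≤ T x y) (m : ℕ) (x y : n) :
    0 ≤ (T ^ m) x y := by
  induction m generalizing y with
  | zero => rw [pow_zero, one_apply]; split_ifs <;> norm_num
  | succ m ih =>
    rw [pow_succ, mul_apply]; exact Finset.sum_nonneg fun z _ => mul_nonneg (ih _) (h _ _)

/-- Power iteration for a positive semidefinite matrix with nonnegative entries. -/
theorem exists_top_limit {T : Matrix n n ℝ} (hT : T.PosSemidef) (h0 : ∀ x y, 0 ≤ T x y)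
    (h1 : ∃ x, 0 < T x x) :
    ∃ (Λ : ℝ) (ψ : n → ℝ), 0 < Λ ∧ T *ᵥ ψ = Λ • ψ ∧
      (∀ (c : ℝ) (φ : n → ℝ), T *ᵥ φ = c • φ → φ ≠ 0 → c ≤ Λ) ∧ ψ ⬝ᵥ ψ = 1 ∧
      ∀ A : Matrix n n ℝ, Tendsto (fun m : ℕ => ((T ^ m *ᵥ fun _ => 1) ⬝ᵥ A *ᵥ (T ^ m *ᵥ fun _ => 1)) /
        ((T ^ m *ᵥ fun _ => 1) ⬝ᵥ (T ^ m *ᵥ fun _ => 1))) atTop (nhds (ψ ⬝ᵥ A *ᵥ ψ)) := by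
  obtain ⟨u, l, hl, hu, hn, hexp⟩ := exists_eigenbasis hT
  obtain ⟨x0, hx0⟩ := h1
  have hne : (univ : Finset n).Nonempty := ⟨x0, mem_univ _⟩
  obtain ⟨i0, -, hi0⟩ := Finset.exists_max_image univ l hne
  have hmax : ∀ i, l i ≤ l i0 := fun i => hi0 i (mem_univ _)
  set Λ := l i0 with hΛ
  set v : n → ℝ := fun _ => 1 with hv
  have hTv : ∀ m : ℕ, T ^ m *ᵥ v = ∑ i, ((u i ⬝ᵥ v) * l i ^ m) • u i := by
    intro m
    conv_lhs => rw [hexp v]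
    rw [mulVec_sum]
    refine Finset.sum_congr rfl fun i _ => ?_
    rw [mulVec_smul, pow_mulVec_eigen (hu i), smul_smul]
  have hΛpos : 0 < Λ := by
    by_contra hneg
    have hz : ∀ i, l i = 0 := fun i => le_antisymm ((hmax i).trans (not_lt.1 hneg)) (hl i)
    have := hTv 1
    simp only [hz, pow_one, mul_zero, zero_smul, Finset.sum_const_zero] at this
    have h2 := congrFun this x0
    have h3 : T x0 x0 ≤ (T *ᵥ v) x0 := by
      simp only [mulVec, dotProduct, hv, mul_one]
      exact Finset.single_le_sum (f := fun y => T x0 y) (fun y _ => h0 x0 y) (mem_univ x0)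
    rw [h2] at h3
    exact absurd (hx0.trans_le h3) (lt_irrefl _)
  have hub : ∀ x, |u i0 x| ≤ 1 := by
    intro x
    rw [abs_le_one_iff_mul_self_le_one, ← hn i0]
    exact Finset.single_le_sum (f := fun y => u i0 y * u i0 y) (fun y _ => mul_self_nonneg _)
      (mem_univ x)
  have hlow : ∀ m : ℕ, Λ ^ m ≤ v ⬝ᵥ (T ^ m *ᵥ v) := by
    intro m
    have e : Λ ^ m = u i0 ⬝ᵥ (T ^ m *ᵥ u i0) := by
      rw [pow_mulVec_eigen (hu i0), dotProduct_smul, hn i0, smul_eq_mul, mul_one]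
    rw [e]
    simp only [dotProduct, mulVec, Finset.mul_sum]
    refine Finset.sum_le_sum fun x _ => Finset.sum_le_sum fun y _ => ?_
    have h2 := pow_apply_nonneg h0 m x y
    have h3 : u i0 x * u i0 y ≤ 1 := by
      refine (le_abs_self _).trans ?_
      rw [abs_mul]
      exact mul_le_one₀ (hub x) (abs_nonneg _) (hub y)
    calc _ = (T ^ m) x y * (u i0 x * u i0 y) := by ring
      _ ≤ (T ^ m) x y * 1 := mul_le_mul_of_nonneg_left h3 h2
      _ = _ := by simp [hv]
  set φ : n → ℝ := ∑ i, ((u i ⬝ᵥ v) * if l i = Λ then 1 else 0) • u i with hφ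
  have hw : Tendsto (fun m : ℕ => (Λ ^ m)⁻¹ • (T ^ m *ᵥ v)) atTop (nhds φ) := by
    have e : ∀ m : ℕ, (Λ ^ m)⁻¹ • (T ^ m *ᵥ v) = ∑ i, ((u i ⬝ᵥ v) * (l i / Λ) ^ m) • u i := by
      intro m
      rw [hTv, Finset.smul_sum]
      refine Finset.sum_congr rfl fun i _ => ?_
      rw [smul_smul, div_pow]; congr 1; ring
    simp_rw [e, hφ]
    refine tendsto_finsetSum _ fun i _ => ?_
    have key : Tendsto (fun m : ℕ => (l i / Λ) ^ m) atTop (nhds (if l i = Λ then 1 else 0)) := ?_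
    · exact (key.const_mul _).smul_const _
    split_ifs with h
    · rw [h, div_self hΛpos.ne']
      simp only [one_pow]
      exact tendsto_const_nhds
    · exact tendsto_pow_atTop_nhds_zero_of_lt_one (div_nonneg (hl i) hΛpos.le)
        ((div_lt_one hΛpos).2 (lt_of_le_of_ne (hmax i) h))
  have hcdot : ∀ a : n → ℝ, Continuous fun w : n → ℝ => a ⬝ᵥ w := fun a => by
    unfold dotProduct; fun_prop
  have hφ1 : 1 ≤ v ⬝ᵥ φ := by
    refine ge_of_tendsto' (((hcdot v).tendsto φ).comp hw) fun m => ?_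
    simp only [Function.comp, dotProduct_smul, smul_eq_mul]
    rw [inv_mul_eq_div, le_div_iff₀ (pow_pos hΛpos m), one_mul]
    exact hlow m
  have hφ0 : φ ≠ 0 := by
    intro h
    rw [h, dotProduct_zero] at hφ1
    exact absurd hφ1 (by norm_num)
  have hφp : 0 < φ ⬝ᵥ φ := by
    have : 0 ≤ φ ⬝ᵥ φ := Finset.sum_nonneg fun x _ => mul_self_nonneg _
    exact lt_of_le_of_ne this fun h => hφ0 (dotProduct_self_eq_zero.1 h.symm)
  have hφT : T *ᵥ φ = Λ • φ := by
    rw [hφ, mulVec_sum, Finset.smul_sum]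
    refine Finset.sum_congr rfl fun i _ => ?_
    rw [mulVec_smul, hu, smul_smul, smul_smul]
    split_ifs with h
    · rw [h]; congr 1; ring
    · simp
  have hs : √(φ ⬝ᵥ φ) * √(φ ⬝ᵥ φ) = φ ⬝ᵥ φ := Real.mul_self_sqrt hφp.le
  have hs0 : 0 < √(φ ⬝ᵥ φ) := Real.sqrt_pos.2 hφp
  refine ⟨Λ, (√(φ ⬝ᵥ φ))⁻¹ • φ, hΛpos, ?_, ?_, ?_, ?_⟩
  · rw [mulVec_smul, hφT, smul_comm]
  · intro c χ hχ hχ0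
    have : ∃ i, u i ⬝ᵥ χ ≠ 0 := by
      by_contra hcon
      push Not at hcon
      apply hχ0
      rw [hexp χ]
      simp [hcon]
    obtain ⟨i, hi⟩ := this
    have hsymm : Tᵀ = T := by simpa [Matrix.IsSymm] using hT.1
    have e1 : u i ⬝ᵥ (T *ᵥ χ) = l i * (u i ⬝ᵥ χ) := by
      rw [dotProduct_mulVec, ← mulVec_transpose, hsymm, hu, smul_dotProduct, smul_eq_mul]
    rw [hχ, dotProduct_smul, smul_eq_mul] at e1
    rw [mul_right_cancel₀ hi e1]
    exact hmax i
  · rw [smul_dotProduct, dotProduct_smul, smul_eq_mul, smul_eq_mul]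
    nth_rewrite 3 [← hs]
    field_simp
  · intro A
    have hcq : Continuous fun w : n → ℝ => w ⬝ᵥ A *ᵥ w := by
      unfold mulVec dotProduct; fun_prop
    have hcs : Continuous fun w : n → ℝ => w ⬝ᵥ w := by unfold dotProduct; fun_prop
    have hlim := ((hcq.tendsto φ).comp hw).div ((hcs.tendsto φ).comp hw) hφp.ne'
    have e : ((√(φ ⬝ᵥ φ))⁻¹ • φ) ⬝ᵥ A *ᵥ ((√(φ ⬝ᵥ φ))⁻¹ • φ) = (φ ⬝ᵥ A *ᵥ φ) / (φ ⬝ᵥ φ) := by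
      rw [mulVec_smul, smul_dotProduct, dotProduct_smul]
      simp only [smul_eq_mul]
      rw [div_eq_mul_inv, ← hs, mul_inv]; rw [hs]; ring
    rw [e]
    refine hlim.congr fun m => ?_
    have hm : (Λ ^ m)⁻¹ ≠ 0 := inv_ne_zero (pow_pos hΛpos m).ne'
    simp only [Function.comp, Pi.div_apply, mulVec_smul, smul_dotProduct, dotProduct_smul,
      smul_eq_mul]
    rw [mul_div_mul_left _ _ hm, mul_div_mul_left _ _ hm]

end Power
end SR

open Finset
namespace SR
section Cauchy

/-- A weighted Cauchy determinant. -/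
noncomputable def cauchyDet (p q x y : ℕ → ℝ) (n : ℕ) : ℝ :=
  (Matrix.of fun i l : Fin n => p i * q l / (x i - y l)).det

theorem cauchyDet_zero (p q x y : ℕ → ℝ) : cauchyDet p q x y 0 = 1 := by simp [cauchyDet]

theorem cauchyDet_succ (p q x y : ℕ → ℝ) (n : ℕ) (hp : p n ≠ 0) (hq : q n ≠ 0)
    (h : ∀ i l, x i - y l ≠ 0) :
    cauchyDet p q x y (n + 1) = cauchyDet p q x y n * (p n * q n / (x n - y n)) *
      ∏ i ∈ range n, ((x n - x i) * (y i - y n)) / ((x i - y n) * (x n - y i)) := by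
  set A : Matrix (Fin n) (Fin n) ℝ := Matrix.of fun i l => p i * q l / (x i - y l)
  set B : Matrix (Fin n) (Fin 1) ℝ := Matrix.of fun i _ => p i * q n / (x i - y n)
  set C : Matrix (Fin 1) (Fin n) ℝ := Matrix.of fun _ l => p n * q l / (x n - y l)
  set d : ℝ := p n * q n / (x n - y n) with hd
  have hd0 : d ≠ 0 := div_ne_zero (mul_ne_zero hp hq) (h n n)
  set D : Matrix (Fin 1) (Fin 1) ℝ := Matrix.of fun _ _ => d with hD
  have hDm : ∀ a b : ℝ, (Matrix.of fun _ _ => a : Matrix (Fin 1) (Fin 1) ℝ) *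
      (Matrix.of fun _ _ => b) = Matrix.of fun _ _ => a * b := fun a b => by
    ext i j; simp [Matrix.mul_apply]
  have hD1 : (Matrix.of fun _ _ => (1 : ℝ) : Matrix (Fin 1) (Fin 1) ℝ) = 1 := by
    ext i j; rw [Subsingleton.elim i j, Matrix.one_apply_eq]; rfl
  let _ : Invertible D := ⟨Matrix.of fun _ _ => d⁻¹, by rw [hD, hDm, inv_mul_cancel₀ hd0, hD1],
    by rw [hD, hDm, mul_inv_cancel₀ hd0, hD1]⟩
  have e1 : cauchyDet p q x y (n + 1) = (Matrix.fromBlocks A B C D).det := by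
    rw [cauchyDet, ← Matrix.det_submatrix_equiv_self (finSumFinEquiv : Fin n ⊕ Fin 1 ≃ Fin (n + 1))]
    congr 1
    ext i j
    rcases i with i | i <;> rcases j with j | j <;> simp [A, B, C, D, d]
  have e2 : A - B * ⅟D * C = Matrix.of fun i l : Fin n =>
      ((y l - y n) / (x n - y l)) *
        ((Matrix.of fun i l : Fin n => ((x n - x i) / (x i - y n)) * A i l) i l) := by
    ext i l
    have hinv : ⅟D = Matrix.of fun _ _ => d⁻¹ := rfl
    rw [hinv]
    simp only [Matrix.sub_apply, Matrix.mul_apply, univ_unique, sum_singleton,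
      A, B, C, Matrix.of_apply, hd]
    have h1 := h n n
    have h2 := h i l
    have h3 := h i n
    have h4 := h n l
    field_simp
    ring
  have e3 : D.det = d := by simp [hD]
  rw [e1, Matrix.det_fromBlocks₂₂, e2, Matrix.det_mul_row, Matrix.det_mul_column, e3]
  have e4 : ∏ i ∈ range n, ((x n - x i) * (y i - y n)) / ((x i - y n) * (x n - y i)) =
    (∏ i : Fin n, (y i - y n) / (x n - y i)) * ∏ i : Fin n, (x n - x i) / (x i - y n) := by
    rw [← Finset.prod_mul_distrib, ← Fin.prod_univ_eq_prod_range
      (fun i => ((x n - x i) * (y i - y n)) / ((x i - y n) * (x n - y i)))]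
    refine Finset.prod_congr rfl fun i _ => ?_
    rw [div_mul_div_comm]; congr 1 <;> ring
  rw [e4]
  have e5 : cauchyDet p q x y n = A.det := rfl
  rw [e5]; ring

end Cauchy

section Wallis
open Real.Wallis

theorem W_mul_tendsto (c : ℝ) :
    Filter.Tendsto (fun k : ℕ => W k * (1 + c / ((k : ℝ) + 1))) Filter.atTop
      (nhds (Real.pi / 2)) := by
  have h : Filter.Tendsto (fun k : ℕ => 1 + c * (1 / ((k : ℝ) + 1))) Filter.atTop (nhds 1) := by
    simpa using (tendsto_one_div_add_atTop_nhds_zero_nat.const_mul c).const_add 1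
  have := Real.tendsto_prod_pi_div_two.mul h
  rw [mul_one] at this
  refine this.congr fun k => ?_
  simp only [W]; congr 2; ring

theorem W_upper (j : ℕ) : W j ≤ Real.pi / 2 * ((4 * j + 2) / (4 * j + 3)) := by
  have hmono : Monotone fun k : ℕ => W k * ((4 * k + 3) / (4 * k + 2)) := by
    refine monotone_nat_of_le_succ fun k => ?_
    rw [W_succ, mul_assoc (W k)]
    refine mul_le_mul_of_nonneg_left ?_ (W_pos k).le
    push_cast
    rw [div_mul_div_comm, div_mul_div_comm, div_le_div_iff₀ (by positivity) (by positivity)]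
    have : (0 : ℝ) ≤ k := k.cast_nonneg
    nlinarith [mul_nonneg this this, mul_nonneg this (mul_nonneg this this)]
  have hlim : Filter.Tendsto (fun k : ℕ => W k * ((4 * k + 3) / (4 * k + 2))) Filter.atTop
      (nhds (Real.pi / 2)) := by
    refine tendsto_of_tendsto_of_tendsto_of_le_of_le (W_mul_tendsto 0) (W_mul_tendsto 1)
      (fun k => ?_) (fun k => ?_)
    · refine mul_le_mul_of_nonneg_left ?_ (W_pos k).le
      rw [zero_div, add_zero, le_div_iff₀ (by positivity)]; linarith
    · refine mul_le_mul_of_nonneg_left ?_ (W_pos k).le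
      rw [div_le_iff₀ (by positivity)]
      have hk : (0 : ℝ) < k + 1 := by positivity
      have : (0 : ℝ) ≤ k := k.cast_nonneg
      field_simp
      nlinarith
  have := hmono.ge_of_tendsto hlim j
  have h1 : (0 : ℝ) < (4 * j + 3) / (4 * j + 2) := by positivity
  calc W j = (W j * ((4 * j + 3) / (4 * j + 2))) * ((4 * j + 2) / (4 * j + 3)) := by
        field_simp
    _ ≤ _ := mul_le_mul_of_nonneg_right this (by positivity)

theorem W_lower (j : ℕ) : Real.pi / 2 * ((4 * j + 1) / (4 * j + 2)) ≤ W j := by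
  have hmono : Antitone fun k : ℕ => W k * ((4 * k + 2) / (4 * k + 1)) := by
    refine antitone_nat_of_succ_le fun k => ?_
    rw [W_succ, mul_assoc (W k)]
    refine mul_le_mul_of_nonneg_left ?_ (W_pos k).le
    push_cast
    rw [div_mul_div_comm, div_mul_div_comm, div_le_div_iff₀ (by positivity) (by positivity)]
    have : (0 : ℝ) ≤ k := k.cast_nonneg
    nlinarith [mul_nonneg this this, mul_nonneg this (mul_nonneg this this)]
  have hlim : Filter.Tendsto (fun k : ℕ => W k * ((4 * k + 2) / (4 * k + 1))) Filter.atTop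
      (nhds (Real.pi / 2)) := by
    refine tendsto_of_tendsto_of_tendsto_of_le_of_le (W_mul_tendsto 0) (W_mul_tendsto 1)
      (fun k => ?_) (fun k => ?_)
    · refine mul_le_mul_of_nonneg_left ?_ (W_pos k).le
      rw [zero_div, add_zero, le_div_iff₀ (by positivity)]; linarith
    · refine mul_le_mul_of_nonneg_left ?_ (W_pos k).le
      rw [div_le_iff₀ (by positivity)]
      have hk : (0 : ℝ) < k + 1 := by positivity
      have : (0 : ℝ) ≤ k := k.cast_nonneg
      field_simp
      nlinarith
  have := hmono.le_of_tendsto hlim j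
  calc Real.pi / 2 * ((4 * j + 1) / (4 * j + 2))
      ≤ (W j * ((4 * j + 2) / (4 * j + 1))) * ((4 * j + 1) / (4 * j + 2)) :=
        mul_le_mul_of_nonneg_right this (by positivity)
    _ = W j := by field_simp

end Wallis
end SR

open Finset
namespace SR
section Bounds
open Real.Wallis

/-- Critical spin correlations along the diagonal in the bulk. -/
noncomputable def bulkCorr (n : ℕ) : ℝ :=
  cauchyDet (fun _ => 2 / Real.pi) (fun _ => 1) (fun i => 2 * i + 1) (fun l => 2 * l) n

/-- Critical spin correlations with a diagonal wall. -/
noncomputable def wallCorr (n : ℕ) : ℝ :=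
  cauchyDet (fun i => 4 / Real.pi * (2 * i + 1)) bw (fun i => (2 * i + 1) ^ 2)
    (fun l => 4 * l ^ 2) n

theorem bw_pos (a : ℕ) : 0 < bw a := by
  unfold bw; split_ifs <;> positivity

theorem bw_of_pos {a : ℕ} (h : 0 < a) : bw a = 1 := by simp [bw, h.ne']

theorem W_eq_prod_reflect (n : ℕ) :
    W n = ∏ i ∈ range n, 4 * ((n : ℝ) - i) ^ 2 / (4 * ((n : ℝ) - i) ^ 2 - 1) := by
  rw [W, ← prod_range_reflect]
  refine prod_congr rfl fun i hi => ?_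
  rw [mem_range] at hi
  have : ((n - 1 - i : ℕ) : ℝ) = n - i - 1 := by
    rw [Nat.cast_sub (by omega), Nat.cast_sub (by omega)]; push_cast; ring
  rw [this, div_mul_div_comm]
  congr 1 <;> ring

theorem two_mul_add_one_sub_two_mul_ne_zero (i l : ℕ) : (2 * (i : ℝ) + 1) - 2 * l ≠ 0 := by
  intro h
  have : (2 * (i : ℤ) + 1) - 2 * l = 0 := by exact_mod_cast h
  omega

theorem bulkCorr_succ (n : ℕ) : bulkCorr (n + 1) = bulkCorr n * (2 / Real.pi * W n) := by
  rw [bulkCorr, cauchyDet_succ _ _ _ _ _ (by positivity) one_ne_zero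
    two_mul_add_one_sub_two_mul_ne_zero, W_eq_prod_reflect, bulkCorr, mul_assoc]
  congr 2
  · rw [mul_one, add_sub_cancel_left, div_one]
  · refine prod_congr rfl fun i hi => ?_
    rw [← neg_div_neg_eq]
    congr 1 <;> ring

theorem one_sixteenth_le_bulkCorr_pow (n : ℕ) (hn : 1 ≤ n) :
    0 < bulkCorr n ∧ 1 / 16 ≤ bulkCorr n ^ 4 * (2 * n - 1) := by
  induction n, hn using Nat.le_induction with
  | base =>
    rw [bulkCorr_succ]
    simp only [bulkCorr, cauchyDet_zero, W, range_zero, prod_empty]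
    refine ⟨by positivity, ?_⟩
    have : (1 : ℝ) / 2 ≤ 2 / Real.pi := by
      rw [div_le_div_iff₀ (by norm_num) Real.pi_pos]; linarith [Real.pi_le_four]
    have := pow_le_pow_left₀ (by norm_num) this 4
    norm_num at this ⊢
    linarith
  | succ n hn ih =>
    have hW := W_lower n
    have hr : ((4 : ℝ) * n + 1) / (4 * n + 2) ≤ 2 / Real.pi * W n := by
      calc ((4 : ℝ) * n + 1) / (4 * n + 2)
          = 2 / Real.pi * (Real.pi / 2 * ((4 * n + 1) / (4 * n + 2))) := by
            field_simp
        _ ≤ _ := mul_le_mul_of_nonneg_left hW (by positivity)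
    have hn' : (1 : ℝ) ≤ n := by exact_mod_cast hn
    have hb : ((2 : ℝ) * n - 1) / (2 * n + 1) ≤ (2 / Real.pi * W n) ^ 4 := by
      refine le_trans ?_ (pow_le_pow_left₀ (by positivity) hr 4)
      have := one_add_mul_le_pow (a := -(1 : ℝ) / (4 * n + 2)) (by
        rw [le_div_iff₀ (by positivity)]; linarith) 4
      have e : (1 : ℝ) + -1 / (4 * n + 2) = (4 * n + 1) / (4 * n + 2) := by field_simp; ring
      rw [e] at this
      refine le_trans (le_of_eq ?_) this
      push_cast
      field_simp; ring
    have hp : 0 < 2 / Real.pi * W n := mul_pos (by positivity) (W_pos n)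
    rw [bulkCorr_succ]
    refine ⟨mul_pos ih.1 hp, ?_⟩
    rw [div_le_iff₀ (by positivity)] at hb
    push_cast
    calc (1 : ℝ) / 16 ≤ bulkCorr n ^ 4 * (2 * n - 1) := ih.2
      _ ≤ bulkCorr n ^ 4 * ((2 / Real.pi * W n) ^ 4 * (2 * n + 1)) :=
        mul_le_mul_of_nonneg_left hb (pow_nonneg ih.1.le 4)
      _ = _ := by ring

theorem prod_le_of_telescope (n m : ℕ) (hn : 1 ≤ n) :
    ∏ i ∈ range m, 4 * ((n : ℝ) + i) * (n + i + 1) / (2 * (n + i) + 1) ^ 2 ≤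
      1 / (1 + (1 / (n : ℝ) - 1 / (n + m)) / 4) := by
  have hn' : (1 : ℝ) ≤ n := by exact_mod_cast hn
  induction m with
  | zero => simp
  | succ m ih =>
    rw [prod_range_succ]
    refine (mul_le_mul_of_nonneg_right ih (by positivity)).trans ?_
    have hm : (0 : ℝ) ≤ m := m.cast_nonneg
    set x : ℝ := n + m with hx
    have hx1 : 1 ≤ x := by linarith
    have hs : (0 : ℝ) ≤ 1 / (n : ℝ) - 1 / x := by
      rw [sub_nonneg]; exact one_div_le_one_div_of_le (by linarith) (by linarith)
    set s : ℝ := 1 / (n : ℝ) - 1 / x with hsd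
    have e1 : 4 * x * (x + 1) / (2 * x + 1) ^ 2 = 1 / (1 + 1 / (4 * x * (x + 1))) := by
      field_simp; ring
    have e2 : 1 / (n : ℝ) - 1 / (n + ((m + 1 : ℕ) : ℝ)) = s + 1 / (x * (x + 1)) := by
      push_cast
      rw [← add_assoc, ← hx, hsd]; field_simp; ring
    rw [e1, e2, div_mul_div_comm, one_mul]
    have hc : 0 ≤ 1 / (x * (x + 1)) := by positivity
    have e3 : 1 / (4 * x * (x + 1)) = 1 / (x * (x + 1)) / 4 := by field_simp
    rw [e3]
    refine one_div_le_one_div_of_le (by positivity) ?_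
    nlinarith [mul_nonneg hs hc]

theorem wallCorr_succ (n : ℕ) (hn : 1 ≤ n) : wallCorr (n + 1) = wallCorr n *
    (2 / Real.pi * ((4 * n + 2) / (4 * n + 1)) * W n *
      ∏ i ∈ range n, 4 * ((n : ℝ) + i) * (n + i + 1) / (2 * (n + i) + 1) ^ 2) := by
  have hne : ∀ i l : ℕ, (2 * (i : ℝ) + 1) ^ 2 - 4 * l ^ 2 ≠ 0 := by
    intro i l
    have : (2 * (i : ℝ) + 1) ^ 2 - 4 * l ^ 2 = ((2 * i + 1) - 2 * l) * (2 * i + 1 + 2 * l) := by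
      ring
    rw [this]
    exact mul_ne_zero (two_mul_add_one_sub_two_mul_ne_zero i l) (by positivity)
  rw [wallCorr, cauchyDet_succ _ _ _ _ _ (by positivity) (bw_pos n).ne' hne,
    W_eq_prod_reflect, wallCorr, mul_assoc, mul_assoc _ (∏ i ∈ range n, _), ← prod_mul_distrib,
    bw_of_pos hn]
  congr 2
  · have : (2 * (n : ℝ) + 1) ^ 2 - 4 * n ^ 2 = 4 * n + 1 := by ring
    rw [this]
    field_simp
    ring
  · refine prod_congr rfl fun i hi => ?_
    rw [div_mul_div_comm, ← neg_div_neg_eq]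
    have h1 := two_mul_add_one_sub_two_mul_ne_zero i n
    have h2 := two_mul_add_one_sub_two_mul_ne_zero n i
    rw [div_eq_div_iff]
    · ring
    · have : -(((2 * (i : ℝ) + 1) ^ 2 - 4 * n ^ 2) * ((2 * n + 1) ^ 2 - 4 * i ^ 2)) =
        -(((2 * i + 1) - 2 * n) * (2 * i + 1 + 2 * n) * (((2 * n + 1) - 2 * i) *
          (2 * n + 1 + 2 * i))) := by ring
      rw [this]
      exact neg_ne_zero.2 (by positivity)
    · have : 4 * ((n : ℝ) - i) ^ 2 - 1 = ((2 * n + 1) - 2 * i) * -((2 * i + 1) - 2 * n) := by ring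
      rw [this]
      exact mul_ne_zero (mul_ne_zero h2 (neg_ne_zero.2 h1)) (by positivity)

theorem wallCorr_pow_le (n : ℕ) : 0 < wallCorr n ∧ wallCorr n ^ 8 * (n + 2) ≤ 3 := by
  rcases Nat.eq_zero_or_pos n with rfl | hn
  · simp only [wallCorr, cauchyDet_zero]; norm_num
  replace hn : 1 ≤ n := hn
  induction n, hn using Nat.le_induction with
  | base =>
    have e : wallCorr 1 = 4 / Real.pi * (1 / √2) := by
      rw [wallCorr, cauchyDet]; simp [bw]
    have h0 : (0 : ℝ) < 4 / Real.pi * (1 / √2) := by positivity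
    have h1 : 4 / Real.pi * (1 / √2) ≤ 1 := by
      rw [div_mul_div_comm, div_le_one (by positivity), mul_one]
      have h2 : (1.4 : ℝ) ≤ √2 := Real.le_sqrt_of_sq_le (by norm_num)
      nlinarith [Real.pi_gt_three]
    rw [e]
    refine ⟨h0, ?_⟩
    have := pow_le_one₀ (n := 8) h0.le h1
    push_cast; linarith
  | succ n hn ih =>
    have hn' : (1 : ℝ) ≤ n := by exact_mod_cast hn
    rw [wallCorr_succ n hn]
    set U := ∏ i ∈ range n, 4 * ((n : ℝ) + i) * (n + i + 1) / (2 * (n + i) + 1) ^ 2 with hU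
    have hU0 : 0 < U := prod_pos fun i _ => by positivity
    have hU1 : U ≤ 8 * n / (8 * n + 1) := by
      refine (prod_le_of_telescope n n hn).trans (le_of_eq ?_)
      field_simp; ring
    set ρ := 2 / Real.pi * ((4 * n + 2) / (4 * n + 1)) * W n * U with hρ
    have hρ0 : 0 < ρ := mul_pos (mul_pos (by positivity) (W_pos n)) hU0
    have hρ1 : ρ ≤ 1 / (1 + 1 / (8 * n + 15)) := by
      calc ρ ≤ 2 / Real.pi * ((4 * n + 2) / (4 * n + 1)) *
            (Real.pi / 2 * ((4 * n + 2) / (4 * n + 3))) * (8 * n / (8 * n + 1)) := by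
            refine mul_le_mul (mul_le_mul_of_nonneg_left (W_upper n) (by positivity)) hU1 hU0.le
              (by positivity)
        _ = (4 * n + 2) / (4 * n + 1) * ((4 * n + 2) / (4 * n + 3)) * (8 * n / (8 * n + 1)) := by
            field_simp
        _ ≤ _ := by
            rw [div_mul_div_comm, div_mul_div_comm, one_add_div (by positivity), one_div_div,
              div_le_div_iff₀ (by positivity) (by positivity)]
            nlinarith [mul_nonneg (sub_nonneg.2 hn') (sub_nonneg.2 hn'),
              mul_nonneg (sub_nonneg.2 hn')
                (mul_nonneg (sub_nonneg.2 hn') (sub_nonneg.2 hn'))]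
    have hρ8 : ρ ^ 8 ≤ (n + 2) / (n + 3) := by
      refine (pow_le_pow_left₀ hρ0.le hρ1 8).trans ?_
      have := one_add_mul_le_pow (a := (1 : ℝ) / (8 * n + 15)) (by
        have : (0 : ℝ) ≤ 1 / (8 * n + 15) := by positivity
        linarith) 8
      rw [div_pow, one_pow, div_le_div_iff₀ (by positivity) (by positivity), one_mul]
      refine le_trans ?_ (mul_le_mul_of_nonneg_left this (by positivity))
      push_cast
      rw [← mul_div_assoc, one_add_div (by positivity), mul_div_assoc', le_div_iff₀ (by positivity)]
      nlinarith
    refine ⟨mul_pos ih.1 hρ0, ?_⟩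
    rw [le_div_iff₀ (by positivity)] at hρ8
    push_cast
    calc (wallCorr n * ρ) ^ 8 * ((n : ℝ) + 1 + 2) = wallCorr n ^ 8 * (ρ ^ 8 * (n + 3)) := by ring
      _ ≤ wallCorr n ^ 8 * (n + 2) := mul_le_mul_of_nonneg_left hρ8 (pow_nonneg ih.1.le 8)
      _ ≤ 3 := ih.2

end Bounds
end SR

open Finset
namespace SR
section Limits

theorem tendsto_inv_mul_sin {c : ℝ} (hc : c ≠ 0) :
    Filter.Tendsto (fun a : ℝ => 1 / a * (1 / Real.sin (c * (Real.pi / a) / 2))) Filter.atTop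
      (nhds (2 / (c * Real.pi))) := by
  have h0 : Filter.Tendsto (fun a : ℝ => c * Real.pi / 2 / a) Filter.atTop (nhds 0) :=
    Filter.Tendsto.const_div_atTop Filter.tendsto_id _
  have h1 : Filter.Tendsto (fun a : ℝ => Real.sinc (c * Real.pi / 2 / a)) Filter.atTop
      (nhds 1) := by
    have := (Real.continuous_sinc.tendsto 0).comp h0
    rwa [Real.sinc_zero] at this
  have h2 := (h1.inv₀ one_ne_zero).const_mul (2 / (c * Real.pi))
  rw [inv_one, mul_one] at h2
  refine h2.congr' ?_
  filter_upwards [Filter.eventually_gt_atTop 0] with a ha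
  have hcp : c * Real.pi / 2 / a ≠ 0 := by positivity
  rw [Real.sinc_of_ne_zero hcp]
  have : c * (Real.pi / a) / 2 = c * Real.pi / 2 / a := by ring
  rw [this, inv_div]
  field_simp

theorem tendsto_two_mul_add_two :
    Filter.Tendsto (fun L : ℕ => (2 * (L : ℝ) + 2)) Filter.atTop Filter.atTop :=
  Filter.tendsto_atTop_add_const_right _ _
    (Filter.Tendsto.const_mul_atTop (by norm_num) tendsto_natCast_atTop_atTop)

theorem tendsto_contraction_wall (i l : ℕ) :
    Filter.Tendsto (fun L : ℕ => contraction L i l) Filter.atTop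
      (nhds (4 / Real.pi * (2 * i + 1) * bw l / ((2 * (i : ℝ) + 1) ^ 2 - 4 * l ^ 2))) := by
  have hc1 : 2 * ((i : ℝ) - l) + 1 ≠ 0 := by
    have := two_mul_add_one_sub_two_mul_ne_zero i l
    intro h; apply this; linarith
  have hc2 : 2 * ((i : ℝ) + l) + 1 ≠ 0 := by positivity
  have h1 := (tendsto_inv_mul_sin hc1).comp tendsto_two_mul_add_two
  have h2 := (tendsto_inv_mul_sin hc2).comp tendsto_two_mul_add_two
  have h := (h1.add h2).const_mul (bw l)
  have e : bw l * (2 / ((2 * ((i : ℝ) - l) + 1) * Real.pi) +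
      2 / ((2 * ((i : ℝ) + l) + 1) * Real.pi)) =
      4 / Real.pi * (2 * i + 1) * bw l / ((2 * (i : ℝ) + 1) ^ 2 - 4 * l ^ 2) := by
    have e1 : (2 * (i : ℝ) + 1) ^ 2 - 4 * l ^ 2 =
      (2 * ((i : ℝ) - l) + 1) * (2 * ((i : ℝ) + l) + 1) := by ring
    rw [e1]
    field_simp
    ring
  rw [e] at h
  refine h.congr fun L => ?_
  simp only [Function.comp, contraction]
  ring

theorem tendsto_det_contraction_wall (r : ℕ) :
    Filter.Tendsto (fun L : ℕ => (Matrix.of fun i l : Fin r => contraction L i l).det)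
      Filter.atTop (nhds (wallCorr r)) := by
  have : Filter.Tendsto (fun L : ℕ => (Matrix.of fun i l : Fin r => contraction L i l))
      Filter.atTop (nhds (Matrix.of fun i l : Fin r =>
        4 / Real.pi * (2 * i + 1) * bw l / ((2 * (i : ℝ) + 1) ^ 2 - 4 * l ^ 2))) :=
    tendsto_pi_nhds.2 fun i => tendsto_pi_nhds.2 fun l => tendsto_contraction_wall i l
  exact ((Continuous.matrix_det continuous_id).tendsto _).comp this

theorem tendsto_contraction_bulk (i l : ℕ) :
    Filter.Tendsto (fun J : ℕ => contraction (2 * J) (J + i) (J + l)) Filter.atTop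
      (nhds (2 / Real.pi * 1 / (2 * (i : ℝ) + 1 - 2 * l))) := by
  have hc0 := two_mul_add_one_sub_two_mul_ne_zero i l
  have hc1 : 2 * ((i : ℝ) - l) + 1 ≠ 0 := by
    intro h; apply hc0; linarith
  have ha : Filter.Tendsto (fun J : ℕ => (4 * (J : ℝ) + 2)) Filter.atTop Filter.atTop :=
    Filter.tendsto_atTop_add_const_right _ _
      (Filter.Tendsto.const_mul_atTop (by norm_num) tendsto_natCast_atTop_atTop)
  have h1 := (tendsto_inv_mul_sin hc1).comp ha
  have h2 : Filter.Tendsto (fun J : ℕ => (1 / (4 * (J : ℝ) + 2)) *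
      (1 / Real.sin (Real.pi / 2 + ((2 * (i + l) - 1 : ℝ) * (Real.pi / 2)) / (4 * J + 2))))
      Filter.atTop (nhds (0 * (1 / Real.sin (Real.pi / 2 + 0)))) := by
    refine Filter.Tendsto.mul (Filter.Tendsto.const_div_atTop ha 1) ?_
    refine Filter.Tendsto.div tendsto_const_nhds ?_ (by simp)
    exact (Real.continuous_sin.tendsto _).comp
      (tendsto_const_nhds.add (Filter.Tendsto.const_div_atTop ha _))
  have h := h1.add h2
  have e : 2 / ((2 * ((i : ℝ) - l) + 1) * Real.pi) + 0 * (1 / Real.sin (Real.pi / 2 + 0)) =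
      2 / Real.pi * 1 / (2 * (i : ℝ) + 1 - 2 * l) := by
    rw [zero_mul, add_zero]
    have : 2 * ((i : ℝ) - l) + 1 = 2 * i + 1 - 2 * l := by ring
    rw [this]
    field_simp
  rw [e] at h
  refine h.congr' ?_
  filter_upwards [Filter.eventually_gt_atTop 0] with J hJ
  simp only [Function.comp, contraction]
  rw [bw_of_pos (by omega)]
  push_cast
  have e1 : (2 * (2 * (J : ℝ)) + 2) = 4 * J + 2 := by ring
  have e2 : (2 * ((J : ℝ) + i + (J + l)) + 1) * (Real.pi / (4 * J + 2)) / 2 =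
      Real.pi / 2 + ((2 * (i + l) - 1 : ℝ) * (Real.pi / 2)) / (4 * J + 2) := by
    field_simp; ring
  have e3 : (J : ℝ) + i - (J + l) = i - l := by ring
  rw [e1, e2, e3]
  ring

theorem tendsto_det_contraction_bulk (r : ℕ) :
    Filter.Tendsto (fun J : ℕ =>
      (Matrix.of fun i l : Fin r => contraction (2 * J) (J + i) (J + l)).det)
      Filter.atTop (nhds (bulkCorr r)) := by
  have : Filter.Tendsto (fun J : ℕ =>
      (Matrix.of fun i l : Fin r => contraction (2 * J) (J + i) (J + l)))
      Filter.atTop (nhds (Matrix.of fun i l : Fin r =>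
        2 / Real.pi * 1 / (2 * (i : ℝ) + 1 - 2 * l))) :=
    tendsto_pi_nhds.2 fun i => tendsto_pi_nhds.2 fun l => tendsto_contraction_bulk i l
  exact ((Continuous.matrix_det continuous_id).tendsto _).comp this

end Limits
end SR

open Finset
namespace SR
section Entries

theorem exp_criticalBeta_sq : Real.exp criticalBeta * Real.exp criticalBeta = 1 + √2 := by
  rw [← Real.exp_add, criticalBeta, add_halves, Real.exp_log (by positivity)]

theorem exp_neg_criticalBeta_sq :
    Real.exp (-criticalBeta) * Real.exp (-criticalBeta) = √2 - 1 := by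
  have h := exp_criticalBeta_sq
  have h2 : Real.exp (-criticalBeta) * Real.exp criticalBeta = 1 := by
    rw [← Real.exp_add]; simp
  have hs := sqrt_two_sq
  have h3 : (Real.exp (-criticalBeta) * Real.exp (-criticalBeta)) * (1 + √2) = 1 := by
    rw [← h]
    calc _ = (Real.exp (-criticalBeta) * Real.exp criticalBeta) *
        (Real.exp (-criticalBeta) * Real.exp criticalBeta) := by ring
      _ = 1 := by rw [h2, mul_one]
  calc Real.exp (-criticalBeta) * Real.exp (-criticalBeta)
      = (Real.exp (-criticalBeta) * Real.exp (-criticalBeta)) * (1 + √2) * (√2 - 1) := by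
        linear_combination (Real.exp (-criticalBeta) * Real.exp (-criticalBeta)) * (-hs)
    _ = √2 - 1 := by rw [h3, one_mul]

theorem criticalBeta_pos : 0 < criticalBeta :=
  div_pos (Real.log_pos (by have : (0 : ℝ) < √2 := by positivity
                            linarith)) two_pos

theorem spinAt_eq (b : ℕ) {M : ℕ} (s : Fin M → Bool) : spinAt b s = 1 ∨ spinAt b s = -1 :=
  mul_self_eq_one_iff.1 (spinAt_sq b s)

theorem one_add_mul_eq_exp {x y : ℝ} (hx : x = 1 ∨ x = -1) (hy : y = 1 ∨ y = -1) :
    1 + (√2 - 1) * (x * y) =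
      √2 * Real.exp (-criticalBeta) * Real.exp (criticalBeta * (x * y)) := by
  have h2 : Real.exp (-criticalBeta) * Real.exp criticalBeta = 1 := by
    rw [← Real.exp_add]; simp
  have h3 := exp_neg_criticalBeta_sq
  have hs := sqrt_two_sq
  have key : x * y = 1 ∨ x * y = -1 := by
    rcases hx with rfl | rfl <;> rcases hy with rfl | rfl <;> norm_num
  rcases key with h | h <;> rw [h]
  · rw [mul_one, mul_one, mul_assoc, h2]; ring
  · rw [mul_neg_one, mul_neg_one, mul_assoc, h3]; linear_combination -hs

/-- The rows `s` and `s'` agree at the site `0` and beyond the site `j`. -/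
def Agree {M : ℕ} (j : ℕ) (s s' : Fin M → Bool) : Prop :=
  ∀ k : Fin M, ((k : ℕ) = 0 ∨ j < k) → s k = s' k

theorem spinAt_congr {M b : ℕ} {s s' : Fin M → Bool}
    (h : ∀ hb : b < M, s ⟨b, hb⟩ = s' ⟨b, hb⟩) : spinAt b s = spinAt b s' := by
  unfold spinAt
  split_ifs with hb
  · rw [h hb]
  · rfl

theorem bond_even_mul_apply {M k : ℕ} (hk : k + 1 < M)
    (A : Matrix (Fin M → Bool) (Fin M → Bool) ℝ) (s s') :
    (gate M (2 * k) * A) s s' =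
      (1 + (√2 - 1) * (spinAt k s * spinAt (k + 1) s)) * A s s' := by
  rw [gate, bond_even hk, add_mul, one_mul, Matrix.add_apply, smul_mul_assoc, Matrix.smul_apply,
    spinM, spinM, Matrix.diagonal_mul_diagonal, Matrix.diagonal_mul, smul_eq_mul]
  ring

theorem bond_odd_mul_apply {M k : ℕ} (hk : k + 1 < M)
    (A : Matrix (Fin M → Bool) (Fin M → Bool) ℝ) (s s') :
    (gate M (2 * k + 1) * A) s s' =
      A s s' + (√2 - 1) * A (Function.update s ⟨k + 1, hk⟩ (!s ⟨k + 1, hk⟩)) s' := by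
  have : flipLow (k + 1) (flipLow (k + 2) s) =
      Function.update s ⟨k + 1, hk⟩ (!s ⟨k + 1, hk⟩) := by
    funext i
    by_cases hi : i = ⟨k + 1, hk⟩
    · subst hi; simp [flipLow]
    · have h1 : (i : ℕ) ≠ k + 1 := fun h => hi (Fin.ext h)
      rw [Function.update_of_ne hi]
      simp only [flipLow]
      by_cases h2 : (i : ℕ) < k + 1
      · rw [if_pos h2, if_pos (by omega), Bool.not_not]
      · rw [if_neg h2, if_neg (by omega)]
  rw [gate, bond_odd hk, add_mul, one_mul, Matrix.add_apply, smul_mul_assoc, Matrix.smul_apply,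
    mul_assoc, flipM_mul_apply, flipM_mul_apply, this, smul_eq_mul]

theorem gates_even_apply {L j : ℕ} (hj : j ≤ L) (s s' : Fin (L + 2) → Bool) :
    gates L (2 * j) s s' = (√2 * Real.exp (-criticalBeta) * Real.exp (-criticalBeta)) ^ j *
      Set.indicator {p | Agree j p.1 p.2} (fun p => Real.exp (criticalBeta *
        ∑ k ∈ range j, (spinAt k p.1 * spinAt (k + 1) p.2 +
          spinAt (k + 1) p.1 * spinAt (k + 1) p.2))) (s, s') := by
  induction j generalizing s s' with
  | zero =>
    rw [mul_zero, gates, Matrix.one_apply]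
    have : Agree 0 s s' ↔ s = s' :=
      ⟨fun h => funext fun k => h k (Nat.eq_zero_or_pos _), fun h k _ => by rw [h]⟩
    by_cases h : s = s'
    · rw [Set.indicator_of_mem (by simpa using this.2 h)]; simp [h]
    · rw [Set.indicator_of_notMem (by simpa using fun h' => h (this.1 h')), if_neg h]; simp
  | succ j ih =>
    have hjL : j + 1 < L + 2 := by omega
    have ih' := ih (by omega)
    have e : gates L (2 * (j + 1)) = gate (L + 2) (2 * j + 1) * (gate (L + 2) (2 * j) *
        gates L (2 * j)) := rfl
    rw [e, bond_odd_mul_apply hjL, bond_even_mul_apply hjL, bond_even_mul_apply hjL,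
      ih', ih']
    set F : (Fin (L + 2) → Bool) × (Fin (L + 2) → Bool) → ℝ := fun p => Real.exp (criticalBeta *
        ∑ k ∈ range j, (spinAt k p.1 * spinAt (k + 1) p.2 +
          spinAt (k + 1) p.1 * spinAt (k + 1) p.2)) with hF
    set i0 : Fin (L + 2) := ⟨j + 1, hjL⟩
    set u := Function.update s i0 (!s i0) with hu
    have hu0 : u i0 = !s i0 := Function.update_self _ _ _
    have hun : ∀ i, i ≠ i0 → u i = s i := fun i hi => Function.update_of_ne hi _ _
    have huk : ∀ k, k ≠ j + 1 → spinAt k u = spinAt k s := fun k hk =>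
      spinAt_congr fun hb => hun _ fun h => hk (congrArg Fin.val h)
    have hsu : spinAt (j + 1) s = spinR (s i0) := by rw [spinAt, dif_pos hjL]
    have hsu' : spinAt (j + 1) s' = spinR (s' i0) := by rw [spinAt, dif_pos hjL]
    have huu : spinAt (j + 1) u = spinR (u i0) := by rw [spinAt, dif_pos hjL]
    have hne : ∀ k : Fin (L + 2), k ≠ i0 → (((k : ℕ) = 0 ∨ j < k) ↔ ((k : ℕ) = 0 ∨ j + 1 < k)) := by
      intro k hk
      have : (k : ℕ) ≠ j + 1 := fun h => hk (Fin.ext h)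
      omega
    have hFu : F (u, s') = F (s, s') := by
      simp only [hF]
      congr 2
      refine sum_congr rfl fun k hk => ?_
      rw [mem_range] at hk
      rw [huk k (by omega), huk (k + 1) (by omega)]
    by_cases hA : Agree (j + 1) s s'
    · rw [Set.indicator_of_mem (show (s, s') ∈ {p : (Fin (L + 2) → Bool) × (Fin (L + 2) → Bool) | Agree (j + 1) p.1 p.2} from hA)]
      have hsum : criticalBeta * ∑ k ∈ range (j + 1), (spinAt k s * spinAt (k + 1) s' +
          spinAt (k + 1) s * spinAt (k + 1) s') =
          criticalBeta * ∑ k ∈ range j, (spinAt k s * spinAt (k + 1) s' +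
          spinAt (k + 1) s * spinAt (k + 1) s') +
          criticalBeta * (spinAt j s * spinAt (j + 1) s') +
          criticalBeta * (spinAt (j + 1) s * spinAt (j + 1) s') := by
        rw [sum_range_succ]; ring
      simp only [hsum, Real.exp_add]
      have hFF : Real.exp (criticalBeta * ∑ k ∈ range j, (spinAt k s * spinAt (k + 1) s' +
          spinAt (k + 1) s * spinAt (k + 1) s')) = F (s, s') := rfl
      rw [hFF, one_add_mul_eq_exp (spinAt_eq _ _) (spinAt_eq _ _),
        one_add_mul_eq_exp (spinAt_eq _ _) (spinAt_eq _ _), huk j (by omega)]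
      by_cases h0 : s i0 = s' i0
      · have h1 : Agree j s s' := fun k hk => by
          by_cases hki : k = i0
          · rw [hki, h0]
          · exact hA k ((hne k hki).1 hk)
        have h2 : ¬ Agree j u s' := fun h => by
          have := h i0 (Or.inr (by simp [i0]))
          rw [hu0, ← h0] at this
          simp at this
        rw [Set.indicator_of_mem (a := (s, s')) (by exact h1), Set.indicator_of_notMem (by exact h2)]
        have h3 : spinAt (j + 1) s = spinAt (j + 1) s' := by rw [hsu, hsu', h0]
        have h4 : Real.exp (-criticalBeta) *
            Real.exp (criticalBeta * (spinAt (j + 1) s * spinAt (j + 1) s')) = 1 := by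
          rw [h3, spinAt_sq, ← Real.exp_add]; simp
        rw [pow_succ, h3, spinAt_sq]
        rw [h3, spinAt_sq] at h4
        linear_combination -(√2 * Real.exp (-criticalBeta) * Real.exp (-criticalBeta)) ^ j *
          √2 * Real.exp (-criticalBeta) * F (s, s') *
          Real.exp (criticalBeta * (spinAt j s * spinAt (j + 1) s')) * h4
      · have h0' : s' i0 = !s i0 := by
          cases h5 : s i0 <;> cases h6 : s' i0 <;> simp_all
        have h1 : ¬ Agree j s s' := fun h => h0 (h i0 (Or.inr (by simp [i0])))
        have h2 : Agree j u s' := fun k hk => by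
          by_cases hki : k = i0
          · rw [hki, hu0, h0']
          · rw [hun k hki]; exact hA k ((hne k hki).1 hk)
        rw [Set.indicator_of_mem (a := (u, s')) (by exact h2), Set.indicator_of_notMem (by exact h1), hFu]
        have h3 : spinAt (j + 1) u = spinAt (j + 1) s' := by rw [huu, hsu', hu0, h0']
        have h5 : spinAt (j + 1) s * spinAt (j + 1) s' = -1 := by
          rw [hsu, hsu', h0', spinR_not, mul_neg, spinR_sq]
        have h4 := exp_neg_criticalBeta_sq
        rw [pow_succ, h3, h5, mul_neg_one]
        linear_combination -(√2 * Real.exp (-criticalBeta) * Real.exp (-criticalBeta)) ^ j *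
          √2 * Real.exp (-criticalBeta) * F (s, s') *
          Real.exp (criticalBeta * (spinAt j s * spinAt (j + 1) s')) * h4
    · rw [Set.indicator_of_notMem (show (s, s') ∉ {p : (Fin (L + 2) → Bool) × (Fin (L + 2) → Bool) | Agree (j + 1) p.1 p.2} from hA)]
      have h1 : ¬ Agree j s s' := fun h => hA fun k hk => h k (by omega)
      have h2 : ¬ Agree j u s' := fun h => hA fun k hk => by
        have hki : k ≠ i0 := by
          rintro rfl
          simp [i0] at hk
        rw [← hun k hki]
        exact h k (by omega)
      rw [Set.indicator_of_notMem (by exact h1), Set.indicator_of_notMem (by exact h2)]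
      ring

/-- The interaction between two consecutive rows. -/
noncomputable def rowEnergy {L : ℕ} (s s' : Fin (L + 2) → Bool) : ℝ :=
  ∑ k ∈ range (L + 1), spinAt k s * spinAt (k + 1) s' + ∑ k ∈ range (L + 2), spinAt k s * spinAt k s'

theorem halfT_apply (L : ℕ) : ∃ c : ℝ, 0 < c ∧ ∀ s s' : Fin (L + 2) → Bool,
    halfT L s s' = c * if s 0 = s' 0 ∧ s (Fin.last _) = s' (Fin.last _) then
      Real.exp (criticalBeta * rowEnergy s s') else 0 := by
  refine ⟨√2 * Real.exp (-criticalBeta) *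
    (√2 * Real.exp (-criticalBeta) * Real.exp (-criticalBeta)) ^ L *
    Real.exp (-(criticalBeta * 2)), by positivity, fun s s' => ?_⟩
  have e : halfT L = gate (L + 2) (2 * L) * gates L (2 * L) := rfl
  rw [e, bond_even_mul_apply (by omega), gates_even_apply le_rfl]
  have hA : Agree L s s' ↔ s 0 = s' 0 ∧ s (Fin.last _) = s' (Fin.last _) := by
    constructor
    · exact fun h => ⟨h 0 (Or.inl rfl), h _ (Or.inr (by simp))⟩
    · rintro ⟨h0, h1⟩ k (hk | hk)
      · have : k = 0 := Fin.ext hk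
        rw [this, h0]
      · have : k = Fin.last _ := Fin.ext (by simp; omega)
        rw [this, h1]
  by_cases h : Agree L s s'
  · rw [Set.indicator_of_mem (s := {p : (Fin (L + 2) → Bool) × (Fin (L + 2) → Bool) | Agree _ p.1 p.2}) h, if_pos (hA.1 h),
      one_add_mul_eq_exp (spinAt_eq _ _) (spinAt_eq _ _)]
    have hl : spinAt (L + 1) s = spinAt (L + 1) s' := spinAt_congr fun hb => h _ (Or.inr (by simp))
    have h0 : spinAt 0 s = spinAt 0 s' := spinAt_congr fun hb => h _ (Or.inl rfl)
    have hE : rowEnergy s s' = (∑ k ∈ range L, (spinAt k s * spinAt (k + 1) s' +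
        spinAt (k + 1) s * spinAt (k + 1) s')) + spinAt L s * spinAt (L + 1) s' + 2 := by
      rw [rowEnergy, sum_range_succ, sum_range_succ _ (L + 1), sum_range_succ', sum_add_distrib,
        hl, h0, spinAt_sq, spinAt_sq]
      ring
    rw [hE, mul_add, mul_add, Real.exp_add, Real.exp_add, hl]
    have h2 : Real.exp (-(criticalBeta * 2)) * Real.exp (criticalBeta * 2) = 1 := by
      rw [← Real.exp_add]; simp
    set X := Real.exp (criticalBeta * ∑ k ∈ range L, (spinAt k s * spinAt (k + 1) s' +
          spinAt (k + 1) s * spinAt (k + 1) s'))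
    set Y := Real.exp (criticalBeta * (spinAt L s * spinAt (L + 1) s'))
    linear_combination -√2 * Real.exp (-criticalBeta) * Y *
      (√2 * Real.exp (-criticalBeta) * Real.exp (-criticalBeta)) ^ L * X * h2
  · rw [Set.indicator_of_notMem (by exact h), if_neg fun h' => h (hA.2 h')]
    ring

theorem halfT_nonneg (L : ℕ) (s s') : 0 ≤ halfT L s s' := by
  obtain ⟨c, hc, h⟩ := halfT_apply L
  rw [h]
  split_ifs <;> positivity

theorem transfer_posSemidef (L : ℕ) : (transfer L).PosSemidef := by
  rw [transfer, ← Matrix.conjTranspose_eq_transpose_of_trivial]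
  exact Matrix.posSemidef_conjTranspose_mul_self _

theorem transfer_nonneg (L : ℕ) (s s') : 0 ≤ transfer L s s' := by
  rw [transfer, Matrix.mul_apply]
  exact sum_nonneg fun i _ => mul_nonneg (halfT_nonneg _ _ _) (halfT_nonneg _ _ _)

theorem transfer_diag_pos (L : ℕ) (s) : 0 < transfer L s s := by
  rw [transfer, Matrix.mul_apply]
  refine sum_pos' (fun i _ => mul_nonneg (halfT_nonneg _ _ _) (halfT_nonneg _ _ _))
    ⟨s, mem_univ _, ?_⟩
  obtain ⟨c, hc, h⟩ := halfT_apply L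
  rw [Matrix.transpose_apply, h, if_pos ⟨rfl, rfl⟩]
  positivity

theorem transfer_limit (L : ℕ) {J r : ℕ} (hr : J + r < L + 2) :
    Filter.Tendsto (fun m : ℕ => ((transfer L ^ m).mulVec (fun _ => 1) ⬝ᵥ
      (spinM (L + 2) J * spinM (L + 2) (J + r)).mulVec ((transfer L ^ m).mulVec fun _ => 1)) /
        ((transfer L ^ m).mulVec (fun _ => 1) ⬝ᵥ (transfer L ^ m).mulVec fun _ => 1))
      Filter.atTop (nhds (Matrix.of fun i l : Fin r => contraction L (J + i) (J + l)).det) := by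
  obtain ⟨Λ, ψ, h1, h2, h3, h4, h5⟩ := exists_top_limit (transfer_posSemidef L)
    (transfer_nonneg L) ⟨fun _ => true, transfer_diag_pos L _⟩
  rw [← IsTop.correlation ⟨h1, h2, h3⟩ h4 hr]
  exact h5 _

end Entries
end SR

open Finset
namespace SR
section Paths
variable {S : Type*} [Fintype S] [DecidableEq S]

/-- Alternately multiply by the diagonal matrices `D i` and apply the matrices `M i`, starting
from the all-ones vector. -/
noncomputable def pathVec (M : ℕ → Matrix S S ℝ) (D : ℕ → S → ℝ) : ℕ → S → ℝ
  | 0 => fun _ => 1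
  | n + 1 => (M n).mulVec fun s => D n s * pathVec M D n s

theorem sum_mul_pathVec (M : ℕ → Matrix S S ℝ) (D : ℕ → S → ℝ) (n : ℕ) (g : S → ℝ) :
    ∑ s, g s * pathVec M D n s = ∑ f : Fin (n + 1) → S, g (f (Fin.last n)) *
      ∏ i : Fin n, M i (f i.succ) (f i.castSucc) * D i (f i.castSucc) := by
  induction n generalizing g with
  | zero =>
    simp only [pathVec, mul_one, univ_eq_empty, prod_empty]
    exact (Fintype.sum_equiv (Equiv.funUnique (Fin 1) S) _ _ fun f => rfl).symm
  | succ n ih =>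
    have h1 : ∑ s, g s * pathVec M D (n + 1) s =
        ∑ s, ∑ s', g s * M n s s' * D n s' * pathVec M D n s' := by
      refine sum_congr rfl fun s _ => ?_
      rw [pathVec, Matrix.mulVec, dotProduct, mul_sum]
      exact sum_congr rfl fun s' _ => by ring
    rw [h1]
    simp_rw [ih]
    rw [← (Fin.snocEquiv fun _ : Fin (n + 2) => S).sum_comp, Fintype.sum_prod_type]
    refine sum_congr rfl fun s _ => sum_congr rfl fun f _ => ?_
    rw [Fin.prod_univ_castSucc]
    simp only [Fin.snocEquiv, Equiv.coe_fn_mk, Fin.snoc_last, Fin.succ_last, Fin.val_last,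
      Fin.snoc_castSucc, ← Fin.castSucc_succ, Fin.val_castSucc]
    ring

theorem pathVec_alternate (V : Matrix S S ℝ) (G : S → ℝ) (m j : ℕ) :
    pathVec (fun i => if Even i then V else V.transpose) (fun i s => if i = 2 * m then G s else 1)
      (2 * (m + (j + 1))) = ((V.transpose * V) ^ (j + 1)).mulVec fun s =>
        G s * ((V.transpose * V) ^ m).mulVec (fun _ => 1) s := by
  have h1 : ∀ k ≤ m, pathVec (fun i => if Even i then V else V.transpose)
      (fun i s => if i = 2 * m then G s else 1) (2 * k) =
        ((V.transpose * V) ^ k).mulVec (fun _ => 1) := by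
    intro k hk
    induction k with
    | zero => simp [pathVec]
    | succ k ih =>
      have e : 2 * (k + 1) = 2 * k + 1 + 1 := by ring
      rw [e, pathVec, pathVec, ih (by omega)]
      simp only [show ¬ (2 * k + 1 = 2 * m) by omega, show ¬ (2 * k = 2 * m) by omega,
        if_false, one_mul, even_two_mul, if_true, Nat.not_even_bit1, Matrix.mulVec_mulVec, pow_succ', Matrix.mul_assoc]
  induction j with
  | zero =>
    have e : 2 * (m + (0 + 1)) = 2 * m + 1 + 1 := by ring
    rw [e, pathVec, pathVec, h1 m le_rfl]
    simp [Nat.not_even_bit1, Matrix.mulVec_mulVec]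
  | succ j ih =>
    have e : 2 * (m + (j + 1 + 1)) = 2 * (m + (j + 1)) + 1 + 1 := by ring
    rw [e, pathVec, pathVec, ih]
    simp only [show ¬ (2 * (m + (j + 1)) + 1 = 2 * m) by omega,
      show ¬ (2 * (m + (j + 1)) = 2 * m) by omega,
      if_false, one_mul, even_two_mul, if_true, Nat.not_even_bit1, Matrix.mulVec_mulVec]
    rw [pow_succ' _ (j + 1), Matrix.mul_assoc]

theorem dot_pow_eq_sum_path (V : Matrix S S ℝ) (G : S → ℝ) (m : ℕ) (hm : 0 < m) :
    ((V.transpose * V) ^ m).mulVec (fun _ => 1) ⬝ᵥ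
      (Matrix.diagonal G).mulVec (((V.transpose * V) ^ m).mulVec fun _ => 1) =
    ∑ f : Fin (4 * m + 1) → S, G (f ⟨2 * m, by omega⟩) *
      ∏ i : Fin (4 * m), (if Even (i : ℕ) then V else V.transpose) (f i.succ) (f i.castSucc) := by
  have h := sum_mul_pathVec (fun i => if Even i then V else V.transpose)
    (fun i s => if i = 2 * m then G s else 1) (4 * m) (fun _ => 1)
  obtain ⟨j, rfl⟩ : ∃ j, m = j + 1 := ⟨m - 1, by omega⟩
  have h2 := pathVec_alternate V G (j + 1) j
  rw [show 2 * (j + 1 + (j + 1)) = 4 * (j + 1) by ring] at h2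
  rw [h2] at h
  have hsym : ((V.transpose * V) ^ (j + 1)).transpose = (V.transpose * V) ^ (j + 1) := by
    rw [Matrix.transpose_pow, Matrix.transpose_mul, Matrix.transpose_transpose]
  have h3 : ((V.transpose * V) ^ (j + 1)).mulVec (fun _ => 1) ⬝ᵥ
      (Matrix.diagonal G).mulVec (((V.transpose * V) ^ (j + 1)).mulVec fun _ => 1) =
      ∑ s, 1 * ((V.transpose * V) ^ (j + 1)).mulVec (fun s =>
        G s * ((V.transpose * V) ^ (j + 1)).mulVec (fun _ => 1) s) s := by
    have : (Matrix.diagonal G).mulVec (((V.transpose * V) ^ (j + 1)).mulVec fun _ => 1) =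
        fun s => G s * ((V.transpose * V) ^ (j + 1)).mulVec (fun _ => 1) s := by
      funext s; rw [Matrix.mulVec_diagonal]
    rw [this]
    have hdot : ∀ w : S → ℝ, ((V.transpose * V) ^ (j + 1)).mulVec (fun _ => 1) ⬝ᵥ w =
        (fun _ => 1) ⬝ᵥ ((V.transpose * V) ^ (j + 1)).mulVec w := fun w => by
      rw [Matrix.dotProduct_mulVec, ← Matrix.mulVec_transpose, hsym]
    rw [hdot]
    rfl
  rw [h3, h]
  refine sum_congr rfl fun f _ => ?_
  rw [one_mul, prod_mul_distrib, mul_comm]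
  congr 1
  rw [prod_eq_single (⟨2 * (j + 1), by omega⟩ : Fin (4 * (j + 1)))]
  · simp
  · intro b _ hb
    rw [if_neg]
    exact fun h => hb (Fin.ext h)
  · simp

end Paths

section Quotient
variable {X V : Type*} [Fintype X] [DecidableEq X] [Fintype V] [DecidableEq V]

/-- The interaction induced on a quotient of the index set. -/
noncomputable def pushJ (π : X → V) (J : X → X → ℝ) (x y : V) : ℝ :=
  ∑ a, ∑ b, if π a = x ∧ π b = y then J a b else 0

theorem energy_comp_eq (π : X → V) (J : X → X → ℝ) (τ : V → Bool) :
    energy J (fun _ => 0) (τ ∘ π) = energy (pushJ π J) (fun _ => 0) τ := by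
  simp only [energy, zero_mul, sum_const_zero, add_zero, pushJ, sum_mul, Function.comp]
  have swap : ∀ G : V → V → X → X → ℝ,
      ∑ x, ∑ y, ∑ a, ∑ b, G x y a b = ∑ a, ∑ b, ∑ x, ∑ y, G x y a b := fun G =>
    calc ∑ x, ∑ y, ∑ a, ∑ b, G x y a b = ∑ x, ∑ a, ∑ y, ∑ b, G x y a b :=
          sum_congr rfl fun x _ => sum_comm
      _ = ∑ a, ∑ x, ∑ y, ∑ b, G x y a b := sum_comm
      _ = ∑ a, ∑ x, ∑ b, ∑ y, G x y a b :=
          sum_congr rfl fun a _ => sum_congr rfl fun x _ => sum_comm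
      _ = ∑ a, ∑ b, ∑ x, ∑ y, G x y a b := sum_congr rfl fun a _ => sum_comm
  rw [swap]
  refine sum_congr rfl fun a _ => sum_congr rfl fun b _ => ?_
  rw [sum_eq_single (π a), sum_eq_single (π b)]
  · simp
  · intro y _ hy
    rw [if_neg fun h => hy h.2.symm, zero_mul]
  · simp
  · intro x _ hx
    refine sum_eq_zero fun y _ => ?_
    rw [if_neg fun h => hx h.1.symm, zero_mul]
  · simp

theorem sum_factor_eq (π : X → V) (ι : V → X) (h : ∀ v, π (ι v) = v)
    (W : (X → Bool) → ℝ) (hW : ∀ f, f ∘ ι ∘ π ≠ f → W f = 0) :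
    ∑ f, W f = ∑ τ : V → Bool, W (τ ∘ π) := by
  symm
  refine sum_of_injOn (fun τ => τ ∘ π) ?_ (by simp) ?_ fun _ _ => rfl
  · intro τ _ τ' _ he
    funext v
    have := congrFun he (ι v)
    simpa [h] using this
  · intro f _ hf
    refine hW f fun he => hf ⟨f ∘ ι, by simp, ?_⟩
    simpa [Function.comp_assoc] using he

theorem le_pushJ (π : X → V) (J : X → X → ℝ) (hJ : ∀ a b, 0 ≤ J a b) (a b : X) :
    J a b ≤ pushJ π J (π a) (π b) := by
  have h0 : ∀ a' b', 0 ≤ if π a' = π a ∧ π b' = π b then J a' b' else 0 := fun a' b' => by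
    split_ifs
    · exact hJ _ _
    · exact le_rfl
  calc J a b = if π a = π a ∧ π b = π b then J a b else 0 := by simp
    _ ≤ ∑ b', if π a = π a ∧ π b' = π b then J a b' else 0 :=
      single_le_sum (f := fun b' => if π a = π a ∧ π b' = π b then J a b' else 0)
        (fun b' _ => h0 a b') (mem_univ b)
    _ ≤ _ := single_le_sum (f := fun a' => ∑ b', if π a' = π a ∧ π b' = π b then J a' b' else 0)
        (fun a' _ => sum_nonneg fun b' _ => h0 a' b') (mem_univ a)

theorem pushJ_nonneg (π : X → V) (J : X → X → ℝ) (hJ : ∀ a b, 0 ≤ J a b) (x y : V) :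
    0 ≤ pushJ π J x y :=
  sum_nonneg fun a _ => sum_nonneg fun b _ => by
    split_ifs
    · exact hJ _ _
    · exact le_rfl

end Quotient
end SR

open Finset
namespace SR
section Strip

/-- Nearest-neighbour couplings on `ℤ²`. -/
noncomputable def nnJ (p q : ℤ × ℤ) : ℝ :=
  if (p.1 - q.1).natAbs + (p.2 - q.2).natAbs = 1 then criticalBeta / 2 else 0

theorem nnJ_nonneg (p q : ℤ × ℤ) : 0 ≤ nnJ p q := by
  unfold nnJ; split_ifs
  · linarith [criticalBeta_pos]
  · exact le_rfl

theorem nnJ_comm (p q : ℤ × ℤ) : nnJ p q = nnJ q p := by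
  unfold nnJ
  rw [← Int.natAbs_neg, ← Int.natAbs_neg (p.2 - q.2), neg_sub, neg_sub]

/-- The sites of the tilted strip: row and column. -/
abbrev StripX (L R : ℕ) := Fin (R + 1) × Fin (L + 2)

/-- The position in `ℤ²` of a site of the tilted strip. -/
def stripPos (w k : ℕ) : ℤ × ℤ := ((k : ℤ) + ((w : ℤ) + 1) / 2, (w : ℤ) / 2 - k)

/-- Couplings of the strip. -/
noncomputable def stripXJ (L R : ℕ) (a b : StripX L R) : ℝ :=
  nnJ (stripPos a.1 a.2) (stripPos b.1 b.2)

theorem nnJ_stripPos_eq_zero {w w' k k' : ℕ} (h1 : w' ≠ w + 1) (h2 : w ≠ w' + 1) :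
    nnJ (stripPos w k) (stripPos w' k') = 0 := by
  rw [nnJ, if_neg]
  simp only [stripPos]
  omega

theorem nnJ_stripPos_even {w : ℕ} (hw : Even w) (k k' : ℕ) :
    nnJ (stripPos w k) (stripPos (w + 1) k') = criticalBeta / 2 *
      ((if k = k' + 1 then 1 else 0) + if k = k' then 1 else 0) := by
  obtain ⟨v, rfl⟩ := hw
  rw [nnJ]
  by_cases h1 : k = k' + 1
  · rw [if_pos h1, if_neg (by omega : ¬ k = k'), if_pos (by simp only [stripPos]; omega)]; ring
  · rw [if_neg h1]
    by_cases h2 : k = k'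
    · rw [if_pos h2, if_pos (by simp only [stripPos]; omega)]; ring
    · rw [if_neg h2, if_neg (by simp only [stripPos]; omega)]; ring

theorem nnJ_stripPos_odd {w : ℕ} (hw : ¬ Even w) (k k' : ℕ) :
    nnJ (stripPos w k) (stripPos (w + 1) k') = criticalBeta / 2 *
      ((if k' = k + 1 then 1 else 0) + if k' = k then 1 else 0) := by
  obtain ⟨v, rfl⟩ := Nat.not_even_iff_odd.1 hw
  rw [nnJ]
  by_cases h1 : k' = k + 1
  · rw [if_pos h1, if_neg (by omega : ¬ k' = k), if_pos (by simp only [stripPos]; omega)]; ring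
  · rw [if_neg h1]
    by_cases h2 : k' = k
    · rw [if_pos h2, if_pos (by simp only [stripPos]; omega)]; ring
    · rw [if_neg h2, if_neg (by simp only [stripPos]; omega)]; ring

theorem sum_adjacent_columns {L : ℕ} (s s' : Fin (L + 2) → Bool) :
    ∑ k : Fin (L + 2), ∑ k' : Fin (L + 2),
      ((if (k' : ℕ) = k + 1 then 1 else 0) + if (k' : ℕ) = k then 1 else 0) *
        (spinR (s k) * spinR (s' k')) = rowEnergy s s' := by
  have hs : ∀ (s : Fin (L + 2) → Bool) (k : Fin (L + 2)), spinR (s k) = spinAt k s := fun s k => by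
    rw [spinAt, dif_pos k.2]
  simp_rw [hs]
  rw [Fin.sum_univ_eq_sum_range (fun k => ∑ k' : Fin (L + 2),
      ((if (k' : ℕ) = k + 1 then 1 else 0) + if (k' : ℕ) = k then (1 : ℝ) else 0) *
        (spinAt k s * spinAt k' s')) (L + 2)]
  have hin : ∀ k, ∑ k' : Fin (L + 2),
      ((if (k' : ℕ) = k + 1 then 1 else 0) + if (k' : ℕ) = k then (1 : ℝ) else 0) *
        (spinAt k s * spinAt k' s') =
      (if k + 1 ∈ range (L + 2) then spinAt k s * spinAt (k + 1) s' else 0) +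
        if k ∈ range (L + 2) then spinAt k s * spinAt k s' else 0 := fun k => by
    rw [Fin.sum_univ_eq_sum_range (fun k' =>
      ((if k' = k + 1 then 1 else 0) + if k' = k then (1 : ℝ) else 0) *
        (spinAt k s * spinAt k' s')) (L + 2)]
    simp only [add_mul, ite_mul, one_mul, zero_mul, sum_add_distrib, sum_ite_eq']
  rw [sum_congr rfl fun k _ => hin k, sum_add_distrib, rowEnergy]
  congr 1
  · rw [sum_range_succ, if_neg (by simp), add_zero]
    refine sum_congr rfl fun k hk => if_pos ?_
    rw [mem_range] at hk ⊢; omega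
  · exact sum_congr rfl fun k hk => if_pos hk

theorem sum_consecutive {R : ℕ} (Φ : Fin (R + 1) → Fin (R + 1) → ℝ)
    (h : ∀ w w' : Fin (R + 1), (w' : ℕ) ≠ w + 1 → (w : ℕ) ≠ w' + 1 → Φ w w' = 0) :
    ∑ w, ∑ w', Φ w w' = ∑ i : Fin R, (Φ i.castSucc i.succ + Φ i.succ i.castSucc) := by
  have hsplit : ∀ w w', Φ w w' = (if (w' : ℕ) = w + 1 then Φ w w' else 0) +
      if (w : ℕ) = w' + 1 then Φ w w' else 0 := fun w w' => by
    by_cases h1 : (w' : ℕ) = w + 1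
    · rw [if_pos h1, if_neg (by omega), add_zero]
    · by_cases h2 : (w : ℕ) = w' + 1
      · rw [if_neg h1, if_pos h2, zero_add]
      · rw [if_neg h1, if_neg h2, h w w' h1 h2, add_zero]
  have key : ∀ Ψ : Fin (R + 1) → Fin (R + 1) → ℝ,
      ∑ w : Fin (R + 1), ∑ w' : Fin (R + 1), (if (w' : ℕ) = w + 1 then Ψ w w' else 0) =
        ∑ i : Fin R, Ψ i.castSucc i.succ := fun Ψ => by
    rw [Fin.sum_univ_castSucc]
    have hz : ∑ w' : Fin (R + 1), (if (w' : ℕ) = (Fin.last R : ℕ) + 1 then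
        Ψ (Fin.last R) w' else 0) = 0 :=
      sum_eq_zero fun w' _ => if_neg (by have := w'.2; simp; omega)
    rw [hz, add_zero]
    refine sum_congr rfl fun i _ => ?_
    rw [sum_eq_single i.succ]
    · simp
    · intro b _ hb
      exact if_neg fun h => hb (Fin.ext (by simpa using h))
    · simp
  simp_rw [sum_add_distrib]
  rw [← key Φ, ← key fun a b => Φ b a, sum_comm (f := fun w w' : Fin (R + 1) => if (w' : ℕ) = w + 1 then
    Φ w' w else 0), ← sum_add_distrib]
  refine sum_congr rfl fun w _ => ?_
  rw [← sum_add_distrib]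
  exact sum_congr rfl fun w' _ => hsplit w w'

/-- The exponent of the `i`-th step of the transfer matrix. -/
noncomputable def stepEnergy {L R : ℕ} (f : StripX L R → Bool) (i : Fin R) : ℝ :=
  if Even (i : ℕ) then rowEnergy (fun k => f (i.succ, k)) (fun k => f (i.castSucc, k))
  else rowEnergy (fun k => f (i.castSucc, k)) (fun k => f (i.succ, k))

theorem energy_stripXJ (L R : ℕ) (f : StripX L R → Bool) :
    energy (stripXJ L R) (fun _ => 0) f = criticalBeta * ∑ i : Fin R, stepEnergy f i := by
  have h1 : energy (stripXJ L R) (fun _ => 0) f = ∑ w, ∑ w', ∑ k, ∑ k',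
      stripXJ L R (w, k) (w', k') * (spinR (f (w, k)) * spinR (f (w', k'))) := by
    simp only [energy, zero_mul, sum_const_zero, add_zero, Fintype.sum_prod_type]
    exact sum_congr rfl fun w _ => sum_comm
  rw [h1, sum_consecutive, mul_sum]
  · refine sum_congr rfl fun i _ => ?_
    have hsymm : ∑ k, ∑ k', stripXJ L R (i.succ, k) (i.castSucc, k') *
        (spinR (f (i.succ, k)) * spinR (f (i.castSucc, k'))) =
        ∑ k, ∑ k', stripXJ L R (i.castSucc, k) (i.succ, k') *
        (spinR (f (i.castSucc, k)) * spinR (f (i.succ, k'))) := by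
      rw [sum_comm]
      refine sum_congr rfl fun k _ => sum_congr rfl fun k' _ => ?_
      rw [stripXJ, nnJ_comm, mul_comm (spinR _)]; rfl
    rw [hsymm, ← two_mul, stepEnergy]
    by_cases he : Even (i : ℕ)
    · rw [if_pos he, ← sum_adjacent_columns, sum_comm, mul_sum, mul_sum]
      refine sum_congr rfl fun k _ => ?_
      rw [mul_sum, mul_sum]
      refine sum_congr rfl fun k' _ => ?_
      rw [stripXJ]
      simp only [Fin.val_castSucc, Fin.val_succ]
      rw [nnJ_stripPos_even he]
      ring
    · rw [if_neg he, ← sum_adjacent_columns, mul_sum, mul_sum]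
      refine sum_congr rfl fun k _ => ?_
      rw [mul_sum, mul_sum]
      refine sum_congr rfl fun k' _ => ?_
      rw [stripXJ]
      simp only [Fin.val_castSucc, Fin.val_succ]
      rw [nnJ_stripPos_odd he]
      ring
  · intro w w' h1 h2
    refine sum_eq_zero fun k _ => sum_eq_zero fun k' _ => ?_
    rw [stripXJ, nnJ_stripPos_eq_zero h1 h2, zero_mul]

/-- Sites of the strip in its two extremal columns. -/
def IsWall {L R : ℕ} (x : StripX L R) : Prop := x.2 = 0 ∨ x.2 = Fin.last _

instance {L R : ℕ} (x : StripX L R) : Decidable (IsWall x) := by unfold IsWall; infer_instance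

/-- The strip with each of its two walls collapsed to a point. -/
abbrev StripV (L R : ℕ) := {x : StripX L R // IsWall x → x.1 = 0}

/-- The collapsing map. -/
def collapse {L R : ℕ} (x : StripX L R) : StripV L R :=
  if h : IsWall x then ⟨(0, x.2), fun _ => rfl⟩ else ⟨x, fun h' => absurd h' h⟩

theorem collapse_of_wall {L R : ℕ} {x : StripX L R} (h : IsWall x) :
    (collapse x : StripX L R) = (0, x.2) := by rw [collapse, dif_pos h]

theorem collapse_of_not_wall {L R : ℕ} {x : StripX L R} (h : ¬ IsWall x) :
    (collapse x : StripX L R) = x := by rw [collapse, dif_neg h]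

theorem collapse_val {L R : ℕ} (x : StripV L R) : collapse x.1 = x := by
  apply Subtype.ext
  by_cases h : IsWall x.1
  · rw [collapse_of_wall h]; exact Prod.ext (x.2 h).symm rfl
  · rw [collapse_of_not_wall h]

/-- Couplings of the collapsed strip. -/
noncomputable def stripJ (L R : ℕ) : StripV L R → StripV L R → ℝ := pushJ collapse (stripXJ L R)

theorem prod_halfT (L : ℕ) : ∃ c : ℝ, 0 < c ∧ ∀ (R : ℕ) (f : Fin (R + 1) → Fin (L + 2) → Bool),
    ∏ i : Fin R, (if Even (i : ℕ) then halfT L else (halfT L).transpose) (f i.succ) (f i.castSucc) =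
      c ^ R * if (∀ i : Fin R, f i.succ 0 = f i.castSucc 0 ∧
          f i.succ (Fin.last _) = f i.castSucc (Fin.last _)) then
        wt (stripXJ L R) (fun _ => 0) (fun x => f x.1 x.2) else 0 := by
  obtain ⟨c, hc, h⟩ := halfT_apply L
  refine ⟨c, hc, fun R f => ?_⟩
  have h' : ∀ i : Fin R, (if Even (i : ℕ) then halfT L else (halfT L).transpose)
      (f i.succ) (f i.castSucc) = c * if f i.succ 0 = f i.castSucc 0 ∧
          f i.succ (Fin.last _) = f i.castSucc (Fin.last _) then
          Real.exp (criticalBeta * stepEnergy (fun x : StripX L R => f x.1 x.2) i) else 0 := by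
    intro i
    by_cases he : Even (i : ℕ)
    · rw [if_pos he, h, stepEnergy, if_pos he]
    · rw [if_neg he, Matrix.transpose_apply, h, stepEnergy, if_neg he]
      congr 1
      exact if_congr ⟨fun h => ⟨h.1.symm, h.2.symm⟩, fun h => ⟨h.1.symm, h.2.symm⟩⟩ rfl rfl
  rw [prod_congr rfl fun i _ => h' i, prod_mul_distrib, prod_const, card_univ, Fintype.card_fin]
  congr 1
  split_ifs with hall
  · rw [wt, energy_stripXJ, mul_sum, Real.exp_sum]
    exact prod_congr rfl fun i _ => if_pos (hall i)
  · push Not at hall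
    obtain ⟨i, hi⟩ := hall
    exact prod_eq_zero (mem_univ i) (if_neg fun h => hi h.1 h.2)

theorem const_of_succ {R : ℕ} {α : Type*} (g : Fin (R + 1) → α)
    (h : ∀ i : Fin R, g i.succ = g i.castSucc) (w : Fin (R + 1)) : g w = g 0 := by
  induction w using Fin.induction with
  | zero => rfl
  | succ i ih => rw [h i, ih]

theorem sum_path_eq_sum_strip (L : ℕ) : ∃ c : ℝ, 0 < c ∧ ∀ (R : ℕ)
    (G : (StripX L R → Bool) → ℝ),
    ∑ f : Fin (R + 1) → Fin (L + 2) → Bool, G (fun x => f x.1 x.2) *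
      ∏ i : Fin R, (if Even (i : ℕ) then halfT L else (halfT L).transpose)
        (f i.succ) (f i.castSucc) =
      c ^ R * ∑ τ : StripV L R → Bool, wt (stripJ L R) (fun _ => 0) τ * G (τ ∘ collapse) := by
  obtain ⟨c, hc, h⟩ := prod_halfT L
  refine ⟨c, hc, fun R G => ?_⟩
  simp_rw [h]
  let P : (StripX L R → Bool) → Prop := fun f => ∀ i : Fin R, f (i.succ, 0) = f (i.castSucc, 0) ∧
          f (i.succ, Fin.last _) = f (i.castSucc, Fin.last _)
  classical
  let W : (StripX L R → Bool) → ℝ := fun f =>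
    G f * (c ^ R * if P f then wt (stripXJ L R) (fun _ => 0) f else 0)
  have e1 : ∑ f : Fin (R + 1) → Fin (L + 2) → Bool, W (fun x => f x.1 x.2) = ∑ f, W f :=
    Fintype.sum_equiv (Equiv.curry (Fin (R + 1)) (Fin (L + 2)) Bool).symm _ _ fun f => rfl
  have e2 := sum_factor_eq (collapse (L := L) (R := R)) Subtype.val collapse_val W (by
    intro f hf
    have : ¬ P f := fun hP => hf (by
      funext x
      have c0 := const_of_succ (fun w => f (w, 0)) fun i => (hP i).1
      have c1 := const_of_succ (fun w => f (w, Fin.last _)) fun i => (hP i).2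
      simp only [Function.comp]
      by_cases hx : IsWall x
      · rw [collapse_of_wall hx]
        obtain ⟨w, k⟩ := x
        rcases hx with hx | hx <;> simp only at hx <;> subst hx
        · exact (c0 w).symm
        · exact (c1 w).symm
      · rw [collapse_of_not_wall hx])
    simp only [W]
    rw [if_neg this, mul_zero, mul_zero])
  have e3 : ∀ τ : StripV L R → Bool, W (τ ∘ collapse) =
      c ^ R * (wt (stripJ L R) (fun _ => 0) τ * G (τ ∘ collapse)) := fun τ => by
    have hP : P (τ ∘ collapse) := fun i => by
      have a1 : ∀ w : Fin (R + 1), (collapse (w, (0 : Fin (L + 2))) : StripV L R) =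
        collapse (0, 0) := fun w => Subtype.ext (by
          rw [collapse_of_wall (Or.inl rfl), collapse_of_wall (Or.inl rfl)])
      have a2 : ∀ w : Fin (R + 1), (collapse (w, Fin.last (L + 1)) : StripV L R) =
        collapse (0, Fin.last _) := fun w => Subtype.ext (by
          rw [collapse_of_wall (Or.inr rfl), collapse_of_wall (Or.inr rfl)])
      simp only [Function.comp, a1 i.succ, a1 i.castSucc, a2 i.succ, a2 i.castSucc, and_self]
    simp only [W]
    rw [if_pos hP, wt, energy_comp_eq, wt, stripJ]
    ring
  rw [mul_sum, ← sum_congr rfl fun τ _ => e3 τ, ← e2, ← e1]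

/-- The sites of the middle row. -/
def midSite {L : ℕ} (m : ℕ) (k : Fin (L + 2)) : StripV L (4 * m) :=
  collapse (⟨2 * m, by omega⟩, k)

theorem strip_limit (L : ℕ) {J r : ℕ} (hr : J + r < L + 2) :
    Filter.Tendsto (fun m : ℕ => ev (stripJ L (4 * m)) (fun _ => 0) fun τ =>
      spinR (τ (midSite m ⟨J, by omega⟩)) * spinR (τ (midSite m ⟨J + r, hr⟩)))
      Filter.atTop (nhds (Matrix.of fun i l : Fin r => contraction L (J + i) (J + l)).det) := by
  refine (transfer_limit L hr).congr' ?_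
  filter_upwards [Filter.eventually_gt_atTop 0] with m hm
  obtain ⟨c, hc, h⟩ := sum_path_eq_sum_strip L
  have e1 := dot_pow_eq_sum_path (halfT L) (fun s => spinAt J s * spinAt (J + r) s) m hm
  have e2 := dot_pow_eq_sum_path (halfT L) (fun _ => 1) m hm
  rw [Matrix.diagonal_one, Matrix.one_mulVec] at e2
  rw [spinM, spinM, Matrix.diagonal_mul_diagonal, transfer, e1, e2]
  have h1 := h (4 * m) (fun f => spinR (f (⟨2 * m, by omega⟩, ⟨J, by omega⟩)) *
    spinR (f (⟨2 * m, by omega⟩, ⟨J + r, hr⟩)))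
  have h2 := h (4 * m) (fun _ => 1)
  simp only [spinAt, dif_pos hr, dif_pos (show J < L + 2 by omega)]
  rw [h1, h2, mul_div_mul_left _ _ (pow_pos hc _).ne', ev, pf]
  simp only [mul_one, Function.comp, midSite]

end Strip
end SR

open Finset
namespace SR
section Symmetrize

variable {V W : Type*} [Fintype V] [DecidableEq V] [Fintype W] [DecidableEq W]

theorem energy_symmetrize (J : V → V → ℝ) (h : V → ℝ) (σ : V → Bool) :
    energy (fun x y => (J x y + J y x) / 2) h σ = energy J h σ := by
  unfold energy
  congr 1
  have h1 : ∑ x, ∑ y, J y x * (spinR (σ x) * spinR (σ y)) =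
      ∑ x, ∑ y, J x y * (spinR (σ x) * spinR (σ y)) := by
    rw [sum_comm]
    exact sum_congr rfl fun x _ => sum_congr rfl fun y _ => by rw [mul_comm (spinR _)]
  have h2 : ∑ x, ∑ y, (J x y + J y x) / 2 * (spinR (σ x) * spinR (σ y)) =
      (∑ x, ∑ y, J x y * (spinR (σ x) * spinR (σ y)) +
        ∑ x, ∑ y, J y x * (spinR (σ x) * spinR (σ y))) / 2 := by
    rw [← sum_add_distrib, sum_div]
    refine sum_congr rfl fun x _ => ?_
    rw [← sum_add_distrib, sum_div]
    exact sum_congr rfl fun y _ => by ring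
  rw [h2, h1]; ring

theorem ev_symmetrize (J : V → V → ℝ) (h : V → ℝ) (F : (V → Bool) → ℝ) :
    ev (fun x y => (J x y + J y x) / 2) h F = ev J h F := by
  simp only [ev, pf, wt, energy_symmetrize]

/-- A magnetization with field is bounded by a correlation with an additional vertex. -/
theorem magn_le_of_embedding {e : Option V → W} (he : Function.Injective e) {J : V → V → ℝ}
    {h : V → ℝ} {J' : W → W → ℝ} (hJs : ∀ x y, J x y = J y x)
    (hJ0 : ∀ x y, 0 ≤ J x y) (hh0 : ∀ x, 0 ≤ h x)
    (hJ0' : ∀ x y, 0 ≤ J' x y) (hJ : ∀ x y, J x y ≤ J' (e (some x)) (e (some y)))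
    (hh : ∀ x, h x / 2 ≤ J' (e (some x)) (e none))
    (hh' : ∀ x, h x / 2 ≤ J' (e none) (e (some x))) (x : V) :
    ev J h (fun σ => spinR (σ x)) ≤
      ev J' (fun _ => 0) fun τ => spinR (τ (e (some x))) * spinR (τ (e none)) := by
  rw [← ev_ghost, ← ev_symmetrize]
  refine ev_le_ev_of_embedding (F := fun τ => spinR (τ (some x)) * spinR (τ none)) he
    (fun a b => ?_) (fun _ => le_rfl) hJ0' (fun _ => le_rfl) (fun a b => ?_) (fun _ => le_rfl)
    (posCone_mul (spin_mem _) (spin_mem _))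
  · rcases a with _ | a <;> rcases b with _ | b <;> simp only [ghostJ]
    · norm_num
    · have := hh0 b; linarith
    · have := hh0 a; linarith
    · have := hJ0 a b; have := hJ0 b a; linarith
  · rcases a with _ | a <;> rcases b with _ | b <;> simp only [ghostJ]
    · simpa using hJ0' _ _
    · have := hh' b; linarith
    · have := hh a; linarith
    · rw [hJs b a, add_self_div_two]; exact hJ a b

end Symmetrize

section Sides

variable {V : Type*} [Fintype V] [DecidableEq V]

/-- Nearest-neighbour couplings read through a placement of the sites in `ℤ²`. -/
noncomputable def nnV (pos : V → ℤ × ℤ) (x y : V) : ℝ := nnJ (pos x) (pos y)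

theorem nnV_nonneg (pos : V → ℤ × ℤ) (x y : V) : 0 ≤ nnV pos x y := nnJ_nonneg _ _

theorem nnV_comm (pos : V → ℤ × ℤ) (x y : V) : nnV pos x y = nnV pos y x := nnJ_comm _ _

theorem nnJ_congr {p q p' q' : ℤ × ℤ} (h1 : p.1 - q.1 = p'.1 - q'.1)
    (h2 : p.2 - q.2 = p'.2 - q'.2) : nnJ p q = nnJ p' q' := by
  rw [nnJ, nnJ, h1, h2]

theorem stripPos_injective {w w' k k' : ℕ} (h : stripPos w k = stripPos w' k') :
    w = w' ∧ k = k' := by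
  simp only [stripPos, Prod.mk.injEq] at h
  omega

theorem not_isWall_iff {L R : ℕ} (x : StripX L R) :
    ¬ IsWall x ↔ 1 ≤ (x.2 : ℕ) ∧ (x.2 : ℕ) ≤ L := by
  have := x.2.2
  simp only [IsWall, Fin.ext_iff, Fin.val_zero, Fin.val_last]
  omega

theorem stripXJ_nonneg (L R : ℕ) (a b : StripX L R) : 0 ≤ stripXJ L R a b := nnJ_nonneg _ _

theorem stripXJ_comm (L R : ℕ) (a b : StripX L R) : stripXJ L R a b = stripXJ L R b a :=
  nnJ_comm _ _

theorem stripJ_nonneg (L R : ℕ) (a b : StripV L R) : 0 ≤ stripJ L R a b :=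
  pushJ_nonneg _ _ (stripXJ_nonneg L R) a b

theorem stripJ_comm (L R : ℕ) (a b : StripV L R) : stripJ L R a b = stripJ L R b a := by
  unfold stripJ pushJ
  rw [sum_comm]
  refine sum_congr rfl fun x _ => sum_congr rfl fun y _ => ?_
  rw [stripXJ_comm]
  exact if_congr and_comm rfl rfl

/-- A point next to the left wall is coupled to it through two bonds. -/
theorem le_stripJ_wall {L R : ℕ} {w : ℕ} (hw : Even w) (h0 : 0 < w) (hR : w < R) (w' : Fin (R + 1)) :
    criticalBeta ≤ stripJ (L + 1) R (collapse (⟨w, by omega⟩, 1)) (collapse (w', 0)) := by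
  have hc : ∀ v : Fin (R + 1), (collapse (v, 0) : StripV (L + 1) R) = collapse (w', 0) := fun v =>
    Subtype.ext (by rw [collapse_of_wall (Or.inl rfl), collapse_of_wall (Or.inl rfl)])
  set a : StripX (L + 1) R := (⟨w, by omega⟩, 1)
  set b : StripX (L + 1) R := (⟨w + 1, by omega⟩, 0)
  set b' : StripX (L + 1) R := (⟨w - 1, by omega⟩, 0)
  have e1 : stripXJ (L + 1) R a b = criticalBeta / 2 := by
    have := nnJ_stripPos_even hw 1 0
    simpa [stripXJ, a, b] using this
  have e2 : stripXJ (L + 1) R a b' = criticalBeta / 2 := by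
    obtain ⟨v, rfl⟩ : ∃ v, w = v + 1 := ⟨w - 1, by omega⟩
    have hv : ¬ Even v := by
      rcases hw with ⟨u, hu⟩; rintro ⟨t, ht⟩; omega
    have := nnJ_stripPos_odd hv 0 1
    rw [nnJ_comm] at this
    simpa [stripXJ, a, b'] using this
  have hne : b ≠ b' := fun h => by
    have := congrArg (fun z => (z.1 : ℕ)) h
    simp only [b, b'] at this
    omega
  have h0 : ∀ a' c, 0 ≤ if (collapse a' : StripV (L + 1) R) = collapse a ∧
      (collapse c : StripV (L + 1) R) = collapse (w', 0) then stripXJ (L + 1) R a' c else 0 :=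
    fun a' c => by
      split_ifs
      · exact stripXJ_nonneg _ _ _ _
      · exact le_rfl
  calc criticalBeta = ∑ c ∈ {b, b'}, if (collapse a : StripV (L + 1) R) = collapse a ∧
      (collapse c : StripV (L + 1) R) = collapse (w', 0) then stripXJ (L + 1) R a c else 0 := by
        rw [sum_pair hne, if_pos ⟨rfl, hc _⟩, if_pos ⟨rfl, hc _⟩, e1, e2]; ring
    _ ≤ ∑ c, if (collapse a : StripV (L + 1) R) = collapse a ∧
      (collapse c : StripV (L + 1) R) = collapse (w', 0) then stripXJ (L + 1) R a c else 0 :=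
        sum_le_sum_of_subset_of_nonneg (subset_univ _) fun c _ _ => h0 a c
    _ ≤ _ := single_le_sum (f := fun a' => ∑ c, if (collapse a' : StripV (L + 1) R) = collapse a ∧
      (collapse c : StripV (L + 1) R) = collapse (w', 0) then stripXJ (L + 1) R a' c else 0)
        (fun a' _ => sum_nonneg fun c _ => h0 a' c) (mem_univ a)

end Sides
end SR

open Finset
namespace SR
section Placement

variable {V : Type*} [Fintype V] [DecidableEq V]

/-- Row of the strip containing `p`, when `p₀` is put into row `2m`. -/
def rowOf (p₀ : ℤ × ℤ) (m : ℕ) (p : ℤ × ℤ) : ℕ := (p.1 - p₀.1 + (p.2 - p₀.2) + 2 * m).toNat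

/-- Column of the strip containing `p`, when `p₀` is put into column `k`. -/
def colOf (p₀ : ℤ × ℤ) (k : ℕ) (p : ℤ × ℤ) : ℕ := ((p.1 - p₀.1 - (p.2 - p₀.2) + 2 * k) / 2).toNat

theorem exists_place (pos : V → ℤ × ℤ) (hpos : Function.Injective pos) (p₀ : ℤ × ℤ) :
    ∃ N : ℕ, ∀ (k m L : ℕ), N + k ≤ L → N ≤ m →
      (∀ y, 2 ≤ (pos y).1 - p₀.1 - ((pos y).2 - p₀.2) + 2 * k) →
      ∃ a : V → StripX L (4 * m), Function.Injective a ∧ (∀ y, ¬ IsWall (a y)) ∧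
        (∀ y, ((a y).1 : ℕ) = rowOf p₀ m (pos y)) ∧ (∀ y, ((a y).2 : ℕ) = colOf p₀ k (pos y)) ∧
        (∀ y, 0 < rowOf p₀ m (pos y) ∧ rowOf p₀ m (pos y) < 4 * m) ∧
        ∀ y, (stripPos (a y).1 (a y).2).1 = (pos y).1 - p₀.1 + (k + m) ∧
          (stripPos (a y).1 (a y).2).2 = (pos y).2 - p₀.2 + (m - k) := by
  obtain ⟨N, hN⟩ : ∃ N : ℕ, ∀ y, ((pos y).1 - p₀.1).natAbs + ((pos y).2 - p₀.2).natAbs < N := by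
    refine ⟨(univ.sup fun y => ((pos y).1 - p₀.1).natAbs + ((pos y).2 - p₀.2).natAbs) + 1,
      fun y => Nat.lt_succ_of_le (le_sup (f := fun y =>
        ((pos y).1 - p₀.1).natAbs + ((pos y).2 - p₀.2).natAbs) (mem_univ y))⟩
  refine ⟨N, fun k m L hL hm hk => ?_⟩
  have hrow : ∀ y, 0 < rowOf p₀ m (pos y) ∧ rowOf p₀ m (pos y) < 4 * m := fun y => by
    have := hN y
    unfold rowOf; omega
  have hcol : ∀ y, 1 ≤ colOf p₀ k (pos y) ∧ colOf p₀ k (pos y) ≤ L := fun y => by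
    have := hN y; have := hk y
    unfold colOf; omega
  let a : V → StripX L (4 * m) := fun y => (⟨rowOf p₀ m (pos y), by have := hrow y; omega⟩,
    ⟨colOf p₀ k (pos y), by have := hcol y; omega⟩)
  have hst : ∀ y, (stripPos (a y).1 (a y).2).1 = (pos y).1 - p₀.1 + (k + m) ∧
          (stripPos (a y).1 (a y).2).2 = (pos y).2 - p₀.2 + (m - k) := fun y => by
    have := hN y; have := hk y
    simp only [stripPos, a, rowOf, colOf]
    omega
  refine ⟨a, fun y z hyz => hpos (Prod.ext ?_ ?_), fun y => (not_isWall_iff _).2 (hcol y),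
    fun y => rfl, fun y => rfl, hrow, hst⟩
  · have h1 := (hst y).1; have h2 := (hst z).1; rw [hyz] at h1; linarith
  · have h1 := (hst y).2; have h2 := (hst z).2; rw [hyz] at h1; linarith

theorem collapse_injective_of_not_wall {L R : ℕ} {x y : StripX L R} (hx : ¬ IsWall x)
    (h : collapse y = collapse x) : y = x := by
  have h' := congrArg Subtype.val h
  rw [collapse_of_not_wall hx] at h'
  by_cases hy : IsWall y
  · rw [collapse_of_wall hy] at h'
    exact absurd (by rw [← h']; exact hy) hx
  · rwa [collapse_of_not_wall hy] at h'

/-- The magnetization at distance `2r` from a straight wall. -/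
theorem magn_le_wallCorr {q : V → ℤ × ℤ} (hq : Function.Injective q) (x : V) (r : ℕ) {h : V → ℝ}
    (hu : ∀ y, -(2 * r : ℤ) ≤ (q y).1 - (q x).1 - ((q y).2 - (q x).2)) (h0 : ∀ y, 0 ≤ h y)
    (hh : ∀ y, h y ≤ if (q y).1 - (q x).1 - ((q y).2 - (q x).2) = -(2 * r : ℤ) then
      2 * criticalBeta else 0) :
    ev (nnV q) h (fun σ => spinR (σ x)) ≤ wallCorr (r + 1) := by
  obtain ⟨N, hN⟩ := exists_place q hq (q x)
  have key : ∀ L, N + r ≤ L → ev (nnV q) h (fun σ => spinR (σ x)) ≤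
      (Matrix.of fun i l : Fin (r + 1) => contraction (L + 1) i l).det := by
    intro L hL
    have hlim := strip_limit (L + 1) (J := 0) (r := r + 1) (by omega)
    simp only [zero_add] at hlim
    refine ge_of_tendsto hlim ?_
    filter_upwards [Filter.eventually_ge_atTop N] with m hm
    obtain ⟨a, ha, hw, hrow, hcol, hrow', hst⟩ := hN (r + 1) m (L + 1) (by omega) hm
      fun y => by have := hu y; push_cast; linarith
    let e : Option V → StripV (L + 1) (4 * m) := fun o =>
      o.elim (midSite m 0) fun y => collapse (a y)
    have hnone : e none = midSite m 0 := rfl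
    have hsome : ∀ y, e (some y) = collapse (a y) := fun y => rfl
    have hne : ∀ y, (collapse (a y) : StripV (L + 1) (4 * m)) ≠ midSite m 0 := fun y hy => by
      have h1 := collapse_injective_of_not_wall (hw y) (hy.symm)
      refine hw y ?_
      rw [← h1]; exact Or.inl rfl
    have he : Function.Injective e := by
      rintro (_ | y) (_ | z) hyz
      · rfl
      · exact absurd hyz.symm (hne z)
      · exact absurd hyz (hne y)
      · exact congrArg some (ha (collapse_injective_of_not_wall (hw z) hyz))
    have hJ : ∀ y z, nnV q y z ≤ stripJ (L + 1) (4 * m) (e (some y)) (e (some z)) := fun y z => by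
      refine le_trans (le_of_eq ?_) (le_pushJ _ _ (stripXJ_nonneg _ _) (a y) (a z))
      exact nnJ_congr (by rw [(hst y).1, (hst z).1]; ring) (by rw [(hst y).2, (hst z).2]; ring)
    have hwall : ∀ y, h y / 2 ≤ stripJ (L + 1) (4 * m) (e (some y)) (e none) := fun y => by
      have h1 := hh y
      split_ifs at h1 with h2
      · have hay : a y = (⟨rowOf (q x) m (q y), by have := hrow' y; omega⟩, 1) := by
          refine Prod.ext (Fin.ext (hrow y)) (Fin.ext ?_)
          rw [hcol y]
          have : (((1 : Fin (L + 1 + 2)) : ℕ)) = 1 := rfl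
          rw [this]
          unfold colOf; push_cast; omega
        rw [hsome, hay]
        refine le_trans (by linarith) (le_stripJ_wall ?_ (hrow' y).1 (hrow' y).2 _)
        have := hrow' y
        rw [Nat.even_iff]
        unfold rowOf at this ⊢
        omega
      · exact le_trans (by linarith) (stripJ_nonneg _ _ _ _)
    have := magn_le_of_embedding he (nnV_comm q) (nnV_nonneg q) h0 (stripJ_nonneg _ _) hJ hwall
      (fun y => by rw [stripJ_comm]; exact hwall y) x
    refine this.trans (le_of_eq ?_)
    have hx : e (some x) = midSite m ⟨r + 1, by omega⟩ := by
      rw [hsome, midSite]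
      congr 1
      refine Prod.ext (Fin.ext ?_) (Fin.ext ?_)
      · rw [hrow x]; simp only [rowOf]; omega
      · rw [hcol x]; simp only [colOf]; push_cast; omega
    rw [hx, hnone]
    congr 1
    funext τ
    rw [mul_comm]
    rfl
  refine ge_of_tendsto ((tendsto_det_contraction_wall (r + 1)).comp
    (Filter.tendsto_add_atTop_nat 1)) ?_
  filter_upwards [Filter.eventually_ge_atTop (N + r)] with L hL
  exact key L hL

end Placement
end SR

open Finset
namespace SR
section Diamond

variable {V : Type*} [Fintype V] [DecidableEq V]

/-- The `ℓ¹` distance on `ℤ²`. -/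
def dist1 (p q : ℤ × ℤ) : ℕ := (p.1 - q.1).natAbs + (p.2 - q.2).natAbs

theorem magn_le_wallCorr_comp {pos : V → ℤ × ℤ} (hpos : Function.Injective pos) (x : V) (r : ℕ)
    (g : ℤ × ℤ → ℤ × ℤ) (hg : Function.Injective g) (hn : ∀ p q, nnJ (g p) (g q) = nnJ p q)
    {h : V → ℝ}
    (hu : ∀ y, -(2 * r : ℤ) ≤ (g (pos y)).1 - (g (pos x)).1 - ((g (pos y)).2 - (g (pos x)).2))
    (h0 : ∀ y, 0 ≤ h y)
    (hh : ∀ y, h y ≤ if (g (pos y)).1 - (g (pos x)).1 - ((g (pos y)).2 - (g (pos x)).2) =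
      -(2 * r : ℤ) then 2 * criticalBeta else 0) :
    ev (nnV pos) h (fun σ => spinR (σ x)) ≤ wallCorr (r + 1) := by
  have : nnV (g ∘ pos) = nnV pos := by
    funext a b; exact hn _ _
  rw [← this]
  exact magn_le_wallCorr (hg.comp hpos) x r hu h0 hh

/-- The boundary field of the diamond of radius `2r` around `p`. -/
noncomputable def diamondField (r : ℕ) (p q : ℤ × ℤ) : ℝ :=
  (if q.1 - p.1 - (q.2 - p.2) = -(2 * r : ℤ) then 2 * criticalBeta else 0) +
  (if q.2 - p.2 - (q.1 - p.1) = -(2 * r : ℤ) then 2 * criticalBeta else 0) +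
  (if q.1 - p.1 - (-q.2 - -p.2) = -(2 * r : ℤ) then 2 * criticalBeta else 0) +
  (if -q.1 - -p.1 - (q.2 - p.2) = -(2 * r : ℤ) then 2 * criticalBeta else 0)

/-- The magnetization at the centre of a diamond. -/
theorem abs_magn_le_wallCorr {pos : V → ℤ × ℤ} (hpos : Function.Injective pos) (x : V) (r : ℕ)
    {h : V → ℝ} (hD : ∀ y, dist1 (pos y) (pos x) ≤ 2 * r)
    (hh : ∀ y, |h y| ≤ diamondField r (pos x) (pos y)) :
    |ev (nnV pos) h (fun σ => spinR (σ x))| ≤ 4 * wallCorr (r + 1) := by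
  have hβ := criticalBeta_pos
  have hif : ∀ (c : Prop) [Decidable c], 0 ≤ if c then 2 * criticalBeta else 0 := fun c _ => by
    split_ifs
    · linarith
    · exact le_rfl
  have hJ : ∀ y z, |nnV pos y z| ≤ nnV pos y z := fun y z => by
    rw [abs_of_nonneg (nnV_nonneg pos y z)]
  refine (abs_ev_le_ev hJ hh (spin_mem x)).trans ?_
  have hD' : ∀ y, ((pos y).1 - (pos x).1).natAbs + ((pos y).2 - (pos x).2).natAbs ≤ 2 * r := hD
  unfold diamondField
  refine (magn_add_le (nnV_nonneg pos) (fun y => add_nonneg (add_nonneg (hif _) (hif _)) (hif _))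
    (fun y => hif _) x).trans ?_
  have a1 := magn_add_le (nnV_nonneg pos)
    (h := fun y => (if (pos y).1 - (pos x).1 - ((pos y).2 - (pos x).2) = -(2 * r : ℤ) then
      2 * criticalBeta else 0) + (if (pos y).2 - (pos x).2 - ((pos y).1 - (pos x).1) =
      -(2 * r : ℤ) then 2 * criticalBeta else 0))
    (h' := fun y => if (pos y).1 - (pos x).1 - (-(pos y).2 - -(pos x).2) = -(2 * r : ℤ) then
      2 * criticalBeta else 0) (fun y => add_nonneg (hif _) (hif _)) (fun y => hif _) x
  have a2 := magn_add_le (nnV_nonneg pos)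
    (h := fun y => (if (pos y).1 - (pos x).1 - ((pos y).2 - (pos x).2) = -(2 * r : ℤ) then
      2 * criticalBeta else 0))
    (h' := fun y => (if (pos y).2 - (pos x).2 - ((pos y).1 - (pos x).1) =
      -(2 * r : ℤ) then 2 * criticalBeta else 0)) (fun y => hif _) (fun y => hif _) x
  have b1 := magn_le_wallCorr_comp hpos x r id Function.injective_id (fun _ _ => rfl)
    (h := fun y => (if (pos y).1 - (pos x).1 - ((pos y).2 - (pos x).2) = -(2 * r : ℤ) then
      2 * criticalBeta else 0))
    (fun y => by have := hD' y; simp only [id]; omega) (fun y => hif _) (fun y => le_rfl)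
  have b2 := magn_le_wallCorr_comp hpos x r Prod.swap Prod.swap_injective
    (fun p q => by simp only [nnJ, Prod.fst_swap, Prod.snd_swap, add_comm])
    (h := fun y => (if (pos y).2 - (pos x).2 - ((pos y).1 - (pos x).1) = -(2 * r : ℤ) then
      2 * criticalBeta else 0))
    (fun y => by have := hD' y; simp only [Prod.fst_swap, Prod.snd_swap]; omega)
    (fun y => hif _) (fun y => le_rfl)
  have b3 := magn_le_wallCorr_comp hpos x r (fun p => (p.1, -p.2))
    (fun p q h => by simp only [Prod.mk.injEq, neg_inj] at h; exact Prod.ext h.1 h.2)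
    (fun p q => by simp only [nnJ, ← Int.natAbs_neg (p.2 - q.2), neg_sub'])
    (h := fun y => (if (pos y).1 - (pos x).1 - (-(pos y).2 - -(pos x).2) = -(2 * r : ℤ) then
      2 * criticalBeta else 0))
    (fun y => by have := hD' y; simp only; omega)
    (fun y => hif _) (fun y => le_rfl)
  have b4 := magn_le_wallCorr_comp hpos x r (fun p => (-p.1, p.2))
    (fun p q h => by simp only [Prod.mk.injEq, neg_inj] at h; exact Prod.ext h.1 h.2)
    (fun p q => by simp only [nnJ, ← Int.natAbs_neg (p.1 - q.1), neg_sub'])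
    (h := fun y => (if -(pos y).1 - -(pos x).1 - ((pos y).2 - (pos x).2) = -(2 * r : ℤ) then
      2 * criticalBeta else 0))
    (fun y => by have := hD' y; simp only; omega)
    (fun y => hif _) (fun y => le_rfl)
  linarith

/-- The number of neighbours of `p` in a set. -/
noncomputable def nbrs (S : Set (ℤ × ℤ)) (p : ℤ × ℤ) : ℝ :=
  S.indicator 1 (p.1 + 1, p.2) + S.indicator 1 (p.1 - 1, p.2) +
    S.indicator 1 (p.1, p.2 + 1) + S.indicator 1 (p.1, p.2 - 1)

theorem nbrs_mono {S T : Set (ℤ × ℤ)} (h : S ⊆ T) (p : ℤ × ℤ) : nbrs S p ≤ nbrs T p := by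
  have : ∀ q, S.indicator (1 : ℤ × ℤ → ℝ) q ≤ T.indicator 1 q := fun q =>
    Set.indicator_le_indicator_of_subset h (fun _ => zero_le_one) q
  unfold nbrs
  linarith [this (p.1 + 1, p.2), this (p.1 - 1, p.2), this (p.1, p.2 + 1), this (p.1, p.2 - 1)]

theorem nbrs_nonneg (S : Set (ℤ × ℤ)) (p : ℤ × ℤ) : 0 ≤ nbrs S p := by
  have : ∀ q, 0 ≤ S.indicator (1 : ℤ × ℤ → ℝ) q := fun q =>
    Set.indicator_nonneg (fun _ _ => zero_le_one) q
  unfold nbrs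
  linarith [this (p.1 + 1, p.2), this (p.1 - 1, p.2), this (p.1, p.2 + 1), this (p.1, p.2 - 1)]

theorem nbrs_union {S T : Set (ℤ × ℤ)} (h : Disjoint S T) (p : ℤ × ℤ) :
    nbrs (S ∪ T) p = nbrs S p + nbrs T p := by
  unfold nbrs
  rw [Set.indicator_union_of_disjoint h]
  ring

theorem nnJ_eq_sum (p q : ℤ × ℤ) : nnJ p q = criticalBeta / 2 *
    ((if q = (p.1 + 1, p.2) then 1 else 0) + (if q = (p.1 - 1, p.2) then 1 else 0) +
      (if q = (p.1, p.2 + 1) then 1 else 0) + (if q = (p.1, p.2 - 1) then 1 else 0)) := by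
  obtain ⟨a, b⟩ := p
  obtain ⟨c, d⟩ := q
  unfold nnJ
  simp only [Prod.mk.injEq]
  by_cases h1 : c = a + 1 ∧ d = b
  · rw [if_pos (by omega), if_pos h1, if_neg (by omega), if_neg (by omega), if_neg (by omega)]
    ring
  by_cases h2 : c = a - 1 ∧ d = b
  · rw [if_pos (by omega), if_neg h1, if_pos h2, if_neg (by omega), if_neg (by omega)]
    ring
  by_cases h3 : c = a ∧ d = b + 1
  · rw [if_pos (by omega), if_neg h1, if_neg h2, if_pos h3, if_neg (by omega)]
    ring
  by_cases h4 : c = a ∧ d = b - 1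
  · rw [if_pos (by omega), if_neg h1, if_neg h2, if_neg h3, if_pos h4]
    ring
  rw [if_neg (by omega), if_neg h1, if_neg h2, if_neg h3, if_neg h4]
  ring

/-- The total coupling of `p` to the points with positions in `S`. -/
theorem sum_nnJ_le {X : Type*} [Fintype X] [DecidableEq X] {pos : X → ℤ × ℤ}
    (hpos : Function.Injective pos) (P : X → Prop)
    [DecidablePred P] (S : Set (ℤ × ℤ)) (hS : ∀ y, P y → pos y ∈ S) (p : ℤ × ℤ) :
    ∑ y, (if P y then nnJ p (pos y) else 0) ≤ criticalBeta / 2 * nbrs S p := by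
  have h1 : ∀ q, ∑ y, (if P y then (if pos y = q then (1 : ℝ) else 0) else 0) ≤ S.indicator 1 q := by
    intro q
    by_cases hq : ∃ y, P y ∧ pos y = q
    · obtain ⟨y, hy, rfl⟩ := hq
      rw [sum_eq_single y, if_pos hy, if_pos rfl, Set.indicator_of_mem (hS y hy)]
      · rfl
      · intro z _ hz
        rw [if_neg fun h => hz (hpos h), ite_self]
      · simp
    · push Not at hq
      rw [sum_eq_zero]
      · exact Set.indicator_nonneg (fun _ _ => zero_le_one) q
      · intro y _
        split_ifs with h2 h3
        · exact absurd h3 (hq y h2)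
        · rfl
        · rfl
  have h2 : ∑ y, (if P y then nnJ p (pos y) else 0) = criticalBeta / 2 *
      (∑ y, (if P y then (if pos y = (p.1 + 1, p.2) then (1 : ℝ) else 0) else 0) +
      ∑ y, (if P y then (if pos y = (p.1 - 1, p.2) then (1 : ℝ) else 0) else 0) +
      ∑ y, (if P y then (if pos y = (p.1, p.2 + 1) then (1 : ℝ) else 0) else 0) +
      ∑ y, (if P y then (if pos y = (p.1, p.2 - 1) then (1 : ℝ) else 0) else 0)) := by
    rw [← sum_add_distrib, ← sum_add_distrib, ← sum_add_distrib, mul_sum]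
    refine sum_congr rfl fun y _ => ?_
    rw [nnJ_eq_sum]
    split_ifs <;> ring
  rw [h2, nbrs]
  refine mul_le_mul_of_nonneg_left ?_ (by linarith [criticalBeta_pos])
  linarith [h1 (p.1 + 1, p.2), h1 (p.1 - 1, p.2), h1 (p.1, p.2 + 1), h1 (p.1, p.2 - 1)]

theorem nbrs_compl_diamond_le (r : ℕ) (p q : ℤ × ℤ) (hq : dist1 q p ≤ 2 * r) :
    criticalBeta * nbrs {z | dist1 z p ≤ 2 * r}ᶜ q ≤ diamondField r p q := by
  have hβ := criticalBeta_pos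
  have key : ∀ (z : ℤ × ℤ) (c d : Prop) [Decidable c] [Decidable d],
      (2 * r < dist1 z p → c ∨ d) → criticalBeta * ({z | dist1 z p ≤ 2 * r}ᶜ : Set _).indicator 1 z ≤
        ((if c then 2 * criticalBeta else 0) + if d then 2 * criticalBeta else 0) / 2 := by
    intro z c d _ _ hz
    by_cases h : dist1 z p ≤ 2 * r
    · rw [Set.indicator_of_notMem (Set.notMem_compl_iff.2 (show z ∈ {z | dist1 z p ≤ 2 * r} from h)), mul_zero]
      split_ifs <;> linarith
    · have := hz (not_le.1 h)
      rw [Set.indicator_of_mem (show z ∈ ({z | dist1 z p ≤ 2 * r}ᶜ : Set _) from h), Pi.one_apply]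
      split_ifs <;> first | linarith | tauto
  have hq' : (q.1 - p.1).natAbs + (q.2 - p.2).natAbs ≤ 2 * r := hq
  unfold diamondField nbrs
  have k1 := key (q.1 + 1, q.2) (q.2 - p.2 - (q.1 - p.1) = -(2 * r : ℤ))
    (-q.1 - -p.1 - (q.2 - p.2) = -(2 * r : ℤ)) (by unfold dist1; simp only; omega)
  have k2 := key (q.1 - 1, q.2) (q.1 - p.1 - (q.2 - p.2) = -(2 * r : ℤ))
    (q.1 - p.1 - (-q.2 - -p.2) = -(2 * r : ℤ)) (by unfold dist1; simp only; omega)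
  have k3 := key (q.1, q.2 + 1) (q.1 - p.1 - (q.2 - p.2) = -(2 * r : ℤ))
    (-q.1 - -p.1 - (q.2 - p.2) = -(2 * r : ℤ)) (by unfold dist1; simp only; omega)
  have k4 := key (q.1, q.2 - 1) (q.2 - p.2 - (q.1 - p.1) = -(2 * r : ℤ))
    (q.1 - p.1 - (-q.2 - -p.2) = -(2 * r : ℤ)) (by unfold dist1; simp only; omega)
  linarith

end Diamond
end SR

open Finset
namespace SR
section TwoPoint

variable {V : Type*} [Fintype V] [DecidableEq V]

theorem abs_ev_le (J : V → V → ℝ) (h : V → ℝ) {F : (V → Bool) → ℝ} {c : ℝ} (hF : ∀ σ, |F σ| ≤ c) :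
    |ev J h F| ≤ c := by
  rw [abs_le]
  constructor
  · rw [← ev_const J h (-c)]
    exact ev_mono J h fun σ => (abs_le.1 (hF σ)).1
  · conv_rhs => rw [← ev_const J h c]
    exact ev_mono J h fun σ => (abs_le.1 (hF σ)).2

/-- The field felt from outside `P`. -/
theorem abs_bdField_le {pos : V → ℤ × ℤ} (hpos : Function.Injective pos) (P : V → Prop)
    [DecidablePred P] {h : V → ℝ} (S : Set (ℤ × ℤ)) (hS : ∀ y, ¬ P y → pos y ∈ S) (ξ : V → Bool)
    (x : Subtype P) :
    |bdField P (nnV pos) h ξ x| ≤ |h x| + criticalBeta * nbrs S (pos x) := by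
  unfold bdField
  refine (abs_add_le _ _).trans (add_le_add le_rfl ?_)
  refine (abs_sum_le_sum_abs _ _).trans ?_
  have h1 : ∀ y, |if P y then 0 else (nnV pos x y + nnV pos y x) * spinR (ξ y)| =
      2 * if ¬ P y then nnJ (pos x) (pos y) else 0 := fun y => by
    split_ifs with hy
    · simp
    · rw [abs_mul, abs_spinR, mul_one, nnV_comm pos y x, ← two_mul,
        abs_of_nonneg (mul_nonneg zero_le_two (nnV_nonneg _ _ _))]
      rfl
  rw [sum_congr rfl fun y _ => h1 y, ← mul_sum]
  have := sum_nnJ_le hpos (fun y => ¬ P y) S hS (pos x)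
  linarith

/-- Conditional magnetization at the centre of a diamond. -/
theorem abs_cev_diamond_le {pos : V → ℤ × ℤ} (hpos : Function.Injective pos) (x : V) (r : ℕ)
    {h : V → ℝ} {T : Set (ℤ × ℤ)} (hT : ∀ y, pos y ∉ T) (hh : ∀ y, |h y| ≤ criticalBeta * nbrs T (pos y))
    (hTD : ∀ z ∈ T, 2 * r < dist1 z (pos x)) (ξ : V → Bool) :
    |cev (fun y => dist1 (pos y) (pos x) ≤ 2 * r) (nnV pos) h (fun σ => spinR (σ x)) ξ| ≤
      4 * wallCorr (r + 1) := by
  have hx : dist1 (pos x) (pos x) ≤ 2 * r := by simp [dist1]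
  have hβ := criticalBeta_pos
  have := abs_magn_le_wallCorr (V := {y // dist1 (pos y) (pos x) ≤ 2 * r}) (pos := fun y => pos y)
    (fun y z hyz => Subtype.ext (hpos hyz)) ⟨x, hx⟩ r
    (h := bdField (fun y => dist1 (pos y) (pos x) ≤ 2 * r) (nnV pos) h ξ) (fun y => y.2) fun y => by
      refine (abs_bdField_le hpos _ (Set.range pos ∩ {z | dist1 z (pos x) ≤ 2 * r}ᶜ)
        (fun y hy => ⟨⟨y, rfl⟩, hy⟩) ξ y).trans ?_
      refine le_trans ?_ (nbrs_compl_diamond_le r (pos x) (pos y) y.2)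
      refine (add_le_add (hh y) le_rfl).trans ?_
      rw [← mul_add, ← nbrs_union]
      · refine mul_le_mul_of_nonneg_left (nbrs_mono ?_ _) hβ.le
        rintro z (hz | hz)
        · exact not_le.2 (hTD z hz)
        · exact hz.2
      · rw [Set.disjoint_left]
        rintro _ hz ⟨⟨y, rfl⟩, -⟩
        exact hT y hz
  unfold cev
  simp only [glue_of_mem (p := fun y => dist1 (pos y) (pos x) ≤ 2 * r) ξ _ hx]
  exact this

theorem abs_magn_diamond_le {pos : V → ℤ × ℤ} (hpos : Function.Injective pos) (x : V) (r : ℕ)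
    {h : V → ℝ} {T : Set (ℤ × ℤ)} (hT : ∀ y, pos y ∉ T) (hh : ∀ y, |h y| ≤ criticalBeta * nbrs T (pos y))
    (hTD : ∀ z ∈ T, 2 * r < dist1 z (pos x)) :
    |ev (nnV pos) h (fun σ => spinR (σ x))| ≤ 4 * wallCorr (r + 1) := by
  rw [← ev_cev (p := fun y => dist1 (pos y) (pos x) ≤ 2 * r)]
  exact abs_ev_le _ _ fun ξ => abs_cev_diamond_le hpos x r hT hh hTD ξ

theorem cev_mul_left {P : V → Prop} [DecidablePred P] (J : V → V → ℝ) (h : V → ℝ)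
    (F G : (V → Bool) → ℝ) (hF : ∀ ξ σ, F (glue P ξ σ) = F ξ) (ξ : V → Bool) :
    cev P J h (fun σ => F σ * G σ) ξ = F ξ * cev P J h G ξ := by
  simp only [cev, hF, ev_mul]

/-- A conditional expectation does not depend on distant spins. -/
theorem cev_glue_of_far {P Q : V → Prop} [DecidablePred P] [DecidablePred Q] {J : V → V → ℝ}
    {h : V → ℝ} (hPQ : ∀ x y, P x → Q y → J x y = 0 ∧ J y x = 0) {F : (V → Bool) → ℝ}
    (hF : ∀ ξ ξ' : V → Bool, (∀ x, P x → ξ x = ξ' x) → F ξ = F ξ') (ξ : V → Bool)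
    (σ : Subtype Q → Bool) : cev P J h F (glue Q ξ σ) = cev P J h F ξ := by
  have h1 : bdField P J h (glue Q ξ σ) = bdField P J h ξ := by
    funext x
    unfold bdField
    congr 1
    refine sum_congr rfl fun y _ => ?_
    split_ifs with hy
    · rfl
    · by_cases hq : Q y
      · have := hPQ x y x.2 hq
        rw [this.1, this.2]; ring
      · rw [glue_of_notMem ξ σ hq]
  unfold cev
  rw [h1]
  congr 1
  funext τ
  exact hF _ _ fun x hx => by rw [glue_of_mem _ _ hx, glue_of_mem _ _ hx]

theorem nnJ_eq_zero {p q : ℤ × ℤ} (h : dist1 p q ≠ 1) : nnJ p q = 0 := if_neg h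

theorem dist1_triangle (p q z : ℤ × ℤ) : dist1 p z ≤ dist1 p q + dist1 q z := by
  unfold dist1; omega

theorem dist1_comm (p q : ℤ × ℤ) : dist1 p q = dist1 q p := by
  unfold dist1; omega

/-- Decay of the two-point function. -/
theorem abs_corr_diamond_le {pos : V → ℤ × ℤ} (hpos : Function.Injective pos) (x y : V) (r : ℕ)
    (hxy : 4 * r + 2 ≤ dist1 (pos x) (pos y)) :
    |ev (nnV pos) (fun _ => 0) (fun σ => spinR (σ x) * spinR (σ y))| ≤
      16 * wallCorr (r + 1) ^ 2 := by
  set P : V → Prop := fun z => dist1 (pos z) (pos x) ≤ 2 * r with hP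
  set Q : V → Prop := fun z => dist1 (pos z) (pos y) ≤ 2 * r with hQ
  have hh : ∀ z, |(0 : ℝ)| ≤ criticalBeta * nbrs ∅ (pos z) := fun z => by simp [nbrs]
  have hx : P x := by simp [hP, dist1]
  have hy : ¬ P y := by
    simp only [hP]
    rw [dist1_comm]; omega
  have hfar : ∀ z w, P z → Q w → nnV pos z w = 0 ∧ nnV pos w z = 0 := fun z w hz hw => by
    have : nnV pos z w = 0 := nnJ_eq_zero fun h1 => by
      have a1 := dist1_triangle (pos x) (pos z) (pos y)
      have a2 := dist1_triangle (pos z) (pos w) (pos y)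
      have a3 := dist1_comm (pos x) (pos z)
      simp only [hP, hQ] at hz hw
      omega
    exact ⟨this, by rw [nnV_comm, this]⟩
  have e1 : cev P (nnV pos) (fun _ => 0) (fun σ => spinR (σ y) * spinR (σ x)) = fun ξ =>
      cev P (nnV pos) (fun _ => 0) (fun σ => spinR (σ x)) ξ * spinR (ξ y) := funext fun ξ => by
    rw [cev_mul_left _ _ (fun σ => spinR (σ y)) _ (fun ξ σ => by rw [glue_of_notMem ξ σ hy]), mul_comm]
  have e2 : ev (nnV pos) (fun _ => 0) (fun σ => spinR (σ x) * spinR (σ y)) =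
      ev (nnV pos) (fun _ => 0) (cev Q (nnV pos) (fun _ => 0) fun ξ =>
        cev P (nnV pos) (fun _ => 0) (fun σ => spinR (σ x)) ξ * spinR (ξ y)) := by
    rw [ev_cev, ← e1, ev_cev]
    simp only [mul_comm]
  rw [e2]
  refine abs_ev_le _ _ fun ξ => ?_
  rw [cev_mul_left]
  · rw [abs_mul]
    have b1 := abs_cev_diamond_le hpos x r (T := ∅) (fun _ => id) hh (by simp) ξ
    have b2 := abs_cev_diamond_le hpos y r (T := ∅) (fun _ => id) hh (by simp) ξ
    calc _ ≤ (4 * wallCorr (r + 1)) * (4 * wallCorr (r + 1)) :=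
          mul_le_mul b1 b2 (abs_nonneg _) ((abs_nonneg _).trans b1)
      _ = _ := by ring
  · intro ξ σ
    exact cev_glue_of_far hfar (fun ξ ξ' h => by rw [h x hx]) ξ σ

end TwoPoint
end SR

open Finset
namespace SR
section Restriction

variable {V W : Type*} [Fintype V] [DecidableEq V] [Fintype W] [DecidableEq W]

/-- Correlations are dominated by those of a subgraph with plus boundary conditions. -/
theorem abs_ev_le_of_restriction {e : V → W} (he : Function.Injective e) {J : V → V → ℝ}
    {h : V → ℝ} {J' : W → W → ℝ} (hJ0 : ∀ a b, 0 ≤ J' a b) (hh0 : ∀ x, 0 ≤ h x)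
    (hJ : ∀ x y, J' (e x) (e y) ≤ J x y)
    (hh : ∀ x, ∑ w, (if ∃ y, e y = w then 0 else J' (e x) w + J' w (e x)) ≤ h x)
    {F : (V → Bool) → ℝ} (hF : F ∈ spinCone V) :
    |ev J' (fun _ => 0) (fun τ => F (τ ∘ e))| ≤ ev J h F := by
  set P : W → Prop := fun w => ∃ y, e y = w with hP
  rw [← ev_cev (p := P)]
  refine abs_ev_le _ _ fun ξ => ?_
  let E : V → Subtype P := fun x => ⟨e x, x, rfl⟩
  choose inv hinv using fun w : Subtype P => w.2
  have hE : ∀ x, inv (E x) = x := fun x => he (hinv (E x))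
  have hinj : Function.Injective inv := fun a b hab => Subtype.ext (by rw [← hinv, ← hinv, hab])
  have h1 : (fun σ : Subtype P → Bool => F (glue P ξ σ ∘ e)) = fun σ => F (σ ∘ E) := by
    funext σ
    congr 1
    funext x
    exact glue_of_mem ξ σ ⟨x, rfl⟩
  unfold cev
  rw [h1]
  have hFE : (fun σ : Subtype P → Bool => F (σ ∘ E)) ∈ spinCone _ := spinCone_comp E hF
  refine (abs_ev_le_ev (J := fun a b => J (inv a) (inv b)) (h := fun a => h (inv a)) ?_ ?_ hFE).trans ?_
  · intro a b
    rw [abs_of_nonneg (hJ0 _ _), ← hinv a, ← hinv b]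
    simpa only [hinv] using hJ (inv a) (inv b)
  · intro a
    refine le_trans ?_ (hh (inv a))
    rw [bdField, zero_add]
    refine (abs_sum_le_sum_abs _ _).trans (sum_le_sum fun w _ => ?_)
    rw [hinv]
    split_ifs
    · simp
    · rw [abs_mul, abs_spinR, mul_one, abs_of_nonneg (add_nonneg (hJ0 _ _) (hJ0 _ _))]
  · have hJn : ∀ x y, 0 ≤ J x y := fun x y => (hJ0 _ _).trans (hJ x y)
    have := ev_le_ev_of_embedding hinj (J := fun a b => J (inv a) (inv b)) (h := fun a => h (inv a))
      (J' := J) (h' := h) (fun _ _ => hJn _ _) (fun _ => hh0 _) hJn hh0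
      (fun _ _ => le_rfl) (fun _ => le_rfl) hFE
    have h2 : (fun τ : V → Bool => F ((τ ∘ inv) ∘ E)) = F := by
      funext τ; congr 1; funext x; simp [hE]
    rwa [h2] at this

/-- Plus boundary conditions. -/
noncomputable def plusField (pos : V → ℤ × ℤ) (x : V) : ℝ :=
  criticalBeta * nbrs (Set.range pos)ᶜ (pos x)

theorem plusField_nonneg (pos : V → ℤ × ℤ) (x : V) : 0 ≤ plusField pos x :=
  mul_nonneg criticalBeta_pos.le (nbrs_nonneg _ _)

theorem abs_ev_strip_le {pos : V → ℤ × ℤ} {L R : ℕ} {a : V → StripX L R} (ha : Function.Injective a)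
    (hw : ∀ z, ¬ IsWall (a z)) (t : ℤ × ℤ) (ht : ∀ z, stripPos (a z).1 (a z).2 = pos z + t)
    {F : (V → Bool) → ℝ} (hF : F ∈ spinCone V) :
    |ev (stripJ L R) (fun _ => 0) (fun τ => F fun z => τ (collapse (a z)))| ≤
      ev (nnV pos) (plusField pos) F := by
  have hinj : Function.Injective fun z => (collapse (a z) : StripV L R) := fun z z' h =>
    ha (collapse_injective_of_not_wall (hw z') h)
  have hcol' : ∀ b z, (collapse b : StripV L R) = collapse (a z) ↔ b = a z := fun b z =>
    ⟨collapse_injective_of_not_wall (hw z), fun h => by rw [h]⟩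
  set q : StripX L R → ℤ × ℤ := fun b => stripPos b.1 b.2 - t with hq
  have hqinj : Function.Injective q := fun b c hbc => by
    have := stripPos_injective (sub_left_injective hbc)
    exact Prod.ext (Fin.ext this.1) (Fin.ext this.2)
  have hqa : ∀ z, q (a z) = pos z := fun z => by simp only [hq]; rw [ht]; abel
  have hqJ : ∀ b c, stripXJ L R b c = nnJ (q b) (q c) := fun b c =>
    nnJ_congr (by simp only [hq, Prod.fst_sub]; ring) (by simp only [hq, Prod.snd_sub]; ring)
  refine abs_ev_le_of_restriction hinj (stripJ_nonneg _ _) (plusField_nonneg pos) ?_ ?_ hF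
  · intro z w
    simp only [stripJ, pushJ, hcol']
    rw [sum_eq_single (a z) (fun b _ hb => sum_eq_zero fun c _ => if_neg fun h => hb h.1)
      (fun h => absurd (mem_univ _) h), sum_eq_single (a w) (fun b _ hb => if_neg fun h => hb h.2)
      (fun h => absurd (mem_univ _) h), if_pos ⟨rfl, rfl⟩, hqJ, hqa, hqa]
    rfl
  · intro z
    have e1 : ∀ w, stripJ L R (collapse (a z)) w =
        ∑ c, if collapse c = w then nnJ (pos z) (q c) else 0 := fun w => by
      simp only [stripJ, pushJ, hcol']
      rw [sum_eq_single (a z) (fun b _ hb => sum_eq_zero fun c _ => if_neg fun h => hb h.1)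
        (fun h => absurd (mem_univ _) h)]
      simp only [true_and, hqJ, hqa]
    have e2 : ∀ w, (if ∃ y, collapse (a y) = w then (0 : ℝ) else
        stripJ L R (collapse (a z)) w + stripJ L R w (collapse (a z))) =
        2 * ∑ c, if collapse c = w then
          (if ∃ y, collapse (a y) = collapse c then 0 else nnJ (pos z) (q c)) else 0 := fun w => by
      rw [stripJ_comm _ _ w, ← two_mul, e1]
      split_ifs with hc
      · rw [sum_eq_zero fun c _ => ?_, mul_zero]
        split_ifs with h3 h4
        · rfl
        · exact absurd (h3 ▸ hc) h4
        · rfl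
      · congr 1
        refine sum_congr rfl fun c _ => ?_
        split_ifs with h3 h4
        · exact absurd (h3 ▸ h4) hc
        · rfl
        · rfl
    rw [sum_congr rfl fun w _ => e2 w, ← mul_sum, sum_comm]
    simp only [sum_ite_eq, mem_univ, if_true]
    have := sum_nnJ_le hqinj (fun c => ¬ ∃ y, collapse (a y) = collapse c) (Set.range pos)ᶜ (by
      rintro c hc ⟨y, hy⟩
      exact hc ⟨y, by rw [hqinj ((hqa y).trans hy)]⟩) (pos z)
    simp only [ite_not] at this
    unfold plusField
    linarith

theorem bulkCorr_le {pos : V → ℤ × ℤ} (hpos : Function.Injective pos) (x y : V) (r : ℕ)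
    (h1 : (pos y).1 = (pos x).1 + r) (h2 : (pos y).2 = (pos x).2 - r) :
    bulkCorr r ≤ ev (nnV pos) (plusField pos) (fun σ => spinR (σ x) * spinR (σ y)) := by
  obtain ⟨N, hN⟩ := exists_place pos hpos (pos x)
  obtain ⟨K, hK⟩ : ∃ K : ℕ, ∀ z, ((pos z).1 - (pos x).1).natAbs + ((pos z).2 - (pos x).2).natAbs ≤ K :=
    ⟨univ.sup fun z => ((pos z).1 - (pos x).1).natAbs + ((pos z).2 - (pos x).2).natAbs,
      fun z => le_sup (f := fun z =>
        ((pos z).1 - (pos x).1).natAbs + ((pos z).2 - (pos x).2).natAbs) (mem_univ z)⟩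
  refine le_of_tendsto (tendsto_det_contraction_bulk r) ?_
  filter_upwards [Filter.eventually_ge_atTop (N + r + K + 2)] with J hJ
  have hr : J + r < 2 * J + 2 := by omega
  refine le_of_tendsto (strip_limit (2 * J) hr) ?_
  filter_upwards [Filter.eventually_ge_atTop N] with m hm
  obtain ⟨a, ha, hw, hrow, hcol, -, hst⟩ := hN J m (2 * J) (by omega) hm fun z => by
    have := hK z; omega
  have hax : a x = (⟨2 * m, by omega⟩, ⟨J, by omega⟩) := by
    refine Prod.ext (Fin.ext ?_) (Fin.ext ?_)
    · rw [hrow]; simp only [rowOf]; omega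
    · rw [hcol]; simp only [colOf]; omega
  have hay : a y = (⟨2 * m, by omega⟩, ⟨J + r, hr⟩) := by
    refine Prod.ext (Fin.ext ?_) (Fin.ext ?_)
    · rw [hrow]; simp only [rowOf]; omega
    · rw [hcol]; simp only [colOf]; omega
  unfold midSite
  rw [← hax, ← hay]
  have hmem : (fun σ : V → Bool => spinR (σ x) * spinR (σ y)) ∈ spinCone V :=
    posCone_mul (spin_mem x) (spin_mem y)
  have key := abs_ev_strip_le ha hw ((J + m : ℤ) - (pos x).1, (m - J : ℤ) - (pos x).2)
    (fun z => Prod.ext ((hst z).1.trans (by rw [Prod.fst_add]; ring))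
      ((hst z).2.trans (by rw [Prod.snd_add]; ring))) hmem
  exact (le_abs_self _).trans key

end Restriction
end SR

open Finset
namespace SR
section Decay

/-- The rate of decay of the boundary magnetization. -/
noncomputable def rate (k : ℕ) : ℝ := ((k : ℝ) + 1) ^ (-(1 / 8 : ℝ))

theorem rate_pos (k : ℕ) : 0 < rate k := Real.rpow_pos_of_pos (by positivity) _

theorem rate_pow (k : ℕ) : rate k ^ 8 * (k + 1) = 1 := by
  have h : (0 : ℝ) < k + 1 := by positivity
  rw [rate, ← Real.rpow_natCast, ← Real.rpow_mul h.le, Nat.cast_ofNat,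
    show (-(1 / 8 : ℝ)) * 8 = -1 by norm_num, Real.rpow_neg_one, inv_mul_cancel₀ h.ne']

theorem rate_anti {k l : ℕ} (h : k ≤ l) : rate l ≤ rate k := by
  refine Real.rpow_le_rpow_of_nonpos (by positivity) ?_ (by norm_num)
  have : (k : ℝ) ≤ l := by exact_mod_cast h
  linarith

theorem rate_le_one (k : ℕ) : rate k ≤ 1 := by
  have := rate_anti (Nat.zero_le k)
  simpa [rate] using this

/-- Comparison with powers of the rate. -/
theorem le_mul_rate {u c : ℝ} (hc : 0 ≤ c) (k : ℕ) (h : u ^ 8 * (k + 1) ≤ c ^ 8) : u ≤ c * rate k := by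
  have hk : (0 : ℝ) < k + 1 := by positivity
  refine le_of_pow_le_pow_left₀ (n := 8) (by norm_num) (mul_nonneg hc (rate_pos k).le) ?_
  rw [mul_pow]
  refine le_of_mul_le_mul_right ?_ hk
  rw [mul_assoc, rate_pow, mul_one]
  exact h

theorem mul_rate_le {u c : ℝ} (hu : 0 ≤ u) (k : ℕ) (h : c ^ 8 ≤ u ^ 8 * (k + 1)) :
    c * rate k ≤ u := by
  have hk : (0 : ℝ) < k + 1 := by positivity
  refine le_of_pow_le_pow_left₀ (n := 8) (by norm_num) hu ?_
  rw [mul_pow]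
  refine le_of_mul_le_mul_right ?_ hk
  rw [mul_assoc, rate_pow, mul_one]
  exact h

theorem wallCorr_le_rate (k r : ℕ) (h : k + 1 ≤ 64 * (r + 2)) : wallCorr r ≤ 2 * rate k := by
  refine le_mul_rate zero_le_two k ?_
  obtain ⟨h0, h1⟩ := wallCorr_pow_le r
  have h2 : ((k : ℝ) + 1) ≤ 64 * (r + 2) := by exact_mod_cast h
  calc wallCorr r ^ 8 * (k + 1) ≤ wallCorr r ^ 8 * (64 * (r + 2)) :=
        mul_le_mul_of_nonneg_left h2 (by positivity)
    _ ≤ 2 ^ 8 := by linarith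

theorem sum_rate_le (N : ℕ) : ∑ k ∈ range N, rate k ≤ 2 * N * rate (N - 1) := by
  induction N with
  | zero => simp
  | succ N ih =>
    rw [sum_range_succ]
    rcases Nat.eq_zero_or_pos N with rfl | hN
    · have := rate_pos 0
      simp only [range_zero, sum_empty, zero_add, Nat.cast_one, Nat.sub_self]
      linarith
    have hN' : (1 : ℝ) ≤ N := by exact_mod_cast hN
    have h1 : 2 * N * rate (N - 1) ≤ (2 * N + 1) * rate N := by
      have e : ((N - 1 : ℕ) : ℝ) + 1 = N := by
        rw [Nat.cast_sub hN]; simp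
      have hb : (1 : ℝ) + 8 * (1 / (2 * N)) ≤ (1 + 1 / (2 * N)) ^ 8 :=
        one_add_mul_le_pow (le_trans (by norm_num) (by positivity : (0 : ℝ) ≤ 1 / (2 * N))) 8
      have h2 : rate (N - 1) ≤ (1 + 1 / (2 * N)) * rate N := by
        refine le_of_pow_le_pow_left₀ (n := 8) (by norm_num)
          (mul_nonneg (by positivity) (rate_pos N).le) ?_
        have e1 := rate_pow (N - 1)
        have e2 := rate_pow N
        rw [e] at e1
        rw [mul_pow]
        have e3 : rate (N - 1) ^ 8 = 1 / N := by field_simp; linarith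
        have e4 : rate N ^ 8 = 1 / (N + 1) := by field_simp; linarith
        rw [e3, e4]
        have e5 : 1 / (N : ℝ) = (1 + 1 / N) * (1 / (N + 1)) := by field_simp
        rw [e5]
        refine mul_le_mul_of_nonneg_right ?_ (by positivity)
        refine le_trans ?_ hb
        have : (0 : ℝ) ≤ 1 / N := by positivity
        have e6 : 8 * (1 / (2 * (N : ℝ))) = 4 * (1 / N) := by field_simp; norm_num
        rw [e6]; linarith
      calc 2 * N * rate (N - 1) ≤ 2 * N * ((1 + 1 / (2 * N)) * rate N) := by gcongr
        _ = _ := by field_simp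
    have := rate_pos N
    rw [Nat.add_sub_cancel]
    push_cast
    linarith

theorem sum_rate_dist_le (n : ℕ) (a : Fin (n + 1)) :
    ∑ b : Fin (n + 1), rate ((a : ℤ) - b).natAbs ≤ 4 * (n + 1) * rate n := by
  have h1 : ∑ b : Fin (n + 1), rate ((a : ℤ) - b).natAbs ≤ 2 * ∑ k ∈ range (n + 1), rate k := by
    rw [Fin.sum_univ_eq_sum_range (fun b => rate ((a : ℤ) - (b : ℕ)).natAbs) (n + 1)]
    have ha := a.2
    rw [← sum_filter_add_sum_filter_not (range (n + 1)) fun b => b ≤ (a : ℕ), two_mul]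
    refine add_le_add ?_ ?_
    · rw [← sum_image (s := (range (n + 1)).filter fun b => b ≤ (a : ℕ)) (f := rate)
        (g := fun b => ((a : ℤ) - (b : ℕ)).natAbs) (by
          intro b hb c hc hbc
          simp only [coe_filter, Set.mem_ofPred_eq, mem_range] at hb hc
          simp only at hbc
          omega)]
      refine sum_le_sum_of_subset_of_nonneg ?_ fun _ _ _ => (rate_pos _).le
      intro c hc
      simp only [mem_image, mem_filter, mem_range] at hc ⊢
      omega
    · rw [← sum_image (s := (range (n + 1)).filter fun b => ¬ b ≤ (a : ℕ)) (f := rate)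
        (g := fun b => ((a : ℤ) - (b : ℕ)).natAbs) (by
          intro b hb c hc hbc
          simp only [coe_filter, Set.mem_ofPred_eq, mem_range] at hb hc
          simp only at hbc
          omega)]
      refine sum_le_sum_of_subset_of_nonneg ?_ fun _ _ _ => (rate_pos _).le
      intro c hc
      simp only [mem_image, mem_filter, mem_range] at hc ⊢
      omega
  have := sum_rate_le (n + 1)
  push_cast at this
  linarith

variable {V : Type*} [Fintype V] [DecidableEq V]

theorem abs_corr_le_one (J : V → V → ℝ) (h : V → ℝ) (x y : V) :
    |ev J h (fun σ => spinR (σ x) * spinR (σ y))| ≤ 1 :=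
  abs_ev_le _ _ fun σ => by rw [abs_mul, abs_spinR, abs_spinR, one_mul]

/-- Decay of the critical two-point function with free boundary conditions. -/
theorem corr_le_rate {pos : V → ℤ × ℤ} (hpos : Function.Injective pos) (x y : V) :
    ev (nnV pos) (fun _ => 0) (fun σ => spinR (σ x) * spinR (σ y)) ≤
      64 * (rate ((pos x).1 - (pos y).1).natAbs * rate ((pos x).2 - (pos y).2).natAbs) := by
  set a := ((pos x).1 - (pos y).1).natAbs with ha
  set b := ((pos x).2 - (pos y).2).natAbs with hb
  have hd : dist1 (pos x) (pos y) = a + b := rfl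
  rcases Nat.lt_or_ge (a + b) 2 with h | h
  · refine (le_abs_self _).trans ((abs_corr_le_one _ _ x y).trans ?_)
    have h1 : (1 / 8 : ℝ) ≤ rate a := by
      refine (mul_rate_le (u := rate a) (c := 1 / 8) (rate_pos a).le 0 ?_).trans' (by simp [rate])
      have := rate_pow a
      have ha' : (a : ℝ) ≤ 1 := by exact_mod_cast (show a ≤ 1 by omega)
      have := pow_pos (rate_pos a) 8
      push_cast; nlinarith
    have h2 : (1 / 8 : ℝ) ≤ rate b := by
      refine (mul_rate_le (u := rate b) (c := 1 / 8) (rate_pos b).le 0 ?_).trans' (by simp [rate])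
      have := rate_pow b
      have hb' : (b : ℝ) ≤ 1 := by exact_mod_cast (show b ≤ 1 by omega)
      have := pow_pos (rate_pos b) 8
      push_cast; nlinarith
    nlinarith
  · set r := (a + b - 2) / 4 with hr
    have h1 := (le_abs_self _).trans (abs_corr_diamond_le hpos x y r (by rw [hd]; omega))
    have h2 := wallCorr_le_rate a (r + 1) (by omega)
    have h3 := wallCorr_le_rate b (r + 1) (by omega)
    have h4 := (wallCorr_pow_le (r + 1)).1
    calc _ ≤ 16 * wallCorr (r + 1) ^ 2 := h1
      _ = 16 * (wallCorr (r + 1) * wallCorr (r + 1)) := by ring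
      _ ≤ 16 * ((2 * rate a) * (2 * rate b)) := by
        have := rate_pos a
        gcongr
      _ = _ := by ring

theorem magn_le_rate {pos : V → ℤ × ℤ} (hpos : Function.Injective pos) (x : V) (k : ℕ)
    {T : Set (ℤ × ℤ)} {h : V → ℝ} (hT : ∀ y, pos y ∉ T)
    (hh : ∀ y, |h y| ≤ criticalBeta * nbrs T (pos y)) (hTD : ∀ z ∈ T, k < dist1 z (pos x)) :
    |ev (nnV pos) h (fun σ => spinR (σ x))| ≤ 8 * rate k := by
  have h1 := abs_magn_diamond_le hpos x (k / 2) hT hh fun z hz => by have := hTD z hz; omega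
  have h2 := wallCorr_le_rate k (k / 2 + 1) (by omega)
  linarith

end Decay
end SR

open Finset
namespace SR
section Box

theorem ev_reflect_sum {V : Type*} [Fintype V] [DecidableEq V] {J : V → V → ℝ} {k : V → Fin 4}
    {θ : V → V} (hθ : Reflection J k θ) {x y : V} (hx : k x = 0) (hy : k y = 0) :
    ev J (fun _ => 0) (fun σ => spinR (σ (θ x)) * spinR (σ y)) +
      ev J (fun _ => 0) (fun σ => spinR (σ (θ x)) * spinR (σ (θ y))) ≤
    ev J (fun _ => 0) (fun σ => spinR (σ x) * spinR (σ y)) +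
      ev J (fun _ => 0) (fun σ => spinR (σ x) * spinR (σ (θ y))) := by
  rw [← sub_nonneg, ← ev_add, ← ev_add, ← ev_sub]
  refine fold_nonneg hθ ?_
  convert posCone_mul (foldGen_mem (k := k) x 1) (foldGen_mem y 0) using 1
  ext ω
  rw [spin_unfold_low hθ hx, spin_unfold_low hθ hy, spin_unfold_high (by rw [hx]; decide),
    spin_unfold_high (by rw [hy]; decide)]
  simp only [foldA, foldB, foldGen, hx, hy, if_true]
  ring

theorem corr_equiv {V : Type*} [Fintype V] [DecidableEq V] {J : V → V → ℝ} (hJ0 : ∀ x y, 0 ≤ J x y)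
    (φ : V ≃ V) (hφ : ∀ x y, J (φ x) (φ y) = J x y) (x y : V) :
    ev J (fun _ => 0) (fun σ => spinR (σ (φ x)) * spinR (σ (φ y))) =
      ev J (fun _ => 0) (fun σ => spinR (σ x) * spinR (σ y)) := by
  apply le_antisymm
  · have := ev_le_ev_of_embedding φ.symm.injective (J := J) (h := fun _ => 0) (J' := J)
      (h' := fun _ => 0) hJ0 (fun _ => le_rfl) hJ0 (fun _ => le_rfl)
      (fun a b => by rw [← hφ (φ.symm a), φ.apply_symm_apply, φ.apply_symm_apply])
      (fun _ => le_rfl) (posCone_mul (spin_mem (φ x)) (spin_mem (φ y)))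
    simpa using this
  · exact ev_le_ev_of_embedding φ.injective (J := J) (h := fun _ => 0) (J' := J)
      (h' := fun _ => 0) hJ0 (fun _ => le_rfl) hJ0 (fun _ => le_rfl) (fun a b => (hφ a b).ge)
      (fun _ => le_rfl) (posCone_mul (spin_mem x) (spin_mem y))

/-- Position of a site of the box. -/
def boxPos (n : ℕ) (x : BoxV n) : ℤ × ℤ := ((x.1 : ℕ), (x.2 : ℕ))

theorem boxPos_injective (n : ℕ) : Function.Injective (boxPos n) := fun x y h => by
  simp only [boxPos, Prod.mk.injEq, Nat.cast_inj] at h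
  exact Prod.ext (Fin.ext h.1) (Fin.ext h.2)

/-- The two-point function of the box. -/
noncomputable def corr (n : ℕ) (x y : BoxV n) : ℝ :=
  ev (nnV (boxPos n)) (fun _ => 0) (fun σ => spinR (σ x) * spinR (σ y))

theorem corr_comm (n : ℕ) (x y : BoxV n) : corr n x y = corr n y x := by
  unfold corr; simp only [mul_comm]

theorem corr_nonneg (n : ℕ) (x y : BoxV n) : 0 ≤ corr n x y :=
  ev_nonneg_of_mem (nnV_nonneg _) (fun _ => le_rfl) (posCone_mul (spin_mem x) (spin_mem y))

/-- Mirror labels of the reflection `i ↦ E - i` of the first coordinate. -/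
def mirrorLabel {n : ℕ} (E : ℕ) (x : BoxV n) : Fin 4 :=
  if 2 * (x.1 : ℕ) < E then 1 else if 2 * (x.1 : ℕ) = E then 2 else if (x.1 : ℕ) ≤ E then 0 else 3

/-- The reflection `i ↦ E - i` of the first coordinate. -/
def mirror {n E : ℕ} (hE : E ≤ n) (x : BoxV n) : BoxV n := (⟨E - x.1, by omega⟩, x.2)

theorem mirrorLabel_eq_zero {n E : ℕ} {x : BoxV n} :
    mirrorLabel E x = 0 ↔ E < 2 * (x.1 : ℕ) ∧ (x.1 : ℕ) ≤ E := by
  unfold mirrorLabel; split_ifs <;> simp <;> omega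

theorem mirrorLabel_eq_one {n E : ℕ} {x : BoxV n} : mirrorLabel E x = 1 ↔ 2 * (x.1 : ℕ) < E := by
  unfold mirrorLabel; split_ifs <;> simp <;> omega

theorem mirrorLabel_eq_two {n E : ℕ} {x : BoxV n} : mirrorLabel E x = 2 ↔ 2 * (x.1 : ℕ) = E := by
  unfold mirrorLabel; split_ifs <;> simp <;> omega

theorem mirrorLabel_eq_three {n E : ℕ} {x : BoxV n} :
    mirrorLabel E x = 3 ↔ E < 2 * (x.1 : ℕ) ∧ E < x.1 := by
  unfold mirrorLabel; split_ifs <;> simp <;> omega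

theorem nnJ_congr_dist {p q p' q' : ℤ × ℤ} (h : dist1 p q = dist1 p' q') : nnJ p q = nnJ p' q' := by
  unfold dist1 at h
  rw [nnJ, nnJ, h]

theorem mirror_reflection {n E : ℕ} (hE : E ≤ n) :
    Reflection (nnV (boxPos n)) (mirrorLabel E) (mirror hE) where
  nonneg := nnV_nonneg _
  k_high x hx := by
    rw [mirrorLabel_eq_zero] at hx; rw [mirrorLabel_eq_one]; simp only [mirror]; omega
  k_low x hx := by
    rw [mirrorLabel_eq_one] at hx; rw [mirrorLabel_eq_zero]; simp only [mirror]; omega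
  invol x hx := by
    rw [mirrorLabel_eq_zero, mirrorLabel_eq_one] at hx
    exact Prod.ext (Fin.ext (by simp only [mirror]; omega)) rfl
  high_high x y hx hy := by
    rw [mirrorLabel_eq_zero] at hx hy
    refine nnJ_congr_dist ?_
    simp only [dist1, boxPos, mirror]; omega
  cross x y hx hy hxy := by
    rw [mirrorLabel_eq_zero] at hx hy
    have : ¬ ((x.1 : ℕ) = y.1 ∧ (x.2 : ℕ) = y.2) := fun h =>
      hxy (Prod.ext (Fin.ext h.1) (Fin.ext h.2))
    constructor <;> refine nnJ_eq_zero ?_ <;> simp only [dist1, boxPos, mirror] <;> omega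
  mirror x y hx hy := by
    rw [mirrorLabel_eq_zero] at hy
    rw [mirrorLabel_eq_two] at hx
    constructor <;> refine nnJ_congr_dist ?_ <;> simp only [dist1, boxPos, mirror] <;> omega
  lone x y hx hy := by
    rw [mirrorLabel_eq_zero] at hy
    rw [mirrorLabel_eq_three] at hx
    constructor <;> refine nnJ_eq_zero ?_ <;> simp only [dist1, boxPos, mirror] <;> omega

theorem corr_rev (n : ℕ) (x y : BoxV n) :
    corr n (Fin.rev x.1, x.2) (Fin.rev y.1, y.2) = corr n x y :=
  corr_equiv (nnV_nonneg _) (Equiv.prodCongr Fin.revPerm (Equiv.refl _)) (fun x y => by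
    refine nnJ_congr_dist ?_
    simp only [dist1, boxPos, Equiv.prodCongr_apply, Prod.map, Fin.revPerm_apply, Fin.val_rev,
      Equiv.refl_apply]
    omega) x y

theorem corr_swap (n : ℕ) (x y : BoxV n) : corr n x.swap y.swap = corr n x y :=
  corr_equiv (nnV_nonneg _) (Equiv.prodComm _ _) (fun x y => by
    refine nnJ_congr_dist ?_
    simp only [dist1, boxPos, Equiv.prodComm_apply, Prod.fst_swap, Prod.snd_swap]
    omega) x y

end Box
end SR

open Finset
namespace SR
section Moves

/-- The site with given coordinates. -/
def site (n i k : ℕ) : BoxV n := (Fin.ofNat (n + 1) i, Fin.ofNat (n + 1) k)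

theorem site_fst {n i : ℕ} (h : i ≤ n) (k : ℕ) : ((site n i k).1 : ℕ) = i :=
  Nat.mod_eq_of_lt (Nat.lt_succ_of_le h)

theorem sum_box {n : ℕ} (f : BoxV n → ℝ) :
    ∑ x, f x = ∑ i ∈ range (n + 1), ∑ k ∈ range (n + 1), f (site n i k) := by
  rw [Fintype.sum_prod_type, ← Fin.sum_univ_eq_sum_range
    (fun i => ∑ k ∈ range (n + 1), f (site n i k)) (n + 1)]
  refine sum_congr rfl fun i _ => ?_
  rw [← Fin.sum_univ_eq_sum_range (fun k => f (site n i k)) (n + 1)]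
  refine sum_congr rfl fun k _ => ?_
  simp [site]

/-- Monotonicity properties of a kernel on `{0, …, n}` under moves towards the centre. -/
structure Moves (n : ℕ) (g : ℕ → ℕ → ℝ) : Prop where
  nonneg : ∀ i j, 0 ≤ g i j
  right_snd : ∀ i j, i ≤ j → j + 1 ≤ n → n ≤ 2 * j + 1 → g i (j + 1) ≤ g i j
  right_fst : ∀ i j, i ≤ j → j + 1 ≤ n → n ≤ 2 * j + 1 → g (j + 1) i ≤ g j i
  left_fst : ∀ i j, i < j → j ≤ n → 2 * i + 1 ≤ n → g i j ≤ g (i + 1) j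
  left_snd : ∀ i j, i < j → j ≤ n → 2 * i + 1 ≤ n → g j i ≤ g j (i + 1)
  diag_right : ∀ i j, i + 1 ≤ n → j + 1 ≤ n → n ≤ 2 * i → n ≤ 2 * j → g (i + 1) (j + 1) ≤ g i j
  diag_left : ∀ i j, 2 * (i + 1) ≤ n → 2 * (j + 1) ≤ n → g i j ≤ g (i + 1) (j + 1)
  sum_right : ∀ i, i + 1 ≤ n → n ≤ 2 * i + 1 →
    ∑ j ∈ range (n + 1), g (i + 1) j ≤ ∑ j ∈ range (n + 1), g i j
  sum_left : ∀ i, 2 * i + 1 ≤ n → ∑ j ∈ range (n + 1), g i j ≤ ∑ j ∈ range (n + 1), g (i + 1) j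

theorem mirror_site {n E i : ℕ} (hE : E ≤ n) (hi : i ≤ n) (k : ℕ) :
    mirror hE (site n i k) = site n (E - i) k :=
  Prod.ext (Fin.ext (by simp only [mirror, site_fst hi]; rw [site_fst (by omega)])) rfl

theorem corr_site_rev {n i j : ℕ} (hi : i ≤ n) (hj : j ≤ n) (k l : ℕ) :
    corr n (site n (n - i) k) (site n (n - j) l) = corr n (site n i k) (site n j l) := by
  have h : ∀ {i} (_ : i ≤ n) k, site n (n - i) k = (Fin.rev (site n i k).1, (site n i k).2) :=
    fun hi k => Prod.ext (Fin.ext (by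
      rw [Fin.val_rev, site_fst (by omega), site_fst hi]; omega)) rfl
  rw [h hi, h hj, corr_rev]

theorem corr_left {n i j : ℕ} (h : i < j) (hj : j ≤ n) (h2 : 2 * i + 1 ≤ n) (k l : ℕ) :
    corr n (site n j l) (site n i k) ≤ corr n (site n j l) (site n (i + 1) k) := by
  have e : site n i k = mirror h2 (site n (i + 1) k) := by
    rw [mirror_site _ (by omega)]; congr 1; omega
  rw [e]
  refine ev_reflect_one (mirror_reflection h2) ?_ ?_
  · rw [Ne, mirrorLabel_eq_one, site_fst hj]; omega
  · rw [mirrorLabel_eq_zero, site_fst (by omega)]; omega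

theorem corr_right {n i j : ℕ} (h : i ≤ j) (hj : j + 1 ≤ n) (h2 : n ≤ 2 * j + 1) (k l : ℕ) :
    corr n (site n i k) (site n (j + 1) l) ≤ corr n (site n i k) (site n j l) := by
  rw [← corr_site_rev (by omega) hj, ← corr_site_rev (i := i) (j := j) (by omega) (by omega)]
  have := corr_left (n := n) (i := n - (j + 1)) (j := n - i) (by omega) (by omega) (by omega) l k
  rwa [show n - (j + 1) + 1 = n - j by omega] at this

theorem corr_diag {n i j : ℕ} (hi : i + 1 ≤ n) (hj : j + 1 ≤ n) (h1 : n ≤ 2 * i) (h2 : n ≤ 2 * j)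
    (k l : ℕ) :
    corr n (site n (i + 1) k) (site n (j + 1) l) ≤ corr n (site n i k) (site n j l) := by
  rw [← corr_site_rev hi hj]
  have hE : n - 1 ≤ n := by omega
  have e1 : site n (n - (i + 1)) k = mirror hE (site n i k) := by
    rw [mirror_site _ (by omega)]; congr 1; omega
  have e2 : site n (n - (j + 1)) l = mirror hE (site n j l) := by
    rw [mirror_site _ (by omega)]; congr 1; omega
  rw [e1, e2]
  refine ev_reflect_both (mirror_reflection hE) ?_ ?_
  · rw [mirrorLabel_eq_zero, site_fst (by omega)]; omega
  · rw [mirrorLabel_eq_zero, site_fst (by omega)]; omega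

theorem sum_corr_left {n i : ℕ} (h : 2 * i + 1 ≤ n) (k l : ℕ) :
    ∑ j ∈ range (n + 1), corr n (site n i k) (site n j l) ≤
      ∑ j ∈ range (n + 1), corr n (site n (i + 1) k) (site n j l) := by
  obtain ⟨m, hm⟩ : ∃ m, n + 1 = (2 * i + 1 + 1) + m := ⟨n - (2 * i + 1), by omega⟩
  have e : site n i k = mirror h (site n (i + 1) k) := by
    rw [mirror_site _ (by omega)]; congr 1; omega
  have hk : mirrorLabel (2 * i + 1) (site n (i + 1) k) = 0 := by
    rw [mirrorLabel_eq_zero, site_fst (by omega)]; omega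
  have split : ∀ f : ℕ → ℝ, ∑ j ∈ range (n + 1), f j =
      ∑ j ∈ range (2 * i + 1 + 1), f j + ∑ j ∈ range m, f (2 * i + 1 + 1 + j) := fun f => by
    rw [hm, sum_range_add]
  rw [split, split]
  refine add_le_add ?_ (sum_le_sum fun j hj => ?_)
  · have key : ∀ j, i < j → j < 2 * i + 1 + 1 →
        corr n (site n i k) (site n j l) + corr n (site n i k) (site n (2 * i + 1 - j) l) ≤
        corr n (site n (i + 1) k) (site n j l) +
          corr n (site n (i + 1) k) (site n (2 * i + 1 - j) l) := fun j hj hj' => by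
      rw [← mirror_site h (by omega), e]
      refine ev_reflect_sum (mirror_reflection h) hk ?_
      rw [mirrorLabel_eq_zero, site_fst (by omega)]; omega
    have h2 : ∀ f : ℕ → ℝ, 2 * ∑ j ∈ range (2 * i + 1 + 1), f j =
        ∑ j ∈ range (2 * i + 1 + 1), (f j + f (2 * i + 1 - j)) := fun f => by
      rw [sum_add_distrib, two_mul, ← sum_range_reflect f]
      simp
    refine le_of_mul_le_mul_left ?_ (zero_lt_two : (0 : ℝ) < 2)
    rw [h2, h2]
    refine sum_le_sum fun j hj => ?_
    rw [mem_range] at hj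
    rcases Nat.lt_or_ge i j with h3 | h3
    · exact key j h3 hj
    · have := key (2 * i + 1 - j) (by omega) (by omega)
      rw [show 2 * i + 1 - (2 * i + 1 - j) = j by omega] at this
      linarith
  · rw [mem_range] at hj
    rw [corr_comm n (site n i k), corr_comm n (site n (i + 1) k)]
    exact corr_left (by omega) (by omega) h _ _

theorem sum_corr_right {n i : ℕ} (hi : i + 1 ≤ n) (h : n ≤ 2 * i + 1) (k l : ℕ) :
    ∑ j ∈ range (n + 1), corr n (site n (i + 1) k) (site n j l) ≤
      ∑ j ∈ range (n + 1), corr n (site n i k) (site n j l) := by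
  have h1 : ∀ i ≤ n, ∑ j ∈ range (n + 1), corr n (site n i k) (site n j l) =
      ∑ j ∈ range (n + 1), corr n (site n (n - i) k) (site n j l) := fun i hi => by
    rw [← sum_range_reflect]
    refine sum_congr rfl fun j hj => ?_
    rw [mem_range] at hj
    rw [← corr_site_rev hi (by omega)]
    congr 2; omega
  rw [h1 _ hi, h1 i (by omega)]
  have := sum_corr_left (n := n) (i := n - (i + 1)) (by omega) k l
  rwa [show n - (i + 1) + 1 = n - i by omega] at this

theorem corr_moves (n k l : ℕ) : Moves n fun i j => corr n (site n i k) (site n j l) where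
  nonneg _ _ := corr_nonneg _ _ _
  right_snd _ _ h h1 h2 := corr_right h h1 h2 k l
  right_fst _ _ h h1 h2 := by
    rw [corr_comm, corr_comm n (site n _ k)]
    exact corr_right h h1 h2 l k
  left_fst _ _ h h1 h2 := by
    rw [corr_comm, corr_comm n (site n (_ + 1) k)]
    exact corr_left h h1 h2 k l
  left_snd _ _ h h1 h2 := corr_left h h1 h2 l k
  diag_right _ _ h1 h2 h3 h4 := corr_diag h1 h2 h3 h4 k l
  diag_left i j h1 h2 := by
    rw [← corr_site_rev (i := i) (by omega) (by omega),
      ← corr_site_rev (i := i + 1) (by omega) (by omega)]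
    have := corr_diag (n := n) (i := n - (i + 1)) (j := n - (j + 1)) (by omega) (by omega)
      (by omega) (by omega) k l
    rwa [show n - (i + 1) + 1 = n - i by omega, show n - (j + 1) + 1 = n - j by omega] at this
  sum_right _ h1 h2 := sum_corr_right h1 h2 k l
  sum_left _ h := sum_corr_left h k l

theorem corr_site_swap (n i k j l : ℕ) :
    corr n (site n k i) (site n l j) = corr n (site n i k) (site n j l) :=
  corr_swap n (site n i k) (site n j l)

theorem Moves.sum {ι : Type*} {n : ℕ} (s : Finset ι) {g : ι → ℕ → ℕ → ℝ}
    (hg : ∀ a ∈ s, Moves n (g a)) : Moves n fun i j => ∑ a ∈ s, g a i j where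
  nonneg i j := sum_nonneg fun a ha => (hg a ha).nonneg i j
  right_snd i j h1 h2 h3 := sum_le_sum fun a ha => (hg a ha).right_snd i j h1 h2 h3
  right_fst i j h1 h2 h3 := sum_le_sum fun a ha => (hg a ha).right_fst i j h1 h2 h3
  left_fst i j h1 h2 h3 := sum_le_sum fun a ha => (hg a ha).left_fst i j h1 h2 h3
  left_snd i j h1 h2 h3 := sum_le_sum fun a ha => (hg a ha).left_snd i j h1 h2 h3
  diag_right i j h1 h2 h3 h4 := sum_le_sum fun a ha => (hg a ha).diag_right i j h1 h2 h3 h4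
  diag_left i j h1 h2 := sum_le_sum fun a ha => (hg a ha).diag_left i j h1 h2
  sum_right i h1 h2 := by
    rw [sum_comm, sum_comm (t := s) (f := fun j a => g a i j)]
    exact sum_le_sum fun a ha => (hg a ha).sum_right i h1 h2
  sum_left i h1 := by
    rw [sum_comm, sum_comm (t := s) (f := fun j a => g a (i + 1) j)]
    exact sum_le_sum fun a ha => (hg a ha).sum_left i h1

end Moves
end SR

open Finset
namespace SR
section Sampling

/-- The multiples of `s` in `{0, …, n}` away from the centre. -/
def marks (n s : ℕ) : Finset ℕ :=
  (range (n + 1)).filter fun l => s ∣ l ∧ (2 * l + 4 * s ≤ n ∨ n + 4 * s ≤ 2 * l)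

theorem mem_marks {n s l : ℕ} :
    l ∈ marks n s ↔ l ≤ n ∧ s ∣ l ∧ (2 * l + 4 * s ≤ n ∨ n + 4 * s ≤ 2 * l) := by
  simp [marks]

theorem dvd_separated {s l l' : ℕ} (h : s ∣ l) (h' : s ∣ l') : l = l' ∨ l + s ≤ l' ∨ l' + s ≤ l := by
  obtain ⟨c, rfl⟩ := h
  obtain ⟨d, rfl⟩ := h'
  rcases lt_trichotomy c d with h | h | h
  · right; left
    nlinarith [Nat.mul_le_mul_left s h]
  · left; rw [h]
  · right; right
    nlinarith [Nat.mul_le_mul_left s h]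

theorem card_marks (n s : ℕ) (hs : 0 < s) : (marks n s).card * s ≤ n + s := by
  have h : marks n s ⊆ (range (n / s + 1)).image (s * ·) := fun l hl => by
    obtain ⟨h1, ⟨c, rfl⟩, -⟩ := mem_marks.1 hl
    exact mem_image_of_mem _ (mem_range.2 (Nat.lt_succ_of_le
      ((Nat.le_div_iff_mul_le hs).2 (by rwa [mul_comm]))))
  have h1 : (marks n s).card ≤ n / s + 1 :=
    (card_le_card h).trans (card_image_le.trans (card_range _).le)
  have h2 := Nat.div_mul_le_self n s
  nlinarith [Nat.mul_le_mul_right s h1]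

namespace Moves

variable {n : ℕ} {g : ℕ → ℕ → ℝ}

theorem diag_right_iter (hg : Moves n g) {l l' : ℕ} (hl : l ≤ n) (hl' : l' ≤ n) :
    ∀ a, n + 2 * a ≤ 2 * l → n + 2 * a ≤ 2 * l' → g l l' ≤ g (l - a) (l' - a)
  | 0, _, _ => le_rfl
  | a + 1, h, h' => by
    refine (diag_right_iter hg hl hl' a (by omega) (by omega)).trans ?_
    have := hg.diag_right (l - (a + 1)) (l' - (a + 1)) (by omega) (by omega) (by omega) (by omega)
    rwa [show l - (a + 1) + 1 = l - a by omega, show l' - (a + 1) + 1 = l' - a by omega] at this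

theorem diag_left_iter (hg : Moves n g) {l l' : ℕ} :
    ∀ a, 2 * l + 2 * a ≤ n → 2 * l' + 2 * a ≤ n → g l l' ≤ g (l + a) (l' + a)
  | 0, _, _ => le_rfl
  | a + 1, h, h' => (diag_left_iter hg a (by omega) (by omega)).trans
      (hg.diag_left (l + a) (l' + a) (by omega) (by omega))

theorem right_snd_iter (hg : Moves n g) {i l : ℕ} (hl : l ≤ n) :
    ∀ b, i + b ≤ l → n + 2 * b ≤ 2 * l → g i l ≤ g i (l - b)
  | 0, _, _ => le_rfl
  | b + 1, h, h' => by
    refine (right_snd_iter hg hl b (by omega) (by omega)).trans ?_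
    have := hg.right_snd i (l - (b + 1)) (by omega) (by omega) (by omega)
    rwa [show l - (b + 1) + 1 = l - b by omega] at this

theorem right_fst_iter (hg : Moves n g) {i l : ℕ} (hl : l ≤ n) :
    ∀ b, i + b ≤ l → n + 2 * b ≤ 2 * l → g l i ≤ g (l - b) i
  | 0, _, _ => le_rfl
  | b + 1, h, h' => by
    refine (right_fst_iter hg hl b (by omega) (by omega)).trans ?_
    have := hg.right_fst i (l - (b + 1)) (by omega) (by omega) (by omega)
    rwa [show l - (b + 1) + 1 = l - b by omega] at this

theorem left_fst_iter (hg : Moves n g) {l j : ℕ} (hj : j ≤ n) :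
    ∀ b, l + b ≤ j → 2 * l + 2 * b ≤ n → g l j ≤ g (l + b) j
  | 0, _, _ => le_rfl
  | b + 1, h, h' => (left_fst_iter hg hj b (by omega) (by omega)).trans
      (hg.left_fst (l + b) j (by omega) (by omega) (by omega))

theorem left_snd_iter (hg : Moves n g) {l j : ℕ} (hj : j ≤ n) :
    ∀ b, l + b ≤ j → 2 * l + 2 * b ≤ n → g j l ≤ g j (l + b)
  | 0, _, _ => le_rfl
  | b + 1, h, h' => (left_snd_iter hg hj b (by omega) (by omega)).trans
      (hg.left_snd (l + b) j (by omega) (by omega) (by omega))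

/-- The displacement of a pair of marks towards the centre. -/
def shift (n s : ℕ) (t : (ℕ × ℕ) × ℕ × ℕ) : ℕ × ℕ :=
  if n + 4 * s ≤ 2 * t.1.1 then
    if n + 4 * s ≤ 2 * t.1.2 then
      if t.1.1 < t.1.2 then (t.1.1 - t.2.1, t.1.2 - t.2.1 - t.2.2)
      else (t.1.1 - t.2.1 - t.2.2, t.1.2 - t.2.2)
    else (t.1.1 - t.2.1, t.1.2 + t.2.2)
  else
    if n + 4 * s ≤ 2 * t.1.2 then (t.1.1 + t.2.1, t.1.2 - t.2.2)
    else if t.1.1 < t.1.2 then (t.1.1 + t.2.1 + t.2.2, t.1.2 + t.2.2)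
      else (t.1.1 + t.2.1, t.1.2 + t.2.1 + t.2.2)

theorem le_shift (hg : Moves n g) {s l l' a b : ℕ} (hl : l ∈ marks n s) (hl' : l' ∈ marks n s)
    (hne : l ≠ l') (ha : a < s) (hb : b < s) :
    g l l' ≤ g (shift n s ((l, l'), a, b)).1 (shift n s ((l, l'), a, b)).2 := by
  obtain ⟨h1, hd, h2⟩ := mem_marks.1 hl
  obtain ⟨h1', hd', h2'⟩ := mem_marks.1 hl'
  have hsep := dvd_separated hd hd'
  unfold shift
  split_ifs <;> dsimp only at *
  · exact (hg.diag_right_iter h1 h1' a (by omega) (by omega)).trans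
      (hg.right_snd_iter (by omega) b (by omega) (by omega))
  · rw [Nat.sub_right_comm]
    exact (hg.diag_right_iter h1 h1' b (by omega) (by omega)).trans
      (hg.right_fst_iter (by omega) a (by omega) (by omega))
  · exact (hg.right_fst_iter h1 a (by omega) (by omega)).trans
      (hg.left_snd_iter (by omega) b (by omega) (by omega))
  · exact (hg.left_fst_iter h1' a (by omega) (by omega)).trans
      (hg.right_snd_iter (by omega) b (by omega) (by omega))
  · rw [Nat.add_right_comm]
    exact (hg.diag_left_iter b (by omega) (by omega)).trans
      (hg.left_fst_iter (by omega) a (by omega) (by omega))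
  · exact (hg.diag_left_iter a (by omega) (by omega)).trans
      (hg.left_snd_iter (by omega) b (by omega) (by omega))

theorem shift_le {s l l' a b : ℕ} (hl : l ∈ marks n s) (hl' : l' ∈ marks n s)
    (ha : a < s) (hb : b < s) :
    (shift n s ((l, l'), a, b)).1 ≤ n ∧ (shift n s ((l, l'), a, b)).2 ≤ n := by
  obtain ⟨h1, -, h2⟩ := mem_marks.1 hl
  obtain ⟨h1', -, h2'⟩ := mem_marks.1 hl'
  unfold shift
  split_ifs <;> dsimp only at * <;> omega

set_option maxHeartbeats 1600000 in
theorem shift_injective {s l l' a b m m' c d : ℕ} (hl : l ∈ marks n s) (hl' : l' ∈ marks n s)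
    (hne : l ≠ l') (ha : a < s) (hb : b < s) (hm : m ∈ marks n s) (hm' : m' ∈ marks n s)
    (hmne : m ≠ m') (hc : c < s) (hd : d < s)
    (h : shift n s ((l, l'), a, b) = shift n s ((m, m'), c, d)) :
    l = m ∧ l' = m' ∧ a = c ∧ b = d := by
  obtain ⟨h1, hdl, h2⟩ := mem_marks.1 hl
  obtain ⟨h1', hdl', h2'⟩ := mem_marks.1 hl'
  obtain ⟨h3, hdm, h4⟩ := mem_marks.1 hm
  obtain ⟨h3', hdm', h4'⟩ := mem_marks.1 hm'
  have s1 := dvd_separated hdl hdl'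
  have s2 := dvd_separated hdm hdm'
  have s3 := dvd_separated hdl hdm
  have s4 := dvd_separated hdl' hdm'
  clear hdl hdl' hdm hdm' hl hl' hm hm' 
  unfold shift at h
  split_ifs at h <;> simp only [Prod.mk.injEq] at * <;> omega

/-- The double sum over marks is controlled by the full double sum. -/
theorem sum_marks_le (hg : Moves n g) {s : ℕ} :
    (s : ℝ) ^ 2 * ∑ l ∈ marks n s, ∑ l' ∈ marks n s, g l l' ≤
      ∑ i ∈ range (n + 1), ∑ j ∈ range (n + 1), g i j + (s : ℝ) ^ 2 * ∑ l ∈ marks n s, g l l := by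
  have hoff : (s : ℝ) ^ 2 * ∑ p ∈ (marks n s).offDiag, g p.1 p.2 ≤
      ∑ i ∈ range (n + 1), ∑ j ∈ range (n + 1), g i j := by
    have e : (s : ℝ) ^ 2 * ∑ p ∈ (marks n s).offDiag, g p.1 p.2 =
        ∑ t ∈ (marks n s).offDiag ×ˢ (range s ×ˢ range s), g t.1.1 t.1.2 := by
      rw [sum_product]
      simp only [sum_const, card_product, card_range, nsmul_eq_mul, mul_sum]
      exact sum_congr rfl fun p _ => by push_cast; ring
    rw [e]
    have hmem : ∀ t ∈ (marks n s).offDiag ×ˢ (range s ×ˢ range s), t.1.1 ∈ marks n s ∧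
        t.1.2 ∈ marks n s ∧ t.1.1 ≠ t.1.2 ∧ t.2.1 < s ∧ t.2.2 < s := fun t ht => by
      simp only [mem_product, mem_offDiag, mem_range] at ht
      tauto
    calc _ ≤ ∑ t ∈ (marks n s).offDiag ×ˢ (range s ×ˢ range s),
          g (shift n s t).1 (shift n s t).2 := sum_le_sum fun t ht => by
            obtain ⟨h1, h2, h3, h4, h5⟩ := hmem t ht
            exact hg.le_shift h1 h2 h3 h4 h5
      _ = ∑ p ∈ ((marks n s).offDiag ×ˢ (range s ×ˢ range s)).image (shift n s), g p.1 p.2 := by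
            refine (sum_image (f := fun p : ℕ × ℕ => g p.1 p.2) fun t ht t' ht' h => ?_).symm
            obtain ⟨h1, h2, h3, h4, h5⟩ := hmem t ht
            obtain ⟨h1', h2', h3', h4', h5'⟩ := hmem t' ht'
            obtain ⟨e1, e2, e3, e4⟩ := shift_injective h1 h2 h3 h4 h5 h1' h2' h3' h4' h5' h
            exact Prod.ext (Prod.ext e1 e2) (Prod.ext e3 e4)
      _ ≤ ∑ p ∈ range (n + 1) ×ˢ range (n + 1), g p.1 p.2 := by
            refine sum_le_sum_of_subset_of_nonneg (fun p hp => ?_) fun p _ _ => hg.nonneg _ _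
            obtain ⟨t, ht, rfl⟩ := mem_image.1 hp
            obtain ⟨h1, h2, h3, h4, h5⟩ := hmem t ht
            have := shift_le h1 h2 h4 h5
            exact mem_product.2 ⟨mem_range.2 (Nat.lt_succ_of_le this.1),
              mem_range.2 (Nat.lt_succ_of_le this.2)⟩
      _ = _ := sum_product ..
  have hsplit : ∑ l ∈ marks n s, ∑ l' ∈ marks n s, g l l' =
      ∑ p ∈ (marks n s).offDiag, g p.1 p.2 + ∑ l ∈ marks n s, g l l := by
    rw [← sum_product' , ← diag_union_offDiag, sum_union (disjoint_diag_offDiag _), add_comm,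
      sum_diag]
  rw [hsplit, mul_add]
  linarith

theorem row_le_right (hg : Moves n g) {i : ℕ} (hi : i ≤ n) :
    ∀ a, n + 2 * a ≤ 2 * i → ∑ j ∈ range (n + 1), g i j ≤ ∑ j ∈ range (n + 1), g (i - a) j
  | 0, _ => le_rfl
  | a + 1, h => by
    refine (row_le_right hg hi a (by omega)).trans ?_
    have := hg.sum_right (i - (a + 1)) (by omega) (by omega)
    rwa [show i - (a + 1) + 1 = i - a by omega] at this

theorem row_le_left (hg : Moves n g) {i : ℕ} :
    ∀ a, 2 * i + 2 * a ≤ n → ∑ j ∈ range (n + 1), g i j ≤ ∑ j ∈ range (n + 1), g (i + a) j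
  | 0, _ => le_rfl
  | a + 1, h => (row_le_left hg a (by omega)).trans (hg.sum_left (i + a) (by omega))

/-- The central sites of `{0, …, n}`, at distance of order `s` from the middle. -/
def central (n s : ℕ) : Finset ℕ :=
  (range (n + 1)).filter fun i => ¬(2 * i + 6 * s ≤ n ∨ n + 6 * s ≤ 2 * i)

theorem card_central (n s : ℕ) : (central n s).card ≤ 6 * s + 2 := by
  have h : central n s ⊆ Ico ((n - 6 * s) / 2) ((n - 6 * s) / 2 + (6 * s + 2)) := fun i hi => by
    simp only [central, mem_filter, mem_range] at hi
    rw [mem_Ico]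
    omega
  simpa using card_le_card h

/-- The full sum of rows is controlled by the sum over marks and the central rows. -/
theorem sum_le_marks (hg : Moves n g) {s : ℕ} (hs : 0 < s) :
    ∑ i ∈ range (n + 1), ∑ j ∈ range (n + 1), g i j ≤
      s * ∑ l ∈ marks n s, ∑ j ∈ range (n + 1), g l j +
        ∑ i ∈ central n s, ∑ j ∈ range (n + 1), g i j := by
  rw [← sum_filter_add_sum_filter_not (range (n + 1))
    fun i => 2 * i + 6 * s ≤ n ∨ n + 6 * s ≤ 2 * i]
  refine add_le_add_left ?_ _
  let φ : ℕ → ℕ := fun i => if 2 * i ≤ n then i + (s - 1 - (i + s - 1) % s) else i - i % s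
  set A := (range (n + 1)).filter fun i => 2 * i + 6 * s ≤ n ∨ n + 6 * s ≤ 2 * i
  have hA : ∀ i ∈ A, i ≤ n ∧ (2 * i + 6 * s ≤ n ∨ n + 6 * s ≤ 2 * i) := fun i hi => by
    simpa [A, Nat.lt_succ_iff] using hi
  have hdvd : ∀ i, s ∣ i + (s - 1 - (i + s - 1) % s) := fun i => by
    have h1 := Nat.mod_lt (i + s - 1) hs
    have h2 : i + (s - 1 - (i + s - 1) % s) = (i + s - 1) - (i + s - 1) % s := by omega
    rw [h2]
    exact Nat.dvd_sub_mod _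
  have hφ : ∀ i ∈ A, φ i ∈ marks n s := fun i hi => by
    obtain ⟨h1, h2⟩ := hA i hi
    have h3 := Nat.mod_lt i hs
    rw [mem_marks]
    simp only [φ]
    split_ifs with h
    · exact ⟨by omega, hdvd i, by omega⟩
    · exact ⟨by omega, Nat.dvd_sub_mod _, by omega⟩
  have hu : ∀ i ∈ A, ∑ j ∈ range (n + 1), g i j ≤ ∑ j ∈ range (n + 1), g (φ i) j := fun i hi => by
    obtain ⟨h1, h2⟩ := hA i hi
    have h3 := Nat.mod_lt i hs
    simp only [φ]
    split_ifs with h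
    · exact hg.row_le_left _ (by omega)
    · exact hg.row_le_right h1 _ (by omega)
  refine (sum_le_sum hu).trans ?_
  rw [← sum_fiberwise_of_maps_to hφ, mul_sum]
  refine sum_le_sum fun l hl => ?_
  rw [sum_congr rfl (g := fun _ => ∑ j ∈ range (n + 1), g l j) fun i hi => by
    rw [(mem_filter.1 hi).2], sum_const, nsmul_eq_mul]
  refine mul_le_mul_of_nonneg_right ?_ (sum_nonneg fun _ _ => hg.nonneg _ _)
  have hcard : (A.filter fun i => φ i = l) ⊆
      if 2 * l ≤ n then Ico (l + 1 - s) (l + 1) else Ico l (l + s) := fun i hi => by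
    rw [mem_filter] at hi
    obtain ⟨h1, h2⟩ := hA i hi.1
    have h3 := Nat.mod_lt i hs
    have h4 := Nat.mod_lt (i + s - 1) hs
    have h5 := hi.2
    have h6 := mem_marks.1 hl
    simp only [φ] at h5
    split_ifs at h5 ⊢ <;> rw [mem_Ico] <;> omega
  have := card_le_card hcard
  have h2 : (if 2 * l ≤ n then Ico (l + 1 - s) (l + 1) else Ico l (l + s)).card ≤ s := by
    split_ifs <;> rw [Nat.card_Ico] <;> omega
  exact_mod_cast this.trans h2

/-- The error made when a double sum is sampled along the marks. -/
theorem sampling_error_le (hg : Moves n g) {s : ℕ} (hs : 0 < s) :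
    ∑ i ∈ range (n + 1), ∑ j ∈ range (n + 1), g i j -
        2 * s * ∑ l ∈ marks n s, ∑ j ∈ range (n + 1), g l j +
        (s : ℝ) ^ 2 * ∑ l ∈ marks n s, ∑ l' ∈ marks n s, g l l' ≤
      2 * ∑ i ∈ central n s, ∑ j ∈ range (n + 1), g i j + (s : ℝ) ^ 2 * ∑ l ∈ marks n s, g l l := by
  have h1 := hg.sum_marks_le (s := s)
  have h2 := hg.sum_le_marks hs
  linarith

end Moves
end Sampling
end SR

open Finset
namespace SR
section SamplingBound

theorem sum_rate_range_le (n : ℕ) {i : ℕ} (hi : i ≤ n) :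
    ∑ j ∈ range (n + 1), rate ((i : ℤ) - j).natAbs ≤ 4 * (n + 1) * rate n := by
  have := sum_rate_dist_le n ⟨i, Nat.lt_succ_of_le hi⟩
  rwa [Fin.sum_univ_eq_sum_range (fun b => rate ((i : ℤ) - (b : ℕ)).natAbs) (n + 1)] at this

theorem Moves.sampling_error_le_rate {n s : ℕ} {g : ℕ → ℕ → ℝ} (hg : Moves n g) {M : ℝ} (hM : 0 ≤ M)
    (hgM : ∀ i ≤ n, ∀ j ≤ n, g i j ≤ M * rate ((i : ℤ) - j).natAbs) (hs : 0 < s) (hsn : s ≤ n + 1) :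
    ∑ i ∈ range (n + 1), ∑ j ∈ range (n + 1), g i j -
        2 * s * ∑ l ∈ marks n s, ∑ j ∈ range (n + 1), g l j +
        (s : ℝ) ^ 2 * ∑ l ∈ marks n s, ∑ l' ∈ marks n s, g l l' ≤ 66 * s * M * (n + 1) := by
  refine (hg.sampling_error_le hs).trans ?_
  have hs1 : (1 : ℝ) ≤ s := by exact_mod_cast hs
  have hsn1 : (s : ℝ) ≤ n + 1 := by exact_mod_cast hsn
  have h1 : ∑ i ∈ central n s, ∑ j ∈ range (n + 1), g i j ≤ (8 * s) * (M * (4 * (n + 1))) := by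
    have hrow : ∀ i ∈ central n s, ∑ j ∈ range (n + 1), g i j ≤ M * (4 * (n + 1)) := fun i hi => by
      have hi' : i ≤ n := Nat.le_of_lt_succ (mem_range.1 (mem_filter.1 hi).1)
      calc ∑ j ∈ range (n + 1), g i j
          ≤ ∑ j ∈ range (n + 1), M * rate ((i : ℤ) - j).natAbs :=
            sum_le_sum fun j hj => hgM i hi' j (Nat.le_of_lt_succ (mem_range.1 hj))
        _ ≤ M * (4 * (n + 1) * rate n) := by
            rw [← mul_sum]
            exact mul_le_mul_of_nonneg_left (sum_rate_range_le n hi') hM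
        _ ≤ _ := mul_le_mul_of_nonneg_left
            (mul_le_of_le_one_right (by positivity) (rate_le_one n)) hM
    refine (sum_le_card_nsmul _ _ _ hrow).trans ?_
    rw [nsmul_eq_mul]
    have hc : ((central n s).card : ℝ) ≤ 6 * s + 2 := by exact_mod_cast card_central n s
    exact mul_le_mul_of_nonneg_right (by linarith) (by positivity)
  have h2 : (s : ℝ) ^ 2 * ∑ l ∈ marks n s, g l l ≤ s * (2 * (n + 1)) * M := by
    have h3 : ∑ l ∈ marks n s, g l l ≤ (marks n s).card * M := by
      rw [← nsmul_eq_mul]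
      refine sum_le_card_nsmul _ _ _ fun l hl => ?_
      have hl' := (mem_marks.1 hl).1
      exact (hgM l hl' l hl').trans (mul_le_of_le_one_right hM (rate_le_one _))
    have h4 : ((marks n s).card : ℝ) * s ≤ n + s := by exact_mod_cast card_marks n s hs
    calc (s : ℝ) ^ 2 * ∑ l ∈ marks n s, g l l ≤ (s : ℝ) ^ 2 * ((marks n s).card * M) := by gcongr
      _ = s * ((marks n s).card * s) * M := by ring
      _ ≤ s * (2 * (n + 1)) * M :=
          mul_le_mul_of_nonneg_right (mul_le_mul_of_nonneg_left (by linarith) (by positivity)) hM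
  calc _ ≤ 2 * ((8 * s) * (M * (4 * (n + 1)))) + s * (2 * (n + 1)) * M := by gcongr
    _ = _ := by ring

theorem rate_moves (n : ℕ) : Moves n fun i j => rate ((i : ℤ) - j).natAbs where
  nonneg _ _ := (rate_pos _).le
  right_snd i j _ _ _ := rate_anti (by omega)
  right_fst i j _ _ _ := rate_anti (by omega)
  left_fst i j _ _ _ := rate_anti (by omega)
  left_snd i j _ _ _ := rate_anti (by omega)
  diag_right i j _ _ _ _ := rate_anti (by omega)
  diag_left i j _ _ := rate_anti (by omega)
  sum_right i h1 h2 := by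
    rw [sum_range_succ', sum_range_succ]
    refine add_le_add (sum_le_sum fun j _ => rate_anti (by omega)) (rate_anti (by omega))
  sum_left i h := by
    rw [sum_range_succ, sum_range_succ']
    refine add_le_add (sum_le_sum fun j _ => rate_anti (by omega)) (rate_anti (by omega))

theorem sum_marks_rate_le {n s : ℕ} (hs : 0 < s) (hsn : (s : ℝ) ≤ (n + 1) * rate n) :
    (s : ℝ) ^ 2 * ∑ l ∈ marks n s, ∑ l' ∈ marks n s, rate ((l : ℤ) - l').natAbs ≤
      6 * (n + 1) ^ 2 * rate n := by
  have hs0 : (0 : ℝ) < s := by exact_mod_cast hs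
  have hr := rate_pos n
  have h1 := (rate_moves n).sum_marks_le (s := s)
  have h2 : ∑ i ∈ range (n + 1), ∑ j ∈ range (n + 1), rate ((i : ℤ) - j).natAbs ≤
      (n + 1) * (4 * (n + 1) * rate n) := by
    refine (sum_le_card_nsmul _ _ _ fun i hi =>
      sum_rate_range_le n (Nat.le_of_lt_succ (mem_range.1 hi))).trans ?_
    rw [card_range, nsmul_eq_mul]
    push_cast
    rfl
  have h3 : (s : ℝ) ^ 2 * ∑ l ∈ marks n s, rate ((l : ℤ) - l).natAbs ≤
      (n + 1) * rate n * (2 * (n + 1)) := by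
    have h4 : ((marks n s).card : ℝ) * s ≤ n + s := by exact_mod_cast card_marks n s hs
    have h5 : (n + 1) * rate n ≤ n + 1 := mul_le_of_le_one_right (by positivity) (rate_le_one n)
    have h6 : ∑ l ∈ marks n s, rate ((l : ℤ) - l).natAbs ≤ (marks n s).card := by
      refine (sum_le_card_nsmul _ _ _ fun l _ => rate_le_one _).trans ?_
      simp
    calc _ ≤ (s : ℝ) ^ 2 * (marks n s).card := by gcongr
      _ = s * ((marks n s).card * s) := by ring
      _ ≤ (n + 1) * rate n * (2 * (n + 1)) := by
          refine mul_le_mul hsn (by linarith) (by positivity) (by positivity)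
  calc _ ≤ _ := h1
    _ ≤ (n + 1) * (4 * (n + 1) * rate n) + (n + 1) * rate n * (2 * (n + 1)) := add_le_add h2 h3
    _ = _ := by ring

variable {V : Type*} [Fintype V] [DecidableEq V]

theorem ev_sq_sum_sub (J : V → V → ℝ) (h : V → ℝ) (A : ℕ → (V → Bool) → ℝ) (R L : Finset ℕ) (s : ℝ) :
    ev J h (fun σ => (∑ i ∈ R, A i σ - s * ∑ l ∈ L, A l σ) ^ 2) =
      ∑ i ∈ R, ∑ j ∈ R, ev J h (fun σ => A i σ * A j σ) -
        2 * s * ∑ l ∈ L, ∑ j ∈ R, ev J h (fun σ => A l σ * A j σ) +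
        s ^ 2 * ∑ l ∈ L, ∑ l' ∈ L, ev J h (fun σ => A l σ * A l' σ) := by
  have e : ∀ P Q : Finset ℕ, ∑ i ∈ P, ∑ j ∈ Q, ev J h (fun σ => A i σ * A j σ) =
      ev J h (fun σ => (∑ i ∈ P, A i σ) * ∑ j ∈ Q, A j σ) := fun P Q => by
    simp only [← ev_sum, sum_mul_sum]
  rw [e, e, e, ← ev_mul, ← ev_mul, ← ev_sub, ← ev_add]
  congr 1
  funext σ
  ring

/-- The total magnetization. -/
noncomputable def total (n : ℕ) (σ : BoxV n → Bool) : ℝ := ∑ x, spinR (σ x)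

/-- The rescaled magnetization of the marked sublattice. -/
noncomputable def sampled (n s : ℕ) (σ : BoxV n → Bool) : ℝ :=
  (s : ℝ) ^ 2 * ∑ l ∈ marks n s, ∑ k ∈ marks n s, spinR (σ (site n l k))

theorem corr_site_le {n i j k l : ℕ} (hi : i ≤ n) (hj : j ≤ n) (hk : k ≤ n) (hl : l ≤ n) :
    corr n (site n i k) (site n j l) ≤
      64 * (rate ((i : ℤ) - j).natAbs * rate ((k : ℤ) - l).natAbs) := by
  have := corr_le_rate (boxPos_injective n) (site n i k) (site n j l)
  simp only [boxPos, site_fst hi, site_fst hj] at this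
  rwa [show ((site n i k).2 : ℕ) = k from Nat.mod_eq_of_lt (Nat.lt_succ_of_le hk),
    show ((site n j l).2 : ℕ) = l from Nat.mod_eq_of_lt (Nat.lt_succ_of_le hl)] at this

theorem ev_sum_mul_sum (n : ℕ) (P : Finset ℕ) (f f' : ℕ → BoxV n) :
    ev (nnV (boxPos n)) (fun _ => 0)
      (fun σ => (∑ k ∈ P, spinR (σ (f k))) * ∑ l ∈ P, spinR (σ (f' l))) =
      ∑ p ∈ P ×ˢ P, corr n (f p.1) (f' p.2) := by
  simp only [corr, sum_product, ← ev_sum, sum_mul_sum]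

/-- The magnetization is well approximated by its sampled version. -/
theorem ev_total_sub_sampled_le {n s : ℕ} (hs : 0 < s) (hsn : (s : ℝ) ≤ (n + 1) * rate n) :
    ev (nnV (boxPos n)) (fun _ => 0) (fun σ => (total n σ - sampled n s σ) ^ 2) ≤
      84480 * s * (n + 1) ^ 3 * rate n := by
  have hr := rate_pos n
  have hsn' : s ≤ n + 1 := by
    have : (n + 1) * rate n ≤ n + 1 := mul_le_of_le_one_right (by positivity) (rate_le_one n)
    exact_mod_cast hsn.trans this
  have hs0 : (0 : ℝ) < s := by exact_mod_cast hs
  have hL : ∀ l ∈ marks n s, l ≤ n := fun l hl => (mem_marks.1 hl).1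
  have hR : ∀ l ∈ range (n + 1), l ≤ n := fun l hl => Nat.le_of_lt_succ (mem_range.1 hl)
  set mid : (BoxV n → Bool) → ℝ :=
    fun σ => s * ∑ l ∈ marks n s, ∑ k ∈ range (n + 1), spinR (σ (site n l k)) with hmid
  have h1 : ev (nnV (boxPos n)) (fun _ => 0) (fun σ => (total n σ - mid σ) ^ 2) ≤
      66 * s * (64 * (4 * (n + 1) ^ 2 * rate n)) * (n + 1) := by
    simp only [total, sum_box, hmid]
    rw [ev_sq_sum_sub _ _ (fun i σ => ∑ k ∈ range (n + 1), spinR (σ (site n i k)))]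
    simp only [ev_sum_mul_sum]
    refine (Moves.sum _ fun p _ => corr_moves n p.1 p.2).sampling_error_le_rate
      (by positivity) (fun i hi j hj => ?_) hs hsn'
    calc _ ≤ ∑ p ∈ range (n + 1) ×ˢ range (n + 1),
          64 * (rate ((i : ℤ) - j).natAbs * rate ((p.1 : ℤ) - p.2).natAbs) :=
          sum_le_sum fun p hp => by
            rw [mem_product] at hp
            exact corr_site_le hi hj (hR _ hp.1) (hR _ hp.2)
      _ = 64 * (∑ k ∈ range (n + 1), ∑ l ∈ range (n + 1), rate ((k : ℤ) - l).natAbs) *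
          rate ((i : ℤ) - j).natAbs := by
          rw [← mul_sum, ← mul_sum, sum_product]
          ring
      _ ≤ 64 * ((n + 1) * (4 * (n + 1) * rate n)) * rate ((i : ℤ) - j).natAbs := by
          have := rate_pos ((i : ℤ) - j).natAbs
          gcongr
          refine (sum_le_card_nsmul _ _ _ fun i hi => sum_rate_range_le n (hR i hi)).trans ?_
          rw [card_range, nsmul_eq_mul]
          push_cast
          rfl
      _ = _ := by ring
  have h2 : ev (nnV (boxPos n)) (fun _ => 0) (fun σ => (mid σ - sampled n s σ) ^ 2) ≤
      66 * s * (64 * (6 * (n + 1) ^ 2 * rate n)) * (n + 1) := by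
    have e : ∀ σ : BoxV n → Bool, (mid σ - sampled n s σ) ^ 2 = (s : ℝ) ^ 2 *
        (∑ k ∈ range (n + 1), ∑ l ∈ marks n s, spinR (σ (site n l k)) -
          s * ∑ k ∈ marks n s, ∑ l ∈ marks n s, spinR (σ (site n l k))) ^ 2 := fun σ => by
      simp only [hmid, sampled]
      rw [sum_comm (s := range (n + 1)), sum_comm (s := marks n s) (t := marks n s)]
      ring
    simp only [e]
    rw [ev_mul, ev_sq_sum_sub _ _ (fun k σ => ∑ l ∈ marks n s, spinR (σ (site n l k)))]
    simp only [ev_sum_mul_sum]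
    have hm : Moves n fun k k' => ∑ p ∈ marks n s ×ˢ marks n s,
        corr n (site n p.1 k) (site n p.2 k') :=
      Moves.sum _ fun p _ => by
        simp only [fun k k' => corr_site_swap n k p.1 k' p.2]
        exact corr_moves n p.1 p.2
    have := hm.sampling_error_le_rate (s := s) (M := 64 * ∑ l ∈ marks n s, ∑ l' ∈ marks n s,
        rate ((l : ℤ) - l').natAbs) (by
          refine mul_nonneg (by norm_num) (sum_nonneg fun _ _ => sum_nonneg fun _ _ => ?_)
          exact (rate_pos _).le)
      (fun i hi j hj => ?_) hs hsn'
    · refine (mul_le_mul_of_nonneg_left this (sq_nonneg (s : ℝ))).trans ?_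
      have h3 := sum_marks_rate_le hs hsn
      calc _ = 66 * s * (64 * ((s : ℝ) ^ 2 * ∑ l ∈ marks n s, ∑ l' ∈ marks n s,
            rate ((l : ℤ) - l').natAbs)) * (n + 1) := by ring
        _ ≤ _ := by gcongr
    · calc _ ≤ ∑ p ∈ marks n s ×ˢ marks n s,
          64 * (rate ((p.1 : ℤ) - p.2).natAbs * rate ((i : ℤ) - j).natAbs) :=
          sum_le_sum fun p hp => by
            rw [mem_product] at hp
            exact corr_site_le (hL _ hp.1) (hL _ hp.2) hi hj
        _ = _ := by
          rw [← mul_sum, ← sum_mul, sum_product]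
          ring
  calc _ ≤ ev (nnV (boxPos n)) (fun _ => 0)
        (fun σ => 2 * (total n σ - mid σ) ^ 2 + 2 * (mid σ - sampled n s σ) ^ 2) :=
        ev_mono _ _ fun σ => by
          nlinarith [sq_nonneg ((total n σ - mid σ) - (mid σ - sampled n s σ))]
    _ = 2 * ev (nnV (boxPos n)) (fun _ => 0) (fun σ => (total n σ - mid σ) ^ 2) +
        2 * ev (nnV (boxPos n)) (fun _ => 0) (fun σ => (mid σ - sampled n s σ) ^ 2) := by
        rw [ev_add, ev_mul, ev_mul]
    _ ≤ 2 * (66 * s * (64 * (4 * (n + 1) ^ 2 * rate n)) * (n + 1)) +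
        2 * (66 * s * (64 * (6 * (n + 1) ^ 2 * rate n)) * (n + 1)) := by gcongr
    _ = _ := by ring

end SamplingBound
end SR

open Finset
namespace SR
section LowerBound

variable {V : Type*} [Fintype V] [DecidableEq V]

theorem ev_flip (J : V → V → ℝ) (F : (V → Bool) → ℝ) :
    ev J (fun _ => 0) (fun σ => F fun x => !σ x) = ev J (fun _ => 0) F := by
  have e : Function.Involutive fun (σ : V → Bool) x => !σ x := fun σ => by simp
  unfold ev
  congr 1
  rw [← Equiv.sum_comp e.toPerm]
  refine sum_congr rfl fun σ _ => ?_
  simp [Function.Involutive.toPerm, wt, energy, spinR_not]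

theorem ev_zero_odd (J : V → V → ℝ) {F : (V → Bool) → ℝ} (hF : ∀ σ, F (fun x => !σ x) = -F σ) :
    ev J (fun _ => 0) F = 0 := by
  have h := ev_flip J F
  simp only [hF, neg_eq_neg_one_mul (F _), ev_mul] at h
  linarith

theorem magn_zero (J : V → V → ℝ) (x : V) : ev J (fun _ => 0) (fun σ => spinR (σ x)) = 0 :=
  ev_zero_odd J fun _ => spinR_not _

/-- The plus two-point function exceeds the free one by at most the product of magnetizations. -/
theorem plus_corr_le {pos : V → ℤ × ℤ} (x y : V) :
    ev (nnV pos) (plusField pos) (fun σ => spinR (σ x) * spinR (σ y)) -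
      ev (nnV pos) (plusField pos) (fun σ => spinR (σ x)) *
        ev (nnV pos) (plusField pos) (fun σ => spinR (σ y)) ≤
      ev (nnV pos) (fun _ => 0) (fun σ => spinR (σ x) * spinR (σ y)) := by
  have := cov_le_cov (J := nnV pos) (h := plusField pos) (h' := fun _ => 0) (nnV_nonneg pos)
    (fun x => by simpa using plusField_nonneg pos x) x y
  rwa [magn_zero, magn_zero, mul_zero, sub_zero] at this

theorem plus_magn_le {pos : V → ℤ × ℤ} (hpos : Function.Injective pos) (x : V) (k : ℕ)
    (hk : ∀ z, z ∉ Set.range pos → k < dist1 z (pos x)) :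
    |ev (nnV pos) (plusField pos) (fun σ => spinR (σ x))| ≤ 8 * rate k :=
  magn_le_rate hpos x k (T := (Set.range pos)ᶜ) (fun y => by simp)
    (fun y => (abs_of_nonneg (plusField_nonneg pos y)).le) fun z hz => hk z hz

theorem site_snd {n k : ℕ} (h : k ≤ n) (i : ℕ) : ((site n i k).2 : ℕ) = k :=
  Nat.mod_eq_of_lt (Nat.lt_succ_of_le h)

theorem range_boxPos {n : ℕ} {z : ℤ × ℤ} :
    z ∈ Set.range (boxPos n) ↔ 0 ≤ z.1 ∧ z.1 ≤ n ∧ 0 ≤ z.2 ∧ z.2 ≤ n := by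
  constructor
  · rintro ⟨x, rfl⟩
    simp only [boxPos]
    omega
  · rintro ⟨h1, h2, h3, h4⟩
    refine ⟨(⟨z.1.toNat, by omega⟩, ⟨z.2.toNat, by omega⟩), ?_⟩
    simp only [boxPos]
    ext <;> simp only <;> omega

theorem lt_dist1_of_not_mem {n k : ℕ} {x : BoxV n} (h1 : k ≤ x.1) (h2 : x.1 + k ≤ n) (h3 : k ≤ x.2)
    (h4 : x.2 + k ≤ n) (z : ℤ × ℤ) (hz : z ∉ Set.range (boxPos n)) : k < dist1 z (boxPos n x) := by
  rw [range_boxPos] at hz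
  simp only [dist1, boxPos]
  omega

/-- Lower bound for the two-point function of the box at central sites. -/
theorem rate_sq_le_corr {n h : ℕ} (hh : 1 ≤ h) (hn : 2 ^ 36 * h ≤ n + 1) {c : ℝ}
    (hc : c ^ 4 * (2 ^ 10 * h) ≤ n + 1) :
    c * rate n ^ 2 ≤ corr n (site n (n / 2 - h) (n / 2 + h)) (site n (n / 2 + h) (n / 2 - h)) := by
  set m := n / 2 with hm
  have hmh : m + h ≤ n := by omega
  have hmh' : h ≤ m := by omega
  have hmhn : m - h ≤ n := by omega
  set x := site n (m - h) (m + h) with hx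
  set y := site n (m + h) (m - h) with hy
  have ex1 : (x.1 : ℕ) = m - h := site_fst hmhn _
  have ex2 : (x.2 : ℕ) = m + h := site_snd hmh _
  have ey1 : (y.1 : ℕ) = m + h := site_fst hmh _
  have ey2 : (y.2 : ℕ) = m - h := site_snd hmhn _
  have hb := bulkCorr_le (boxPos_injective n) x y (2 * h)
    (by simp only [boxPos]; omega) (by simp only [boxPos]; omega)
  have hp := plus_corr_le (pos := boxPos n) x y
  have hk : m - 2 * h ≤ m := by omega
  have hmx := plus_magn_le (boxPos_injective n) x (m - 2 * h)
    (lt_dist1_of_not_mem (by omega) (by omega) (by omega) (by omega))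
  have hmy := plus_magn_le (boxPos_injective n) y (m - 2 * h)
    (lt_dist1_of_not_mem (by omega) (by omega) (by omega) (by omega))
  have hmul := mul_le_mul hmx hmy (abs_nonneg _) (by have := rate_pos (m - 2 * h); positivity)
  rw [← abs_mul] at hmul
  have hmul' := (le_abs_self _).trans hmul
  obtain ⟨hu, hu4⟩ := one_sixteenth_le_bulkCorr_pow (2 * h) (by omega)
  set u := bulkCorr (2 * h) with hu_def
  set v := rate (m - 2 * h) with hv
  set w := rate n with hw
  have hv0 : 0 < v := rate_pos _
  have hw0 : 0 < w := rate_pos _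
  have hv8 : v ^ 8 * ((m - 2 * h : ℕ) + 1) = 1 := rate_pow _
  have hw8 : w ^ 8 * ((n : ℝ) + 1) = 1 := rate_pow _
  have hh0 : (1 : ℝ) ≤ h := by exact_mod_cast hh
  have hmr : (2 : ℝ) ^ 34 * h ≤ ((m - 2 * h : ℕ) : ℝ) + 1 := by
    have : 2 ^ 34 * h ≤ (m - 2 * h) + 1 := by omega
    exact_mod_cast this
  push_cast at hu4
  have hv1 : v ^ 8 * (2 ^ 34 * h) ≤ 1 := by
    rw [← hv8]; gcongr
  have hw1 : w ^ 8 * (c ^ 4 * (2 ^ 10 * h)) ≤ 1 := by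
    rw [← hw8]; gcongr
  have hu1 : 1 / 16 ≤ u ^ 4 * (4 * h) := by
    have : 0 < u ^ 4 := by positivity
    nlinarith
  have h1 : 64 * v ^ 2 ≤ u / 2 := by
    refine le_of_pow_le_pow_left₀ (n := 4) (by norm_num) (by positivity) ?_
    have e : (0 : ℝ) < h := by linarith
    rw [← mul_le_mul_iff_left₀ e]
    have e1 : (64 * v ^ 2) ^ 4 * h = 2 ^ 24 * v ^ 8 * h := by ring
    have e2 : (u / 2) ^ 4 * h = u ^ 4 * (4 * h) / 64 := by ring
    rw [e1, e2]
    linarith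
  have h2 : c * w ^ 2 ≤ u / 2 := by
    refine le_of_pow_le_pow_left₀ (n := 4) (by norm_num) (by positivity) ?_
    have e : (0 : ℝ) < h := by linarith
    rw [← mul_le_mul_iff_left₀ e]
    have e1 : (c * w ^ 2) ^ 4 * h = w ^ 8 * (c ^ 4 * (2 ^ 10 * h)) / 2 ^ 10 := by ring
    have e2 : (u / 2) ^ 4 * h = u ^ 4 * (4 * h) / 64 := by ring
    rw [e1, e2]
    linarith
  change c * w ^ 2 ≤ ev (nnV (boxPos n)) (fun _ => 0) (fun σ => spinR (σ x) * spinR (σ y))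
  linarith

theorem corr_central_le {n h a b c d : ℕ} (hh : 2 * h ≤ n) (ha : a < h) (hb : b < h) (hc : c < h)
    (hd : d < h) :
    corr n (site n (n / 2 - h) (n / 2 + h)) (site n (n / 2 + h) (n / 2 - h)) ≤
      corr n (site n (n / 2 - h + a) (n / 2 + h - c)) (site n (n / 2 + h - b) (n / 2 - h + d)) := by
  set m := n / 2 with hm
  refine ((corr_moves n (m + h) (m - h)).left_fst_iter (l := m - h) (j := m + h) (by omega) a
    (by omega) (by omega)).trans ?_
  refine ((corr_moves n (m + h) (m - h)).right_snd_iter (l := m + h) (i := m - h + a) (by omega) b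
    (by omega) (by omega)).trans ?_
  rw [← corr_site_swap, ← corr_site_swap n (m - h + a)]
  refine ((corr_moves n (m - h + a) (m + h - b)).left_snd_iter (l := m - h) (j := m + h) (by omega) d
    (by omega) (by omega)).trans ?_
  exact ((corr_moves n (m - h + a) (m + h - b)).right_fst_iter (l := m + h) (i := m - h + d) (by omega)
    c (by omega) (by omega))

/-- The square of sites on which the two-point function is bounded below. -/
def centralPair (n h : ℕ) (t : (Fin h × Fin h) × Fin h × Fin h) : BoxV n × BoxV n :=
  (site n (n / 2 - h + t.1.1) (n / 2 + h - t.1.2), site n (n / 2 + h - t.2.1) (n / 2 - h + t.2.2))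

theorem centralPair_injective {n h : ℕ} (hh : 2 * h ≤ n) : Function.Injective (centralPair n h) := by
  rintro ⟨⟨a, c⟩, b, d⟩ ⟨⟨a', c'⟩, b', d'⟩ e
  simp only [centralPair, Prod.mk.injEq] at e
  obtain ⟨e1, e2⟩ := e
  have f1 := congrArg (fun x : BoxV n => (x.1 : ℕ)) e1
  have f2 := congrArg (fun x : BoxV n => (x.2 : ℕ)) e1
  have f3 := congrArg (fun x : BoxV n => (x.1 : ℕ)) e2
  have f4 := congrArg (fun x : BoxV n => (x.2 : ℕ)) e2
  rw [site_fst (by omega), site_fst (by omega)] at f1 f3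
  rw [site_snd (by omega), site_snd (by omega)] at f2 f4
  clear e1 e2
  simp only [Prod.mk.injEq, Fin.ext_iff]
  omega

theorem le_sum_corr {n h : ℕ} (hh : 1 ≤ h) (hn : 2 ^ 36 * h ≤ n + 1) :
    (h : ℝ) ^ 4 * rate n ^ 2 ≤ ∑ x, ∑ y, corr n x y := by
  have hn2 : 2 * h ≤ n := by omega
  have hn1 : (2 : ℝ) ^ 36 * h ≤ (n : ℝ) + 1 := by exact_mod_cast hn
  have h1 := rate_sq_le_corr hh hn (c := 1)
    (by have : (1 : ℝ) ≤ h := by exact_mod_cast hh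
        linarith)
  rw [one_mul] at h1
  have key := fun a b c d : Fin h => h1.trans
    (corr_central_le hn2 a.2 b.2 c.2 d.2)
  clear hn
  calc (h : ℝ) ^ 4 * rate n ^ 2 = ∑ t : (Fin h × Fin h) × Fin h × Fin h, rate n ^ 2 := by
        simp only [sum_const, card_univ, Fintype.card_prod, Fintype.card_fin, nsmul_eq_mul]
        push_cast; ring
    _ ≤ ∑ t, corr n (centralPair n h t).1 (centralPair n h t).2 := sum_le_sum fun t _ =>
        key t.1.1 t.2.1 t.1.2 t.2.2
    _ = ∑ p ∈ univ.image (centralPair n h), corr n p.1 p.2 :=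
        (sum_image (f := fun p : BoxV n × BoxV n => corr n p.1 p.2)
          (centralPair_injective hn2).injOn).symm
    _ ≤ ∑ p : BoxV n × BoxV n, corr n p.1 p.2 :=
        sum_le_sum_of_subset_of_nonneg (subset_univ _) fun _ _ _ => corr_nonneg _ _ _
    _ = _ := Fintype.sum_prod_type (fun p : BoxV n × BoxV n => corr n p.1 p.2)

theorem sum_corr_le (n : ℕ) :
    ∑ x, ∑ y, corr n x y ≤ 1024 * ((n : ℝ) + 1) ^ 4 * rate n ^ 2 := by
  have hr := rate_pos n
  set R := ∑ i ∈ range (n + 1), ∑ j ∈ range (n + 1), rate ((i : ℤ) - j).natAbs with hR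
  have hR0 : 0 ≤ R := sum_nonneg fun _ _ => sum_nonneg fun _ _ => (rate_pos _).le
  have h1 : R ≤ ((n : ℝ) + 1) * (4 * (n + 1) * rate n) := by
    refine (sum_le_card_nsmul _ _ _ fun i hi =>
      sum_rate_range_le n (Nat.le_of_lt_succ (mem_range.1 hi))).trans ?_
    rw [card_range, nsmul_eq_mul]
    push_cast
    rfl
  calc ∑ x, ∑ y, corr n x y ≤ ∑ i ∈ range (n + 1), ∑ k ∈ range (n + 1), ∑ j ∈ range (n + 1),
        ∑ l ∈ range (n + 1), 64 * (rate ((i : ℤ) - j).natAbs * rate ((k : ℤ) - l).natAbs) := by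
        simp only [sum_box]
        refine sum_le_sum fun i hi => sum_le_sum fun k hk => sum_le_sum fun j hj =>
          sum_le_sum fun l hl => ?_
        rw [mem_range] at hi hj hk hl
        exact corr_site_le (by omega) (by omega) (by omega) (by omega)
    _ = 64 * (R * R) := by
        rw [hR, sum_mul_sum]
        simp only [mul_sum]
        refine sum_congr rfl fun i _ => sum_congr rfl fun k _ => ?_
        simp only [sum_mul, mul_sum]
        rw [sum_comm]
    _ ≤ 64 * ((((n : ℝ) + 1) * (4 * (n + 1) * rate n)) * (((n : ℝ) + 1) * (4 * (n + 1) * rate n))) := by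
        gcongr
    _ = _ := by ring

end LowerBound
end SR

open Finset
namespace SR
section Clue

variable {V : Type*} [Fintype V] [DecidableEq V] {Ω : Type*} [Fintype Ω] [DecidableEq Ω]
  {p : (V → Ω) → ℝ} {U : Finset V} {f g : (V → Ω) → ℝ}

/-- A function which depends only on the coordinates in `U`. -/
def DependsOnly (U : Finset V) (g : (V → Ω) → ℝ) : Prop :=
  ∀ ω ω', (∀ v ∈ U, ω v = ω' v) → g ω = g ω'

theorem cexp_dependsOnly (p : (V → Ω) → ℝ) (U : Finset V) (f : (V → Ω) → ℝ) :
    DependsOnly U (cexp p U f) := fun ω ω' h => by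
  have e : (univ.filter fun τ : V → Ω => ∀ v ∈ U, τ v = ω v) =
      univ.filter fun τ : V → Ω => ∀ v ∈ U, τ v = ω' v :=
    filter_congr fun τ _ => forall₂_congr fun v hv => by rw [h v hv]
  rw [cexp, cexp, e]

theorem pexp_mul_cexp (hp : ∀ ω, 0 < p ω) (hg : DependsOnly U g) :
    pexp p (fun ω => g ω * cexp p U f ω) = pexp p (fun ω => g ω * f ω) := by
  have hD : ∀ ω : V → Ω, 0 < ∑ τ ∈ univ.filter (fun τ : V → Ω => ∀ v ∈ U, τ v = ω v), p τ :=
    fun ω => sum_pos (fun τ _ => hp τ) ⟨ω, by simp⟩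
  simp only [pexp, cexp, mul_div_assoc', mul_sum, sum_div, sum_filter]
  rw [sum_comm]
  refine sum_congr rfl fun τ _ => ?_
  have h1 : ∀ ω : V → Ω, p ω * (g ω * if ∀ v ∈ U, τ v = ω v then p τ * f τ else 0) /
      (∑ a, if ∀ v ∈ U, a v = ω v then p a else 0) =
      (if ∀ v ∈ U, ω v = τ v then p ω else 0) * (g τ * (p τ * f τ) /
        ∑ a, if ∀ v ∈ U, a v = τ v then p a else 0) := fun ω => by
    by_cases h : ∀ v ∈ U, τ v = ω v
    · have h' : ∀ v ∈ U, ω v = τ v := fun v hv => (h v hv).symm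
      have e : ∀ a : V → Ω, (∀ v ∈ U, a v = ω v) ↔ ∀ v ∈ U, a v = τ v := fun a =>
        forall₂_congr fun v hv => by rw [h v hv]
      rw [if_pos h, if_pos h', hg ω τ h', mul_div_assoc]
      simp only [e, mul_div_assoc]
    · have h' : ¬ ∀ v ∈ U, ω v = τ v := fun h' => h fun v hv => (h' v hv).symm
      rw [if_neg h, if_neg h', zero_mul, mul_zero, mul_zero, zero_div]
  rw [sum_congr rfl fun ω _ => h1 ω, ← sum_mul]
  have := (hD τ).ne'
  rw [sum_filter] at this
  field_simp

theorem pexp_sq_sub (hp : ∀ ω, 0 < p ω) (hg : DependsOnly U g) :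
    pexp p (fun ω => (f ω - g ω) ^ 2) = pexp p (fun ω => (f ω - cexp p U f ω) ^ 2) +
      pexp p (fun ω => (cexp p U f ω - g ω) ^ 2) := by
  have hd : DependsOnly U fun ω => cexp p U f ω - g ω := fun ω ω' h => by
    dsimp only
    rw [cexp_dependsOnly p U f ω ω' h, hg ω ω' h]
  have h := pexp_mul_cexp (f := f) hp hd
  simp only [pexp] at h ⊢
  rw [← sum_add_distrib]
  have : ∑ ω, p ω * (f ω - g ω) ^ 2 = ∑ ω, (p ω * (f ω - cexp p U f ω) ^ 2 +
      p ω * (cexp p U f ω - g ω) ^ 2) + 2 * (∑ ω, p ω * ((cexp p U f ω - g ω) * f ω) -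
        ∑ ω, p ω * ((cexp p U f ω - g ω) * cexp p U f ω)) := by
    rw [← sum_sub_distrib, mul_sum, ← sum_add_distrib]
    exact sum_congr rfl fun ω _ => by ring
  rw [this, h]
  ring

theorem pvar_eq (f : (V → Ω) → ℝ) : pvar p f = pexp p fun ω => (f ω - pexp p f) ^ 2 := rfl

theorem pexp_cexp (hp : ∀ ω, 0 < p ω) : pexp p (cexp p U f) = pexp p f := by
  simpa using pexp_mul_cexp (p := p) (U := U) (f := f) (g := fun _ => 1) hp fun _ _ _ => rfl

theorem pexp_sq_nonneg (hp : ∀ ω, 0 < p ω) (g : (V → Ω) → ℝ) : 0 ≤ pexp p fun ω => g ω ^ 2 :=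
  sum_nonneg fun ω _ => mul_nonneg (hp ω).le (sq_nonneg _)

theorem pvar_eq_add (hp : ∀ ω, 0 < p ω) :
    pvar p f = pexp p (fun ω => (f ω - cexp p U f ω) ^ 2) + pvar p (cexp p U f) := by
  rw [pvar_eq, pvar_eq, pexp_cexp hp]
  exact pexp_sq_sub hp fun _ _ _ => rfl

theorem clue_le_one (hp : ∀ ω, 0 < p ω) : clue p f U ≤ 1 := by
  unfold clue
  split_ifs with h
  · exact zero_le_one
  · have h0 : 0 ≤ pvar p f := pexp_sq_nonneg hp _
    refine div_le_one_of_le₀ ?_ h0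
    rw [pvar_eq_add (f := f) (U := U) hp]
    exact le_add_of_nonneg_left (pexp_sq_nonneg hp _)

/-- The clue is bounded below by the quality of any approximation. -/
theorem one_sub_le_clue (hp : ∀ ω, 0 < p ω) (hg : DependsOnly U g) {v e : ℝ} (hv : 0 < v)
    (hvf : v ≤ pvar p f) (he : pexp p (fun ω => (f ω - g ω) ^ 2) ≤ e) : 1 - e / v ≤ clue p f U := by
  have hf : 0 < pvar p f := hv.trans_le hvf
  rw [clue, if_neg hf.ne', le_div_iff₀ hf]
  have h1 := pvar_eq_add (f := f) (U := U) hp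
  have h2 := pexp_sq_sub (f := f) hp hg
  have h3 := pexp_sq_nonneg hp fun ω => cexp p U f ω - g ω
  have he0 : 0 ≤ e := (pexp_sq_nonneg hp fun ω => f ω - g ω).trans he
  have h4 : e ≤ e / v * pvar p f := by
    rw [div_mul_eq_mul_div, le_div_iff₀ hv]
    exact mul_le_mul_of_nonneg_left hvf he0
  linarith

theorem energy_boxPos (n : ℕ) (σ : BoxV n → Bool) :
    energy (nnV (boxPos n)) (fun _ => 0) σ = criticalBeta * boxInteraction n σ := by
  have e : ∀ x y : BoxV n, nnV (boxPos n) x y =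
      if ((x.1 : ℤ) - (y.1 : ℤ)).natAbs + ((x.2 : ℤ) - (y.2 : ℤ)).natAbs = 1
        then criticalBeta / 2 else 0 := fun _ _ => rfl
  simp only [energy, boxInteraction, e, zero_mul, sum_const_zero, add_zero, mul_sum]
  refine sum_congr rfl fun x _ => sum_congr rfl fun y _ => ?_
  split_ifs <;> ring

theorem pexp_criticalIsingBox (n : ℕ) (F : (BoxV n → Bool) → ℝ) :
    pexp (criticalIsingBox n) F = ev (nnV (boxPos n)) (fun _ => 0) F := by
  simp only [pexp, ev, criticalIsingBox, pf, wt, energy_boxPos, sum_div]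
  exact sum_congr rfl fun σ _ => div_mul_eq_mul_div _ _ _

theorem criticalIsingBox_pos (n : ℕ) (σ : BoxV n → Bool) : 0 < criticalIsingBox n σ :=
  div_pos (Real.exp_pos _) (sum_pos (fun _ _ => Real.exp_pos _) univ_nonempty)

end Clue
end SR

namespace SR

open Finset

section ExponentialMoments

variable {V : Type*} [Fintype V] [DecidableEq V] {J : V → V → ℝ}

theorem ev_exp_mul (J : V → V → ℝ) (h : V → ℝ) (t : ℝ) :
    ev J h (fun σ => Real.exp (t * ∑ x, spinR (σ x))) = pf J (fun x => h x + t) / pf J h := by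
  unfold ev pf
  congr 1
  refine Finset.sum_congr rfl fun σ _ => ?_
  rw [wt, wt, ← Real.exp_add]
  congr 1
  simp only [energy, add_mul, Finset.sum_add_distrib, Finset.mul_sum]
  ring

theorem exp_ev_le (h : V → ℝ) (f : (V → Bool) → ℝ) :
    Real.exp (ev J h f) ≤ ev J h (fun σ => Real.exp (f σ)) := by
  have h1 := ev_mono J h (F := fun σ => Real.exp (ev J h f) * (1 + (f σ - ev J h f)))
    (G := fun σ => Real.exp (f σ)) fun σ => by
      have := Real.add_one_le_exp (f σ - ev J h f)
      calc Real.exp (ev J h f) * (1 + (f σ - ev J h f))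
          ≤ Real.exp (ev J h f) * Real.exp (f σ - ev J h f) := by gcongr; linarith
        _ = _ := by rw [← Real.exp_add]; ring_nf
  rwa [ev_mul, ev_add, ev_sub, ev_const, ev_const, sub_self, add_zero, mul_one] at h1

theorem ev_exp_le (h : V → ℝ) (t : ℝ) :
    ev J h (fun σ => Real.exp (t * ∑ x, spinR (σ x))) ≤
      Real.exp (t * ∑ x, ev J (fun y => h y + t) (fun σ => spinR (σ x))) := by
  have h1 := exp_ev_le (J := J) (fun y => h y + t) fun σ => (-t) * ∑ x, spinR (σ x)
  rw [ev_exp_mul, ev_mul, ev_sum, neg_mul, Real.exp_neg] at h1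
  simp only [add_neg_cancel_right] at h1
  rw [ev_exp_mul]
  have := inv_anti₀ (inv_pos.2 (Real.exp_pos _)) h1
  rwa [inv_div, inv_inv] at this

theorem ev_exp_le_of_abs_le (hJ : ∀ x y, 0 ≤ J x y) {h H : V → ℝ} (hh : ∀ x, |h x| ≤ H x)
    (t : ℝ) : ev J h (fun σ => Real.exp (t * ∑ x, spinR (σ x))) ≤
      Real.exp (|t| * ∑ x, ev J (fun y => H y + |t|) (fun σ => spinR (σ x))) := by
  refine (ev_exp_le h t).trans (Real.exp_le_exp.2 ((le_abs_self _).trans ?_))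
  rw [abs_mul]
  gcongr
  refine (Finset.abs_sum_le_sum_abs _ _).trans (Finset.sum_le_sum fun x _ => ?_)
  exact abs_ev_le_ev (fun x y => (abs_of_nonneg (hJ x y)).le)
    (fun y => (abs_add_le _ _).trans (by have := hh y; gcongr)) (spin_mem x)

theorem magn_nsmul_le (hJ : ∀ x y, 0 ≤ J x y) {t : ℝ} (ht : 0 ≤ t) (k : ℕ) (x : V) :
    ev J (fun _ => k * t) (fun σ => spinR (σ x)) ≤
      k * ev J (fun _ => t) (fun σ => spinR (σ x)) := by
  induction k with
  | zero => simp [magn_zero]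
  | succ k ih =>
    have := magn_add_le hJ (h := fun _ => k * t) (h' := fun _ => t) (fun _ => by positivity)
      (fun _ => ht) x
    push_cast
    simp only [add_mul, one_mul] at *
    linarith

theorem sum_magn_const_le (hJ : ∀ x y, 0 ≤ J x y) {t : ℝ} (ht : 0 ≤ t) :
    ∑ x, ev J (fun _ => t) (fun σ => spinR (σ x)) ≤
      2 * t * ev J (fun _ => 0) (fun σ => (∑ x, spinR (σ x)) ^ 2) := by
  obtain ⟨k, hk⟩ := exists_nat_ge (t * Fintype.card V + 1)
  have hk0 : (0 : ℝ) < k := by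
    have : 0 ≤ t * Fintype.card V := by positivity
    linarith
  set u := t / k
  have hu : 0 ≤ u := by positivity
  have hku : k * u = t := by simp only [u]; field_simp
  have hf : ∀ σ : V → Bool, |∑ x, spinR (σ x)| ≤ Fintype.card V := fun σ =>
    (Finset.abs_sum_le_sum_abs _ _).trans (by simp [abs_spinR])
  have huf : ∀ σ : V → Bool, |u * ∑ x, spinR (σ x)| ≤ 1 := by
    intro σ
    rw [abs_mul, abs_of_nonneg hu]
    calc u * |∑ x, spinR (σ x)| ≤ u * Fintype.card V := by gcongr; exact hf σ
      _ ≤ 1 := by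
        simp only [u]
        rw [div_mul_eq_mul_div, div_le_one hk0]
        linarith
  have hodd : ev J (fun _ => 0) (fun σ => ∑ x, spinR (σ x)) = 0 := by
    rw [ev_sum]
    exact Finset.sum_eq_zero fun x _ => magn_zero J x
  have h1 : ∑ x, ev J (fun _ => u) (fun σ => spinR (σ x)) =
      ev J (fun _ => 0) (fun σ => Real.exp (u * ∑ x, spinR (σ x)) * ∑ x, spinR (σ x)) /
        ev J (fun _ => 0) (fun σ => Real.exp (u * ∑ x, spinR (σ x))) := by
    rw [ev_exp_mul, ← ev_sum]
    unfold ev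
    have : (fun _ => 0 + u : V → ℝ) = fun _ => u := by simp
    rw [this, div_div_div_cancel_right₀ (pf_pos J _).ne']
    congr 1
    refine Finset.sum_congr rfl fun σ _ => ?_
    rw [← mul_assoc]
    congr 1
    rw [wt, wt, ← Real.exp_add]
    congr 1
    simp only [energy, Finset.mul_sum, zero_mul, Finset.sum_const_zero, add_zero]
  have hden : 1 ≤ ev J (fun _ => 0) (fun σ => Real.exp (u * ∑ x, spinR (σ x))) := by
    have := exp_ev_le (J := J) (fun _ => 0) fun σ => u * ∑ x, spinR (σ x)
    rwa [ev_mul, hodd, mul_zero, Real.exp_zero] at this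
  have hnum : ev J (fun _ => 0) (fun σ => Real.exp (u * ∑ x, spinR (σ x)) * ∑ x, spinR (σ x)) ≤
      2 * u * ev J (fun _ => 0) (fun σ => (∑ x, spinR (σ x)) ^ 2) := by
    rw [← ev_mul]
    have : ev J (fun _ => 0) (fun σ => Real.exp (u * ∑ x, spinR (σ x)) * ∑ x, spinR (σ x)) =
        ev J (fun _ => 0) (fun σ => (Real.exp (u * ∑ x, spinR (σ x)) - 1) * ∑ x, spinR (σ x)) := by
      simp only [sub_mul, one_mul]
      rw [ev_sub, hodd, sub_zero]
    rw [this]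
    refine ev_mono _ _ fun σ => (le_abs_self _).trans ?_
    rw [abs_mul, ← sq_abs (∑ x, spinR (σ x))]
    have := Real.abs_exp_sub_one_le (huf σ)
    rw [abs_mul, abs_of_nonneg hu] at this
    nlinarith [abs_nonneg (∑ x, spinR (σ x))]
  have hnn : 0 ≤ ev J (fun _ => 0) (fun σ => (∑ x, spinR (σ x)) ^ 2) :=
    ev_nonneg _ _ fun σ => sq_nonneg _
  calc ∑ x, ev J (fun _ => t) (fun σ => spinR (σ x))
      ≤ ∑ x, k * ev J (fun _ => u) (fun σ => spinR (σ x)) := by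
        refine Finset.sum_le_sum fun x _ => ?_
        have := magn_nsmul_le hJ hu k x
        rwa [hku] at this
    _ ≤ k * (2 * u * ev J (fun _ => 0) (fun σ => (∑ x, spinR (σ x)) ^ 2)) := by
        rw [← Finset.mul_sum, h1]
        gcongr
        rw [div_le_iff₀ (by linarith)]
        have : 0 ≤ 2 * u * ev J (fun _ => 0) (fun σ => (∑ x, spinR (σ x)) ^ 2) := by positivity
        nlinarith
    _ = _ := by linear_combination 2 * ev J (fun _ => 0) (fun σ => (∑ x, spinR (σ x)) ^ 2) * hku

theorem pow_four_le_exp (x : ℝ) : x ^ 4 ≤ 24 * (Real.exp x + Real.exp (-x)) := by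
  have h1 : |x| ^ 4 / (4).factorial ≤ Real.exp |x| := Real.pow_div_factorial_le_exp _ (abs_nonneg x) 4
  have h2 : |x| ^ 4 = x ^ 4 := by rw [← abs_pow]; exact abs_of_nonneg (by positivity)
  rw [h2, show (Nat.factorial 4 : ℝ) = 24 by norm_num [Nat.factorial]] at h1
  have : Real.exp |x| ≤ Real.exp x + Real.exp (-x) := by
    rcases abs_cases x with ⟨h, -⟩ | ⟨h, -⟩ <;> rw [h] <;>
      linarith [Real.exp_pos x, Real.exp_pos (-x)]
  linarith

/-- Fourth moment of the magnetization in a field dominated by `H`, at the scale `A` of its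
fluctuations. -/
theorem ev_pow_four_le (hJ : ∀ x y, 0 ≤ J x y) {h H : V → ℝ} (hh : ∀ x, |h x| ≤ H x) {A C D : ℝ}
    (hA : 0 < A) (hC : ∑ x, ev J H (fun σ => spinR (σ x)) ≤ C * A)
    (hD : ev J (fun _ => 0) (fun σ => (∑ x, spinR (σ x)) ^ 2) ≤ D * A ^ 2) :
    ev J h (fun σ => (∑ x, spinR (σ x)) ^ 4) ≤ 48 * Real.exp (C + 2 * D) * A ^ 4 := by
  have hm : ∑ x, ev J (fun y => H y + A⁻¹) (fun σ => spinR (σ x)) ≤ (C + 2 * D) * A := by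
    calc _ ≤ ∑ x, (ev J H (fun σ => spinR (σ x)) + ev J (fun _ => A⁻¹) (fun σ => spinR (σ x))) :=
          Finset.sum_le_sum fun x _ => magn_add_le hJ (fun x => (abs_nonneg _).trans (hh x))
            (fun _ => by positivity) x
      _ ≤ C * A + 2 * A⁻¹ * (D * A ^ 2) := by
          rw [Finset.sum_add_distrib]
          refine add_le_add hC ((sum_magn_const_le hJ (by positivity)).trans ?_)
          gcongr
      _ = _ := by field_simp
  have he : ∀ t : ℝ, |t| = A⁻¹ →
      ev J h (fun σ => Real.exp (t * ∑ x, spinR (σ x))) ≤ Real.exp (C + 2 * D) := by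
    intro t ht
    refine (ev_exp_le_of_abs_le hJ hh t).trans (Real.exp_le_exp.2 ?_)
    rw [ht]
    calc _ ≤ A⁻¹ * ((C + 2 * D) * A) := by gcongr
      _ = _ := by field_simp
  have h1 := he A⁻¹ (abs_of_pos (by positivity))
  have h2 := he (-A⁻¹) (by rw [abs_neg]; exact abs_of_pos (by positivity))
  have h3 := ev_mono J h (F := fun σ => (∑ x, spinR (σ x)) ^ 4)
    (G := fun σ => 24 * A ^ 4 * (Real.exp (A⁻¹ * ∑ x, spinR (σ x)) +
      Real.exp (-A⁻¹ * ∑ x, spinR (σ x)))) fun σ => by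
    have := pow_four_le_exp (A⁻¹ * ∑ x, spinR (σ x))
    rw [mul_pow, inv_pow, inv_mul_le_iff₀ (by positivity)] at this
    rw [neg_mul]
    linarith
  rw [ev_mul, ev_add] at h3
  refine h3.trans ?_
  calc _ ≤ 24 * A ^ 4 * (Real.exp (C + 2 * D) + Real.exp (C + 2 * D)) := by gcongr
    _ = _ := by ring

end ExponentialMoments

end SR

namespace SR

open Finset

section CharacteristicFunction

variable {V : Type*} [Fintype V] [DecidableEq V] (J : V → V → ℝ) (h : V → ℝ)

theorem cos_le_quartic (x : ℝ) : Real.cos x ≤ 1 - x ^ 2 / 2 + x ^ 4 / 2 := by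
  by_cases hx : |x| ≤ 1
  · have h1 := (abs_le.1 (Real.cos_bound hx)).2
    rw [← abs_pow, abs_of_nonneg (by positivity : 0 ≤ x ^ 4)] at h1
    have : 0 ≤ x ^ 4 := by positivity
    linarith
  · have h1 : 1 ≤ x ^ 2 := (one_le_sq_iff_one_le_abs x).2 (not_le.1 hx).le
    have := Real.cos_le_one x
    nlinarith

theorem ev_cos_sq_add_ev_sin_sq_le (f : (V → Bool) → ℝ) (t : ℝ) :
    (ev J h fun σ => Real.cos (t * f σ)) ^ 2 + (ev J h fun σ => Real.sin (t * f σ)) ^ 2 ≤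
      1 - t ^ 2 * ((ev J h fun σ => f σ ^ 2) - (ev J h f) ^ 2) +
        8 * t ^ 4 * ev J h fun σ => f σ ^ 4 := by
  set m1 := ev J h f with hm1
  set m2 := ev J h fun σ => f σ ^ 2 with hm2
  set m4 := ev J h fun σ => f σ ^ 4 with hm4
  have h1 : ∀ σ, (ev J h fun σ' => Real.cos (t * f σ)  * Real.cos (t * f σ') +
      Real.sin (t * f σ) * Real.sin (t * f σ')) ≤ (1 - t ^ 2 / 2 * m2 + 4 * t ^ 4 * m4) +
      (t ^ 2 * m1) * f σ - t ^ 2 / 2 * f σ ^ 2 + 4 * t ^ 4 * f σ ^ 4 := by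
    intro σ
    calc _ ≤ ev J h fun σ' => (1 - t ^ 2 / 2 * f σ ^ 2 + 4 * t ^ 4 * f σ ^ 4 +
          (t ^ 2 * f σ) * f σ') + ((4 * t ^ 4) * f σ' ^ 4 - t ^ 2 / 2 * f σ' ^ 2) := by
          refine ev_mono J h fun σ' => ?_
          rw [← Real.cos_sub]
          refine (cos_le_quartic _).trans ?_
          have : (f σ - f σ') ^ 4 ≤ 8 * (f σ ^ 4 + f σ' ^ 4) := by
            nlinarith [sq_nonneg (f σ ^ 2 - f σ' ^ 2), sq_nonneg (f σ + f σ'),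
              sq_nonneg ((f σ + f σ') ^ 2), sq_nonneg (f σ * f σ'), sq_nonneg (f σ ^ 2 + f σ' ^ 2 - 2 * f σ * f σ'),
              mul_nonneg (sq_nonneg (f σ + f σ')) (sq_nonneg (f σ - f σ')),
              mul_nonneg (sq_nonneg (f σ + f σ')) (add_nonneg (sq_nonneg (f σ)) (sq_nonneg (f σ')))]
          have h2 : t ^ 4 * (f σ - f σ') ^ 4 ≤ t ^ 4 * (8 * (f σ ^ 4 + f σ' ^ 4)) := by gcongr
          nlinarith
      _ = _ := by
          rw [ev_add, ev_add, ev_sub, ev_const, ev_mul, ev_mul, ev_mul]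
          ring
  have h2 := ev_mono J h h1
  rw [ev_add, ev_sub, ev_add, ev_const, ev_mul, ev_mul, ev_mul] at h2
  have h3 : (ev J h fun σ => ev J h fun σ' => Real.cos (t * f σ)  * Real.cos (t * f σ') +
      Real.sin (t * f σ) * Real.sin (t * f σ')) = (ev J h fun σ => Real.cos (t * f σ)) ^ 2 +
      (ev J h fun σ => Real.sin (t * f σ)) ^ 2 := by
    simp only [ev_add, ev_mul, mul_comm _ (ev J h _)]
    ring
  rw [h3] at h2
  refine h2.trans (le_of_eq ?_)
  rw [← hm1, ← hm2, ← hm4]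
  ring

/-- Characteristic functions decay exponentially in the number of conditionally independent
blocks. -/
theorem abs_ev_cos_le {ι : Type*} [DecidableEq ι] {P : ι → V → Prop} [∀ j, DecidablePred (P j)]
    (hP : ∀ j k, j ≠ k → ∀ x y, P j x → P k y → J x y = 0 ∧ J y x = 0)
    (hd : ∀ j k x, P j x → P k x → j = k) {f : ι → (V → Bool) → ℝ}
    (hf : ∀ j (ξ ξ' : V → Bool), (∀ x, P j x → ξ x = ξ' x) → f j ξ = f j ξ') {ρ : ℝ}
    (hρ0 : 0 ≤ ρ) (hρ : ∀ j ξ, cev (P j) J h (fun σ => Real.cos (f j σ)) ξ ^ 2 +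
      cev (P j) J h (fun σ => Real.sin (f j σ)) ξ ^ 2 ≤ ρ ^ 2) (S : Finset ι) :
    ∀ (R Θ : (V → Bool) → ℝ) (B : ℝ), 0 ≤ B → (∀ ξ, |R ξ| ≤ B) →
      (∀ j ∈ S, ∀ ξ σ, R (glue (P j) ξ σ) = R ξ ∧ Θ (glue (P j) ξ σ) = Θ ξ) →
      |ev J h fun σ => R σ * Real.cos (Θ σ + ∑ j ∈ S, f j σ)| ≤ B * ρ ^ #S := by
  have hg : ∀ j k, j ≠ k → ∀ ξ σ, f k (glue (P j) ξ σ) = f k ξ := fun j k hjk ξ σ =>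
    hf k _ _ fun x hx => glue_of_notMem ξ σ fun hj => hjk (hd _ _ _ hj hx)
  induction S using Finset.induction_on with
  | empty =>
    intro R Θ B hB hR _
    simp only [Finset.sum_empty, add_zero, Finset.card_empty, pow_zero, mul_one]
    refine abs_ev_le J h fun σ => ?_
    rw [abs_mul]
    calc |R σ| * |Real.cos (Θ σ)| ≤ B * 1 := by
          gcongr
          exacts [hR σ, Real.abs_cos_le_one _]
      _ = B := mul_one B
  | insert j S hj ih =>
    intro R Θ B hB hR hinv
    set c := cev (P j) J h (fun σ => Real.cos (f j σ)) with hc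
    set s := cev (P j) J h (fun σ => Real.sin (f j σ)) with hs
    set z : (V → Bool) → ℂ := fun ξ => ⟨c ξ, s ξ⟩ with hz
    have hzρ : ∀ ξ, ‖z ξ‖ ≤ ρ := fun ξ => by
      refine abs_le_of_sq_le_sq' ?_ hρ0 |>.2
      rw [← Complex.normSq_eq_norm_sq, Complex.normSq_apply]
      simpa only [sq] using hρ j ξ
    have key : ev J h (fun σ => R σ * Real.cos (Θ σ + ∑ k ∈ insert j S, f k σ)) =
        ev J h fun σ => (R σ * ‖z σ‖) * Real.cos ((Θ σ + (z σ).arg) + ∑ k ∈ S, f k σ) := by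
      rw [← ev_cev (p := P j)]
      congr 1
      funext ξ
      set A := Θ ξ + ∑ k ∈ S, f k ξ with hA
      have h1 : ∀ σ, Θ (glue (P j) ξ σ) + ∑ k ∈ insert j S, f k (glue (P j) ξ σ) =
          A + f j (glue (P j) ξ σ) := by
        intro σ
        rw [Finset.sum_insert hj, (hinv j (Finset.mem_insert_self _ _) ξ σ).2, hA,
          Finset.sum_congr rfl fun k hk => hg j k (by rintro rfl; exact hj hk) ξ σ]
        ring
      have h2 : cev (P j) J h (fun σ => R σ * Real.cos (Θ σ + ∑ k ∈ insert j S, f k σ)) ξ =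
          R ξ * (Real.cos A * c ξ - Real.sin A * s ξ) := by
        simp only [cev, (hinv j (Finset.mem_insert_self _ _) ξ _).1, h1, Real.cos_add, ev_mul,
          ev_sub, hc, hs]
      rw [h2, mul_assoc]
      congr 1
      clear_value A
      have e1 : c ξ = ‖z ξ‖ * Real.cos (z ξ).arg := (Complex.norm_mul_cos_arg (z ξ)).symm
      have e2 : s ξ = ‖z ξ‖ * Real.sin (z ξ).arg := (Complex.norm_mul_sin_arg (z ξ)).symm
      have e3 : Θ ξ + (z ξ).arg + ∑ k ∈ S, f k ξ = A + (z ξ).arg := by rw [hA]; ring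
      rw [e1, e2, e3, Real.cos_add]
      ring
    rw [key, Finset.card_insert_of_notMem hj, pow_succ', ← mul_assoc]
    refine ih _ _ (B * ρ) (by positivity) (fun ξ => ?_) fun k hk ξ σ => ?_
    · rw [abs_mul, abs_norm]
      exact mul_le_mul (hR ξ) (hzρ ξ) (norm_nonneg _) hB
    · have hjk : j ≠ k := by rintro rfl; exact hj hk
      have h1 := hinv k (Finset.mem_insert_of_mem hk) ξ σ
      have h2 : z (glue (P k) ξ σ) = z ξ := by
        simp only [hz, hc, hs]
        rw [cev_glue_of_far (hP j k hjk) (fun ξ ξ' h => by rw [hf j ξ ξ' h]),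
          cev_glue_of_far (hP j k hjk) (fun ξ ξ' h => by rw [hf j ξ ξ' h])]
      rw [h1.1, h1.2, h2]
      exact ⟨rfl, rfl⟩

/-- A small ball estimate from bounds on finitely many values of the characteristic function. -/
theorem ev_small_ball_le (F : (V → Bool) → ℝ) {τ r : ℝ} (hτ : 0 < τ) {K : ℕ} (hK : 0 < K)
    (hr : ∀ j : ℕ, 0 < j → j < K → |ev J h fun σ => Real.cos (j * τ * F σ)| ≤ r) (hr0 : 0 ≤ r) :
    ev J h (fun σ => if K * τ * |F σ| ≤ 1 then 1 else 0) ≤ 4 / K + 4 * r := by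
  have hK0 : (0 : ℝ) < K := by exact_mod_cast hK
  have h1 : ∀ σ, (if K * τ * |F σ| ≤ 1 then (1 : ℝ) else 0) ≤
      4 / K ^ 2 * ∑ j ∈ range K, ∑ k ∈ range K, Real.cos ((j - k : ℝ) * τ * F σ) := by
    intro σ
    have e : ∑ j ∈ range K, ∑ k ∈ range K, Real.cos ((j - k : ℝ) * τ * F σ) =
        (∑ j ∈ range K, Real.cos (j * τ * F σ)) ^ 2 +
          (∑ j ∈ range K, Real.sin (j * τ * F σ)) ^ 2 := by
      simp only [sq, Finset.sum_mul_sum, ← Finset.sum_add_distrib, ← Real.cos_sub, sub_mul]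
    rw [e]
    split_ifs with hF
    · have h2 : (K : ℝ) / 2 ≤ ∑ j ∈ range K, Real.cos (j * τ * F σ) := by
        calc (K : ℝ) / 2 = ∑ j ∈ range K, (1 / 2 : ℝ) := by simp; ring
          _ ≤ _ := by
            refine Finset.sum_le_sum fun j hj => ?_
            have hjK : (j : ℝ) ≤ K := by exact_mod_cast (Finset.mem_range.1 hj).le
            have : |j * τ * F σ| ≤ 1 := by
              rw [abs_mul, abs_of_nonneg (by positivity)]
              exact le_trans (by gcongr) hF
            have h3 := (sq_le_one_iff_abs_le_one _).2 this
            linarith [Real.one_sub_sq_div_two_le_cos (x := j * τ * F σ)]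
      have h3 : ((K : ℝ) / 2) ^ 2 ≤ (∑ j ∈ range K, Real.cos (j * τ * F σ)) ^ 2 := by gcongr
      rw [div_mul_eq_mul_div, le_div_iff₀ (by positivity)]
      nlinarith [sq_nonneg (∑ j ∈ range K, Real.sin (j * τ * F σ))]
    · positivity
  refine (ev_mono J h h1).trans ?_
  rw [ev_mul, ev_sum]
  simp only [ev_sum]
  have h2 : ∀ j ∈ range K, ∀ k ∈ range K,
      ev J h (fun σ => Real.cos ((j - k : ℝ) * τ * F σ)) ≤ (if j = k then 1 else 0) + r := by
    intro j hj k hk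
    rw [Finset.mem_range] at hj hk
    rcases lt_trichotomy j k with hjk | rfl | hjk
    · have := (abs_le.1 (hr (k - j) (by omega) (by omega))).2
      rw [Nat.cast_sub hjk.le] at this
      rw [if_neg hjk.ne, zero_add]
      refine le_trans (le_of_eq ?_) this
      congr 1
      funext σ
      rw [← Real.cos_neg]
      ring_nf
    · simp only [sub_self, zero_mul, Real.cos_zero, ev_const, if_true]
      linarith
    · have := (abs_le.1 (hr (j - k) (by omega) (by omega))).2
      rw [Nat.cast_sub hjk.le] at this
      rw [if_neg hjk.ne', zero_add]
      exact this
  calc _ ≤ 4 / (K : ℝ) ^ 2 * ∑ j ∈ range K, ∑ k ∈ range K, ((if j = k then 1 else 0) + r) := by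
        gcongr with j hj k hk
        exact h2 j hj k hk
    _ = 4 / (K : ℝ) ^ 2 * (K + K ^ 2 * r) := by
        congr 1
        simp only [Finset.sum_add_distrib, Finset.sum_ite_eq, Finset.mem_range, Finset.sum_const,
          Finset.card_range, nsmul_eq_mul]
        rw [Finset.sum_congr rfl fun j hj => if_pos (Finset.mem_range.1 hj)]
        simp
        ring
    _ = _ := by field_simp

end CharacteristicFunction

end SR

namespace SR

open Finset

section Cov

variable {V : Type*} [Fintype V] [DecidableEq V]

theorem magn_mul_magn_le {J : V → V → ℝ} {h : V → ℝ} (hJ : ∀ x y, 0 ≤ J x y) (hh : ∀ x, 0 ≤ h x)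
    (x y : V) : ev J h (fun σ => spinR (σ x)) * ev J h (fun σ => spinR (σ y)) ≤
      ev J h (fun σ => spinR (σ x) * spinR (σ y)) := by
  have key := replica_nonneg duo_monomials (fun _ => J) (fun _ => h)
    (fun x y => by
      simpa [Fin.sum_univ_two] using duo_coupling _ _ (abs_of_nonneg (hJ x y)).le x y)
    (fun x => by simpa [Fin.sum_univ_two] using duo_field _ _ (abs_of_nonneg (hh x)).le x)
    (posCone_mul (spinCone_duo (spin_mem x)).2 (spinCone_duo (spin_mem y)).2)
  have s1 : ∀ i j : Fin 2, i ≠ j → _ := fun i j hij => replica_pair (fun _ => J) (fun _ => h) hij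
    (fun σ => spinR (σ x)) (fun σ => spinR (σ y))
  have s2 := fun i : Fin 2 => replica_single (fun _ => J) (fun _ => h) i
    (fun σ => spinR (σ x) * spinR (σ y))
  simp only [sub_mul, mul_sub, Finset.sum_sub_distrib] at key
  rw [s2 0, s2 1, s1 0 1 (by decide), s1 1 0 (by decide)] at key
  have hP : 0 < ∏ k : Fin 2, pf J h := Finset.prod_pos fun k _ => pf_pos _ _
  refine le_of_mul_le_mul_left ?_ hP
  linarith

end Cov

section BlockEstimates

theorem ev_total_sq (n : ℕ) (h : BoxV n → ℝ) : ev (nnV (boxPos n)) h (fun σ => total n σ ^ 2) =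
    ∑ x, ∑ y, ev (nnV (boxPos n)) h (fun σ => spinR (σ x) * spinR (σ y)) := by
  simp only [total, sq, Finset.sum_mul_sum, ev_sum]

theorem sum_plus_magn_le (n : ℕ) : ∑ x, ev (nnV (boxPos n)) (plusField (boxPos n))
    (fun σ => spinR (σ x)) ≤ 64 * (((n : ℝ) + 1) ^ 2 * rate n) := by
  have hsum : ∑ k ∈ range (n + 1), rate k ≤ 2 * (n + 1) * rate n := by
    have := sum_rate_le (n + 1)
    push_cast at this
    simpa using this
  have hrefl : ∑ k ∈ range (n + 1), rate (n - k) = ∑ k ∈ range (n + 1), rate k := by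
    have := Finset.sum_range_reflect rate (n + 1)
    simpa using this
  calc ∑ x, ev (nnV (boxPos n)) (plusField (boxPos n)) (fun σ => spinR (σ x))
      ≤ ∑ i ∈ range (n + 1), ∑ k ∈ range (n + 1),
          8 * (rate i + rate (n - i) + (rate k + rate (n - k))) := by
        rw [sum_box]
        refine Finset.sum_le_sum fun i hi => Finset.sum_le_sum fun k hk => ?_
        have hi := Finset.mem_range.1 hi
        have hk := Finset.mem_range.1 hk
        have e1 : ((site n i k).1 : ℕ) = i := site_fst (by omega) _
        have e2 : ((site n i k).2 : ℕ) = k := site_snd (by omega) _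
        refine (le_abs_self _).trans ((plus_magn_le (boxPos_injective n) (site n i k)
          (min (min i (n - i)) (min k (n - k))) (lt_dist1_of_not_mem (by omega) (by omega)
          (by omega) (by omega))).trans ?_)
        have := rate_pos i
        have := rate_pos (n - i)
        have := rate_pos k
        have := rate_pos (n - k)
        gcongr
        rcases min_choice (min i (n - i)) (min k (n - k)) with h | h <;> rw [h]
        · rcases min_choice i (n - i) with h | h <;> rw [h] <;> linarith
        · rcases min_choice k (n - k) with h | h <;> rw [h] <;> linarith
    _ = 8 * (4 * ((n + 1) * ∑ k ∈ range (n + 1), rate k)) := by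
        simp only [← Finset.mul_sum, Finset.sum_add_distrib, Finset.sum_const, Finset.card_range,
          nsmul_eq_mul, hrefl]
        push_cast
        ring
    _ ≤ 8 * (4 * ((n + 1) * (2 * (n + 1) * rate n))) := by gcongr
    _ = _ := by ring

theorem block_pow_four_le (n : ℕ) {h : BoxV n → ℝ} (hh : ∀ x, |h x| ≤ plusField (boxPos n) x) :
    ev (nnV (boxPos n)) h (fun σ => total n σ ^ 4) ≤
      48 * Real.exp 2112 * (((n : ℝ) + 1) ^ 2 * rate n) ^ 4 := by
  have hr := rate_pos n
  have h2 : ev (nnV (boxPos n)) (fun _ => 0) (fun σ => total n σ ^ 2) ≤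
      1024 * (((n : ℝ) + 1) ^ 2 * rate n) ^ 2 := by
    rw [ev_total_sq]
    refine (sum_corr_le n).trans (le_of_eq ?_)
    ring
  refine (ev_pow_four_le (nnV_nonneg _) hh (by positivity) (sum_plus_magn_le n) h2).trans ?_
  norm_num

theorem rate_sq_le_plus_cov {n h : ℕ} (hh : 1 ≤ h) (hn : 2 ^ 70 * h ≤ n + 1)
    (t : (Fin h × Fin h) × Fin h × Fin h) :
    rate n ^ 2 ≤ ev (nnV (boxPos n)) (plusField (boxPos n)) (fun σ =>
        spinR (σ (centralPair n h t).1) * spinR (σ (centralPair n h t).2)) -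
      ev (nnV (boxPos n)) (plusField (boxPos n)) (fun σ => spinR (σ (centralPair n h t).1)) *
        ev (nnV (boxPos n)) (plusField (boxPos n)) (fun σ => spinR (σ (centralPair n h t).2)) := by
  obtain ⟨⟨a, c⟩, b, d⟩ := t
  have hn2 : 2 * h ≤ n := by omega
  have hnr : (2 : ℝ) ^ 70 * h ≤ (n : ℝ) + 1 := by exact_mod_cast hn
  have h1 : 2 ^ 15 * rate n ^ 2 ≤ corr n _ _ := (rate_sq_le_corr hh (by omega) (c := 2 ^ 15)
    (by linarith)).trans (corr_central_le hn2 a.2 b.2 c.2 d.2)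
  set x := (centralPair n h ((a, c), b, d)).1 with hx
  set y := (centralPair n h ((a, c), b, d)).2 with hy
  have hG : corr n x y ≤ ev (nnV (boxPos n)) (plusField (boxPos n))
      (fun σ => spinR (σ x) * spinR (σ y)) :=
    ev_le_ev (nnV_nonneg _) (fun _ => le_rfl) (fun _ _ => le_rfl) (plusField_nonneg _)
      (posCone_mul (spin_mem x) (spin_mem y))
  set m := n / 2 with hm
  have ha := a.2
  have hb := b.2
  have hc := c.2
  have hd := d.2
  have ex1 : (x.1 : ℕ) = m - h + a := site_fst (by omega) _
  have ex2 : (x.2 : ℕ) = m + h - c := site_snd (by omega) _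
  have ey1 : (y.1 : ℕ) = m + h - b := site_fst (by omega) _
  have ey2 : (y.2 : ℕ) = m - h + d := site_snd (by omega) _
  have hmx := plus_magn_le (boxPos_injective n) x (m - h)
    (lt_dist1_of_not_mem (by omega) (by omega) (by omega) (by omega))
  have hmy := plus_magn_le (boxPos_injective n) y (m - h)
    (lt_dist1_of_not_mem (by omega) (by omega) (by omega) (by omega))
  have hv : rate (m - h) ≤ 2 * rate n := by
    refine le_mul_rate (by norm_num) n ?_
    have e := rate_pow (m - h)
    have h3 : (n : ℝ) + 1 ≤ 2 ^ 8 * ((m - h : ℕ) + 1) := by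
      have : n + 1 ≤ 2 ^ 8 * ((m - h) + 1) := by omega
      exact_mod_cast this
    calc rate (m - h) ^ 8 * ((n : ℝ) + 1) ≤ rate (m - h) ^ 8 * (2 ^ 8 * ((m - h : ℕ) + 1)) := by
          have := rate_pos (m - h)
          gcongr
      _ = 2 ^ 8 := by linear_combination 2 ^ 8 * e
  have hw := rate_pos n
  have hmul := mul_le_mul (hmx.trans (by linarith : _ ≤ 16 * rate n))
    (hmy.trans (by linarith : _ ≤ 16 * rate n)) (abs_nonneg _) (by positivity)
  rw [← abs_mul] at hmul
  have hmul' := (le_abs_self _).trans hmul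
  have : 0 < rate n ^ 2 := by positivity
  have h4 : 2 ^ 15 * rate n ^ 2 ≤ corr n x y := h1
  linarith

theorem le_block_variance {n h : ℕ} (hh : 1 ≤ h) (hn : 2 ^ 70 * h ≤ n + 1) {H : BoxV n → ℝ}
    (hH : ∀ x, |H x| ≤ plusField (boxPos n) x) :
    (h : ℝ) ^ 4 * rate n ^ 2 ≤ ev (nnV (boxPos n)) H (fun σ => total n σ ^ 2) -
      ev (nnV (boxPos n)) H (total n) ^ 2 := by
  set C : BoxV n × BoxV n → ℝ := fun p => ev (nnV (boxPos n)) (plusField (boxPos n))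
      (fun σ => spinR (σ p.1) * spinR (σ p.2)) -
    ev (nnV (boxPos n)) (plusField (boxPos n)) (fun σ => spinR (σ p.1)) *
      ev (nnV (boxPos n)) (plusField (boxPos n)) (fun σ => spinR (σ p.2)) with hC
  calc (h : ℝ) ^ 4 * rate n ^ 2 = ∑ t : (Fin h × Fin h) × Fin h × Fin h, rate n ^ 2 := by
        simp only [sum_const, card_univ, Fintype.card_prod, Fintype.card_fin, nsmul_eq_mul]
        push_cast; ring
    _ ≤ ∑ t, C (centralPair n h t) := sum_le_sum fun t _ => rate_sq_le_plus_cov hh hn t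
    _ = ∑ p ∈ univ.image (centralPair n h), C p :=
        (sum_image (f := C) (centralPair_injective (by omega)).injOn).symm
    _ ≤ ∑ p : BoxV n × BoxV n, C p :=
        sum_le_sum_of_subset_of_nonneg (subset_univ _) fun p _ _ =>
          sub_nonneg.2 (magn_mul_magn_le (nnV_nonneg _) (plusField_nonneg _) p.1 p.2)
    _ = ∑ x, ∑ y, C (x, y) := Fintype.sum_prod_type C
    _ ≤ ∑ x, ∑ y, (ev (nnV (boxPos n)) H (fun σ => spinR (σ x) * spinR (σ y)) -
          ev (nnV (boxPos n)) H (fun σ => spinR (σ x)) *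
            ev (nnV (boxPos n)) H (fun σ => spinR (σ y))) :=
        sum_le_sum fun x _ => sum_le_sum fun y _ => cov_le_cov (nnV_nonneg _) hH x y
    _ = _ := by
        have : ev (nnV (boxPos n)) H (total n) =
            ∑ x, ev (nnV (boxPos n)) H (fun σ => spinR (σ x)) := ev_sum _ _ _ _
        rw [ev_total_sq, this, sq, Finset.sum_mul_sum]
        simp only [Finset.sum_sub_distrib]

/-- Decay of the characteristic function of the magnetization of a box, uniform in the boundary
condition. -/
theorem exists_block_decay : ∃ c : ℝ, 0 < c ∧ ∃ θ₀ : ℝ, 0 < θ₀ ∧ ∃ n₀ : ℕ, ∀ n ≥ n₀,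
    ∀ H : BoxV n → ℝ, (∀ x, |H x| ≤ plusField (boxPos n) x) → ∀ t : ℝ,
      |t * (((n : ℝ) + 1) ^ 2 * rate n)| ≤ θ₀ →
      ev (nnV (boxPos n)) H (fun σ => Real.cos (t * total n σ)) ^ 2 +
        ev (nnV (boxPos n)) H (fun σ => Real.sin (t * total n σ)) ^ 2 ≤
        1 - c * (t * (((n : ℝ) + 1) ^ 2 * rate n)) ^ 2 := by
  set c : ℝ := ((2 : ℝ) ^ 71)⁻¹ ^ 4 with hc
  set K : ℝ := 8 * (48 * Real.exp 2112) with hK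
  have hK0 : 0 < K := by positivity
  have hc0 : 0 < c := by positivity
  refine ⟨c / 2, by positivity, Real.sqrt (c / (2 * K)), by positivity, 2 ^ 71,
    fun n hn H hH t ht => ?_⟩
  set A := ((n : ℝ) + 1) ^ 2 * rate n with hA
  set h := (n + 1) / 2 ^ 70 with hh
  have h1 : 1 ≤ h := by omega
  have h2 : ((n : ℝ) + 1) * (2 ^ 71)⁻¹ ≤ h := by
    rw [← div_eq_mul_inv, div_le_iff₀ (by positivity)]
    have : n + 1 ≤ h * 2 ^ 71 := by omega
    exact_mod_cast this
  have hr := rate_pos n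
  have hvar : c * A ^ 2 ≤ ev (nnV (boxPos n)) H (fun σ => total n σ ^ 2) -
      ev (nnV (boxPos n)) H (total n) ^ 2 := by
    refine le_trans ?_ (le_block_variance h1 (by omega) hH)
    calc c * A ^ 2 = (((n : ℝ) + 1) * (2 ^ 71)⁻¹) ^ 4 * rate n ^ 2 := by rw [hc, hA]; ring
      _ ≤ _ := by gcongr
  have h4 := block_pow_four_le n hH
  refine (ev_cos_sq_add_ev_sin_sq_le _ H (total n) t).trans ?_
  rw [← hA] at h4
  have h5 : 8 * t ^ 4 * ev (nnV (boxPos n)) H (fun σ => total n σ ^ 4) ≤ K * (t * A) ^ 4 := by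
    calc _ ≤ 8 * t ^ 4 * (48 * Real.exp 2112 * A ^ 4) := by gcongr
      _ = _ := by rw [hK]; ring
  have h6 : t ^ 2 * (c * A ^ 2) ≤ t ^ 2 * (ev (nnV (boxPos n)) H (fun σ => total n σ ^ 2) -
      ev (nnV (boxPos n)) H (total n) ^ 2) := by gcongr
  have h7 : (t * A) ^ 2 ≤ c / (2 * K) := by
    rw [← sq_abs, ← Real.sq_sqrt (by positivity : 0 ≤ c / (2 * K))]
    gcongr
  have h8 : K * (t * A) ^ 4 ≤ c / 2 * (t * A) ^ 2 := by
    calc K * (t * A) ^ 4 = K * (t * A) ^ 2 * (t * A) ^ 2 := by ring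
      _ ≤ K * (c / (2 * K)) * (t * A) ^ 2 := by gcongr
      _ = _ := by field_simp
  rw [show t ^ 2 * (c * A ^ 2) = c * (t * A) ^ 2 by ring] at h6
  clear_value A c K
  generalize t ^ 2 * (_ - _) = a at h6 ⊢
  generalize 8 * t ^ 4 * _ = b at h5 ⊢
  linarith

end BlockEstimates

end SR

namespace SR

open Finset

section Transport

variable {V W : Type*} [Fintype V] [DecidableEq V] [Fintype W] [DecidableEq W]

theorem ev_equiv (φ : V ≃ W) (J : W → W → ℝ) (h : W → ℝ) (F : (V → Bool) → ℝ) :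
    ev (fun x y => J (φ x) (φ y)) (fun x => h (φ x)) F = ev J h (fun σ => F (fun x => σ (φ x))) := by
  have hw : ∀ σ : W → Bool, wt (fun x y => J (φ x) (φ y)) (fun x => h (φ x)) (fun x => σ (φ x)) =
      wt J h σ := by
    intro σ
    simp only [wt, energy]
    rw [← φ.sum_comp (fun x => h x * spinR (σ x)), ← φ.sum_comp (fun x => ∑ y, _)]
    simp only [← φ.sum_comp (fun y => J (φ _) y * _)]
  have hs : ∀ g : (V → Bool) → ℝ, ∑ σ, g σ = ∑ σ : W → Bool, g (fun x => σ (φ x)) := fun g =>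
    Fintype.sum_equiv (Equiv.arrowCongr φ (Equiv.refl Bool)) _ _ fun σ => by
      congr 1
      funext x
      simp
  unfold ev pf
  rw [hs, hs]
  simp only [hw]

end Transport

section Blocks

/-- The `j`-th block of side length `l` at the bottom of the box. -/
def inBlock (n l j : ℕ) (x : BoxV n) : Prop :=
  j * (l + 2) ≤ x.1 ∧ x.1 ≤ j * (l + 2) + l ∧ (x.2 : ℕ) ≤ l

instance (n l j : ℕ) : DecidablePred (inBlock n l j) := fun x => by
  unfold inBlock
  infer_instance

variable {n l m : ℕ}

theorem inBlock_dist {j k : ℕ} (hjk : j ≠ k) {x y : BoxV n} (hx : inBlock n l j x)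
    (hy : inBlock n l k y) : 1 < dist1 (boxPos n x) (boxPos n y) := by
  obtain ⟨h1, h2, -⟩ := hx
  obtain ⟨h3, h4, -⟩ := hy
  simp only [dist1, boxPos]
  rcases lt_or_gt_of_ne hjk with h | h
  · have : (j + 1) * (l + 2) ≤ k * (l + 2) := Nat.mul_le_mul_right _ h
    have := add_one_mul j (l + 2)
    omega
  · have : (k + 1) * (l + 2) ≤ j * (l + 2) := Nat.mul_le_mul_right _ h
    have := add_one_mul k (l + 2)
    omega

/-- A block is a translate of a smaller box. -/
def blockEquiv (j : ℕ) (hj : j * (l + 2) + l ≤ n) : BoxV l ≃ Subtype (inBlock n l j) where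
  toFun x := ⟨(⟨j * (l + 2) + x.1, by omega⟩, ⟨x.2, by omega⟩), by
    simp only [inBlock]
    omega⟩
  invFun y := (⟨y.1.1 - j * (l + 2), by have := y.2; unfold inBlock at this; omega⟩,
    ⟨y.1.2, by have := y.2; unfold inBlock at this; omega⟩)
  left_inv x := by
    ext <;> simp
  right_inv y := by
    have := y.2
    unfold inBlock at this
    ext <;> simp
    omega

theorem boxPos_blockEquiv (j : ℕ) (hj : j * (l + 2) + l ≤ n) (x : BoxV l) :
    boxPos n (blockEquiv j hj x) = ((boxPos l x).1 + (j * (l + 2) : ℕ), (boxPos l x).2) := by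
  simp only [boxPos, blockEquiv, Equiv.coe_fn_mk, Nat.cast_add, Prod.mk.injEq, and_true]
  ring

theorem abs_bdField_block_le (j : ℕ) (hj : j * (l + 2) + l ≤ n) (ξ : BoxV n → Bool) (x : BoxV l) :
    |bdField (inBlock n l j) (nnV (boxPos n)) (fun _ => 0) ξ (blockEquiv j hj x)| ≤
      plusField (boxPos l) x := by
  set S : Set (ℤ × ℤ) := {z | (z.1 - (j * (l + 2) : ℕ), z.2) ∉ Set.range (boxPos l)} with hS
  refine (abs_bdField_le (boxPos_injective n) (inBlock n l j) S (fun y hy => ?_) ξ _).trans ?_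
  · simp only [hS, Set.mem_ofPred_eq, range_boxPos, boxPos]
    unfold inBlock at hy
    omega
  · have e : ∀ p q : ℤ, S.indicator (1 : ℤ × ℤ → ℝ) (p + (j * (l + 2) : ℕ), q) =
        (Set.range (boxPos l))ᶜ.indicator 1 (p, q) := by
      intro p q
      simp [Set.indicator, hS]
    rw [abs_zero, zero_add, plusField, boxPos_blockEquiv]
    simp only [nbrs, e, add_right_comm _ _ (1 : ℤ), add_sub_right_comm, le_refl]

/-- The total spin of a block. -/
noncomputable def blockSum (n l j : ℕ) (σ : BoxV n → Bool) : ℝ :=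
  ∑ x, if inBlock n l j x then spinR (σ x) else 0

theorem cev_block (j : ℕ) (hj : j * (l + 2) + l ≤ n) (g : ℝ → ℝ) (ξ : BoxV n → Bool) :
    cev (inBlock n l j) (nnV (boxPos n)) (fun _ => 0) (fun σ => g (blockSum n l j σ)) ξ =
      ev (nnV (boxPos l)) (fun x => bdField (inBlock n l j) (nnV (boxPos n)) (fun _ => 0) ξ
        (blockEquiv j hj x)) (fun σ => g (total l σ)) := by
  have hJ : nnV (boxPos l) = fun x y => nnV (boxPos n) (blockEquiv j hj x) (blockEquiv j hj y) := by
    funext x y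
    simp only [nnV, boxPos_blockEquiv]
    exact nnJ_congr (by simp) rfl
  rw [hJ, ev_equiv (blockEquiv j hj) (fun x y => nnV (boxPos n) x y) (bdField _ _ _ ξ), cev]
  congr 1
  funext σ
  congr 1
  rw [blockSum, total, sum_ite_subtype (p := inBlock n l j)]
  rw [(blockEquiv j hj).sum_comp (fun x => spinR (σ x))]
  have : ∀ x : BoxV n, (if inBlock n l j x then 0 else if inBlock n l j x then
      spinR (glue (inBlock n l j) ξ σ x) else 0) = 0 := fun x => by split_ifs <;> rfl
  rw [Finset.sum_congr rfl fun x _ => this x, Finset.sum_const_zero, add_zero]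
  refine Finset.sum_congr rfl fun x _ => ?_
  rw [if_pos x.2, glue_of_mem ξ σ x.2]

theorem abs_ev_cos_total_le (hm : m * (l + 2) ≤ n + 2) {t ρ : ℝ} (hρ0 : 0 ≤ ρ)
    (hρ : ∀ H : BoxV l → ℝ, (∀ x, |H x| ≤ plusField (boxPos l) x) →
      ev (nnV (boxPos l)) H (fun σ => Real.cos (t * total l σ)) ^ 2 +
        ev (nnV (boxPos l)) H (fun σ => Real.sin (t * total l σ)) ^ 2 ≤ ρ ^ 2) :
    |ev (nnV (boxPos n)) (fun _ => 0) (fun σ => Real.cos (t * total n σ))| ≤ ρ ^ m := by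
  classical
  have hj : ∀ j : Fin m, (j : ℕ) * (l + 2) + l ≤ n := fun j => by
    have := Nat.mul_le_mul_right (l + 2) (Nat.succ_le_of_lt j.2)
    have := add_one_mul (j : ℕ) (l + 2)
    simp only [Nat.succ_eq_add_one] at *
    omega
  have hdisj : ∀ (j k : Fin m) x, inBlock n l j x → inBlock n l k x → j = k := by
    intro j k x h1 h2
    by_contra h
    have := inBlock_dist (fun e => h (Fin.ext e)) h1 h2
    simp [dist1] at this
  set rest : (BoxV n → Bool) → ℝ := fun σ => ∑ x, if ∃ j : Fin m, inBlock n l j x then 0 else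
    spinR (σ x) with hrest
  have htot : ∀ σ, total n σ = rest σ + ∑ j : Fin m, blockSum n l j σ := by
    intro σ
    simp only [hrest, blockSum, total]
    rw [Finset.sum_comm, ← Finset.sum_add_distrib]
    refine Finset.sum_congr rfl fun x _ => ?_
    split_ifs with h
    · obtain ⟨j, hx⟩ := h
      rw [Finset.sum_eq_single j (fun k _ hk => if_neg fun h' => hk (hdisj _ _ _ h' hx))
        (by simp), if_pos hx, zero_add]
    · rw [Finset.sum_eq_zero fun j _ => if_neg fun h' => h ⟨j, h'⟩, add_zero]
  have key := abs_ev_cos_le (nnV (boxPos n)) (fun _ => 0) (P := fun j : Fin m => inBlock n l j)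
    (fun j k hjk x y hx hy => by
      have := inBlock_dist (fun e => hjk (Fin.ext e)) hx hy
      have h0 : nnV (boxPos n) x y = 0 := nnJ_eq_zero (by omega)
      exact ⟨h0, by rw [nnV_comm, h0]⟩)
    hdisj (f := fun j σ => t * blockSum n l j σ)
    (fun j ξ ξ' h => by
      simp only [blockSum]
      congr 1
      refine Finset.sum_congr rfl fun x _ => ?_
      split_ifs with hx
      · rw [h x hx]
      · rfl) hρ0
    (fun j ξ => by
      rw [cev_block j (hj j) (fun u => Real.cos (t * u)), cev_block j (hj j) (fun u => Real.sin (t * u))]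
      exact hρ _ fun x => abs_bdField_block_le j (hj j) ξ x) univ (fun _ => 1) (fun σ => t * rest σ)
    1 zero_le_one (fun _ => by simp) fun j _ ξ σ => ⟨rfl, by
      simp only [hrest]
      congr 1
      refine Finset.sum_congr rfl fun x _ => ?_
      split_ifs with hx
      · rfl
      · rw [glue_of_notMem ξ σ fun h => hx ⟨j, h⟩]⟩
  simp only [one_mul, ← Finset.mul_sum, ← mul_add, ← htot, Finset.card_univ, Fintype.card_fin]
    at key
  exact key

/-- The total spin is spread out on the scale of its standard deviation. -/
theorem exists_anticoncentration {ε : ℝ} (hε : 0 < ε) : ∃ a : ℝ, 0 < a ∧ ∃ n₀ : ℕ, ∀ n ≥ n₀,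
    ev (nnV (boxPos n)) (fun _ => 0) (fun σ =>
      if |total n σ| ≤ a * (((n : ℝ) + 1) ^ 2 * rate n) then 1 else 0) ≤ ε := by
  obtain ⟨c, hc, θ, hθ, l₀, hdecay⟩ := exists_block_decay
  obtain ⟨K, hK⟩ := exists_nat_ge (8 / ε)
  have hK0 : (0 : ℝ) < K := lt_of_lt_of_le (by positivity) hK
  set ρ := Real.sqrt (max 0 (1 - c * (θ / K) ^ 2)) with hρ
  have hρ1 : ρ < 1 := by
    rw [hρ, Real.sqrt_lt' one_pos]
    have : 0 < c * (θ / K) ^ 2 := by positivity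
    exact max_lt (by norm_num) (by linarith)
  obtain ⟨m, hm⟩ := exists_pow_lt_of_lt_one (by positivity : 0 < ε / 8) hρ1
  obtain ⟨M, hM, hM0⟩ : ∃ M : ℕ, ρ ^ M ≤ ε / 8 ∧ 0 < M := by
    refine ⟨m + 1, ?_, by omega⟩
    have := pow_le_pow_of_le_one (Real.sqrt_nonneg _ : 0 ≤ ρ) hρ1.le (Nat.le_succ m)
    exact this.trans hm.le
  have hMr : (0 : ℝ) < M := by exact_mod_cast hM0
  refine ⟨(16 * (M : ℝ) ^ 2 * θ)⁻¹, by positivity, M * (l₀ + 2), fun n hn => ?_⟩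
  obtain ⟨l, hl⟩ : ∃ l, (n + 1) / M = l + 2 := by
    refine ⟨(n + 1) / M - 2, ?_⟩
    have : l₀ + 2 ≤ (n + 1) / M := (Nat.le_div_iff_mul_le hM0).2 (by rw [mul_comm]; omega)
    omega
  have hl0 : l₀ ≤ l := by
    have : l₀ + 2 ≤ (n + 1) / M := (Nat.le_div_iff_mul_le hM0).2 (by rw [mul_comm]; omega)
    omega
  have hml : M * (l + 2) ≤ n + 1 := by rw [← hl]; exact Nat.mul_div_le _ _
  have hnl : n + 1 ≤ 4 * M * (l + 1) := by
    have h1 := Nat.lt_mul_div_succ (n + 1) hM0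
    rw [hl] at h1
    have h2 : M * (l + 2 + 1) ≤ M * (4 * (l + 1)) := Nat.mul_le_mul_left _ (by omega)
    have h3 : M * (4 * (l + 1)) = 4 * M * (l + 1) := by ring
    omega
  set A := ((l : ℝ) + 1) ^ 2 * rate l with hA
  have hrl := rate_pos l
  have hrn := rate_pos n
  have hA0 : 0 < A := by positivity
  set τ := θ / (K * A) with hτ
  have hball := ev_small_ball_le (nnV (boxPos n)) (fun _ => 0) (total n) (τ := τ) (r := ρ ^ M)
    (by positivity) (K := K) (by exact_mod_cast hK0)
    (fun j hj0 hjK => by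
      refine abs_ev_cos_total_le (m := M) (l := l) (by omega) (Real.sqrt_nonneg _) fun H hH => ?_
      have hj1 : (1 : ℝ) ≤ j := by exact_mod_cast hj0
      have hj2 : (j : ℝ) ≤ K := by exact_mod_cast hjK.le
      have e : j * τ * A = j * (θ / K) := by rw [hτ]; field_simp
      refine (hdecay l hl0 H hH (j * τ) ?_).trans ?_
      · rw [← hA, e, abs_of_nonneg (by positivity)]
        calc j * (θ / K) ≤ K * (θ / K) := by gcongr
          _ = θ := by field_simp
      · rw [← hA, e, hρ, Real.sq_sqrt (le_max_left _ _)]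
        refine le_trans ?_ (le_max_right _ _)
        have : (θ / K) ^ 2 ≤ (j * (θ / K)) ^ 2 := by
          have : 0 ≤ θ / K := by positivity
          gcongr
          nlinarith
        have : c * (θ / K) ^ 2 ≤ c * (j * (θ / K)) ^ 2 := by gcongr
        linarith) (by positivity)
  refine le_trans (ev_mono _ _ fun σ => ?_) (hball.trans ?_)
  · have h1 : (16 * (M : ℝ) ^ 2 * θ)⁻¹ * (((n : ℝ) + 1) ^ 2 * rate n) ≤ (K * τ)⁻¹ := by
      have h2 : (K * τ)⁻¹ = A / θ := by rw [hτ]; field_simp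
      have h3 : ((n : ℝ) + 1) ≤ 4 * M * (l + 1) := by exact_mod_cast hnl
      have hln : l ≤ n := by
        have : 1 * (l + 2) ≤ M * (l + 2) := Nat.mul_le_mul_right _ hM0
        omega
      have h4 := rate_anti hln
      rw [h2, inv_mul_le_iff₀ (by positivity)]
      calc ((n : ℝ) + 1) ^ 2 * rate n ≤ (4 * M * (l + 1)) ^ 2 * rate l := by gcongr
        _ = _ := by rw [hA]; field_simp; ring
    have hKτ : 0 < K * τ := by positivity
    split_ifs with h5 h6 h6
    · exact le_rfl
    · refine absurd ?_ h6
      calc K * τ * |total n σ| ≤ K * τ * (K * τ)⁻¹ := by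
            gcongr
            exact h5.trans h1
        _ = 1 := mul_inv_cancel₀ hKτ.ne'
    · exact zero_le_one
    · exact le_rfl
  · have : 4 / (K : ℝ) ≤ ε / 2 := by
      rw [div_le_iff₀ hK0]
      rw [div_le_iff₀ hε] at hK
      linarith
    linarith

end Blocks

end SR

namespace SR

open Finset

section Reconstruction

theorem sampled_dependsOnly (n s : ℕ) : DependsOnly (sublattice n s) (sampled n s) := by
  intro σ σ' h
  unfold sampled
  congr 1
  refine sum_congr rfl fun l hl => sum_congr rfl fun k hk => ?_
  rw [mem_marks] at hl hk
  rw [h]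
  simp [sublattice, site_fst hl.1, site_snd hk.1, hl.2.1, hk.2.1]

theorem le_ev_total_sq {n : ℕ} (hn : 2 ^ 36 ≤ n) : (((n : ℝ) + 1) / 2 ^ 37) ^ 4 * rate n ^ 2 ≤
    ev (nnV (boxPos n)) (fun _ => 0) (fun σ => total n σ ^ 2) := by
  have h1 := le_sum_corr (n := n) (h := (n + 1) / 2 ^ 36) (by omega) (by omega)
  have h2 : ((n : ℝ) + 1) / 2 ^ 37 ≤ ((n + 1) / 2 ^ 36 : ℕ) := by
    rw [div_le_iff₀ (by positivity)]
    have : n + 1 ≤ (n + 1) / 2 ^ 36 * 2 ^ 37 := by omega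
    exact_mod_cast this
  rw [ev_total_sq]
  refine le_trans ?_ h1
  gcongr

theorem one_sub_le_clue_avgMagn {n s : ℕ} (hn : 2 ^ 36 ≤ n) (hs : 0 < s)
    (hsn : (s : ℝ) ≤ (n + 1) * rate n) :
    1 - 84480 * 2 ^ 148 * (s / ((n + 1) * rate n)) ≤
      clue (criticalIsingBox n) (avgMagn n) (sublattice n s) := by
  have hr := rate_pos n
  set c : ℝ := (Fintype.card (BoxV n) : ℝ)⁻¹ with hc
  have hc0 : 0 < c := inv_pos.2 (by exact_mod_cast Fintype.card_pos)
  have hf : avgMagn n = fun σ => c * total n σ := rfl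
  have hmean : pexp (criticalIsingBox n) (avgMagn n) = 0 := by
    rw [pexp_criticalIsingBox]
    refine ev_zero_odd _ fun σ => ?_
    simp only [avgMagn, spinR_not, sum_neg_distrib, mul_neg]
  have h := one_sub_le_clue (p := criticalIsingBox n) (f := avgMagn n) (U := sublattice n s)
    (g := fun σ => c * sampled n s σ)
    (v := c ^ 2 * ((((n : ℝ) + 1) / 2 ^ 37) ^ 4 * rate n ^ 2))
    (e := c ^ 2 * (84480 * s * (n + 1) ^ 3 * rate n))
    (criticalIsingBox_pos n)
    (fun σ σ' hσ => by simp only [sampled_dependsOnly n s σ σ' hσ]) (by positivity)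
    (by
      rw [pvar_eq, hmean, pexp_criticalIsingBox, hf]
      simp only [sub_zero, mul_pow, ev_mul]
      exact mul_le_mul_of_nonneg_left (le_ev_total_sq hn) (sq_nonneg c))
    (by
      rw [pexp_criticalIsingBox, hf]
      simp only [← mul_sub, mul_pow, ev_mul]
      exact mul_le_mul_of_nonneg_left (ev_total_sub_sampled_le hs hsn) (sq_nonneg c))
  refine le_trans (le_of_eq ?_) h
  field_simp

theorem majority_eq (n : ℕ) (σ : BoxV n → Bool) :
    majority n σ = if 0 < total n σ then 1 else -1 := by
  have hc0 : (0 : ℝ) < (Fintype.card (BoxV n) : ℝ)⁻¹ :=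
    inv_pos.2 (by exact_mod_cast Fintype.card_pos)
  have h : 0 < avgMagn n σ ↔ 0 < total n σ := mul_pos_iff_of_pos_left hc0
  simp only [majority, h]

theorem total_not (n : ℕ) (σ : BoxV n → Bool) : total n (fun x => !σ x) = -total n σ := by
  simp only [total, spinR_not, sum_neg_distrib]

/-- The mean of the majority is minus the probability of a tie. -/
theorem abs_ev_majority_le (n : ℕ) {A : ℝ} (hA : 0 ≤ A) :
    |ev (nnV (boxPos n)) (fun _ => 0) (majority n)| ≤
      ev (nnV (boxPos n)) (fun _ => 0) (fun σ => if |total n σ| ≤ A then 1 else 0) := by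
  have h1 := ev_flip (nnV (boxPos n)) (majority n)
  have hm := fun σ => majority_eq n σ
  have h2 := ev_mono (nnV (boxPos n)) (fun _ => 0)
    (F := fun σ => majority n σ + majority n (fun x => !σ x)) (G := fun _ => 0) fun σ => by
      simp only [hm, total_not]
      split_ifs <;> linarith
  have h3 := ev_mono (nnV (boxPos n)) (fun _ => 0)
    (F := fun σ => (-2) * if |total n σ| ≤ A then (1 : ℝ) else 0)
    (G := fun σ => majority n σ + majority n (fun x => !σ x)) fun σ => by
      simp only [hm, total_not]
      by_cases h4 : |total n σ| ≤ A
      · rw [if_pos h4]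
        split_ifs <;> linarith
      · rw [if_neg h4]
        have h5 : total n σ ≠ 0 := fun h => h4 (by rwa [h, abs_zero])
        rcases h5.lt_or_gt with h6 | h6
        · rw [if_neg h6.not_gt, if_pos (by linarith)]
          linarith
        · rw [if_pos h6, if_neg (by linarith)]
          linarith
  simp only [ev_mul, ev_add, ev_const] at h1 h2 h3
  rw [abs_le]
  constructor <;> linarith

theorem one_sub_le_clue_majority {n s : ℕ} (hs : 0 < s) (hsn : (s : ℝ) ≤ (n + 1) * rate n)
    {a ε : ℝ} (ha : 0 < a) (hε : ε ≤ 1 / 2)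
    (hac : ev (nnV (boxPos n)) (fun _ => 0)
      (fun σ => if |total n σ| ≤ a * (((n : ℝ) + 1) ^ 2 * rate n) then 1 else 0) ≤ ε) :
    1 - 8 * (ε + 84480 / a ^ 2 * (s / ((n + 1) * rate n))) ≤
      clue (criticalIsingBox n) (majority n) (sublattice n s) := by
  have hr := rate_pos n
  set A := a * (((n : ℝ) + 1) ^ 2 * rate n) with hA
  have hA0 : 0 < A := by positivity
  have hmean := (abs_ev_majority_le n hA0.le).trans hac
  have hpt : ∀ σ, (majority n σ - if 0 < sampled n s σ then 1 else -1) ^ 2 ≤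
      4 * ((if |total n σ| ≤ A then 1 else 0) +
        (A ^ 2)⁻¹ * (total n σ - sampled n s σ) ^ 2) := fun σ => by
    rw [majority_eq]
    have h0 : 0 ≤ (A ^ 2)⁻¹ * (total n σ - sampled n s σ) ^ 2 := by positivity
    by_cases h1 : |total n σ| ≤ A
    · rw [if_pos h1]
      split_ifs <;> nlinarith
    rw [if_neg h1]
    have hbig : A ≤ |total n σ - sampled n s σ| →
        1 ≤ (A ^ 2)⁻¹ * (total n σ - sampled n s σ) ^ 2 := fun h => by
      rw [le_inv_mul_iff₀ (by positivity), mul_one, ← sq_abs (_ - _)]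
      gcongr
    rw [not_le] at h1
    split_ifs with h2 h3 h3
    · linarith
    · rw [abs_of_pos h2] at h1
      have := hbig (by rw [abs_of_nonneg (by linarith)]; linarith)
      linarith
    · rw [abs_of_nonpos (not_lt.1 h2)] at h1
      have := hbig (by rw [abs_of_nonpos (by linarith)]; linarith)
      linarith
    · linarith
  have h := one_sub_le_clue (p := criticalIsingBox n) (f := majority n) (U := sublattice n s)
    (g := fun σ => if 0 < sampled n s σ then 1 else -1) (v := 1 / 2)
    (e := 4 * (ε + (A ^ 2)⁻¹ * (84480 * s * (n + 1) ^ 3 * rate n)))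
    (criticalIsingBox_pos n)
    (fun σ σ' hσ => by simp only [sampled_dependsOnly n s σ σ' hσ]) (by norm_num)
    (by
      rw [pvar_eq, pexp_criticalIsingBox, pexp_criticalIsingBox]
      set m := ev (nnV (boxPos n)) (fun _ => 0) (majority n) with hm
      have e : (fun σ => (majority n σ - m) ^ 2) =
          fun σ => (1 + m ^ 2) - 2 * m * majority n σ := by
        funext σ
        rw [majority_eq]
        split_ifs <;> ring
      rw [e, ev_sub, ev_const, ev_mul, ← hm]
      have : |m| ≤ 1 / 2 := hmean.trans hε
      nlinarith [abs_le.1 this, sq_abs m, abs_nonneg m])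
    (by
      rw [pexp_criticalIsingBox]
      refine (ev_mono _ _ hpt).trans ?_
      simp only [ev_mul, ev_add]
      gcongr
      exact ev_total_sub_sampled_le hs hsn)
  refine le_trans (le_of_eq ?_) h
  rw [hA]
  field_simp
  ring

theorem mul_rate_eq (n : ℕ) : ((n : ℝ) + 1) * rate n = ((n : ℝ) + 1) ^ ((7 : ℝ) / 8) := by
  have h : (0 : ℝ) < (n : ℝ) + 1 := by positivity
  rw [rate]
  nth_rewrite 1 [← Real.rpow_one ((n : ℝ) + 1)]
  rw [← Real.rpow_add h]
  norm_num

end Reconstruction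

end SR

open Filter SR

/-- **Sparse reconstruction for the critical planar Ising model** (Theorem 1.5 of the paper):
for the critical Ising measures on the boxes `{0,…,n}²` with free boundary conditions, if the
mesh sizes satisfy `s_n = o(n^{7/8})`, then the average magnetization `M_n` and the majority
`Maj_n = sign(M_n)` can be fully reconstructed from the sublattice `H_n` of mesh size `s_n`:
`clue(M_n|H_n) → 1` and `clue(Maj_n|H_n) → 1`. -/
theorem critical_planar_ising_sparse_reconstruction
    (s : ℕ → ℕ) (hs : ∀ n, 0 < s n)
    (hmesh : Tendsto (fun n => (s n : ℝ) / (n : ℝ) ^ ((7 : ℝ) / 8)) atTop (nhds 0)) :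
    Tendsto (fun n => clue (criticalIsingBox n) (avgMagn n) (sublattice n (s n)))
      atTop (nhds 1) ∧
    Tendsto (fun n => clue (criticalIsingBox n) (majority n) (sublattice n (s n)))
      atTop (nhds 1) := by
  have hu : Tendsto (fun n => (s n : ℝ) / (((n : ℝ) + 1) * rate n)) atTop (nhds 0) := by
    refine squeeze_zero' (.of_forall fun n => ?_) ?_ hmesh
    · have := rate_pos n
      positivity
    · filter_upwards [eventually_gt_atTop 0] with n hn
      have : (0 : ℝ) < n := by exact_mod_cast hn
      rw [mul_rate_eq]
      gcongr
      linarith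
  have hsn : ∀ᶠ n in atTop, (s n : ℝ) ≤ ((n : ℝ) + 1) * rate n := by
    filter_upwards [hu.eventually_le_const one_pos] with n hn
    have := rate_pos n
    rwa [div_le_one (by positivity)] at hn
  constructor
  · have h1 : Tendsto (fun n : ℕ => 1 - 84480 * 2 ^ 148 * ((s n : ℝ) / (((n : ℝ) + 1) * rate n)))
        atTop (nhds 1) := by
      simpa using (hu.const_mul (84480 * 2 ^ 148)).const_sub 1
    refine tendsto_of_tendsto_of_tendsto_of_le_of_le' h1 tendsto_const_nhds ?_
      (.of_forall fun n => clue_le_one (criticalIsingBox_pos n))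
    filter_upwards [hsn, eventually_ge_atTop (2 ^ 36)] with n hn h36
    exact one_sub_le_clue_avgMagn h36 (hs n) hn
  · refine Metric.tendsto_atTop.2 fun δ hδ => ?_
    obtain ⟨a, ha, n₀, hn₀⟩ := exists_anticoncentration (ε := min (1 / 2) (δ / 32)) (by positivity)
    have h1 : Tendsto (fun n : ℕ => 84480 / a ^ 2 * ((s n : ℝ) / (((n : ℝ) + 1) * rate n)))
        atTop (nhds 0) := by
      simpa using hu.const_mul (84480 / a ^ 2)
    refine eventually_atTop.1 ?_
    filter_upwards [hsn, eventually_ge_atTop n₀,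
      h1.eventually_le_const (show (0 : ℝ) < δ / 32 by positivity)] with n hn hn0 hb
    have h2 := one_sub_le_clue_majority (hs n) hn ha (min_le_left _ _) (hn₀ n hn0)
    have h3 := clue_le_one (f := majority n) (U := sublattice n (s n)) (criticalIsingBox_pos n)
    have h4 := min_le_right (1 / 2) (δ / 32)
    rw [Real.dist_eq, abs_of_nonpos (by linarith)]
    linarith
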